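/- For all integers k ≥ 4 and 1 ≤ ℓ < k/2 there exists n₀ such that every k-uniform hypergraph H = (V,E) on |V| = n ≥ n₀ vertices with n divisible by k−ℓ and δ_{k−2}(H) ≥ ((4(k−ℓ)−1)/(4(k−ℓ)²))·C(n,2) contains a Hamiltonian ℓ-cycle. -/

import Mathlib

open Finset

/-- `E` is the edge set of a `k`-uniform hypergraph on vertex set `Fin n`:
every edge is a `k`-element set of vertices. -/
def Uniform (n k : ℕ) (E : Finset (Finset (Fin n))) : Prop :=
  ∀ e ∈ E, e.card = k

/-- The degree `d(S)` of a vertex set `S`: the number of edges containing `S`. -/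
def deg {n : ℕ} (E : Finset (Finset (Fin n))) (S : Finset (Fin n)) : ℕ :=
  (E.filter fun e => S ⊆ e).card

/-- The minimum `s`-degree `δ_s(H)`: the minimum of `d(S)` over all `s`-element
vertex sets `S`. -/
noncomputable def minDeg (n : ℕ) (E : Finset (Finset (Fin n))) (s : ℕ) : ℕ :=
  sInf {d | ∃ S : Finset (Fin n), S.card = s ∧ deg E S = d}

/-- `d(L, X^(i) Y^(j))`: the number of edges of the form `L ∪ I ∪ J` with
`I ∈ X^(i)`, `J ∈ Y^(j)` (take `Y = ∅`, `j = 0` when `Y^(j)` is omitted). -/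
def degIn {n : ℕ} (E : Finset (Finset (Fin n))) (L X Y : Finset (Fin n)) (i j : ℕ) : ℕ :=
  (E.filter fun e =>
    L ⊆ e ∧ e \ L ⊆ X ∪ Y ∧ ((e \ L) ∩ X).card = i ∧ ((e \ L) ∩ Y).card = j).card

/-- The `i`-th edge of an ℓ-cycle given by the cyclic ordering `f` of the `n`
vertices: `k` cyclically consecutive vertices starting at position `i * (k - ℓ)`. -/
def cycEdge (n k ℓ : ℕ) (f : ℕ → Fin n) (i : ℕ) : Finset (Fin n) :=
  (Finset.range k).image fun j => f ((i * (k - ℓ) + j) % n)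

/-- `H = (Fin n, E)` contains a Hamiltonian ℓ-cycle: there is a cyclic ordering of
all `n` vertices such that each of the `n / (k - ℓ)` windows of `k` consecutive
vertices (consecutive windows overlapping in `ℓ` vertices) is an edge, and two
consecutive edges share exactly `ℓ` vertices. -/
def HasHamCycle (n k ℓ : ℕ) (E : Finset (Finset (Fin n))) : Prop :=
  ∃ f : ℕ → Fin n, Set.InjOn f (Set.Iio n) ∧
    (∀ i < n / (k - ℓ), cycEdge n k ℓ f i ∈ E) ∧
    (∀ i < n / (k - ℓ),
      (cycEdge n k ℓ f i ∩ cycEdge n k ℓ f ((i + 1) % (n / (k - ℓ)))).card = ℓ)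

/-- The `i`-th edge of an ℓ-path given by the linear ordering `f`. -/
def pathEdge (n k ℓ : ℕ) (f : ℕ → Fin n) (i : ℕ) : Finset (Fin n) :=
  (Finset.range k).image fun j => f (i * (k - ℓ) + j)

/-- `f` is (the linear ordering of the vertices of) an ℓ-path with `t` edges all of
which belong to `E`: the path has `t * (k - ℓ) + ℓ` vertices, every edge consists of
`k` consecutive vertices and two consecutive edges intersect in exactly `ℓ` vertices. -/
def IsPath (n k ℓ t : ℕ) (E : Finset (Finset (Fin n))) (f : ℕ → Fin n) : Prop :=
  Set.InjOn f (Set.Iio (t * (k - ℓ) + ℓ)) ∧ ∀ i < t, pathEdge n k ℓ f i ∈ E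

/-- The vertex set of the ℓ-path described by `f` with `t` edges. -/
def pathVerts (n k ℓ t : ℕ) (f : ℕ → Fin n) : Finset (Fin n) :=
  (Finset.range (t * (k - ℓ) + ℓ)).image f

/-- The first end (first `ℓ` vertices) of the ℓ-path described by `f`. -/
def pathEnd0 (n ℓ : ℕ) (f : ℕ → Fin n) : Finset (Fin n) :=
  (Finset.range ℓ).image f

/-- The last end (last `ℓ` vertices) of the ℓ-path described by `f` with `t` edges. -/
def pathEnd1 (n k ℓ t : ℕ) (f : ℕ → Fin n) : Finset (Fin n) :=
  (Finset.Ico (t * (k - ℓ)) (t * (k - ℓ) + ℓ)).image f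

/-- The extremal hypergraph `X_{k,ℓ}(n)` on `Fin n`.  If `n` is an odd multiple of
`k - ℓ`, take `A` to be the first `⌊n / (2(k-ℓ))⌋` vertices and all `k`-sets meeting
`A` as edges.  If `n` is an even multiple of `k - ℓ`, take `A` to be the first
`n / (2(k-ℓ)) - 1` vertices, fix the `ℓ + 1` following vertices (which lie in
`B = V ∖ A`), and take as edges all `k`-sets meeting `A` together with all `k`-subsets
of `B` containing all `ℓ + 1` fixed vertices. -/
def Xedges (n k ℓ : ℕ) : Finset (Finset (Fin n)) :=
  if Odd (n / (k - ℓ)) then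
    (Finset.powersetCard k (Finset.univ : Finset (Fin n))).filter fun e =>
      ∃ v ∈ e, (v : ℕ) < n / (2 * (k - ℓ))
  else
    (Finset.powersetCard k (Finset.univ : Finset (Fin n))).filter fun e =>
      (∃ v ∈ e, (v : ℕ) < n / (2 * (k - ℓ)) - 1) ∨
      ((∀ v ∈ e, n / (2 * (k - ℓ)) - 1 ≤ (v : ℕ)) ∧
        ∀ w : Fin n, n / (2 * (k - ℓ)) - 1 ≤ (w : ℕ) → (w : ℕ) < n / (2 * (k - ℓ)) + ℓ →
          w ∈ e)

/-- `e(B)`: the number of edges lying entirely inside `B`. -/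
def edgesIn {n : ℕ} (E : Finset (Finset (Fin n))) (B : Finset (Fin n)) : ℕ :=
  (E.filter fun e => e ⊆ B).card

/-- `(A, B)` is an `(ℓ,ξ)`-extremal partition of the vertex set:
`|A| = ⌈n/(2(k-ℓ))⌉ - 1`, `|B| = ⌊(2(k-ℓ)-1)n/(2(k-ℓ)) + 1⌋` and
`e(B) ≤ ξ · C(n,k)`. -/
def IsExtremalPartition (n k ℓ : ℕ) (E : Finset (Finset (Fin n))) (ξ : ℝ)
    (A B : Finset (Fin n)) : Prop :=
  Disjoint A B ∧ A ∪ B = Finset.univ ∧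
  A.card = ⌈(n : ℝ) / (2 * ((k - ℓ : ℕ) : ℝ))⌉₊ - 1 ∧
  B.card = ⌊(2 * ((k - ℓ : ℕ) : ℝ) - 1) * (n : ℝ) / (2 * ((k - ℓ : ℕ) : ℝ)) + 1⌋₊ ∧
  (edgesIn E B : ℝ) ≤ ξ * (n.choose k : ℝ)

/-- `H` is `(ℓ,ξ)`-extremal. -/
def IsExtremal (n k ℓ : ℕ) (E : Finset (Finset (Fin n))) (ξ : ℝ) : Prop :=
  ∃ A B, IsExtremalPartition n k ℓ E ξ A B

/-- `(A, B)` is a minimal `(ℓ,ξ)`-extremal partition: among all `(ℓ,ξ)`-extremal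
partitions it minimises `e(B)`. -/
def IsMinExtremalPartition (n k ℓ : ℕ) (E : Finset (Finset (Fin n))) (ξ : ℝ)
    (A B : Finset (Fin n)) : Prop :=
  IsExtremalPartition n k ℓ E ξ A B ∧
  ∀ A' B' : Finset (Fin n), IsExtremalPartition n k ℓ E ξ A' B' →
    edgesIn E B ≤ edgesIn E B'

open scoped Classical in
/-- `A_ε`: the set of vertices `v` with `d(v, B^(k-1)) ≥ (1-ε)·C(|B|, k-1)`. -/
noncomputable def Aeps (n k : ℕ) (E : Finset (Finset (Fin n))) (B : Finset (Fin n)) (ε : ℝ) :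
    Finset (Fin n) :=
  Finset.univ.filter fun v =>
    (1 - ε) * (B.card.choose (k - 1) : ℝ) ≤ (degIn E {v} B ∅ (k - 1) 0 : ℝ)

open scoped Classical in
/-- `B_ε`: the set of vertices `v` with `d(v, B^(k-1)) ≤ ε·C(|B|, k-1)`. -/
noncomputable def Beps (n k : ℕ) (E : Finset (Finset (Fin n))) (B : Finset (Fin n)) (ε : ℝ) :
    Finset (Fin n) :=
  Finset.univ.filter fun v =>
    (degIn E {v} B ∅ (k - 1) 0 : ℝ) ≤ ε * (B.card.choose (k - 1) : ℝ)

/-- `V_ε = V ∖ (A_ε ∪ B_ε)`. -/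
noncomputable def Veps (n k : ℕ) (E : Finset (Finset (Fin n))) (B : Finset (Fin n)) (ε : ℝ) :
    Finset (Fin n) :=
  Finset.univ \ (Aeps n k E B ε ∪ Beps n k E B ε)

/-- `L` is an ε-typical ℓ-set: `L ⊆ B_ε`, `|L| = ℓ` and
`d(L, B^(k-ℓ)) ≤ ε·C(|B|, k-ℓ)`. -/
def IsTypical (n k ℓ : ℕ) (E : Finset (Finset (Fin n))) (B : Finset (Fin n)) (ε : ℝ)
    (L : Finset (Fin n)) : Prop :=
  L.card = ℓ ∧ L ⊆ Beps n k E B ε ∧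
    (degIn E L B ∅ (k - ℓ) 0 : ℝ) ≤ ε * (B.card.choose (k - ℓ) : ℝ)

section Paths
variable {V : Type} [DecidableEq V]

/-- `PathOn E ℓ L M L'`: the hypergraph `E` has an ℓ-path with ends `L`, `L'` and interior `M`,
where the ends may be ordered arbitrarily. -/
inductive PathOn (E : Finset (Finset V)) (ℓ : ℕ) : Finset V → Finset V → Finset V → Prop
  | edge {L I L' : Finset V} : L.card = ℓ → L'.card = ℓ → Disjoint L I → Disjoint L L' →
      Disjoint I L' → L ∪ I ∪ L' ∈ E → PathOn E ℓ L I L'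
  | cat {L M L' M' L'' : Finset V} : PathOn E ℓ L M L' → PathOn E ℓ L' M' L'' →
      Disjoint (L ∪ M) (M' ∪ L'') → PathOn E ℓ L (M ∪ L' ∪ M') L''

variable {E : Finset (Finset V)} {ℓ : ℕ} {L M L' : Finset V}

theorem PathOn.card_left (h : PathOn E ℓ L M L') : L.card = ℓ := by
  induction h <;> assumption

theorem PathOn.card_right (h : PathOn E ℓ L M L') : L'.card = ℓ := by
  induction h <;> assumption

theorem PathOn.disj (h : PathOn E ℓ L M L') : Disjoint L M ∧ Disjoint L L' ∧ Disjoint M L' := by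
  induction h with
  | edge _ _ h1 h2 h3 _ => exact ⟨h1, h2, h3⟩
  | cat _ _ h3 h1 h2 =>
    simp only [disjoint_union_left, disjoint_union_right] at *
    tauto

theorem PathOn.symm (h : PathOn E ℓ L M L') : PathOn E ℓ L' M L := by
  induction h with
  | @edge L I L' c c' h1 h2 h3 he =>
    refine .edge c' c h3.symm h2.symm h1.symm ?_
    grind
  | @cat L M L' M' L'' _ _ h3 h1 h2 =>
    have := PathOn.cat h2 h1 (by
      grind)
    grind

theorem PathOn.map {W : Type} [DecidableEq W] {F : Finset (Finset W)} (φ : V ↪ W)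
    (hF : ∀ e ∈ E, e.map φ ∈ F) (h : PathOn E ℓ L M L') :
    PathOn F ℓ (L.map φ) (M.map φ) (L'.map φ) := by
  induction h with
  | edge c c' h1 h2 h3 he =>
    refine .edge (by simpa) (by simpa) (by simpa) (by simpa) (by simpa) ?_
    simpa [map_union] using hF _ he
  | cat _ _ h3 h1 h2 =>
    rw [map_union, map_union]
    exact .cat h1 h2 (by rw [← map_union, ← map_union]; simpa using h3)

theorem PathOn.card_mid {k : ℕ} (hE : ∀ e ∈ E, e.card = k) (hk : ℓ ≤ k)
    (h : PathOn E ℓ L M L') : ∃ e, 0 < e ∧ M.card + ℓ = (k - ℓ) * e := by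
  induction h with
  | edge c c' h1 h2 h3 he =>
    refine ⟨1, one_pos, ?_⟩
    have := hE _ he
    rw [card_union_of_disjoint (disjoint_union_left.2 ⟨h2, h3⟩), card_union_of_disjoint h1] at this
    omega
  | cat p p' h3 h1 h2 =>
    obtain ⟨e, he, h1⟩ := h1
    obtain ⟨e', he', h2⟩ := h2
    refine ⟨e + e', by omega, ?_⟩
    have d1 := p.disj
    have d2 := p'.disj
    simp only [disjoint_union_left, disjoint_union_right] at h3
    rw [card_union_of_disjoint (disjoint_union_left.2 ⟨h3.1.2, d2.1⟩),
      card_union_of_disjoint d1.2.2, p.card_right, mul_add]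
    omega

/-- A Hamiltonian ℓ-cycle, cut into two paths. -/
def HamC [Fintype V] (E : Finset (Finset V)) (ℓ : ℕ) : Prop :=
  ∃ L M L' M', PathOn E ℓ L M L' ∧ PathOn E ℓ L' M' L ∧ Disjoint M M' ∧
    L ∪ M ∪ L' ∪ M' = univ

theorem PathOn.exists_list {k : ℕ} (hE : ∀ e ∈ E, e.card = k) (hk : ℓ ≤ k)
    (h : PathOn E ℓ L M L') (l l' : List V) (hl : l.Nodup) (hl' : l'.Nodup)
    (hlL : l.toFinset = L) (hlL' : l'.toFinset = L') :
    ∃ m : List V, m.Nodup ∧ m.toFinset = M ∧ ∀ i, i * (k - ℓ) + k ≤ (l ++ m ++ l').length →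
      (((l ++ m ++ l').drop (i * (k - ℓ))).take k).toFinset ∈ E := by
  induction h generalizing l l' with
  | @edge L I L' c c' h1 h2 h3 he =>
    refine ⟨I.toList, nodup_toList _, toList_toFinset _, ?_⟩
    have := hE _ he
    rw [card_union_of_disjoint (disjoint_union_left.2 ⟨h2, h3⟩), card_union_of_disjoint h1] at this
    have e1 : l.length = ℓ := by rw [← c, ← hlL, List.toFinset_card_of_nodup hl]
    have e2 : l'.length = ℓ := by rw [← c', ← hlL', List.toFinset_card_of_nodup hl']
    intro i hi
    have hlen : (l ++ I.toList ++ l').length = k := by simp [e1, e2]; omega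
    rw [hlen] at hi
    have : i * (k - ℓ) = 0 := by omega
    rw [this, List.drop_zero, List.take_of_length_le hlen.le]
    simpa [hlL, hlL', union_assoc] using he
  | @cat L M L' M' L'' p p' h3 h1 h2 =>
    have nd : L'.toList.Nodup := nodup_toList _
    obtain ⟨m, a1, a2, a3⟩ := h1 l L'.toList hl nd hlL (toList_toFinset _)
    obtain ⟨m', b1, b2, b3⟩ := h2 L'.toList l' nd hl' (toList_toFinset _) hlL'
    have d1 := p.disj
    have d2 := p'.disj
    simp only [disjoint_union_left, disjoint_union_right] at h3
    refine ⟨m ++ L'.toList ++ m', ?_, by simp [a2, b2, union_assoc], ?_⟩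
    · refine List.nodup_append'.2 ⟨List.nodup_append'.2 ⟨a1, nd, ?_⟩, b1, ?_⟩
      · rw [← List.disjoint_toFinset_iff_disjoint, a2, toList_toFinset]; exact d1.2.2
      · rw [← List.disjoint_toFinset_iff_disjoint, List.toFinset_append, a2, b2, toList_toFinset]
        exact disjoint_union_left.2 ⟨h3.1.2, d2.1⟩
    · obtain ⟨e, he, hc⟩ := p.card_mid hE hk
      have e1 : l.length = ℓ := by
        rw [← p.card_left, ← hlL, List.toFinset_card_of_nodup hl]
      have e2 : m.length = M.card := by rw [← a2, List.toFinset_card_of_nodup a1]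
      have e3 : L'.card = ℓ := p.card_right
      intro i hi
      rcases lt_or_ge i e with hie | hie
      · have hle : i * (k - ℓ) + k ≤ (l ++ m ++ L'.toList).length := by
          have : (i + 1) * (k - ℓ) ≤ e * (k - ℓ) := Nat.mul_le_mul_right _ hie
          grind
        have := a3 i hle
        rwa [show l ++ (m ++ L'.toList ++ m') ++ l' = (l ++ m ++ L'.toList) ++ (m' ++ l') by simp,
          List.drop_append_of_le_length (by omega),
          List.take_append_of_le_length (by rw [List.length_drop]; omega)]
      · obtain ⟨j, rfl⟩ := Nat.exists_eq_add_of_le hie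
        have hs : (e + j) * (k - ℓ) = (l ++ m).length + j * (k - ℓ) := by
          grind
        have := b3 j (by grind)
        rwa [show l ++ (m ++ L'.toList ++ m') ++ l' = (l ++ m) ++ (L'.toList ++ m' ++ l') by simp,
          hs, List.drop_length_add_append]

theorem sdiff_aux {U C L M L' A B : Finset V} (h1 : A ⊆ U) (h2 : B ⊆ U) (h3 : Disjoint A B)
    (h4 : Disjoint C U) (h5 : Disjoint (L ∪ M ∪ L') U) (h6 : Disjoint C (L ∪ M ∪ L'))
    (h7 : Disjoint L L') (h8 : Disjoint M L') :
    (U ∪ C ∪ (L ∪ M ∪ L')) \ (A ∪ L') = U \ (A ∪ B) ∪ B ∪ C ∪ L ∪ M := by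
  ext x
  have b1 := @h1 x
  have b2 := @h2 x
  rw [disjoint_left] at *
  grind

/-- Two disjoint paths joined by a connecting path. -/
theorem PathOn.join {S C L₀ L₁ : Finset V} (h0 : L₀ ⊆ S) (h1 : L₁ ⊆ S)
    (p : PathOn E ℓ L₀ (S \ (L₀ ∪ L₁)) L₁) (q : PathOn E ℓ L₁ C L) (r : PathOn E ℓ L M L')
    (hCS : Disjoint C S) (hBS : Disjoint (L ∪ M ∪ L') S) (hCB : Disjoint C (L ∪ M ∪ L')) :
    PathOn E ℓ L₀ ((S ∪ C ∪ (L ∪ M ∪ L')) \ (L₀ ∪ L')) L' := by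
  have sub1 : L₀ ∪ S \ (L₀ ∪ L₁) ⊆ S := union_subset h0 sdiff_subset
  have a := PathOn.cat p q (by
    rw [disjoint_union_right]
    refine ⟨(hCS.mono_right sub1).symm, ((hBS.mono_right sub1).mono_left ?_).symm⟩
    intro x hx; simp [hx])
  have sub2 : L₀ ∪ (S \ (L₀ ∪ L₁) ∪ L₁ ∪ C) ⊆ S ∪ C := by
    grind
  have sub3 : M ∪ L' ⊆ L ∪ M ∪ L' := by grind
  have b := PathOn.cat a r (by
    refine Disjoint.mono sub2 sub3 ?_
    rw [disjoint_union_left]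
    exact ⟨hBS.symm, hCB⟩)
  rwa [sdiff_aux h0 h1 p.disj.2.1 hCS hBS hCB r.disj.2.1 r.disj.2.2]

end Paths

theorem HamC.hasHamCycle {n k ℓ : ℕ} {E : Finset (Finset (Fin n))} (hE : Uniform n k E)
    (hlk : 2 * ℓ < k) (hn : 3 * (k - ℓ) ≤ n) (h : HamC E ℓ) : HasHamCycle n k ℓ E := by
  obtain ⟨L, M, L', M', p, p', hMM, hu⟩ := h
  have hk : ℓ ≤ k := by omega
  have ht : 0 < k - ℓ := by omega
  obtain ⟨m, a1, a2, a3⟩ := p.exists_list hE hk L.toList L'.toList (nodup_toList _) (nodup_toList _)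
    (toList_toFinset _) (toList_toFinset _)
  obtain ⟨m', b1, b2, b3⟩ := p'.exists_list hE hk L'.toList L.toList (nodup_toList _)
    (nodup_toList _) (toList_toFinset _) (toList_toFinset _)
  obtain ⟨e, he, hc⟩ := p.card_mid hE hk
  obtain ⟨e', he', hc'⟩ := p'.card_mid hE hk
  have e1 : L.card = ℓ := p.card_left
  have e2 : m.length = M.card := by rw [← a2, List.toFinset_card_of_nodup a1]
  have e2' : m'.length = M'.card := by rw [← b2, List.toFinset_card_of_nodup b1]
  have e3 : L'.card = ℓ := p.card_right
  have d1 := p.disj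
  have d2 := p'.disj
  set l := L.toList ++ m ++ L'.toList ++ m' with hl
  have hlen : l.length = (k - ℓ) * (e + e') := by
    simp only [hl, List.length_append, length_toList, e1, e2, e2', e3, mul_add]; omega
  have hlu : l.toFinset = univ := by
    simp only [hl, List.toFinset_append, toList_toFinset, a2, b2, hu]
  have hnd : l.Nodup := by
    refine List.nodup_append'.2 ⟨List.nodup_append'.2 ⟨List.nodup_append'.2
      ⟨nodup_toList _, a1, ?_⟩, nodup_toList _, ?_⟩, b1, ?_⟩ <;>
    rw [← List.disjoint_toFinset_iff_disjoint] <;>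
    simp only [List.toFinset_append, toList_toFinset, a2, b2, disjoint_union_left] <;>
    simp only [disjoint_comm] at *  <;> tauto
  have hln : l.length = n := by
    rw [← List.toFinset_card_of_nodup hnd, hlu, card_univ, Fintype.card_fin]
  have hdiv : n / (k - ℓ) = e + e' := by
    rw [← hln, hlen, Nat.mul_div_cancel_left _ ht]
  have hn0 : 0 < n := by omega
  have hwin : ∀ i < e + e', (((l ++ L.toList).drop (i * (k - ℓ))).take k).toFinset ∈ E := by
    intro i hi
    rcases lt_or_ge i e with hie | hie
    · have hle : i * (k - ℓ) + k ≤ (L.toList ++ m ++ L'.toList).length := by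
        have : (i + 1) * (k - ℓ) ≤ e * (k - ℓ) := Nat.mul_le_mul_right _ hie
        simp only [List.length_append, length_toList]
        rw [mul_comm (k - ℓ) e] at hc
        rw [add_mul] at this
        omega
      have := a3 i hle
      rwa [hl, List.append_assoc _ m', List.drop_append_of_le_length (by omega),
        List.take_append_of_le_length (by rw [List.length_drop]; omega)]
    · obtain ⟨j, rfl⟩ := Nat.exists_eq_add_of_le hie
      have hs : (e + j) * (k - ℓ) = (L.toList ++ m).length + j * (k - ℓ) := by
        rw [List.length_append, length_toList, e1, e2, add_mul, mul_comm e, ← hc]; ring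
      have hj : (j + 1) * (k - ℓ) ≤ e' * (k - ℓ) := Nat.mul_le_mul_right _ (by omega)
      have := b3 j (by
        rw [mul_comm (k - ℓ) e'] at hc'
        rw [add_mul] at hj
        simp only [List.length_append, length_toList]; omega)
      rwa [hl, show L.toList ++ m ++ L'.toList ++ m' ++ L.toList
        = (L.toList ++ m) ++ (L'.toList ++ m' ++ L.toList) by simp, hs, List.drop_length_add_append]
  obtain ⟨R, hR⟩ : ∃ R, l = L.toList ++ R :=
    ⟨m ++ (L'.toList ++ m'), by simp only [hl, List.append_assoc]⟩
  clear_value l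
  let f : ℕ → Fin n := fun i => l.getD i ⟨0, hn0⟩
  have hf : ∀ i (h : i < l.length), f i = l[i] := fun i h => by simp [f, List.getD_eq_getElem?_getD, h]
  have hinj : Set.InjOn f (Set.Iio n) := by
    intro i hi j hj hij
    rw [Set.mem_Iio, ← hln] at hi hj
    rw [hf i hi, hf j hj] at hij
    exact (List.Nodup.getElem_inj_iff hnd).1 hij
  have hcyc : ∀ i < e + e', cycEdge n k ℓ f i
      = (((l ++ L.toList).drop (i * (k - ℓ))).take k).toFinset := by
    intro i hi
    have hi' : (i + 1) * (k - ℓ) ≤ (e + e') * (k - ℓ) := Nat.mul_le_mul_right _ (by omega)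
    rw [mul_comm (e + e'), ← hlen, hln, add_mul] at hi'
    have hval : ∀ j (_ : j < k), f ((i * (k - ℓ) + j) % n) = (l ++ L.toList)[i * (k - ℓ) + j]'(by
        rw [List.length_append, hln, length_toList]; omega) := by
      intro j hj
      have hL : L.toList.length = ℓ := by rw [length_toList, e1]
      rcases lt_or_ge (i * (k - ℓ) + j) n with h | h
      · have h' : i * (k - ℓ) + j < l.length := by omega
        simp only [Nat.mod_eq_of_lt h]
        rw [hf _ h', List.getElem_append_left h']
      · have h2 : i * (k - ℓ) + j - n < n := by omega
        have h3 : i * (k - ℓ) + j - n < l.length := by omega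
        have h4 : (i * (k - ℓ) + j) % n = i * (k - ℓ) + j - n := by
          rw [Nat.mod_eq_sub_mod h, Nat.mod_eq_of_lt h2]
        rw [h4, hf _ h3, List.getElem_append_right (by omega)]
        simp only [hR, ← hln]
        rw [List.getElem_append_left (by rw [hL, ← hR]; omega)]
    ext x
    simp only [cycEdge, mem_image, mem_range, List.mem_toFinset, List.mem_iff_getElem,
      List.length_take, List.length_drop, List.length_append, hln, length_toList,
      List.getElem_take, List.getElem_drop]
    constructor
    · rintro ⟨j, hj, rfl⟩
      exact ⟨j, by omega, (hval j hj).symm⟩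
    · rintro ⟨j, hj, rfl⟩
      exact ⟨j, by omega, hval j (by omega)⟩
  refine ⟨f, hinj, fun i hi => ?_, fun i hi => ?_⟩
  · rw [hdiv] at hi
    rw [hcyc i hi]
    exact hwin i hi
  · rw [hdiv] at hi ⊢
    have hm : 3 ≤ e + e' := by
      rw [← hln, hlen, mul_comm 3] at hn
      exact Nat.le_of_mul_le_mul_left hn ht
    have hnm : n = (e + e') * (k - ℓ) := by rw [← hln, hlen, mul_comm]
    have key : cycEdge n k ℓ f i ∩ cycEdge n k ℓ f ((i + 1) % (e + e'))
        = (range ℓ).image fun j => f (((i + 1) * (k - ℓ) + j) % n) := by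
      have hshift : ∀ j, ((i + 1) % (e + e') * (k - ℓ) + j) % n = ((i + 1) * (k - ℓ) + j) % n := by
        intro j
        rw [Nat.add_mod, Nat.add_mod ((i + 1) * (k - ℓ)), hnm, Nat.mul_mod_mul_right,
          Nat.mul_mod_mul_right, Nat.mod_mod]
      ext x
      simp only [cycEdge, mem_inter, mem_image, mem_range, hshift]
      constructor
      · rintro ⟨⟨j, hj, rfl⟩, j', hj', h⟩
        have h := hinj (Set.mem_Iio.2 (Nat.mod_lt _ hn0)) (Set.mem_Iio.2 (Nat.mod_lt _ hn0)) h
        have h2 : j = (k - ℓ) + j' := by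
          have h' : ((k - ℓ) + j') ≡ j [MOD n] := by
            apply Nat.ModEq.add_left_cancel' (i * (k - ℓ))
            rw [← add_assoc, ← add_one_mul]; exact h
          rcases le_total j ((k - ℓ) + j') with hle | hle
          · have := (Nat.modEq_iff_dvd' hle).1 h'.symm
            have := Nat.eq_zero_of_dvd_of_lt this (by omega)
            omega
          · have := (Nat.modEq_iff_dvd' hle).1 h'
            have := Nat.eq_zero_of_dvd_of_lt this (by omega)
            omega
        exact ⟨j', by omega, by rw [h2, add_mul, one_mul, add_assoc]⟩
      · rintro ⟨j, hj, rfl⟩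
        exact ⟨⟨(k - ℓ) + j, by omega, by rw [add_mul, one_mul, add_assoc]⟩, j, by omega, rfl⟩
    rw [key, card_image_of_injOn, card_range]
    intro j hj j' hj' h
    have h := hinj (Set.mem_Iio.2 (Nat.mod_lt _ hn0)) (Set.mem_Iio.2 (Nat.mod_lt _ hn0)) h
    have h : j ≡ j' [MOD n] := Nat.ModEq.add_left_cancel' _ h
    simp only [coe_range, Set.mem_Iio] at hj hj'
    exact Nat.ModEq.eq_of_lt_of_lt h (by omega) (by omega)

noncomputable section Density

variable {Ω Ω' : Type} [Fintype Ω] [Fintype Ω']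

/-- The average of `f` over a finite type. -/
def ex (f : Ω → ℝ) : ℝ := (∑ ω, f ω) / Fintype.card Ω

open Classical in
/-- The proportion of the elements of a finite type that satisfy `P`. -/
def pr (P : Ω → Prop) : ℝ := ex fun ω => if P ω then 1 else 0

theorem ex_mono {f g : Ω → ℝ} (h : ∀ ω, f ω ≤ g ω) : ex f ≤ ex g := by
  unfold ex; gcongr; exact h _

theorem ex_nonneg {f : Ω → ℝ} (h : ∀ ω, 0 ≤ f ω) : 0 ≤ ex f :=
  div_nonneg (sum_nonneg fun i _ => h i) (by positivity)

theorem ex_add (f g : Ω → ℝ) : ex (fun ω => f ω + g ω) = ex f + ex g := by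
  simp [ex, sum_add_distrib, add_div]

theorem ex_sub (f g : Ω → ℝ) : ex (fun ω => f ω - g ω) = ex f - ex g := by
  simp [ex, sum_sub_distrib, sub_div]

theorem ex_sum {ι : Type} (s : Finset ι) (f : ι → Ω → ℝ) :
    ex (fun ω => ∑ i ∈ s, f i ω) = ∑ i ∈ s, ex (f i) := by
  simp only [ex]; rw [sum_comm, sum_div]

theorem ex_mul_left (c : ℝ) (f : Ω → ℝ) : ex (fun ω => c * f ω) = c * ex f := by
  simp [ex, ← mul_sum, mul_div_assoc]

theorem ex_const [Nonempty Ω] (c : ℝ) : ex (fun _ : Ω => c) = c := by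
  simp [ex]

theorem ex_const_le {c : ℝ} (hc : 0 ≤ c) : ex (fun _ : Ω => c) ≤ c := by
  rcases isEmpty_or_nonempty Ω with h | h
  · simpa [ex] using hc
  · rw [ex_const]

theorem ex_equiv (e : Ω ≃ Ω') (f : Ω' → ℝ) : ex (fun ω => f (e ω)) = ex f := by
  simp only [ex]; rw [Equiv.sum_comp e, Fintype.card_congr e]

theorem ex_prod (f : Ω × Ω' → ℝ) : ex f = ex fun a => ex fun b => f (a, b) := by
  simp only [ex, Fintype.sum_prod_type, Fintype.card_prod, Nat.cast_mul, ← sum_div, div_div]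
  rw [mul_comm]

theorem ex_comm (f : Ω → Ω' → ℝ) : ex (fun a => ex fun b => f a b) = ex fun b => ex fun a => f a b := by
  rw [← ex_prod (fun x : Ω × Ω' => f x.1 x.2), ← ex_equiv (Equiv.prodComm Ω' Ω), ex_prod]; rfl

theorem exists_le_of_ex_le [Nonempty Ω] {f : Ω → ℝ} {c : ℝ} (h : ex f ≤ c) : ∃ ω, f ω ≤ c := by
  by_contra! hc
  have h1 : ∑ ω : Ω, c < ∑ ω, f ω := sum_lt_sum_of_nonempty univ_nonempty fun i _ => hc i
  have h2 : (0 : ℝ) < Fintype.card Ω := by exact_mod_cast Fintype.card_pos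
  rw [ex, div_le_iff₀ h2] at h
  simp at h1
  linarith

theorem ex_sq_le (f : Ω → ℝ) : (ex f) ^ 2 ≤ ex fun ω => f ω ^ 2 := by
  rcases isEmpty_or_nonempty Ω with h | h
  · simp [ex]
  have h2 : (0 : ℝ) < Fintype.card Ω := by exact_mod_cast Fintype.card_pos
  have := sq_sum_le_card_mul_sum_sq (s := (univ : Finset Ω)) (f := f)
  rw [ex, ex, div_pow, div_le_div_iff₀ (by positivity) h2, card_univ] at *
  nlinarith

variable {P Q : Ω → Prop}

open Classical in
theorem pr_eq : pr P = ((univ.filter fun ω => P ω).card : ℝ) / Fintype.card Ω := by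
  simp only [pr, ex, sum_boole]

theorem pr_nonneg (P : Ω → Prop) : 0 ≤ pr P := ex_nonneg fun ω => by split_ifs <;> norm_num

theorem pr_mono (h : ∀ ω, P ω → Q ω) : pr P ≤ pr Q := ex_mono fun ω => by
  grind

theorem pr_congr (h : ∀ ω, P ω ↔ Q ω) : pr P = pr Q := by
  congr 1; ext ω; exact h ω

theorem pr_le_one (P : Ω → Prop) : pr P ≤ 1 :=
  (ex_mono fun ω => by split_ifs <;> norm_num).trans (ex_const_le zero_le_one)

theorem pr_true [Nonempty Ω] (h : ∀ ω, P ω) : pr P = 1 := by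
  simp [pr, h, ex_const]

theorem pr_false (h : ∀ ω, ¬ P ω) : pr P = 0 := by
  simp [pr, h, ex]

theorem pr_or_le (P Q : Ω → Prop) : pr (fun ω => P ω ∨ Q ω) ≤ pr P + pr Q := by
  classical
  rw [pr, pr, pr, ← ex_add]
  refine ex_mono fun ω => ?_
  grind

theorem pr_exists_le {ι : Type} (s : Finset ι) (P : ι → Ω → Prop) :
    pr (fun ω => ∃ i ∈ s, P i ω) ≤ ∑ i ∈ s, pr (P i) := by
  classical
  induction s using Finset.induction_on with
  | empty => simp [pr_false]
  | insert a s ha ih =>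
    rw [sum_insert ha]
    refine le_trans (le_trans (pr_mono fun ω h => ?_) (pr_or_le (P a) _)) (by gcongr)
    simpa using h

theorem pr_sub_le (P Q : Ω → Prop) : pr P - pr Q ≤ pr (fun ω => P ω ∧ ¬ Q ω) := by
  have := pr_or_le (fun ω => P ω ∧ ¬ Q ω) Q
  have := pr_mono (P := P) (Q := fun ω => (P ω ∧ ¬ Q ω) ∨ Q ω) fun ω h => by tauto
  linarith

theorem pr_add_pr_not [Nonempty Ω] (P : Ω → Prop) : pr P + pr (fun ω => ¬ P ω) = 1 := by
  classical
  rw [pr, pr, ← ex_add]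
  refine Eq.trans ?_ (ex_const (Ω := Ω) 1)
  grind

theorem pr_split (P Q : Ω → Prop) :
    pr P = pr (fun ω => P ω ∧ Q ω) + pr (fun ω => P ω ∧ ¬ Q ω) := by
  classical
  rw [pr, pr, pr, ← ex_add]
  grind

theorem exists_of_pr_pos (h : 0 < pr P) : ∃ ω, P ω := by
  by_contra! hc
  rw [pr_false hc] at h
  exact lt_irrefl _ h

theorem exists_of_pr_lt (h : pr Q < pr P) : ∃ ω, P ω ∧ ¬ Q ω :=
  exists_of_pr_pos (by linarith [pr_sub_le P Q])

theorem pr_equiv (e : Ω ≃ Ω') (P : Ω' → Prop) : pr (fun ω => P (e ω)) = pr P :=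
  by
  classical
  exact ex_equiv e fun ω => if P ω then 1 else 0

theorem pr_prod (P : Ω × Ω' → Prop) : pr P = ex fun a => pr fun b => P (a, b) := ex_prod _

theorem pr_swap (P : Ω × Ω' → Prop) : pr P = pr fun x : Ω' × Ω => P (x.2, x.1) :=
  (pr_equiv (Equiv.prodComm Ω' Ω) P).symm

theorem pr_prod_le {P : Ω × Ω' → Prop} {c : ℝ} (hc : 0 ≤ c)
    (h : ∀ a, pr (fun b => P (a, b)) ≤ c) : pr P ≤ c := by
  rw [pr_prod]; exact (ex_mono h).trans (ex_const_le hc)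

theorem pr_prod_le' {P : Ω × Ω' → Prop} {c : ℝ} (hc : 0 ≤ c)
    (h : ∀ b, pr (fun a => P (a, b)) ≤ c) : pr P ≤ c := by
  rw [pr_swap]; exact pr_prod_le hc h

theorem mul_pr_le_ex {f : Ω → ℝ} {c : ℝ} (hf : ∀ ω, 0 ≤ f ω) (h : ∀ ω, P ω → c ≤ f ω) :
    c * pr P ≤ ex f := by
  rw [pr, ← ex_mul_left]
  refine ex_mono fun ω => ?_
  split_ifs with h1
  · simpa using h ω h1
  · simpa using hf ω

theorem mul_pr_le_prod {P : Ω → Prop} {Q : Ω → Ω' → Prop} {c : ℝ}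
    (h : ∀ a, P a → c ≤ pr (Q a)) :
    c * pr P ≤ pr fun x : Ω × Ω' => P x.1 ∧ Q x.1 x.2 := by
  rw [pr_prod]
  exact mul_pr_le_ex (fun _ => pr_nonneg _) fun a ha => (h a ha).trans (pr_mono fun _ hb => ⟨ha, hb⟩)

theorem pr_fst [Nonempty Ω'] (P : Ω → Prop) : pr (fun x : Ω × Ω' => P x.1) = pr P := by
  rw [pr_prod]
  classical
  unfold pr; congr 1; ext a; exact ex_const (Ω := Ω') (if P a then 1 else 0)

theorem pr_snd [Nonempty Ω] (P : Ω' → Prop) : pr (fun x : Ω × Ω' => P x.2) = pr P := by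
  rw [pr_swap]; exact pr_fst P

theorem pr_and_prod (P : Ω → Prop) (Q : Ω' → Prop) :
    pr (fun x : Ω × Ω' => P x.1 ∧ Q x.2) = pr P * pr Q := by
  classical
  rw [pr_prod, mul_comm]
  refine Eq.trans ?_ (ex_mul_left (pr Q) fun ω => if P ω then 1 else 0)
  congr 1; ext a
  by_cases h : P a <;> simp [h, pr_false]

/-- Reverse Markov inequality. -/
theorem ex_sub_le_pr {f : Ω → ℝ} {c : ℝ} (hc : 0 ≤ c) (hf : ∀ ω, f ω ≤ 1) :
    ex f - c ≤ pr fun ω => c ≤ f ω := by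
  have h1 : ex f ≤ ex (fun ω => c + if c ≤ f ω then 1 else 0) := ex_mono fun ω => by
    grind
  rw [ex_add] at h1
  have := ex_const_le (Ω := Ω) hc
  simp only [pr]
  grind

theorem pr_sub_le_pr_fiber (Q : Ω × Ω' → Prop) {c : ℝ} (hc : 0 ≤ c) :
    pr Q - c ≤ pr fun a => c ≤ pr fun b => Q (a, b) := by
  rw [pr_prod]
  exact ex_sub_le_pr hc fun _ => pr_le_one _

theorem markov {f : Ω → ℝ} (hf : ∀ ω, 0 ≤ f ω) (c : ℝ) : c * pr (fun ω => c ≤ f ω) ≤ ex f :=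
  mul_pr_le_ex hf fun _ h => h

/-- Doubling: two independent copies of the second coordinate. -/
theorem pr_sq_le (Q : Ω → Ω' → Prop) :
    (pr fun x : Ω × Ω' => Q x.1 x.2) ^ 2 ≤
      pr fun x : Ω × Ω' × Ω' => Q x.1 x.2.1 ∧ Q x.1 x.2.2 := by
  rw [pr_prod, pr_prod]
  refine (ex_sq_le _).trans (le_of_eq ?_)
  congr 1; ext a
  exact (sq _).trans (pr_and_prod _ _).symm

theorem ex_pi_prod {r : ℕ} (F : Fin r → Ω → ℝ) :
    ex (fun f : Fin r → Ω => ∏ i, F i (f i)) = ∏ i, ex (F i) := by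
  classical
  simp only [ex, prod_div_distrib, prod_const, card_univ, Fintype.card_fin,
    Fintype.card_fun, Nat.cast_pow]
  congr 1
  rw [prod_univ_sum, Fintype.piFinset_univ]

theorem pr_pi {r : ℕ} (P : Fin r → Ω → Prop) :
    pr (fun f : Fin r → Ω => ∀ i, P i (f i)) = ∏ i, pr (P i) := by
  classical
  refine Eq.trans ?_ (ex_pi_prod fun i ω => if P i ω then 1 else 0)
  unfold pr
  congr 1; ext f
  rw [prod_boole]
  simp

theorem pr_eval {r : ℕ} (i : Fin r) (P : Ω → Prop) :
    pr (fun f : Fin r → Ω => P (f i)) = pr P := by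
  classical
  rcases isEmpty_or_nonempty Ω with h | h
  · rw [pr_false fun f => h.elim (f i), pr_false fun ω => h.elim ω]
  · have := pr_pi (fun j ω => j = i → P ω)
    rw [prod_eq_single i (fun j _ hj => pr_true fun ω h => absurd h hj) (by simp)] at this
    simpa using this

end Density

noncomputable section Blocks

/-- A type of tuples of `sz` vertices. -/
class Blk (V Ω : Type) where
  sz : ℕ
  eqv : Ω ≃ (Fin sz → V)

instance Blk.vertex {V : Type} : Blk V V := ⟨1, (Equiv.funUnique (Fin 1) V).symm⟩
instance Blk.tuple {V : Type} {a : ℕ} : Blk V (Fin a → V) := ⟨a, Equiv.refl _⟩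
instance Blk.prod {V A B : Type} [Blk V A] [Blk V B] : Blk V (A × B) :=
  ⟨sz V A + sz V B, (Equiv.prodCongr (eqv (V := V) (Ω := A)) (eqv (V := V) (Ω := B))).trans
    (Fin.appendEquiv _ _)⟩
instance (priority := low) Blk.pi {V A : Type} {p : ℕ} [Blk V A] : Blk V (Fin p → A) :=
  ⟨p * sz V A, ((Equiv.arrowCongr (Equiv.refl _) (eqv (V := V) (Ω := A))).trans
    (Equiv.curry _ _ _).symm).trans (Equiv.arrowCongr finProdFinEquiv (Equiv.refl _))⟩

variable {V : Type} [DecidableEq V]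

variable (V) in
/-- The set of vertices of a tuple. -/
def im {Ω : Type} [Blk V Ω] (ω : Ω) : Finset V := univ.image (Blk.eqv (V := V) ω)

theorem im_vertex (v : V) : im V v = {v} := by
  ext x; simp [im, Blk.eqv, Blk.sz, eq_comm]

theorem im_tuple {a : ℕ} (x : Fin a → V) : im V x = univ.image x := rfl

theorem im_prod {A B : Type} [Blk V A] [Blk V B] (x : A × B) : im V x = im V x.1 ∪ im V x.2 := by
  ext v
  simp only [im, mem_image, mem_univ, true_and, mem_union]
  constructor
  · rintro ⟨i, rfl⟩
    refine Fin.addCases (fun i => Or.inl ⟨i, ?_⟩) (fun i => Or.inr ⟨i, ?_⟩) i <;>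
      simp [Blk.eqv]
  · rintro (⟨i, rfl⟩ | ⟨i, rfl⟩)
    · exact ⟨Fin.castAdd _ i, by simp [Blk.eqv]⟩
    · exact ⟨Fin.natAdd _ i, by simp [Blk.eqv]⟩

theorem im_pi {A : Type} {p : ℕ} [Blk V A] (x : Fin p → A) :
    @im V _ _ Blk.pi x = univ.biUnion fun i => im V (x i) := by
  ext v
  simp only [im, mem_image, mem_univ, true_and, mem_biUnion]
  constructor
  · rintro ⟨i, rfl⟩
    exact ⟨(finProdFinEquiv.symm i).1, (finProdFinEquiv.symm i).2, by simp [Blk.eqv]⟩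
  · rintro ⟨i, j, rfl⟩
    exact ⟨finProdFinEquiv (i, j), by simp [Blk.eqv]⟩

theorem card_im_le {Ω : Type} [Blk V Ω] (ω : Ω) : (im V ω).card ≤ Blk.sz V Ω :=
  card_image_le.trans (by simp)

variable [Fintype V] {Ω : Type} [Fintype Ω] [Blk V Ω]

omit [DecidableEq V] in
theorem pr_mem (Z : Finset V) : pr (fun v => v ∈ Z) = Z.card / Fintype.card V := by
  rw [pr_eq]; simp

/-- A random tuple rarely meets a small set. -/
theorem pr_hit_le (Z : Finset V) :
    pr (fun ω : Ω => ¬ Disjoint (im V ω) Z) ≤ Blk.sz V Ω * (Z.card / Fintype.card V) := by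
  have h1 : pr (fun ω : Ω => ¬ Disjoint (im V ω) Z)
      = pr (fun x : Fin (Blk.sz V Ω) → V => ∃ i ∈ univ, x i ∈ Z) := by
    rw [← pr_equiv (Blk.eqv (V := V) (Ω := Ω))]
    refine pr_congr fun ω => ?_
    rw [not_disjoint_iff]
    simp [im]
  rw [h1]
  refine (pr_exists_le _ _).trans ?_
  simp [pr_eval, pr_mem]

/-- `E` has many edges containing any given set of at most `k - 2` vertices. -/
def LowDeg (E : Finset (Finset V)) (k : ℕ) (η : ℝ) : Prop :=
  ∀ S : Finset V, S.card + 2 ≤ k → η ≤ pr fun x : Fin (k - S.card) → V => S ∪ univ.image x ∈ E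

theorem pr_tuple (P : Finset V → Prop) {a : ℕ} (h : Blk.sz V Ω = a) :
    pr (fun ω : Ω => P (im V ω)) = pr fun x : Fin a → V => P (univ.image x) := by
  subst h
  exact pr_equiv (Blk.eqv (V := V) (Ω := Ω)) fun x => P (univ.image x)

theorem LowDeg.le_pr {E : Finset (Finset V)} {k : ℕ} {η : ℝ} (h : LowDeg E k η) (S : Finset V)
    (hS : S.card + 2 ≤ k) (hΩ : Blk.sz V Ω + S.card = k) :
    η ≤ pr fun ω : Ω => S ∪ im V ω ∈ E := by
  rw [pr_tuple (fun X => S ∪ X ∈ E) (a := k - S.card) (by omega)]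
  exact h S hS

end Blocks

noncomputable section Selection

theorem exists_large_pow_mul_exp_lt (d : ℕ) {c : ℝ} (hc : 0 < c) {ε : ℝ} (hε : 0 < ε) :
    ∃ n₀ : ℕ, ∀ n : ℕ, n₀ ≤ n → (n : ℝ) ^ d * Real.exp (-(c * n)) < ε := by
  have h := (Real.tendsto_pow_mul_exp_neg_atTop_nhds_zero d).comp
    ((tendsto_natCast_atTop_atTop (R := ℝ)).const_mul_atTop hc)
  have h2 := (h.const_mul (1 / c ^ d)).eventually_lt_const (u := ε) (by simpa using hε)
  obtain ⟨n₀, hn⟩ := Filter.eventually_atTop.1 h2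
  refine ⟨n₀, fun n hn' => ?_⟩
  have := hn n hn'
  simp only [Function.comp, mul_pow] at this
  rwa [← mul_assoc, ← mul_assoc, one_div_mul_cancel (by positivity), one_mul] at this

variable {Ω : Type} [Fintype Ω]

theorem ex_exp_neg_count_le {r : ℕ} (A : Ω → Prop) [DecidablePred A] {α : ℝ} (hA : α ≤ pr A) :
    ex (fun g : Fin r → Ω => Real.exp (-((univ.filter fun j => A (g j)).card : ℝ)))
      ≤ Real.exp (-(3 / 5 * α * r)) := by
  have h1 : ∀ g : Fin r → Ω, Real.exp (-((univ.filter fun j => A (g j)).card : ℝ))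
      = ∏ j, (if A (g j) then Real.exp (-1) else 1) := by
    intro g
    rw [prod_ite, prod_const, prod_const_one, mul_one, ← Real.exp_nat_mul]
    congr 1; ring
  have h2 : ex (fun ω => if A ω then Real.exp (-1) else 1) ≤ Real.exp (-(3 / 5 * α)) := by
    have he : Real.exp (-1) ≤ 2 / 5 := by
      rw [Real.exp_neg, inv_le_comm₀ (Real.exp_pos _) (by norm_num)]
      linarith [Real.exp_one_gt_d9]
    have : ex (fun ω => if A ω then Real.exp (-1) else 1) ≤
        ex (fun ω => 1 - 3 / 5 * if A ω then 1 else 0) := ex_mono fun ω => by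
      split_ifs <;> linarith
    rw [ex_sub, ex_mul_left] at this
    have h3 : ex (fun ω => if A ω then (1 : ℝ) else 0) = pr A := by
      unfold pr; congr!
    have := ex_const_le (Ω := Ω) zero_le_one
    have := Real.add_one_le_exp (-(3 / 5 * α))
    linarith
  simp only [h1]
  rw [ex_pi_prod fun _ ω => if A ω then Real.exp (-1) else 1, prod_const, card_univ,
    Fintype.card_fin]
  refine (pow_le_pow_left₀ (ex_nonneg fun ω => ?_) h2 r).trans (le_of_eq ?_)
  · split_ifs <;> positivity
  · rw [← Real.exp_nat_mul]; congr 1; ring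

theorem pr_pair {r : ℕ} {i j : Fin r} (hij : i ≠ j) {P : Ω → Ω → Prop} {c : ℝ} (hc : 0 ≤ c)
    (h : ∀ a, pr (P a) ≤ c) : pr (fun g : Fin r → Ω => P (g i) (g j)) ≤ c := by
  rw [← pr_equiv (Equiv.piSplitAt j (fun _ : Fin r => Ω)).symm]
  refine pr_prod_le' hc fun g => ?_
  simpa [Equiv.piSplitAt, hij] using h (g ⟨i, hij⟩)

/-- Random selection of a small family of pairwise disjoint tuples that contains many tuples of
each of polynomially many dense classes. -/
theorem selection (q d : ℕ) (hq : 0 < q) {α γ : ℝ} (hα : 0 < α) (hγ : 0 < γ)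
    (hγα : 8 * q ^ 2 * γ ≤ α) :
    ∃ n₀ : ℕ, ∀ (V Ω ι : Type) [Fintype V] [DecidableEq V] [Fintype Ω] [Blk V Ω] [Fintype ι]
      (A : ι → Ω → Prop), n₀ ≤ Fintype.card V → Blk.sz V Ω = q →
      Fintype.card ι ≤ Fintype.card V ^ d → (∀ i, α ≤ pr (A i)) →
      ∃ F : Finset Ω, (∀ ω ∈ F, ∀ ω' ∈ F, ω ≠ ω' → Disjoint (im V ω) (im V ω')) ∧
        (F.card : ℝ) ≤ γ * Fintype.card V ∧
        ∀ i, ∃ G ⊆ F, (∀ ω ∈ G, A i ω) ∧ α * γ / 8 * Fintype.card V ≤ G.card := by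
  obtain ⟨n₁, hn₁⟩ := exists_large_pow_mul_exp_lt d (c := α * γ / 20) (by positivity)
    (ε := 1 / 2) (by norm_num)
  obtain ⟨n₂, hn₂⟩ := exists_nat_ge (2 / γ)
  refine ⟨max n₁ (n₂ + 1), fun V Ω ι _ _ _ _ _ A hn hsz hι hA => ?_⟩
  classical
  set n := Fintype.card V with hndef
  have hn1 := hn₁ n (le_of_max_le_left hn)
  have hn2 : 2 / γ ≤ n := hn₂.trans (by exact_mod_cast (by omega))
  have hγn : 2 ≤ γ * n := by rwa [div_le_iff₀' hγ] at hn2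
  have hn0 : 0 < n := by omega
  have hnR : (0 : ℝ) < n := by exact_mod_cast hn0
  have : Nonempty V := Fintype.card_pos_iff.1 hn0
  have : Nonempty Ω := ⟨(Blk.eqv (V := V)).symm fun _ => Classical.arbitrary V⟩
  set r := ⌊γ * n⌋₊ with hr
  have hr1 : (r : ℝ) ≤ γ * n := Nat.floor_le (by positivity)
  have hr2 : γ * n / 2 ≤ r := by have := Nat.lt_floor_add_one (γ * n); linarith
  have hr0 : (0 : ℝ) < r := by linarith
  let X : ι → (Fin r → Ω) → ℝ := fun i g => ((univ.filter fun j => A i (g j)).card : ℝ)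
  let bad : (Fin r → Ω) → Finset (Fin r × Fin r) := fun g =>
    univ.filter fun p => p.1 < p.2 ∧ ¬ Disjoint (im V (g p.2)) (im V (g p.1))
  have hY : ex (fun g => ((bad g).card : ℝ)) ≤ r ^ 2 * (q ^ 2 / n) := by
    have h1 : ∀ g, ((bad g).card : ℝ) = ∑ p : Fin r × Fin r,
        if (p.1 < p.2 ∧ ¬ Disjoint (im V (g p.2)) (im V (g p.1))) then 1 else 0 := by
      intro g; simp [bad]
    simp only [h1]
    rw [ex_sum]
    have h2 : ∀ p : Fin r × Fin r, ex (fun g : Fin r → Ω =>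
        if (p.1 < p.2 ∧ ¬ Disjoint (im V (g p.2)) (im V (g p.1))) then (1 : ℝ) else 0)
        ≤ q ^ 2 / n := by
      intro p
      by_cases hp : p.1 < p.2
      · simp only [hp, true_and]
        have := pr_pair (P := fun a b : Ω => ¬ Disjoint (im V b) (im V a)) hp.ne
          (c := (q : ℝ) ^ 2 / n) (by positivity) fun a => by
            refine (pr_hit_le _).trans ?_
            rw [hsz, sq, mul_div_assoc]
            gcongr
            exact_mod_cast hsz ▸ card_im_le a
        refine le_trans (le_of_eq ?_) this
        unfold pr; congr!
      · simp only [hp, false_and, if_false]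
        exact (ex_const_le le_rfl).trans (by positivity)
    refine (sum_le_sum fun p _ => h2 p).trans (le_of_eq ?_)
    simp [sq]
  let Φ : (Fin r → Ω) → ℝ := fun g => ∑ i, Real.exp (α * r / 2) * Real.exp (-X i g)
    + (2 * (q ^ 2 * γ * r))⁻¹ * ((bad g).card : ℝ)
  have hΦ : ex Φ < 1 := by
    rw [ex_add, ex_sum, ex_mul_left]
    have h1 : ∑ i, ex (fun g => Real.exp (α * r / 2) * Real.exp (-X i g)) < 1 / 2 := by
      calc ∑ i, ex (fun g => Real.exp (α * r / 2) * Real.exp (-X i g))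
          ≤ ∑ i : ι, Real.exp (-(α * γ / 20 * n)) := by
            refine sum_le_sum fun i _ => ?_
            rw [ex_mul_left]
            refine (mul_le_mul_of_nonneg_left (ex_exp_neg_count_le (A i) (hA i))
              (Real.exp_pos _).le).trans ?_
            rw [← Real.exp_add]
            apply Real.exp_le_exp.2
            nlinarith
        _ = Fintype.card ι * Real.exp (-(α * γ / 20 * n)) := by simp
        _ ≤ (n : ℝ) ^ d * Real.exp (-(α * γ / 20 * n)) := by
            gcongr; exact_mod_cast hι
        _ < 1 / 2 := hn1
    have h2 : (2 * (q ^ 2 * γ * r))⁻¹ * ex (fun g => ((bad g).card : ℝ)) ≤ 1 / 2 := by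
      rw [inv_mul_le_iff₀ (by positivity)]
      refine hY.trans ?_
      rw [mul_div_assoc', div_le_iff₀ hnR]
      have : (0:ℝ) ≤ r * q ^ 2 := by positivity
      nlinarith
    linarith
  obtain ⟨g, hg⟩ := exists_le_of_ex_le (le_refl (ex Φ))
  have hg : Φ g < 1 := hg.trans_lt hΦ
  have hbad : ((bad g).card : ℝ) ≤ α * r / 4 := by
    have h1 : (2 * (q ^ 2 * γ * r))⁻¹ * ((bad g).card : ℝ) ≤ 1 := by
      have : 0 ≤ ∑ i, Real.exp (α * r / 2) * Real.exp (-X i g) :=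
        sum_nonneg fun i _ => by positivity
      simp only [Φ] at hg
      linarith
    rw [inv_mul_le_iff₀ (by positivity)] at h1
    nlinarith
  have hX : ∀ i, α * r / 2 ≤ X i g := by
    intro i
    by_contra! hlt
    have h1 : 1 ≤ Real.exp (α * r / 2) * Real.exp (-X i g) := by
      rw [← Real.exp_add]; exact Real.one_le_exp (by linarith)
    have h2 := single_le_sum (f := fun i => Real.exp (α * r / 2) * Real.exp (-X i g))
      (fun i _ => by positivity) (mem_univ i)
    have h3 : 0 ≤ (2 * (q ^ 2 * γ * r))⁻¹ * ((bad g).card : ℝ) := by positivity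
    simp only [Φ] at hg
    linarith
  let J : Finset (Fin r) := univ \ (bad g).image Prod.snd
  have hJ : ∀ j ∈ J, ∀ j' ∈ J, j ≠ j' → Disjoint (im V (g j)) (im V (g j')) := by
    have main : ∀ j ∈ J, ∀ j' ∈ J, j < j' → Disjoint (im V (g j')) (im V (g j)) := by
      intro j _ j' hj' hlt
      by_contra hd
      simp only [J, mem_sdiff, mem_univ, true_and, mem_image, not_exists, not_and] at hj'
      exact hj' (j, j') (by simp [bad, hlt, hd]) rfl
    intro j hj j' hj' hne
    rcases lt_or_gt_of_ne hne with h | h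
    · exact (main j hj j' hj' h).symm
    · exact main j' hj' j hj h
  have hne : ∀ ω : Ω, (im V ω).Nonempty := fun ω => by
    rw [im, image_nonempty]
    exact ⟨⟨0, by omega⟩, mem_univ _⟩
  have hinj : Set.InjOn g J := by
    intro j hj j' hj' he
    by_contra hc
    have := hJ j hj j' hj' hc
    rw [he, disjoint_self_iff_empty] at this
    exact (hne _).ne_empty this
  refine ⟨J.image g, ?_, ?_, fun i => ⟨(J.filter fun j => A i (g j)).image g, ?_, ?_, ?_⟩⟩
  · simp only [mem_image]
    rintro _ ⟨j, hj, rfl⟩ _ ⟨j', hj', rfl⟩ h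
    exact hJ j hj j' hj' fun h' => h (by rw [h'])
  · refine le_trans ?_ hr1
    exact_mod_cast card_image_le.trans ((card_le_univ J).trans (by simp))
  · exact image_subset_image (filter_subset _ _)
  · simp only [mem_image, mem_filter]
    rintro _ ⟨j, ⟨_, hj⟩, rfl⟩
    exact hj
  · rw [card_image_of_injOn (hinj.mono (by intro x hx; simp at hx ⊢; exact hx.1))]
    have h1 : (univ.filter fun j => A i (g j)).card ≤ (J.filter fun j => A i (g j)).card
        + (bad g).card := by
      refine le_trans (card_le_card (t := (J.filter fun j => A i (g j)) ∪ (bad g).image Prod.snd)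
        fun j hj => ?_) ((card_union_le _ _).trans (by gcongr; exact card_image_le))
      by_cases hjb : j ∈ (bad g).image Prod.snd
      · exact mem_union_right _ hjb
      · exact mem_union_left _ (by simp only [mem_filter, J, mem_sdiff] at hj ⊢; exact ⟨⟨mem_univ _, hjb⟩, hj.2⟩)
    have h2 := hX i
    have h3 : X i g ≤ ((J.filter fun j => A i (g j)).card : ℝ) + ((bad g).card : ℝ) := by
      simp only [X]; exact_mod_cast h1
    nlinarith

end Selection

noncomputable section Assembly

variable {V : Type} [DecidableEq V]

/-- Greedy connection of disjoint paths whose interiors are to be specified later. -/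
theorem connect {G ι : Type} [AddCommGroup G] [DecidableEq ι] {E : Finset (Finset V)} {ℓ q z : ℕ}
    {w : V → G} {κ : G} {adm : Finset V → Prop} {D : Finset V}
    (hconn : ∀ A B, adm A → adm B → Disjoint A B → ∀ Z : Finset V, Z.card ≤ z →
      ∃ C ⊆ D, PathOn E ℓ A C B ∧ ∑ v ∈ C, w v = κ ∧ C.card ≤ q ∧ Disjoint C Z)
    (L L' : ι → Finset V) (L₀ L₁ Z₀ : Finset V) (hL₁ : adm L₁) (I : Finset ι)
    (hz : Z₀.card + I.card * q ≤ z) (ha : ∀ i ∈ I, adm (L i)) (ha' : ∀ i ∈ I, adm (L' i))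
    (hd : ∀ i ∈ I, Disjoint L₁ (L i)) (hd' : ∀ i ∈ I, ∀ j ∈ I, i ≠ j → Disjoint (L' i) (L j)) :
    ∃ C L₂, C ⊆ D ∧ Disjoint C Z₀ ∧ C.card ≤ I.card * q ∧ ∑ v ∈ C, w v = I.card • κ ∧ adm L₂ ∧
      (L₂ = L₁ ∨ ∃ i ∈ I, L₂ = L' i) ∧
      ∀ (M₀ : Finset V) (M : ι → Finset V), PathOn E ℓ L₀ M₀ L₁ →
        (∀ i ∈ I, PathOn E ℓ (L i) (M i) (L' i)) →
        (∀ i ∈ I, ∀ j ∈ I, i ≠ j → Disjoint (L i ∪ M i ∪ L' i) (L j ∪ M j ∪ L' j)) →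
        (∀ i ∈ I, Disjoint (L i ∪ M i ∪ L' i) (L₀ ∪ M₀ ∪ L₁)) →
        Disjoint C (L₀ ∪ M₀ ∪ L₁) → (∀ i ∈ I, Disjoint C (L i ∪ M i ∪ L' i)) →
        PathOn E ℓ L₀ ((L₀ ∪ M₀ ∪ L₁ ∪ C ∪ I.biUnion fun i => L i ∪ M i ∪ L' i) \ (L₀ ∪ L₂)) L₂ := by
  induction I using Finset.induction_on with
  | empty =>
    refine ⟨∅, L₁, by simp, by simp, by simp, by simp, hL₁, Or.inl rfl, fun M₀ M p _ _ _ _ _ => ?_⟩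
    convert p using 1
    have d := p.disj
    simp only [disjoint_left] at d
    ext x
    grind
  | insert i I hi ih =>
    rw [card_insert_of_notMem hi, add_mul, one_mul] at hz
    obtain ⟨C, L₂, hCD, hCZ, hCc, hCw, hL₂, hor, hC⟩ := ih (by omega)
      (fun j hj => ha j (mem_insert_of_mem hj)) (fun j hj => ha' j (mem_insert_of_mem hj))
      (fun j hj => hd j (mem_insert_of_mem hj))
      (fun j hj j' hj' => hd' j (mem_insert_of_mem hj) j' (mem_insert_of_mem hj'))
    have hii : i ∈ insert i I := mem_insert_self _ _
    have hdis : Disjoint L₂ (L i) := by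
      grind
    obtain ⟨C', hC'D, hp, hw, hc, hZ⟩ := hconn L₂ (L i) hL₂ (ha i hii) hdis (Z₀ ∪ C)
      ((card_union_le _ _).trans (by omega))
    rw [disjoint_union_right] at hZ
    refine ⟨C ∪ C', L' i, union_subset hCD hC'D, disjoint_union_left.2 ⟨hCZ, hZ.1⟩, ?_, ?_,
      ha' i hii, Or.inr ⟨i, hii, rfl⟩, fun M₀ M p0 pI dI d0 dC dCI => ?_⟩
    · rw [card_insert_of_notMem hi, add_mul, one_mul]
      grind
    · rw [sum_union hZ.2.symm, hCw, hw, card_insert_of_notMem hi, add_smul, one_smul]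
    rw [disjoint_union_left] at dC
    have h1 := hC M₀ M p0 (fun j hj => pI j (mem_insert_of_mem hj))
      (fun j hj j' hj' => dI j (mem_insert_of_mem hj) j' (mem_insert_of_mem hj'))
      (fun j hj => d0 j (mem_insert_of_mem hj)) dC.1
      (fun j hj => (disjoint_union_left.1 (dCI j (mem_insert_of_mem hj))).1)
    set S := L₀ ∪ M₀ ∪ L₁ ∪ C ∪ I.biUnion fun i => L i ∪ M i ∪ L' i with hS
    have h2 := PathOn.join (S := S) (fun x hx => by simp [hS, hx]) (fun x hx => by
      grind) h1 hp (pI i hii)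
      (by
        rw [hS, disjoint_union_right, disjoint_union_right, disjoint_biUnion_right]
        exact ⟨⟨dC.2, hZ.2⟩, fun j hj => (disjoint_union_left.1 (dCI j (mem_insert_of_mem hj))).2⟩)
      (by
        rw [hS, disjoint_union_right, disjoint_union_right, disjoint_biUnion_right]
        exact ⟨⟨d0 i hii, (disjoint_union_left.1 (dCI i hii)).1.symm⟩, fun j hj =>
          dI i hii j (mem_insert_of_mem hj) (by rintro rfl; exact hi hj)⟩)
      (disjoint_union_left.1 (dCI i hii)).2
    convert h2 using 2
    rw [biUnion_insert, hS]
    ac_rfl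

theorem exists_injective_choice {α β : Type} [DecidableEq β] (s : Finset α) (G : α → Finset β)
    (h : ∀ a ∈ s, s.card ≤ (G a).card) :
    ∃ f : s → β, Function.Injective f ∧ ∀ a : s, f a ∈ G a :=
  (Finset.all_card_le_biUnion_card_iff_exists_injective fun a : s => G a).1 fun t => by
    rcases t.eq_empty_or_nonempty with rfl | ⟨a, ha⟩
    · simp
    · calc t.card ≤ s.card := (card_le_univ t).trans (by simp)
        _ ≤ (G a).card := h a a.2
        _ ≤ _ := card_le_card (subset_biUnion_of_mem (fun a : s => G a) ha)

/-- The pieces of an absorber: disjoint paths of weight `-κ` that span `W`. -/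
def AbsValid {G : Type} [AddCommGroup G] (E : Finset (Finset V)) (ℓ : ℕ) (adm : Finset V → Prop)
    (w : V → G) (κ : G) {J : Type} [Fintype J] (st mid en : J → Finset V) (W : Finset V) : Prop :=
  (∀ j, PathOn E ℓ (st j) (mid j) (en j) ∧ adm (st j) ∧ adm (en j) ∧
    ∑ v ∈ st j ∪ mid j ∪ en j, w v = -κ) ∧
  (∀ i j, i ≠ j → Disjoint (st i ∪ mid i ∪ en i) (st j ∪ mid j ∪ en j)) ∧
  (univ.biUnion fun j => st j ∪ mid j ∪ en j) = W

/-- There are disjoint paths with given ends that span `W`. -/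
def Spans (E : Finset (Finset V)) (ℓ : ℕ) {J : Type} [Fintype J] (st en : J → Finset V) (W : Finset V) :
    Prop :=
  ∃ mid : J → Finset V, (∀ j, PathOn E ℓ (st j) (mid j) (en j)) ∧
    (∀ i j, i ≠ j → Disjoint (st i ∪ mid i ∪ en i) (st j ∪ mid j ∪ en j)) ∧
    (univ.biUnion fun j => st j ∪ mid j ∪ en j) = W

theorem absorbing_path {G Ω J : Type} [AddCommGroup G] [Blk V Ω] [Fintype J] {E : Finset (Finset V)}
    {ℓ q z s₀ cap : ℕ} (hs₀ : 0 < s₀)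
    {w : V → G} {κ : G} {adm 𝒮 : Finset V → Prop} {D : Finset V}
    (hconn : ∀ A B, adm A → adm B → Disjoint A B → ∀ Z : Finset V, Z.card ≤ z →
      ∃ C ⊆ D, PathOn E ℓ A C B ∧ ∑ v ∈ C, w v = κ ∧ C.card ≤ q ∧ Disjoint C Z)
    {L₀ M₀ L₁ : Finset V} (hp : PathOn E ℓ L₀ M₀ L₁) (hL₁ : adm L₁)
    (hDP : Disjoint D (L₀ ∪ M₀ ∪ L₁)) (h𝒮 : ∀ S, 𝒮 S → S.card = s₀)
    (hsplit : ∀ U ⊆ D, ∑ v ∈ U, w v = 0 → ∃ P : Finset (Finset V), (∀ S ∈ P, 𝒮 S) ∧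
      (∀ S ∈ P, ∀ S' ∈ P, S ≠ S' → Disjoint S S') ∧ P.biUnion id = U)
    (st mid en : Ω → J → Finset V) (F : Finset Ω)
    (hF : ∀ ω ∈ F, ∀ ω' ∈ F, ω ≠ ω' → Disjoint (im V ω) (im V ω'))
    (hFD : ∀ ω ∈ F, im V ω ⊆ D)
    (hFv : ∀ ω ∈ F, AbsValid E ℓ adm w κ (st ω) (mid ω) (en ω) (im V ω))
    (hhit : ∀ S, 𝒮 S → S ⊆ D → ∃ A ⊆ F, (∀ ω ∈ A, Spans E ℓ (st ω) (en ω) (im V ω ∪ S)) ∧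
      cap ≤ A.card)
    (hz : F.card * Blk.sz V Ω + F.card * Fintype.card J * q ≤ z) :
    ∃ R L, R ⊆ D ∧ R.card ≤ F.card * Blk.sz V Ω + F.card * Fintype.card J * q ∧ ∑ v ∈ R, w v = 0 ∧ adm L ∧
      L ⊆ L₀ ∪ M₀ ∪ L₁ ∪ R ∧ ∀ U ⊆ D \ R, ∑ v ∈ U, w v = 0 → U.card ≤ cap →
        PathOn E ℓ L₀ ((L₀ ∪ M₀ ∪ L₁ ∪ R ∪ U) \ (L₀ ∪ L)) L := by
  classical
  have hblk : ∀ ω ∈ F, ∀ j, st ω j ∪ mid ω j ∪ en ω j ⊆ im V ω := fun ω hω j => by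
    rw [← (hFv ω hω).2.2]
    grind
  have hst : ∀ ω j, st ω j ⊆ st ω j ∪ mid ω j ∪ en ω j := fun ω j x hx => by simp [hx]
  have hen : ∀ ω j, en ω j ⊆ st ω j ∪ mid ω j ∪ en ω j := fun ω j x hx => by simp [hx]
  have hZc : (F.biUnion (im V)).card ≤ F.card * Blk.sz V Ω :=
    card_biUnion_le_card_mul _ _ _ fun ω _ => card_im_le ω
  obtain ⟨C, L, hCD, hCZ, hCc, hCw, hL, hor, hC⟩ := connect hconn
    (fun x : Ω × J => st x.1 x.2) (fun x => en x.1 x.2) L₀ L₁ (F.biUnion (im V)) hL₁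
    (F ×ˢ univ) (by rw [card_product, card_univ]; omega)
    (fun x hx => ((hFv x.1 (mem_product.1 hx).1).1 x.2).2.1)
    (fun x hx => ((hFv x.1 (mem_product.1 hx).1).1 x.2).2.2.1)
    (fun x hx => by
      have h1 := (mem_product.1 hx).1
      refine (hDP.mono ((hst x.1 x.2).trans ((hblk _ h1 x.2).trans (hFD _ h1))) ?_).symm
      intro v hv; simp [hv])
    (fun x hx y hy hxy => by
      have h1 := (mem_product.1 hx).1
      have h2 := (mem_product.1 hy).1
      by_cases h : x.1 = y.1
      · obtain ⟨a, i⟩ := x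
        obtain ⟨b, j⟩ := y
        obtain rfl : a = b := h
        exact ((hFv a h1).2.1 i j fun h' => hxy (by rw [h'])).mono (hen _ _) (hst _ _)
      grind)
  rw [card_product, card_univ] at hCc hCw
  set Z := F.biUnion (im V) with hZ
  have hZD : Z ⊆ D := biUnion_subset.2 hFD
  have himZ : ∀ ω ∈ F, im V ω ⊆ Z := fun ω hω => subset_biUnion_of_mem (im V) hω
  have hZw : ∑ v ∈ Z, w v = -((F.card * Fintype.card J) • κ) := by
    rw [hZ, sum_biUnion fun a ha b hb hab => hF a ha b hb hab,
      sum_congr rfl fun ω hω => (by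
        rw [← (hFv ω hω).2.2, sum_biUnion fun i _ j _ hij => (hFv ω hω).2.1 i j hij,
          sum_congr rfl fun j _ => ((hFv ω hω).1 j).2.2.2] : ∑ v ∈ im V ω, w v = ∑ j : J, -κ)]
    simp [mul_smul]
  refine ⟨Z ∪ C, L, union_subset hZD hCD, (card_union_le _ _).trans (by omega), ?_, hL, ?_,
    fun U hU hUw hUc => ?_⟩
  · rw [sum_union hCZ.symm, hCw, hZw]; simp
  · grind
  obtain ⟨P, hP𝒮, hPd, hPU⟩ := hsplit U (hU.trans sdiff_subset) hUw
  have hPsub : ∀ S ∈ P, S ⊆ U := fun S hS => by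
    grind
  have hPc : P.card ≤ cap := by
    refine le_trans ?_ hUc
    rw [← hPU, card_biUnion (t := id) hPd, ← mul_one P.card, ← smul_eq_mul, ← sum_const]
    exact sum_le_sum fun S hS => by grind
  choose! A hAF hAs hAc using hhit
  obtain ⟨f, hf, hfA⟩ := exists_injective_choice P A fun S hS =>
    hPc.trans (hAc S (hP𝒮 S hS) ((hPsub S hS).trans (hU.trans sdiff_subset)))
  have key : ∀ ω, ∃ X : Finset V, (X = ∅ ∨ ∃ S : P, f S = ω ∧ X = S.1) ∧
      (ω ∈ F → Spans E ℓ (st ω) (en ω) (im V ω ∪ X)) ∧ ∀ S : P, f S = ω → X = S.1 := by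
    intro ω
    by_cases h : ∃ S : P, f S = ω
    · obtain ⟨S, rfl⟩ := h
      exact ⟨S.1, Or.inr ⟨S, rfl, rfl⟩, fun _ => hAs S.1 (hP𝒮 _ S.2)
        ((hPsub _ S.2).trans (hU.trans sdiff_subset)) _ (hfA S), fun T hT => by rw [hf hT]⟩
    · refine ⟨∅, Or.inl rfl, fun hω => ⟨mid ω, fun j => ((hFv ω hω).1 j).1, (hFv ω hω).2.1, ?_⟩,
        fun S hS => absurd ⟨S, hS⟩ h⟩
      rw [(hFv ω hω).2.2, union_empty]
  choose X hXor hXs hXS using key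
  choose! mid' hm1 hm2 hm3 using hXs
  have hXU : ∀ ω, X ω ⊆ U := fun ω => by
    rcases hXor ω with h | ⟨S, _, h⟩
    · rw [h]; exact empty_subset _
    · rw [h]; exact hPsub _ S.2
  have hXd : ∀ ω ω', ω ≠ ω' → Disjoint (X ω) (X ω') := fun ω ω' hne => by
    rcases hXor ω with h | ⟨S, hS, h⟩
    · rw [h]; exact disjoint_empty_left _
    rcases hXor ω' with h' | ⟨S', hS', h'⟩
    · rw [h']; exact disjoint_empty_right _
    grind
  have hUZC : Disjoint U (Z ∪ C) := disjoint_of_subset_left hU sdiff_disjoint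
  rw [disjoint_union_right] at hUZC
  have hblk' : ∀ ω ∈ F, ∀ j, st ω j ∪ mid' ω j ∪ en ω j ⊆ im V ω ∪ X ω := fun ω hω j => by
    rw [← hm3 ω hω]
    exact subset_biUnion_of_mem (fun j => st ω j ∪ mid' ω j ∪ en ω j) (mem_univ j)
  have hWD : ∀ ω ∈ F, im V ω ∪ X ω ⊆ D := fun ω hω =>
    union_subset (hFD ω hω) ((hXU ω).trans (hU.trans sdiff_subset))
  have fin := hC M₀ (fun x => mid' x.1 x.2) hp (fun x hx => hm1 _ (mem_product.1 hx).1 _)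
    (fun x hx y hy hxy => by
      have h1 := (mem_product.1 hx).1
      have h2 := (mem_product.1 hy).1
      by_cases h : x.1 = y.1
      · grind
      · refine Disjoint.mono (hblk' _ h1 _) (hblk' _ h2 _) ?_
        rw [disjoint_union_left, disjoint_union_right, disjoint_union_right]
        exact ⟨⟨hF _ h1 _ h2 h, (hUZC.1.mono (hXU _) (himZ _ h1)).symm⟩,
          hUZC.1.mono (hXU _) (himZ _ h2), hXd _ _ h⟩)
    (fun x hx => by
      grind)
    (hDP.mono_left hCD)
    (fun x hx => by
      have h1 := (mem_product.1 hx).1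
      refine Disjoint.mono_right (hblk' _ h1 _) ?_
      rw [disjoint_union_right]
      grind)
  convert fin using 2
  have h1 : ((F ×ˢ univ).biUnion fun x : Ω × J => st x.1 x.2 ∪ mid' x.1 x.2 ∪ en x.1 x.2)
      = Z ∪ U := by
    rw [product_biUnion]
    rw [biUnion_congr rfl fun ω hω => hm3 ω hω, hZ, ← hPU]
    ext v
    simp only [mem_biUnion, mem_union, id]
    constructor
    · rintro ⟨ω, hω, h | h⟩
      · grind
      · rcases hXor ω with h' | ⟨S, _, h'⟩
        · rw [h'] at h; simp at h
        grind
    · rintro (⟨ω, hω, h⟩ | ⟨S, hS, h⟩)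
      · grind
      · refine ⟨f ⟨S, hS⟩, ?_, Or.inr ?_⟩
        · exact hAF S (hP𝒮 S hS) ((hPsub S hS).trans (hU.trans sdiff_subset)) (hfA ⟨S, hS⟩)
        grind
  rw [h1]
  ac_rfl

theorem union_sdiff_union_eq {A B S : Finset V} (hA : A ⊆ S) (hB : B ⊆ S) :
    A ∪ S \ (A ∪ B) ∪ B = S := by
  ext x
  grind

set_option maxHeartbeats 1000000 in
theorem assembly (ℓ qc qa p s₀ : ℕ) (hqc : 0 < qc) (hqa : 0 < qa) (hs₀ : 0 < s₀) {c γ₀ K : ℝ}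
    (hc : 0 < c) (hγ₀ : 0 < γ₀) (hK : 0 ≤ K) :
    ∃ β > 0, ∃ n₀ : ℕ, ∀ (V G Ω J : Type) [Fintype J] [Fintype V] [DecidableEq V] [AddCommGroup G] [Fintype Ω]
      [Blk V Ω] (E : Finset (Finset V)) (w : V → G) (κ : G) (adm 𝒮 : Finset V → Prop)
      (D L₀ M₀ L₁ : Finset V) (st mid en : Ω → J → Finset V),
      n₀ ≤ Fintype.card V → Blk.sz V Ω = qa → Fintype.card J = p → PathOn E ℓ L₀ M₀ L₁ → adm L₀ → adm L₁ →
      (∀ L, adm L → L.card = ℓ) → D = univ \ (L₀ ∪ M₀ ∪ L₁) →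
      ∑ v, w v = ∑ v ∈ L₀ ∪ M₀ ∪ L₁, w v + κ →
      (∀ A B, adm A → adm B → Disjoint A B →
        c ≤ pr fun ω : Fin qc → V => PathOn E ℓ A (im V ω) B ∧ im V ω ⊆ D ∧
          ∑ v ∈ im V ω, w v = κ) →
      (∀ S, 𝒮 S → S.card = s₀) →
      (∀ S, 𝒮 S → S ⊆ D → c ≤ pr fun ω : Ω => im V ω ⊆ D ∧
        AbsValid E ℓ adm w κ (st ω) (mid ω) (en ω) (im V ω) ∧
        Spans E ℓ (st ω) (en ω) (im V ω ∪ S)) →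
      (∀ U ⊆ D, ∑ v ∈ U, w v = 0 → ∃ P : Finset (Finset V), (∀ S ∈ P, 𝒮 S) ∧
        (∀ S ∈ P, ∀ S' ∈ P, S ≠ S' → Disjoint S S') ∧ P.biUnion id = U) →
      (∀ R₁ ⊆ D, ∀ R₂ ⊆ D, Disjoint R₁ R₂ → ∑ v ∈ D \ R₁, w v = κ →
        ((R₁ ∪ R₂).card : ℝ) ≤ γ₀ * Fintype.card V →
        ∃ (b : ℕ) (L M L' : Fin b → Finset V), (b : ℝ) ≤ β * Fintype.card V ∧
          (∀ i, PathOn E ℓ (L i) (M i) (L' i) ∧ adm (L i) ∧ adm (L' i) ∧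
            ∑ v ∈ L i ∪ M i ∪ L' i, w v = -κ ∧ L i ∪ M i ∪ L' i ⊆ D \ (R₁ ∪ R₂)) ∧
          (∀ i j, i ≠ j → Disjoint (L i ∪ M i ∪ L' i) (L j ∪ M j ∪ L' j)) ∧
          ((D \ (R₁ ∪ R₂ ∪ univ.biUnion fun i => L i ∪ M i ∪ L' i)).card : ℝ) ≤
            β * Fintype.card V + K * R₂.card) →
      HamC E ℓ := by
  set N : ℝ := qa + p * qc with hN
  have hqc' : (1 : ℝ) ≤ qc := by exact_mod_cast hqc
  have hqa' : (1 : ℝ) ≤ qa := by exact_mod_cast hqa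
  have hN1 : 0 < N := by positivity
  obtain ⟨γA, hγA, hA1, hA2, hA3⟩ : ∃ γA > 0, 8 * qa ^ 2 * γA ≤ c ∧ N * qc * γA ≤ c / 2 ∧
      N * γA ≤ γ₀ / 2 := by
    refine ⟨min (c / (8 * qa ^ 2)) (min (c / 2 / (N * qc)) (γ₀ / 2 / N)), by positivity, ?_, ?_, ?_⟩
    · rw [← le_div_iff₀' (by positivity)]; exact min_le_left _ _
    · rw [← le_div_iff₀' (by positivity)]; grind
    · rw [← le_div_iff₀' (by positivity)]; grind
  obtain ⟨γR, hγR, hR1, hR2, hR3⟩ : ∃ γR > 0, 8 * qc ^ 2 * γR ≤ c / 2 ∧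
      (K + 1) * qc * γR ≤ c * γA / 16 ∧ qc * γR ≤ γ₀ / 2 := by
    refine ⟨min (c / 2 / (8 * qc ^ 2)) (min (c * γA / 16 / ((K + 1) * qc)) (γ₀ / 2 / qc)),
      by positivity, ?_, ?_, ?_⟩
    · rw [← le_div_iff₀' (by positivity)]; exact min_le_left _ _
    · rw [← le_div_iff₀' (by positivity)]; grind
    · rw [← le_div_iff₀' (by positivity)]; grind
  obtain ⟨nA, hnA⟩ := selection qa s₀ hqa hc hγA hA1
  obtain ⟨nR, hnR⟩ := selection qc (2 * ℓ) hqc (half_pos hc) hγR hR1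
  obtain ⟨β, hβ, hβ1, hβ2⟩ : ∃ β > 0, β ≤ c * γA / 16 ∧ qc * β ≤ c * γR / 32 := by
    refine ⟨min (c * γA / 16) (c * γR / 32 / qc), by positivity, min_le_left _ _, ?_⟩
    rw [← le_div_iff₀' (by positivity)]; exact min_le_right _ _
  refine ⟨β, hβ, max 1 (max nA nR), ?_⟩
  intro V G Ω J _ _ _ _ _ _ E w κ adm 𝒮 D L₀ M₀ L₁ st mid en hn hqΩ hJ hp hL₀ hL₁ hadm hD hw hconn
    h𝒮 habs hsplit hcover
  subst hJ
  classical
  have hn1 : 1 ≤ Fintype.card V := (le_max_left _ _).trans hn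
  have hnpos : (0 : ℝ) < Fintype.card V := by exact_mod_cast hn1
  have : Nonempty V := Fintype.card_pos_iff.1 hn1
  set n : ℝ := (Fintype.card V : ℝ) with hndef
  have hcardS : Fintype.card {S : Finset V // 𝒮 S ∧ S ⊆ D} ≤ (Fintype.card V) ^ s₀ := by
    rw [Fintype.card_subtype]
    refine (card_le_card (t := powersetCard s₀ univ) fun S hS => ?_).trans ?_
    · grind
    · rw [card_powersetCard, card_univ]; exact Nat.choose_le_pow _ _
  obtain ⟨F, hFd, hFc, hFr⟩ := hnA V Ω {S : Finset V // 𝒮 S ∧ S ⊆ D} (fun S ω => im V ω ⊆ D ∧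
        AbsValid E ℓ adm w κ (st ω) (mid ω) (en ω) (im V ω) ∧
        Spans E ℓ (st ω) (en ω) (im V ω ∪ S.1))
    (((le_max_left _ _).trans (le_max_right _ _)).trans hn) hqΩ hcardS
    (fun S => habs S.1 S.2.1 S.2.2)
  set F' := F.filter fun ω => im V ω ⊆ D ∧ AbsValid E ℓ adm w κ (st ω) (mid ω) (en ω) (im V ω)
    with hF'
  have hF'c : (F'.card : ℝ) ≤ γA * n :=
    (by exact_mod_cast card_le_card (filter_subset _ _) : (F'.card : ℝ) ≤ F.card).trans hFc
  -- connectors avoiding a given small set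
  have hcavoid : ∀ A B, adm A → adm B → Disjoint A B → ∀ Z : Finset V, qc * (Z.card : ℝ) ≤ c / 2 * n →
      c / 2 ≤ pr fun ω : Fin qc → V => PathOn E ℓ A (im V ω) B ∧ im V ω ⊆ D \ Z ∧
          ∑ v ∈ im V ω, w v = κ := by
    intro A B hA hB hAB Z hZ
    have h1 := hconn A B hA hB hAB
    have h2 := pr_hit_le (V := V) (Ω := Fin qc → V) Z
    have h3 : (Blk.sz V (Fin qc → V) : ℝ) * (Z.card / Fintype.card V) ≤ c / 2 := by
      have : (Blk.sz V (Fin qc → V)) = qc := rfl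
      rw [this, ← mul_div_assoc, div_le_iff₀ hnpos]; exact hZ
    have h4 := pr_sub_le (fun ω : Fin qc → V => PathOn E ℓ A (im V ω) B ∧ im V ω ⊆ D ∧
          ∑ v ∈ im V ω, w v = κ) (fun ω => ¬ Disjoint (im V ω) Z)
    refine le_trans ?_ (h4.trans (pr_mono fun ω h => ⟨h.1.1, ?_, h.1.2.2⟩))
    · linarith
    · rw [subset_sdiff]; grind
  have hsum1 : (F'.card * Blk.sz V Ω + F'.card * Fintype.card J * qc : ℕ) ≤ N * γA * n := by
    rw [hqΩ]; push_cast
    calc (F'.card : ℝ) * qa + F'.card * Fintype.card J * qc = F'.card * N := by rw [hN]; ring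
      _ ≤ γA * n * N := by gcongr
      _ = _ := by ring
  have hconn1 : ∀ A B, adm A → adm B → Disjoint A B → ∀ Z : Finset V,
      Z.card ≤ F'.card * Blk.sz V Ω + F'.card * Fintype.card J * qc →
      ∃ C ⊆ D, PathOn E ℓ A C B ∧ ∑ v ∈ C, w v = κ ∧ C.card ≤ qc ∧ Disjoint C Z := by
    intro A B hA hB hAB Z hZ
    have h1 := hcavoid A B hA hB hAB Z (by
      have h2 : (Z.card : ℝ) ≤ N * γA * n := le_trans (by exact_mod_cast hZ) hsum1
      calc qc * (Z.card : ℝ) ≤ qc * (N * γA * n) := by gcongr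
        _ = N * qc * γA * n := by ring
        _ ≤ c / 2 * n := by gcongr)
    obtain ⟨ω, hω⟩ := exists_of_pr_pos (lt_of_lt_of_le (half_pos hc) h1)
    rw [subset_sdiff] at hω
    exact ⟨im V ω, hω.2.1.1, hω.1, hω.2.2, card_im_le ω, hω.2.1.2⟩
  have hDP : Disjoint D (L₀ ∪ M₀ ∪ L₁) := hD ▸ sdiff_disjoint
  obtain ⟨R₁, L, hR₁D, hR₁c, hR₁w, hL, hLsub, habsorb⟩ :=
    absorbing_path (cap := ⌊c * γA / 8 * n⌋₊) hs₀ hconn1 hp hL₁ hDP h𝒮 hsplit st mid en F'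
      (fun ω hω ω' hω' h => hFd ω (mem_filter.1 hω).1 ω' (mem_filter.1 hω').1 h)
      (fun ω hω => (mem_filter.1 hω).2.1) (fun ω hω => (mem_filter.1 hω).2.2)
      (fun S hS hSD => by
        obtain ⟨A, hAF, hA, hAc⟩ := hFr ⟨S, hS, hSD⟩
        refine ⟨A, fun ω hω => mem_filter.2 ⟨hAF hω, (hA ω hω).1, (hA ω hω).2.1⟩,
          fun ω hω => (hA ω hω).2.2, ?_⟩
        exact Nat.floor_le_of_le hAc) le_rfl
  have hR₁c' : (R₁.card : ℝ) ≤ N * γA * n := le_trans (by exact_mod_cast hR₁c) hsum1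
  -- the reservoir
  have hcardP : Fintype.card {x : Finset V × Finset V // adm x.1 ∧ adm x.2 ∧ Disjoint x.1 x.2} ≤
      (Fintype.card V) ^ (2 * ℓ) := by
    rw [Fintype.card_subtype]
    refine (card_le_card (t := powersetCard ℓ univ ×ˢ powersetCard ℓ univ) fun x hx => ?_).trans ?_
    · rw [mem_product, mem_powersetCard, mem_powersetCard]
      have := (mem_filter.1 hx).2
      exact ⟨⟨subset_univ _, hadm _ this.1⟩, subset_univ _, hadm _ this.2.1⟩
    · rw [card_product, card_powersetCard, card_univ, two_mul, pow_add]
      exact Nat.mul_le_mul (Nat.choose_le_pow _ _) (Nat.choose_le_pow _ _)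
  obtain ⟨Q, hQd, hQc, hQr⟩ := hnR V (Fin qc → V)
    {x : Finset V × Finset V // adm x.1 ∧ adm x.2 ∧ Disjoint x.1 x.2}
    (fun x ω => PathOn E ℓ x.1.1 (im V ω) x.1.2 ∧ im V ω ⊆ D \ R₁ ∧ ∑ v ∈ im V ω, w v = κ)
    (((le_max_right _ _).trans (le_max_right _ _)).trans hn) rfl hcardP
    (fun x => hcavoid _ _ x.2.1 x.2.2.1 x.2.2.2 R₁ (by
      calc qc * (R₁.card : ℝ) ≤ qc * (N * γA * n) := by gcongr
        _ = N * qc * γA * n := by ring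
        _ ≤ c / 2 * n := by gcongr))
  set R₂ := (Q.filter fun ω => im V ω ⊆ D \ R₁).biUnion (im V) with hR₂
  have hR₂sub : R₂ ⊆ D \ R₁ := biUnion_subset.2 fun ω hω => (mem_filter.1 hω).2
  have hR₂D : R₂ ⊆ D := hR₂sub.trans sdiff_subset
  have hR₁₂ : Disjoint R₁ R₂ := (disjoint_of_subset_left hR₂sub sdiff_disjoint).symm
  have hR₂c : (R₂.card : ℝ) ≤ qc * γR * n := by
    have h1 : R₂.card ≤ (Q.filter fun ω => im V ω ⊆ D \ R₁).card * qc :=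
      card_biUnion_le_card_mul _ _ _ fun ω _ => card_im_le ω
    have h2 : (Q.filter fun ω => im V ω ⊆ D \ R₁).card ≤ Q.card := card_le_card (filter_subset _ _)
    calc (R₂.card : ℝ) ≤ Q.card * qc := by exact_mod_cast h1.trans (Nat.mul_le_mul_right _ h2)
      _ ≤ γR * n * qc := by gcongr
      _ = _ := by ring
  have hDw : ∑ v ∈ D, w v = κ := by
    have h1 := sum_sdiff (f := w) (subset_univ (L₀ ∪ M₀ ∪ L₁))
    grind
  have hDR₁ : ∑ v ∈ D \ R₁, w v = κ := by
    have h1 := sum_sdiff (f := w) hR₁D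
    grind
  obtain ⟨b, A, M, A', hb, hpieces, hpd, hleft⟩ := hcover R₁ hR₁D R₂ hR₂D hR₁₂ hDR₁ (by
    calc ((R₁ ∪ R₂).card : ℝ) ≤ R₁.card + R₂.card := by exact_mod_cast card_union_le _ _
      _ ≤ N * γA * n + qc * γR * n := add_le_add hR₁c' hR₂c
      _ ≤ γ₀ / 2 * n + γ₀ / 2 * n := by gcongr
      _ = _ := by ring)
  have hconn2 : ∀ A B, adm A → adm B → Disjoint A B → ∀ Z : Finset V, Z.card ≤ b * qc →
      ∃ C ⊆ R₂, PathOn E ℓ A C B ∧ ∑ v ∈ C, w v = κ ∧ C.card ≤ qc ∧ Disjoint C Z := by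
    intro A B hA hB hAB Z hZ
    obtain ⟨T, hTQ, hT, hTc⟩ := hQr ⟨(A, B), hA, hB, hAB⟩
    have hlt : Z.card < T.card := by
      have h1 : (Z.card : ℝ) ≤ b * qc := by exact_mod_cast hZ
      have h2 : (b * qc : ℝ) ≤ c * γR / 32 * n := by
        calc (b * qc : ℝ) ≤ β * n * qc := by gcongr
          _ = qc * β * n := by ring
          _ ≤ _ := by gcongr
      have h3 : 0 < c * γR * n := by positivity
      have : (Z.card : ℝ) < T.card := by linarith
      exact_mod_cast this
    obtain ⟨ω, hω, hωZ⟩ : ∃ ω ∈ T, Disjoint (im V ω) Z := by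
      by_contra! hcon
      simp only [not_disjoint_iff] at hcon
      choose! f hf1 hf2 using hcon
      refine absurd (card_le_card_of_injOn f (fun ω hω => hf2 ω hω) fun a ha a' ha' haa => ?_)
        (not_le.2 hlt)
      by_contra hne
      exact disjoint_left.1 (hQd a (hTQ ha) a' (hTQ ha') hne) (hf1 a ha) (haa ▸ hf1 a' ha')
    obtain ⟨h1, h2, h3⟩ := hT ω hω
    exact ⟨im V ω, subset_biUnion_of_mem (im V) (mem_filter.2 ⟨hTQ hω, h2⟩), h1, h3,
      card_im_le ω, hωZ⟩
  have hApc : ∀ i, A i ⊆ D \ (R₁ ∪ R₂) := fun i x hx => (hpieces i).2.2.2.2 (by simp [hx])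
  have hApc' : ∀ i, A' i ⊆ D \ (R₁ ∪ R₂) := fun i x hx => (hpieces i).2.2.2.2 (by simp [hx])
  have hPD : Disjoint (L₀ ∪ M₀ ∪ L₁ ∪ R₁) (D \ (R₁ ∪ R₂)) := by
    rw [disjoint_union_left]
    exact ⟨(hDP.mono_left sdiff_subset).symm, (sdiff_disjoint.mono_right subset_union_left).symm⟩
  obtain ⟨C, L₂, hCR, -, hCc, hCw, hL₂, hL₂or, hC⟩ := connect hconn2 A A' L₀ L ∅ hL univ
    (by simp) (fun i _ => (hpieces i).2.1) (fun i _ => (hpieces i).2.2.1)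
    (fun i _ => hPD.mono hLsub (hApc i)) (fun i _ j _ hij => (hpd i j hij).mono
      (fun x hx => by simp [hx]) (fun x hx => by simp [hx]))
  rw [card_univ, Fintype.card_fin] at hCc hCw
  have hL₀L : Disjoint L₀ L := (habsorb ∅ (empty_subset _) (by simp) (by simp)).disj.2.1
  have hL₂L₀ : Disjoint L₂ L₀ := by
    rcases hL₂or with rfl | ⟨i, _, rfl⟩
    · exact hL₀L.symm
    · exact (hPD.mono (fun x hx => by simp [hx]) (hApc' i)).symm
  obtain ⟨C', hC'R, hC'p, hC'w, -, hC'C⟩ := hconn2 L₂ L₀ hL₂ hL₀ hL₂L₀ C hCc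
  set B := univ.biUnion fun i => A i ∪ M i ∪ A' i with hB
  have hBD : B ⊆ D \ (R₁ ∪ R₂) := biUnion_subset.2 fun i _ => (hpieces i).2.2.2.2
  have hBw : ∑ v ∈ B, w v = -(b • κ) := by
    rw [hB, sum_biUnion fun i _ j _ hij => hpd i j hij,
      sum_congr rfl fun i _ => (hpieces i).2.2.2.1]
    simp
  set U := D \ (R₁ ∪ B ∪ C ∪ C') with hU
  have hBR₁ : Disjoint R₁ B := (disjoint_of_subset_left hBD
    (sdiff_disjoint.mono_right subset_union_left)).symm
  have hBR₂ : Disjoint B R₂ := disjoint_of_subset_left hBD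
    (sdiff_disjoint.mono_right subset_union_right)
  have hUw : ∑ v ∈ U, w v = 0 := by
    have h1 := sum_sdiff (f := w) (union_subset (union_subset (union_subset hR₁D
      (hBD.trans sdiff_subset)) (hCR.trans hR₂D)) (hC'R.trans hR₂D))
    rw [← hU, sum_union, sum_union, sum_union hBR₁, hR₁w, hBw, hCw, hC'w, hDw] at h1
    · grind
    · exact disjoint_union_left.2 ⟨hR₁₂.mono_right hCR, hBR₂.mono_right hCR⟩
    · exact disjoint_union_left.2 ⟨disjoint_union_left.2 ⟨hR₁₂.mono_right hC'R,
        hBR₂.mono_right hC'R⟩, hC'C.symm⟩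
  have hUD : U ⊆ D \ R₁ := sdiff_subset_sdiff subset_rfl fun x hx => by simp [hx]
  have hUc : U.card ≤ ⌊c * γA / 8 * n⌋₊ := by
    refine Nat.le_floor ?_
    have h1 : U ⊆ (D \ (R₁ ∪ R₂ ∪ B)) ∪ R₂ := fun x hx => by
      simp only [hU, mem_sdiff, mem_union] at hx ⊢
      tauto
    calc (U.card : ℝ) ≤ (D \ (R₁ ∪ R₂ ∪ B)).card + R₂.card := by
          exact_mod_cast (card_le_card h1).trans (card_union_le _ _)
      _ ≤ β * n + K * R₂.card + R₂.card := by gcongr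
      _ = β * n + (K + 1) * R₂.card := by ring
      _ ≤ c * γA / 16 * n + (K + 1) * (qc * γR * n) := by gcongr
      _ = c * γA / 16 * n + (K + 1) * qc * γR * n := by ring
      _ ≤ c * γA / 16 * n + c * γA / 16 * n := by gcongr
      _ = _ := by ring
  have hpU := habsorb U hUD hUw hUc
  have hUn : L₀ ∪ ((L₀ ∪ M₀ ∪ L₁ ∪ R₁ ∪ U) \ (L₀ ∪ L)) ∪ L = L₀ ∪ M₀ ∪ L₁ ∪ R₁ ∪ U := by
    refine union_sdiff_union_eq ?_ (hLsub.trans subset_union_left)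
    rw [union_assoc, union_assoc, union_assoc]
    exact subset_union_left
  have hPU : Disjoint (L₀ ∪ M₀ ∪ L₁ ∪ R₁ ∪ U) B := by
    rw [disjoint_union_left]
    exact ⟨hPD.mono_right hBD, sdiff_disjoint.mono_right fun x hx => by simp [hx]⟩
  have hPUC : ∀ X ⊆ R₂, X ⊆ C ∪ C' → Disjoint X (L₀ ∪ M₀ ∪ L₁ ∪ R₁ ∪ U) := fun X hX hX' => by
    rw [disjoint_union_right, disjoint_union_right]
    refine ⟨⟨hDP.mono_left (hX.trans hR₂D), (hR₁₂.mono_right hX).symm⟩, ?_⟩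
    refine (sdiff_disjoint.mono_right (hX'.trans fun x hx => ?_)).symm
    simp only [mem_union] at hx ⊢; tauto
  have fin := hC _ M hpU (fun i _ => (hpieces i).1) (fun i _ j _ hij => hpd i j hij)
    (fun i _ => by
      rw [hUn]
      exact (hPU.mono_right (subset_biUnion_of_mem (fun i => A i ∪ M i ∪ A' i) (mem_univ i))).symm)
    (by rw [hUn]; exact hPUC C hCR subset_union_left)
    (fun i _ => (hBR₂.mono (subset_biUnion_of_mem (fun i => A i ∪ M i ∪ A' i) (mem_univ i))
      hCR).symm)
  rw [hUn, ← hB] at fin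
  have hL₂sub : L₂ ⊆ L₀ ∪ M₀ ∪ L₁ ∪ R₁ ∪ U ∪ C ∪ B := by
    rcases hL₂or with rfl | ⟨i, _, rfl⟩
    · exact hLsub.trans fun x hx => by
        simp only [mem_union] at hx ⊢; tauto
    · intro x hx
      have : x ∈ B := subset_biUnion_of_mem (fun i => A i ∪ M i ∪ A' i) (mem_univ i) (by simp [hx])
      simp [this]
  refine ⟨L₀, _, L₂, C', fin, hC'p, ?_, ?_⟩
  · refine (disjoint_of_subset_left sdiff_subset ?_)
    rw [disjoint_union_left, disjoint_union_left]
    exact ⟨⟨(hPUC C' hC'R subset_union_right).symm, hC'C.symm⟩, hBR₂.mono_right hC'R⟩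
  · refine eq_univ_of_forall fun x => ?_
    by_cases h0 : x ∈ L₀
    · simp [h0]
    by_cases h2 : x ∈ L₂
    · simp [h2]
    by_cases h' : x ∈ C'
    · simp [h']
    have hS : x ∈ L₀ ∪ M₀ ∪ L₁ ∪ R₁ ∪ U ∪ C ∪ B := by
      by_cases hxD : x ∈ D
      · by_cases hxU : x ∈ R₁ ∪ B ∪ C ∪ C'
        · simp only [mem_union, h', or_false] at hxU
          rcases hxU with (h | h) | h <;> simp [h]
        · have : x ∈ U := mem_sdiff.2 ⟨hxD, hxU⟩
          simp [this]
      · have : x ∈ L₀ ∪ M₀ ∪ L₁ := by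
          by_contra hcon
          exact hxD (hD ▸ mem_sdiff.2 ⟨mem_univ _, hcon⟩)
        exact mem_union_left _ (mem_union_left _ (mem_union_left _ (mem_union_left _ this)))
    refine mem_union_left _ (mem_union_left _ (mem_union_right _ (mem_sdiff.2 ⟨hS, ?_⟩)))
    simp [h0, h2]

end Assembly

noncomputable section Clean

variable {V : Type} [DecidableEq V]

variable (V) in
/-- All the vertices of the tuple are distinct. -/
def Distinct {Ω : Type} [Blk V Ω] (ω : Ω) : Prop := (im V ω).card = Blk.sz V Ω

theorem dist_iff_injective {Ω : Type} [Blk V Ω] (ω : Ω) :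
    Distinct V ω ↔ Function.Injective (Blk.eqv (V := V) ω) := by
  rw [Distinct, im, ← Set.injOn_univ, ← coe_univ, ← card_image_iff]
  simp

theorem dist_tuple {a : ℕ} (x : Fin a → V) : Distinct V x ↔ Function.Injective x := dist_iff_injective x

theorem dist_prod {A B : Type} [Blk V A] [Blk V B] (x : A × B) :
    Distinct V x ↔ Distinct V x.1 ∧ Distinct V x.2 ∧ Disjoint (im V x.1) (im V x.2) := by
  have h1 := card_im_le (V := V) x.1
  have h2 := card_im_le (V := V) x.2
  have h3 := card_union_add_card_inter (im V x.1) (im V x.2)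
  have h4 : Blk.sz V (A × B) = Blk.sz V A + Blk.sz V B := rfl
  rw [Distinct, im_prod, h4, disjoint_iff_inter_eq_empty, ← card_eq_zero, Distinct, Distinct]
  omega

theorem Distinct.pi {A : Type} {p : ℕ} [Blk V A] {x : Fin p → A} (h : @Distinct V _ _ Blk.pi x) :
    (∀ i, Distinct V (x i)) ∧ ∀ i j, i ≠ j → Disjoint (im V (x i)) (im V (x j)) := by
  rw [@dist_iff_injective V _ _ Blk.pi] at h
  have key : ∀ i a, (@Blk.eqv V _ Blk.pi) x (finProdFinEquiv (i, a)) = Blk.eqv (V := V) (x i) a := by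
    intro i a
    simp [Blk.eqv, Function.uncurry]
  constructor
  · intro i
    rw [dist_iff_injective]
    intro a b hab
    rw [← key, ← key] at hab
    simpa using h hab
  · intro i j hij
    rw [disjoint_left]
    intro v hv hv'
    simp only [im, mem_image, mem_univ, true_and] at hv hv'
    obtain ⟨a, rfl⟩ := hv
    obtain ⟨b, hb⟩ := hv'
    rw [← key, ← key] at hb
    have := h hb
    simp at this
    exact hij this.1.symm

variable [Fintype V] {Ω : Type} [Fintype Ω] [Blk V Ω]

theorem pr_not_dist_le : pr (fun ω : Ω => ¬ Distinct V ω) ≤ (Blk.sz V Ω : ℝ) ^ 2 / Fintype.card V := by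
  have h1 : pr (fun ω : Ω => ¬ Distinct V ω) ≤ pr (fun x : Fin (Blk.sz V Ω) → V =>
      ∃ i ∈ (univ : Finset (Fin (Blk.sz V Ω) × Fin (Blk.sz V Ω))), i.1 ≠ i.2 ∧ x i.1 = x i.2) := by
    rw [← pr_equiv (Blk.eqv (V := V) (Ω := Ω))]
    refine pr_mono fun ω h => ?_
    rw [dist_iff_injective, Function.Injective] at h
    push Not at h
    obtain ⟨a, b, hab, hne⟩ := h
    exact ⟨(a, b), mem_univ _, hne, hab⟩
  refine h1.trans ((pr_exists_le _ _).trans ?_)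
  calc _ ≤ ∑ _i : Fin (Blk.sz V Ω) × Fin (Blk.sz V Ω), (1 : ℝ) / Fintype.card V := by
        refine sum_le_sum fun i _ => ?_
        by_cases hi : i.1 = i.2
        · rw [pr_false fun x hx => hx.1 hi]; positivity
        · refine le_trans (pr_mono fun x hx => hx.2) (pr_pair hi (P := fun a b : V => a = b)
            (by positivity) fun a => ?_)
          have := pr_mem (V := V) {a}
          rw [card_singleton, Nat.cast_one] at this
          rw [← this]
          exact pr_mono fun b hb => by simp [hb]
    _ = _ := by simp [sq]; ring

theorem pr_clean (P : Ω → Prop) (Z : Finset V) :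
    pr P - ((Blk.sz V Ω : ℝ) ^ 2 + Blk.sz V Ω * Z.card) / Fintype.card V ≤
      pr fun ω => P ω ∧ Distinct V ω ∧ Disjoint (im V ω) Z := by
  have h1 := pr_not_dist_le (V := V) (Ω := Ω)
  have h2 := pr_hit_le (V := V) (Ω := Ω) Z
  have h3 := pr_sub_le P fun ω : Ω => ¬ Distinct V ω
  have h4 := pr_sub_le (fun ω => P ω ∧ ¬ ¬ Distinct V ω) fun ω : Ω => ¬ Disjoint (im V ω) Z
  grind

/-- The edges, together with all sets that are too small to be edges. -/
def plus (E : Finset (Finset V)) (k : ℕ) : Finset (Finset V) :=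
  univ.filter fun X => X ∈ E ∨ X.card < k

theorem mem_of_mem_plus {E : Finset (Finset V)} {k : ℕ} {X : Finset V} (h : X ∈ plus E k)
    (hX : k ≤ X.card) : X ∈ E := by
  rcases (mem_filter.1 h).2 with h | h
  · exact h
  · omega

theorem LowDeg.le_pr_plus [Nonempty V] {E : Finset (Finset V)} {k s : ℕ} {η : ℝ} (h : LowDeg E k η)
    (hη : η ≤ 1) (S : Finset V) (hS : S.card ≤ s) (hs : s + 2 ≤ k) (hΩ : Blk.sz V Ω + s = k) :
    η ≤ pr fun ω : Ω => S ∪ im V ω ∈ plus E k := by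
  rcases hS.lt_or_eq with hlt | rfl
  · have : Nonempty Ω := (Blk.eqv (V := V) (Ω := Ω)).nonempty
    rw [pr_true]
    · exact hη
    · intro ω
      refine mem_filter.2 ⟨mem_univ _, Or.inr ?_⟩
      have h1 := card_im_le (V := V) ω
      grind
  · exact (h.le_pr S hs hΩ).trans (pr_mono fun ω hω => mem_filter.2 ⟨mem_univ _, Or.inl hω⟩)

theorem le_pr_prod {A B : Type} [Fintype A] [Fintype B] [Nonempty A] {Q : A × B → Prop} {c : ℝ}
    (h : ∀ a, c ≤ pr fun b => Q (a, b)) : c ≤ pr Q := by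
  rw [pr_prod, ← ex_const (Ω := A) c]
  exact ex_mono h

theorem pr_proj₁₂ {A B C : Type} [Fintype A] [Fintype B] [Fintype C] [Nonempty C]
    (P : A → B → Prop) :
    pr (fun x : A × (B × C) => P x.1 x.2.1) = pr fun x : A × B => P x.1 x.2 := by
  rw [pr_prod, pr_prod]
  exact congrArg ex (funext fun a => pr_fst (Ω' := C) (P a))

theorem pr_proj₁₃ {A B C : Type} [Fintype A] [Fintype B] [Fintype C] [Nonempty B]
    (P : A → C → Prop) :
    pr (fun x : A × (B × C) => P x.1 x.2.2) = pr fun x : A × C => P x.1 x.2 := by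
  rw [pr_prod, pr_prod]
  exact congrArg ex (funext fun a => pr_snd (Ω := B) (P a))

end Clean

noncomputable section Connectors

variable {V : Type} [DecidableEq V] [Fintype V] {E : Finset (Finset V)} {k ℓ : ℕ} {η ε : ℝ}

theorem PathOn.edge_plus {L I L' : Finset V} (hL : L.card = ℓ) (hL' : L'.card = ℓ)
    (h1 : Disjoint L I) (h2 : Disjoint L L') (h3 : Disjoint I L') (hI : k ≤ ℓ + I.card + ℓ)
    (h : L ∪ I ∪ L' ∈ plus E k) : PathOn E ℓ L I L' := by
  refine .edge hL hL' h1 h2 h3 (mem_of_mem_plus h ?_)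
  rw [card_union_of_disjoint (disjoint_union_left.2 ⟨h2, h3⟩), card_union_of_disjoint h1]
  omega

/-- Many choices of the middle vertices turn `A`, `B` into the ends of an edge. -/
def Link (E : Finset (Finset V)) (k ℓ : ℕ) (ε : ℝ) (A B : Finset V) : Prop :=
  ε ≤ pr fun I : Fin (k - 2 * ℓ) → V => A ∪ im V I ∪ B ∈ plus E k

theorem Link.symm {A B : Finset V} (h : Link E k ℓ ε A B) : Link E k ℓ ε B A := by
  refine h.trans (pr_mono fun I hI => ?_)
  grind

theorem connector_of_link {c : ℝ} (hε : 0 ≤ ε) (hk : 2 * ℓ < k) {A B Z : Finset V}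
    (hA : A.card = ℓ) (hB : B.card = ℓ) (hAB : Disjoint A B)
    (h₀ : c ≤ pr fun x : (Fin ℓ → V) × (Fin ℓ → V) × (Fin ℓ → V) =>
      (Link E k ℓ ε A (im V x.2.1) ∧ Link E k ℓ ε (im V x.2.1) (im V x.1)) ∧
      Link E k ℓ ε (im V x.1) (im V x.2.2) ∧ Link E k ℓ ε (im V x.2.2) B) :
    c * ε ^ 4 - ((4 * (k - ℓ) - ℓ : ℕ) ^ 2 + (4 * (k - ℓ) - ℓ : ℕ) * ((A ∪ B ∪ Z).card : ℝ)) /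
        Fintype.card V ≤
      pr fun ω : Fin (4 * (k - ℓ) - ℓ) → V => PathOn E ℓ A (im V ω) B ∧ Disjoint (im V ω) Z := by
  let T := Fin ℓ → V
  let I := Fin (k - 2 * ℓ) → V
  have h : c ≤ pr fun x : T × T × T =>
      Link E k ℓ ε A (im V x.1) ∧ Link E k ℓ ε (im V x.1) (im V x.2.1) ∧
      Link E k ℓ ε (im V x.2.1) (im V x.2.2) ∧ Link E k ℓ ε (im V x.2.2) B := by
    refine h₀.trans (le_of_eq ?_)
    rw [← pr_equiv (((Equiv.prodAssoc T T T).symm.trans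
      ((Equiv.prodComm T T).prodCongr (Equiv.refl T))).trans (Equiv.prodAssoc T T T))]
    exact pr_congr fun x => and_assoc
  have h1 : c * ε ^ 4 ≤ pr fun y : (T × T × T) × (I × I × I × I) =>
      A ∪ im V y.2.1 ∪ im V y.1.1 ∈ plus E k ∧
      im V y.1.1 ∪ im V y.2.2.1 ∪ im V y.1.2.1 ∈ plus E k ∧
      im V y.1.2.1 ∪ im V y.2.2.2.1 ∪ im V y.1.2.2 ∈ plus E k ∧
      im V y.1.2.2 ∪ im V y.2.2.2.2 ∪ B ∈ plus E k := by
    have h2 := mul_pr_le_prod (c := ε ^ 4) (P := fun x : T × T × T =>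
      Link E k ℓ ε A (im V x.1) ∧ Link E k ℓ ε (im V x.1) (im V x.2.1) ∧
      Link E k ℓ ε (im V x.2.1) (im V x.2.2) ∧ Link E k ℓ ε (im V x.2.2) B)
      (Q := fun x (y : I × I × I × I) => A ∪ im V y.1 ∪ im V x.1 ∈ plus E k ∧
      im V x.1 ∪ im V y.2.1 ∪ im V x.2.1 ∈ plus E k ∧
      im V x.2.1 ∪ im V y.2.2.1 ∪ im V x.2.2 ∈ plus E k ∧
      im V x.2.2 ∪ im V y.2.2.2 ∪ B ∈ plus E k) (fun x hx => by
        rw [pr_and_prod (fun i : I => A ∪ im V i ∪ im V x.1 ∈ plus E k) (fun y : I × I × I =>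
          im V x.1 ∪ im V y.1 ∪ im V x.2.1 ∈ plus E k ∧
          im V x.2.1 ∪ im V y.2.1 ∪ im V x.2.2 ∈ plus E k ∧
          im V x.2.2 ∪ im V y.2.2 ∪ B ∈ plus E k),
          pr_and_prod (fun i : I => im V x.1 ∪ im V i ∪ im V x.2.1 ∈ plus E k) (fun y : I × I =>
          im V x.2.1 ∪ im V y.1 ∪ im V x.2.2 ∈ plus E k ∧
          im V x.2.2 ∪ im V y.2 ∪ B ∈ plus E k),
          pr_and_prod (fun i : I => im V x.2.1 ∪ im V i ∪ im V x.2.2 ∈ plus E k) (fun y : I =>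
          im V x.2.2 ∪ im V y ∪ B ∈ plus E k)]
        obtain ⟨a1, a2, a3, a4⟩ := hx
        unfold Link at a1 a2 a3 a4
        calc ε ^ 4 = ε * (ε * (ε * ε)) := by ring
          _ ≤ _ := by gcongr <;> exact pr_nonneg _)
    refine le_trans ?_ (h2.trans (pr_mono fun y hy => hy.2))
    nlinarith [mul_le_mul_of_nonneg_left h (pow_nonneg hε 4)]
  have hsz : Blk.sz V ((T × T × T) × (I × I × I × I)) = 4 * (k - ℓ) - ℓ := by
    change (ℓ + (ℓ + ℓ)) + ((k - 2 * ℓ) + ((k - 2 * ℓ) + ((k - 2 * ℓ) + (k - 2 * ℓ)))) = _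
    omega
  have h3 := pr_clean (V := V) (Ω := (T × T × T) × (I × I × I × I))
    (fun y => A ∪ im V y.2.1 ∪ im V y.1.1 ∈ plus E k ∧
      im V y.1.1 ∪ im V y.2.2.1 ∪ im V y.1.2.1 ∈ plus E k ∧
      im V y.1.2.1 ∪ im V y.2.2.2.1 ∪ im V y.1.2.2 ∈ plus E k ∧
      im V y.1.2.2 ∪ im V y.2.2.2.2 ∪ B ∈ plus E k) (A ∪ B ∪ Z)
  rw [hsz] at h3
  refine (sub_le_sub_right h1 _).trans (h3.trans ?_)
  have h4 := pr_tuple (V := V) (Ω := (T × T × T) × (I × I × I × I))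
    (fun X => PathOn E ℓ A X B ∧ Disjoint X Z) hsz
  refine le_trans ?_ h4.le
  refine pr_mono fun y ⟨⟨e1, e2, e3, e4⟩, hd, hZ⟩ => ?_
  obtain ⟨⟨x1, x2, x3⟩, i1, i2, i3, i4⟩ := y
  have hcd : ∀ {a : ℕ} (x : Fin a → V), Distinct V x → (im V x).card = a := fun x hx => hx
  simp only [dist_prod, im_prod, disjoint_union_left, disjoint_union_right] at hd hZ ⊢
  dsimp only at e1 e2 e3 e4
  obtain ⟨⟨d1, ⟨d2, d3, d23⟩, d12, d13⟩, ⟨f1, ⟨f2, ⟨f3, f4, f34⟩, f23, f24⟩, f12, f13, f14⟩,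
    ⟨g11, g21, g31⟩, ⟨g12, g22, g32⟩, ⟨g13, g23, g33⟩, g14, g24, g34⟩ := hd
  obtain ⟨⟨⟨z1, z2, z3⟩, z4, z5, z6, z7⟩, ⟨⟨y1, y2, y3⟩, y4, y5, y6, y7⟩⟩ := hZ.1
  have p1 : PathOn E ℓ A (im V i1) (im V x1) :=
    .edge_plus hA (hcd _ d1) z4.symm z1.symm g11.symm (by rw [hcd _ f1]; omega) e1
  have p2 : PathOn E ℓ (im V x1) (im V i2) (im V x2) :=
    .edge_plus (hcd _ d1) (hcd _ d2) g12 d12 g22.symm (by rw [hcd _ f2]; omega) e2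
  have p3 : PathOn E ℓ (im V x2) (im V i3) (im V x3) :=
    .edge_plus (hcd _ d2) (hcd _ d3) g23 d23 g33.symm (by rw [hcd _ f3]; omega) e3
  have p4 : PathOn E ℓ (im V x3) (im V i4) B :=
    .edge_plus (hcd _ d3) hB g34 y3 y7 (by rw [hcd _ f4]; omega) e4
  have q12 := p1.cat p2 (by
    simp only [disjoint_union_left, disjoint_union_right]
    grind)
  have q34 := p3.cat p4 (by
    simp only [disjoint_union_left, disjoint_union_right]
    grind)
  have q := q12.cat q34 (by
    simp only [disjoint_union_left, disjoint_union_right]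
    grind)
  grind

theorem connector_link_of_two_mul_le [Nonempty V] (h : LowDeg E k η) (hη : η ≤ 1)
    (hk : 2 * ℓ + 2 ≤ k) {A B : Finset V} (hA : A.card ≤ ℓ) (hB : B.card ≤ ℓ) : Link E k ℓ η A B := by
  refine (h.le_pr_plus (Ω := Fin (k - 2 * ℓ) → V) hη (A ∪ B) (s := 2 * ℓ) ?_ hk ?_).trans
    (pr_mono fun I hI => ?_)
  · grind
  · change k - 2 * ℓ + 2 * ℓ = k; omega
  · rwa [union_right_comm]

theorem pr_link_of_two_mul_add_one [Nonempty V] (h : LowDeg E k η) (hη0 : 0 ≤ η) (hη : η ≤ 1)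
    (hε : 0 ≤ ε) (hεη : ε ≤ η) (hk : k = 2 * ℓ + 1) (hℓ : 2 ≤ ℓ) {A B : Finset V} (hA : A.card ≤ ℓ)
    (hB : B.card ≤ ℓ) (hκ : 0 ≤ η * (η - ε) ^ 2 - 2 * ε) :
    (η * (η - ε) ^ 2 - 2 * ε) ^ 2 ≤ pr fun x : (Fin ℓ → V) × (Fin ℓ → V) × (Fin ℓ → V) =>
      (Link E k ℓ ε A (im V x.2.1) ∧ Link E k ℓ ε (im V x.2.1) (im V x.1)) ∧
      Link E k ℓ ε (im V x.1) (im V x.2.2) ∧ Link E k ℓ ε (im V x.2.2) B := by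
  let P := Fin (ℓ - 1) → V
  let C := Fin (k - 2 * ℓ) → V
  let T := Fin ℓ → V
  have hP : ∀ p : P, (im V p).card ≤ ℓ - 1 := fun p => card_im_le p
  have one : ∀ {A : Finset V}, A.card ≤ ℓ → ∀ p : P,
      η - ε ≤ pr fun c : C => Link E k ℓ ε A (im V (p, c)) := fun {A} hA p => by
    have h1 : η ≤ pr fun y : C × C => A ∪ im V y.2 ∪ im V (p, y.1) ∈ plus E k := by
      refine (h.le_pr_plus (Ω := C × C) hη (A ∪ im V p) (s := 2 * ℓ - 1) ?_ (by omega) ?_).trans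
        (pr_mono fun y hy => ?_)
      · grind
      · change (k - 2 * ℓ + (k - 2 * ℓ)) + (2 * ℓ - 1) = k; omega
      · convert hy using 1
        rw [im_prod, im_prod]
        grind
    have := pr_sub_le_pr_fiber (fun y : C × C => A ∪ im V y.2 ∪ im V (p, y.1) ∈ plus E k) hε
    exact (sub_le_sub_right h1 _).trans this
  have h1 : η * (η - ε) ^ 2 ≤ pr fun x : (P × C × C) × T =>
      (Link E k ℓ ε A (im V (x.1.1, x.1.2.1)) ∧ Link E k ℓ ε B (im V (x.1.1, x.1.2.2))) ∧
      im V x.1 ∪ im V x.2 ∈ plus E k := by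
    refine le_trans ?_ (mul_pr_le_prod (c := η) (P := fun x : P × C × C =>
      Link E k ℓ ε A (im V (x.1, x.2.1)) ∧ Link E k ℓ ε B (im V (x.1, x.2.2)))
      (Q := fun x (y : T) => im V x ∪ im V y ∈ plus E k) fun x _ =>
        h.le_pr_plus (Ω := T) hη (im V x) (s := ℓ + 1) ?_ (by omega) ?_)
    · refine mul_le_mul_of_nonneg_left (le_pr_prod fun p => ?_) hη0
      rw [pr_and_prod (fun c : C => Link E k ℓ ε A (im V (p, c)))
        fun c : C => Link E k ℓ ε B (im V (p, c)), sq]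
      exact mul_le_mul (one hA p) (one hB p) (by linarith) (pr_nonneg _)
    · refine (card_im_le x).trans ?_
      change ℓ - 1 + (k - 2 * ℓ + (k - 2 * ℓ)) ≤ ℓ + 1
      omega
    · change ℓ + (ℓ + 1) = k; omega
  have b1 : pr (fun x : (P × C × C) × T => im V x.1 ∪ im V x.2 ∈ plus E k ∧
      ¬ Link E k ℓ ε (im V (x.1.1, x.1.2.1)) (im V x.2)) ≤ ε := by
    refine pr_prod_le' hε fun y => pr_prod_le hε fun p => pr_prod_le hε fun c => ?_
    by_cases hl : Link E k ℓ ε (im V (p, c)) (im V y)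
    · rw [pr_false fun z hz => hz.2 hl]; exact hε
    · refine le_trans (pr_mono fun z hz => ?_) (not_le.1 hl).le
      have := hz.1
      rw [im_prod, im_prod, ← union_assoc] at this
      rwa [im_prod]
  have b2 : pr (fun x : (P × C × C) × T => im V x.1 ∪ im V x.2 ∈ plus E k ∧
      ¬ Link E k ℓ ε (im V (x.1.1, x.1.2.2)) (im V x.2)) ≤ ε := by
    refine pr_prod_le' hε fun y => pr_prod_le hε fun p => pr_prod_le' hε fun c => ?_
    by_cases hl : Link E k ℓ ε (im V (p, c)) (im V y)
    · rw [pr_false fun z hz => hz.2 hl]; exact hε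
    · refine le_trans (pr_mono fun z hz => ?_) (not_le.1 hl).le
      have := hz.1
      rw [im_prod, im_prod, union_comm (im V z), ← union_assoc] at this
      rwa [im_prod]
  let F : Finset V → T → P × C → Prop := fun A t x =>
    Link E k ℓ ε A (im V x) ∧ Link E k ℓ ε (im V x) (im V t)
  have h2 : η * (η - ε) ^ 2 - 2 * ε ≤ pr fun x : T × (P × C × C) =>
      F A x.1 (x.2.1, x.2.2.1) ∧ F B x.1 (x.2.1, x.2.2.2) := by
    have h3 := pr_sub_le (fun x : (P × C × C) × T =>
      (Link E k ℓ ε A (im V (x.1.1, x.1.2.1)) ∧ Link E k ℓ ε B (im V (x.1.1, x.1.2.2))) ∧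
      im V x.1 ∪ im V x.2 ∈ plus E k) (fun x => im V x.1 ∪ im V x.2 ∈ plus E k ∧
      ¬ Link E k ℓ ε (im V (x.1.1, x.1.2.1)) (im V x.2))
    have h4 := pr_sub_le (fun x : (P × C × C) × T => ((
      (Link E k ℓ ε A (im V (x.1.1, x.1.2.1)) ∧ Link E k ℓ ε B (im V (x.1.1, x.1.2.2))) ∧
      im V x.1 ∪ im V x.2 ∈ plus E k) ∧ ¬ (im V x.1 ∪ im V x.2 ∈ plus E k ∧
      ¬ Link E k ℓ ε (im V (x.1.1, x.1.2.1)) (im V x.2)))) (fun x => im V x.1 ∪ im V x.2 ∈ plus E k ∧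
      ¬ Link E k ℓ ε (im V (x.1.1, x.1.2.2)) (im V x.2))
    rw [pr_swap]
    refine le_trans (by linarith) (h4.trans (pr_mono fun x hx => ?_))
    grind
  have h5 := pr_sq_le fun (t : T) (x : P × C × C) => F A t (x.1, x.2.1) ∧ F B t (x.1, x.2.2)
  refine (pow_le_pow_left₀ hκ h2 2).trans (h5.trans ?_)
  rw [pr_prod, pr_prod]
  refine ex_mono fun t => ?_
  have h6 : ∀ A : Finset V, pr (fun x : P × C => F A t x) =
      pr fun x : T => Link E k ℓ ε A (im V x) ∧ Link E k ℓ ε (im V x) (im V t) := fun A =>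
    pr_tuple (V := V) (Ω := P × C) (fun X => Link E k ℓ ε A X ∧ Link E k ℓ ε X (im V t))
      (by change ℓ - 1 + (k - 2 * ℓ) = ℓ; omega)
  calc _ ≤ pr fun x : (P × C × C) × (P × C × C) => F A t (x.1.1, x.1.2.1) ∧ F B t (x.2.1, x.2.2.2) :=
        pr_mono fun x hx => ⟨hx.1.1, hx.2.2⟩
    _ = pr (fun x : P × C => F A t x) * pr (fun x : P × C => F B t x) := by
        rw [pr_and_prod (fun x : P × C × C => F A t (x.1, x.2.1)) fun x : P × C × C => F B t (x.1, x.2.2),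
          pr_proj₁₂ fun p c => F A t (p, c), pr_proj₁₃ fun p c => F B t (p, c)]
    _ = _ := by
        rw [h6, h6, ← pr_and_prod]
        exact pr_congr fun x => and_congr_right fun _ =>
          ⟨fun h => ⟨h.2.symm, h.1.symm⟩, fun h => ⟨h.2.symm, h.1.symm⟩⟩

theorem connector (h : LowDeg E k η) (hη0 : 0 < η) (hη : η ≤ 1) (hk4 : 4 ≤ k) (hk : 2 * ℓ < k)
    {A B Z : Finset V} (hA : A.card = ℓ) (hB : B.card = ℓ) (hAB : Disjoint A B) [Nonempty V] :
    (η ^ 3 / 2) ^ 2 * (η ^ 3 / 16) ^ 4 - ((4 * (k - ℓ) - ℓ : ℕ) ^ 2 + (4 * (k - ℓ) - ℓ : ℕ) *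
        ((A ∪ B ∪ Z).card : ℝ)) / Fintype.card V ≤
      pr fun ω : Fin (4 * (k - ℓ) - ℓ) → V => PathOn E ℓ A (im V ω) B ∧ Disjoint (im V ω) Z := by
  have h3 : η ^ 3 ≤ η := by
    calc η ^ 3 ≤ η ^ 1 := pow_le_pow_of_le_one hη0.le hη (by norm_num)
      _ = η := pow_one η
  have h31 : 0 < η ^ 3 := by positivity
  refine connector_of_link (by positivity) hk hA hB hAB ?_
  by_cases hc : 2 * ℓ + 2 ≤ k
  · rw [pr_true]
    · exact pow_le_one₀ (by positivity) (by linarith)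
    · have hl : ∀ {A B : Finset V}, A.card ≤ ℓ → B.card ≤ ℓ → Link E k ℓ (η ^ 3 / 16) A B := fun hA hB =>
        le_trans (by linarith) (connector_link_of_two_mul_le h hη hc hA hB)
      exact fun x => ⟨⟨hl hA.le (card_im_le _), hl (card_im_le _) (card_im_le _)⟩,
        hl (card_im_le _) (card_im_le _), hl (card_im_le _) hB.le⟩
  · have h1 : η ^ 3 / 2 ≤ η * (η - η ^ 3 / 16) ^ 2 - 2 * (η ^ 3 / 16) := by
      have : (15 / 16 * η) ^ 2 ≤ (η - η ^ 3 / 16) ^ 2 := pow_le_pow_left₀ (by positivity) (by linarith) 2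
      nlinarith [mul_le_mul_of_nonneg_left this hη0.le]
    exact (pow_le_pow_left₀ (by positivity) h1 2).trans (pr_link_of_two_mul_add_one h hη0.le hη
      (by positivity) (by linarith) (by omega) (by omega) hA.le hB.le (by linarith))

end Connectors

noncomputable section Gadgets

variable {V : Type} [DecidableEq V] [Fintype V] {E : Finset (Finset V)} {k ℓ : ℕ} {η ε : ℝ}

variable (V) in
/-- All but two vertices of an edge: an end of a gadget, and parts of the next two segments. -/
abbrev Trunk (k ℓ : ℕ) : Type := (Fin ℓ → V) × (Fin (k - 1 - 2 * ℓ) → V) × (Fin (ℓ - 1) → V)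

variable (V) in
/-- The vertices of a gadget: a path with two edges, one vertex of which is missing. -/
abbrev Gadget (k ℓ : ℕ) : Type :=
  Trunk V k ℓ × (V × V) × (Fin (k - 1 - 2 * ℓ) → V) × (Fin ℓ → V)

/-- The gadget can hold `x` as well as `y`. -/
def Holds (E : Finset (Finset V)) (k ℓ : ℕ) (x y : V) (g : Gadget V k ℓ) : Prop :=
  (im V g.1 ∪ {x, g.2.1.2} ∈ plus E k ∧ im V g.1 ∪ {y, g.2.1.1} ∈ plus E k) ∧
    im V g.1.2.2 ∪ {g.2.1.1, g.2.1.2} ∪ im V g.2.2 ∈ plus E k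

/-- The interior of a gadget. -/
def gadgetMid (g : Gadget V k ℓ) : Finset V :=
  im V g.1.2.1 ∪ im V g.1.2.2 ∪ {g.2.1.1, g.2.1.2} ∪ im V g.2.2.1

theorem im_gadget (g : Gadget V k ℓ) : im V g = im V g.1.1 ∪ gadgetMid g ∪ im V g.2.2.2 := by
  simp only [im_prod, gadgetMid, im_vertex]
  grind

omit [Fintype V] in
theorem union_pair_eq (L I M I' : Finset V) (x y z : V) :
    L ∪ (I ∪ {x}) ∪ (M ∪ {y}) = L ∪ (I ∪ M) ∪ {x, y} ∧
    M ∪ {y} ∪ (I' ∪ {x}) ∪ L = M ∪ {x, y} ∪ (I' ∪ L) ∧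
    I ∪ M ∪ {x, y} ∪ I' ∪ {z} = I ∪ {z} ∪ (M ∪ {y}) ∪ (I' ∪ {x}) := by
  grind

theorem Holds.path_left {x y : V} {g : Gadget V k ℓ} (h : Holds E k ℓ x y g) (hℓ : 1 ≤ ℓ)
    (hk : 2 * ℓ < k) (hd : Distinct V g) (hx : x ∉ im V g) :
    PathOn E ℓ (im V g.1.1) (gadgetMid g ∪ {x}) (im V g.2.2.2) := by
  obtain ⟨⟨L₀, I, M⟩, ⟨x', y'⟩, I', L₁⟩ := g
  obtain ⟨⟨e1, -⟩, e2⟩ := h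
  dsimp only at e1 e2 ⊢
  have hcd : ∀ {a : ℕ} (x : Fin a → V), Distinct V x → (im V x).card = a := fun x hx => hx
  simp only [dist_prod, im_prod, im_vertex, disjoint_union_left, disjoint_union_right,
    disjoint_singleton_left, disjoint_singleton_right, mem_singleton, mem_union, not_or] at hd hx e1 e2
  obtain ⟨⟨d1, ⟨d2, d3, d4⟩, d5, d6⟩, ⟨⟨-, -, d7⟩, ⟨d8, d9, d10⟩, ⟨d11, d12⟩, d13, d14⟩,
    ⟨⟨d15, d16, d17⟩, d18, d19, d20⟩, ⟨d21, d22, d23⟩, d24, d25, d26⟩ := hd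
  obtain ⟨⟨h1, h2, h3⟩, ⟨h4, h5⟩, h6, h7⟩ := hx
  have c1 : (im V M ∪ {y'}).card = ℓ := by
    grind
  have c2 : (im V I ∪ {x}).card = k - 2 * ℓ := by
    grind
  have c3 : (im V I' ∪ {x'}).card = k - 2 * ℓ := by
    grind
  have p1 : PathOn E ℓ (im V L₀) (im V I ∪ {x}) (im V M ∪ {y'}) := by
    refine .edge_plus (k := k) (hcd _ d1) c1 (by simp [*]) (by simp [*]) ?_ (by omega) ?_
    · grind
    grind
  have p2 : PathOn E ℓ (im V M ∪ {y'}) (im V I' ∪ {x'}) (im V L₁) := by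
    refine .edge_plus (k := k) c1 (hcd _ d9) ?_ ?_ ?_ (by omega) ?_
    · grind
    · simp [*]
    · simp [*]
    grind
  have q := p1.cat p2 (by
    simp only [disjoint_union_left, disjoint_union_right, disjoint_singleton_left,
        disjoint_singleton_right, mem_singleton, mem_union, not_or]
    grind)
  rwa [← (union_pair_eq ∅ _ _ _ _ _ x).2.2] at q

theorem Holds.path_right {x y : V} {g : Gadget V k ℓ} (h : Holds E k ℓ x y g) (hℓ : 1 ≤ ℓ)
    (hk : 2 * ℓ < k) (hd : Distinct V g) (hy : y ∉ im V g) :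
    PathOn E ℓ (im V g.1.1) (gadgetMid g ∪ {y}) (im V g.2.2.2) := by
  let g' : Gadget V k ℓ := (g.1, (g.2.1.2, g.2.1.1), g.2.2)
  have h' : Holds E k ℓ y x g' := ⟨h.1.symm, by
    have := h.2
    rwa [pair_comm] at this⟩
  have hi : im V g' = im V g := by
    simp only [im_prod, im_vertex, g']
    grind
  have := h'.path_left hℓ hk (by rw [Distinct, hi]; exact hd) (by rwa [hi])
  convert this using 1
  simp only [gadgetMid, g', pair_comm]

/-- Many vertices complete `R ∪ {u}` to an edge. -/
def Extends (E : Finset (Finset V)) (k : ℕ) (ε : ℝ) (R : Finset V) (u : V) : Prop :=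
  ε ≤ pr fun y : V => R ∪ {u, y} ∈ plus E k

variable (E k ℓ ε) in
/-- The density of the trunks that many vertices complete to edges together with `x` and with `y`. -/
def common (x y : V) : ℝ :=
  pr fun R : Trunk V k ℓ => Extends E k ε (im V R) x ∧ Extends E k ε (im V R) y

theorem sz_trunk (hℓ : 1 ≤ ℓ) (hk : 2 * ℓ < k) : Blk.sz V (Trunk V k ℓ) = k - 2 := by
  change ℓ + (k - 1 - 2 * ℓ + (ℓ - 1)) = k - 2
  omega

variable [Nonempty V]

theorem mul_common_le (h : LowDeg E k η) (hη0 : 0 ≤ η) (hη : η ≤ 1) (hε : 0 ≤ ε) (hk4 : 4 ≤ k)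
    (hℓ : 1 ≤ ℓ) (hk : 2 * ℓ < k) (x y : V) :
    η * ε ^ 2 * common E k ℓ ε x y ≤ pr (Holds E k ℓ x y) := by
  have h1 := mul_pr_le_prod (c := η * ε ^ 2)
    (P := fun R : Trunk V k ℓ => Extends E k ε (im V R) x ∧ Extends E k ε (im V R) y)
    (Q := fun R (z : (V × V) × (Fin (k - 1 - 2 * ℓ) → V) × (Fin ℓ → V)) =>
      (im V R ∪ {y, z.1.1} ∈ plus E k ∧ im V R ∪ {x, z.1.2} ∈ plus E k) ∧
      im V R.2.2 ∪ {z.1.1, z.1.2} ∪ im V z.2 ∈ plus E k) fun R hR => by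
    refine le_trans ?_ (mul_pr_le_prod (c := η) (P := fun z : V × V =>
      im V R ∪ {y, z.1} ∈ plus E k ∧ im V R ∪ {x, z.2} ∈ plus E k)
      (Q := fun z (w : (Fin (k - 1 - 2 * ℓ) → V) × (Fin ℓ → V)) =>
        im V R.2.2 ∪ {z.1, z.2} ∪ im V w ∈ plus E k) fun z _ =>
        h.le_pr_plus hη (im V R.2.2 ∪ {z.1, z.2}) (s := ℓ + 1) ?_ (by omega) ?_)
    · rw [pr_and_prod (fun v => im V R ∪ {y, v} ∈ plus E k) fun v => im V R ∪ {x, v} ∈ plus E k, sq]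
      exact mul_le_mul_of_nonneg_left (mul_le_mul hR.2 hR.1 hε (pr_nonneg _)) hη0
    · have h1 := card_union_le (im V R.2.2) {z.1, z.2}
      have h2 : (im V R.2.2).card ≤ ℓ - 1 := card_im_le R.2.2
      grind
    · change k - 1 - 2 * ℓ + ℓ + (ℓ + 1) = k; omega
  exact h1.trans (pr_mono fun g hg => ⟨hg.2.1.symm, hg.2.2⟩)

theorem pr_le_common (h : LowDeg E k η) (hη : η ≤ 1) (hε : 0 ≤ ε) (hεη : ε ≤ η) (hk4 : 4 ≤ k)
    (hℓ : 1 ≤ ℓ) (hk : 2 * ℓ < k) (s : V) :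
    (η - ε) ^ 2 / 2 ≤ pr fun x => (η - ε) ^ 2 / 2 ≤ common E k ℓ ε s x := by
  have hsz := sz_trunk (V := V) hℓ hk
  have h1 : η - ε ≤ pr fun R : Trunk V k ℓ => Extends E k ε (im V R) s := by
    refine le_trans ?_ (pr_sub_le_pr_fiber (fun z : Trunk V k ℓ × V => im V z.1 ∪ {s, z.2} ∈ plus E k) hε)
    refine sub_le_sub_right ((h.le_pr_plus hη {s} (s := 1) (by simp) (by omega) ?_).trans
      (pr_mono fun z hz => ?_)) _
    · change Blk.sz V (Trunk V k ℓ) + 1 + 1 = k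
      omega
    · convert hz using 1
      rw [im_prod z, im_vertex]
      grind
  have h2 : ∀ R : Trunk V k ℓ, η - ε ≤ pr fun x => Extends E k ε (im V R) x := fun R => by
    refine le_trans ?_ (pr_sub_le_pr_fiber (fun z : V × V => im V R ∪ {z.1, z.2} ∈ plus E k) hε)
    refine sub_le_sub_right ((h.le_pr_plus hη (im V R) (s := k - 2) ?_ (by omega) ?_).trans
      (pr_mono fun z hz => ?_)) _
    · exact (card_im_le R).trans hsz.le
    · change 1 + 1 + (k - 2) = k; omega
    · convert hz using 1
      rw [im_prod z, im_vertex, im_vertex]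
      grind
  have h3 : (η - ε) * pr (fun R : Trunk V k ℓ => Extends E k ε (im V R) s) ≤
      pr fun z : V × Trunk V k ℓ => Extends E k ε (im V z.2) s ∧ Extends E k ε (im V z.2) z.1 :=
    (mul_pr_le_prod (Q := fun R : Trunk V k ℓ => Extends E k ε (im V R)) fun R _ => h2 R).trans
      (pr_swap _).le
  have h4 := pr_sub_le_pr_fiber (fun z : V × Trunk V k ℓ =>
    Extends E k ε (im V z.2) s ∧ Extends E k ε (im V z.2) z.1) (c := (η - ε) ^ 2 / 2) (by positivity)
  refine le_trans ?_ h4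
  nlinarith [mul_le_mul_of_nonneg_left h1 (sub_nonneg.2 hεη)]

theorem pr_common_lt_le (h : LowDeg E k η) (hη0 : 0 < η) (hη : η ≤ 1) (hε : 0 ≤ ε) (hk4 : 4 ≤ k)
    (hℓ : 1 ≤ ℓ) (hk : 2 * ℓ < k) :
    pr (fun z : V × V => common E k ℓ ε z.1 z.2 < η / 2) ≤ 4 * ε / η := by
  have hsz := sz_trunk (V := V) hℓ hk
  let bad : (V × V) × Trunk V k ℓ → Prop := fun z => im V z.2 ∪ {z.1.1, z.1.2} ∈ plus E k ∧
    ¬ (Extends E k ε (im V z.2) z.1.1 ∧ Extends E k ε (im V z.2) z.1.2)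
  have h1 : pr bad ≤ ε + ε := by
    refine (pr_mono (fun z hz => ?_)).trans ((pr_or_le
      (fun z : (V × V) × Trunk V k ℓ => im V z.2 ∪ {z.1.1, z.1.2} ∈ plus E k ∧ ¬ Extends E k ε (im V z.2) z.1.1)
      (fun z => im V z.2 ∪ {z.1.1, z.1.2} ∈ plus E k ∧ ¬ Extends E k ε (im V z.2) z.1.2)).trans
      (add_le_add ?_ ?_))
    · grind
    · refine pr_prod_le' hε fun R => pr_prod_le hε fun x => ?_
      by_cases hx : Extends E k ε (im V R) x
      · rw [pr_false fun z hz => hz.2 hx]; exact hε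
      · exact (pr_mono fun z hz => hz.1).trans (not_le.1 hx).le
    · refine pr_prod_le' hε fun R => pr_prod_le' hε fun x => ?_
      by_cases hx : Extends E k ε (im V R) x
      · rw [pr_false fun z hz => hz.2 hx]; exact hε
      · refine (pr_mono fun z hz => ?_).trans (not_le.1 hx).le
        have := hz.1
        rwa [pair_comm] at this
  have h2 : ∀ z : V × V, common E k ℓ ε z.1 z.2 < η / 2 → η / 2 ≤ pr fun R => bad (z, R) := fun z hz => by
    have h3 : η ≤ pr fun R : Trunk V k ℓ => im V R ∪ {z.1, z.2} ∈ plus E k := by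
      refine (h.le_pr_plus hη {z.1, z.2} (s := 2) card_le_two (by omega) ?_).trans (pr_mono fun R hR => ?_)
      · omega
      · rwa [union_comm]
    have h4 := pr_sub_le (fun R : Trunk V k ℓ => im V R ∪ {z.1, z.2} ∈ plus E k)
      (fun R => Extends E k ε (im V R) z.1 ∧ Extends E k ε (im V R) z.2)
    rw [common] at hz
    grind
  have h3 := mul_pr_le_ex (fun z : V × V => pr_nonneg fun R => bad (z, R)) h2
  rw [← pr_prod] at h3
  rw [le_div_iff₀ hη0]
  linarith

variable (V) in
/-- A vertex together with two gadgets. -/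
abbrev Switch (k ℓ : ℕ) : Type := V × Gadget V k ℓ × Gadget V k ℓ

/-- Two gadgets that pass a vertex on from `v` to `s`. -/
def Passes (E : Finset (Finset V)) (k ℓ : ℕ) (s v : V) (z : Switch V k ℓ) : Prop :=
  Holds E k ℓ s z.1 z.2.1 ∧ Holds E k ℓ z.1 v z.2.2

/-- The density of switches between two vertices. -/
def passDensity (η ε : ℝ) : ℝ :=
  (η * ε ^ 2 * ((η - ε) ^ 2 / 2)) * (η * ε ^ 2 * (η / 2)) * ((η - ε) ^ 2 / 4)

theorem pr_passes_lt_le (h : LowDeg E k η) (hη0 : 0 < η) (hη : η ≤ 1) (hε : 0 ≤ ε) (hεη : ε < η)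
    (hk4 : 4 ≤ k) (hℓ : 1 ≤ ℓ) (hk : 2 * ℓ < k) (s : V) :
    pr (fun v => pr (Passes E k ℓ s v) < passDensity η ε) ≤ 16 * ε / (η * (η - ε) ^ 2) := by
  set r := (η - ε) ^ 2 / 2 with hr
  have hr0 : 0 < r := by have := sub_pos.2 hεη; positivity
  have h1 := pr_le_common h hη hε hεη.le hk4 hℓ hk s
  have h2 := pr_common_lt_le h hη0 hη hε hk4 hℓ hk
  let bad : V × V → Prop := fun z => r ≤ common E k ℓ ε s z.2 ∧ common E k ℓ ε z.2 z.1 < η / 2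
  have h3 : pr bad ≤ 4 * ε / η := by
    rw [pr_swap]
    exact (pr_mono fun z hz => hz.2).trans h2
  have h4 : ∀ v, pr (Passes E k ℓ s v) < passDensity η ε → r / 2 ≤ pr fun x => bad (v, x) := fun v hv => by
    by_contra! hc
    have h5 := pr_sub_le (fun x => r ≤ common E k ℓ ε s x) (fun x => bad (v, x))
    have h6 := mul_pr_le_prod (c := (η * ε ^ 2 * r) * (η * ε ^ 2 * (η / 2)))
      (P := fun x => r ≤ common E k ℓ ε s x ∧ ¬ bad (v, x))
      (Q := fun x (z : Gadget V k ℓ × Gadget V k ℓ) => Holds E k ℓ s x z.1 ∧ Holds E k ℓ x v z.2)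
      fun x hx => by
        rw [pr_and_prod]
        have h7 : η / 2 ≤ common E k ℓ ε x v := not_lt.1 fun hlt => hx.2 ⟨hx.1, hlt⟩
        have h8 := mul_common_le h hη0.le hη hε hk4 hℓ hk s x
        have h9 := mul_common_le h hη0.le hη hε hk4 hℓ hk x v
        refine mul_le_mul (le_trans ?_ h8) (le_trans ?_ h9) (by positivity) (pr_nonneg _)
        · exact mul_le_mul_of_nonneg_left hx.1 (by positivity)
        · exact mul_le_mul_of_nonneg_left h7 (by positivity)
    have h7 : pr (fun x : V × Gadget V k ℓ × Gadget V k ℓ => (r ≤ common E k ℓ ε s x.1 ∧ ¬ bad (v, x.1)) ∧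
        Holds E k ℓ s x.1 x.2.1 ∧ Holds E k ℓ x.1 v x.2.2) ≤ pr (Passes E k ℓ s v) :=
      pr_mono fun x hx => hx.2
    have h8 : r / 2 ≤ pr fun x => r ≤ common E k ℓ ε s x ∧ ¬ bad (v, x) := by linarith
    have h9 := mul_le_mul_of_nonneg_left h8
      (by positivity : 0 ≤ (η * ε ^ 2 * r) * (η * ε ^ 2 * (η / 2)))
    have : passDensity η ε = (η * ε ^ 2 * r) * (η * ε ^ 2 * (η / 2)) * (r / 2) := by
      rw [passDensity, hr]; ring
    linarith
  have h5 := mul_pr_le_ex (fun v => pr_nonneg fun x => bad (v, x)) h4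
  rw [← pr_prod] at h5
  have h6 : 16 * ε / (η * (η - ε) ^ 2) = 4 * ε / η / (r / 2) := by
    grind
  rw [h6, le_div_iff₀ (by positivity)]
  linarith

end Gadgets

noncomputable section Absorbers

variable {V : Type} [DecidableEq V] {k ℓ : ℕ}

/-- The number of vertices that an absorber swallows. -/
abbrev absNum (k ℓ : ℕ) : ℕ := ℓ + (k - 2 * ℓ + (ℓ + (k - 2 * ℓ)))

variable (V) in
/-- An ℓ-set and the interior of an edge. -/
abbrev Half (k ℓ : ℕ) : Type := (Fin ℓ → V) × (Fin (k - 2 * ℓ) → V)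

variable (V) in
/-- The base path of an absorber, and the vertices that can be inserted into it. -/
abbrev Base (k ℓ : ℕ) : Type :=
  ((Half V k ℓ × (Fin ℓ → V)) × ((Fin (k - 2 * ℓ) → V) × (Fin ℓ → V)) ×
    ((Fin (k - 2 * ℓ) → V) × (Fin ℓ → V))) × Half V k ℓ

variable (V) in
/-- An absorber. -/
abbrev Absorber (k ℓ : ℕ) : Type := Base V k ℓ × (Fin (absNum k ℓ) → Switch V k ℓ)

/-- The vertices that can be inserted into the base path. -/
def insertable (τ : Base V k ℓ) :
    (Fin ℓ → V) × (Fin (k - 2 * ℓ) → V) × (Fin ℓ → V) × (Fin (k - 2 * ℓ) → V) :=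
  (τ.1.2.2.2, τ.1.2.2.1, τ.1.1.2, τ.1.2.1.1)

/-- The vertices that can be inserted into the base path, enumerated. -/
def insVertex (τ : Base V k ℓ) : Fin (absNum k ℓ) → V := Blk.eqv (V := V) (insertable τ)

theorem image_insVertex (τ : Base V k ℓ) : univ.image (insVertex τ) = im V (insertable τ) := rfl

/-- The base path has the required edges, with and without the insertable vertices. -/
def BaseOk (E : Finset (Finset V)) (k ℓ : ℕ) [Fintype V] (τ : Base V k ℓ) : Prop :=
  ((im V τ.1.1.1 ∪ im V τ.1.2.1.2 ∈ plus E k ∧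
      im V τ.1.1.2 ∪ im V τ.1.2.1.1 ∪ im V τ.1.2.1.2 ∈ plus E k) ∧
    im V τ.1.1.1 ∪ im V τ.1.2.2.2 ∈ plus E k ∧
      im V τ.1.1.2 ∪ im V τ.1.2.2.1 ∪ im V τ.1.2.2.2 ∈ plus E k) ∧
    im V τ.1.2.1.2 ∪ im V τ.2 ∈ plus E k

/-- The vertices of the base path other than its ends. -/
def baseMid (τ : Base V k ℓ) : Finset V := im V τ.1.1.1.2 ∪ im V τ.1.2.1.2 ∪ im V τ.2.2

theorem im_base (τ : Base V k ℓ) :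
    im V τ = im V τ.1.1.1.1 ∪ baseMid τ ∪ im V τ.2.1 ∪ im V (insertable τ) := by
  simp only [im_prod, baseMid, insertable]
  grind

theorem disjoint_insertable {τ : Base V k ℓ} (h : Distinct V τ) :
    Disjoint (im V τ.1.1.1.1 ∪ baseMid τ ∪ im V τ.2.1) (im V (insertable τ)) := by
  simp only [dist_prod, im_prod, disjoint_union_left, disjoint_union_right, baseMid, insertable] at h ⊢
  grind

theorem insVertex_injective {τ : Base V k ℓ} (h : Distinct V τ) : Function.Injective (insVertex τ) := by
  rw [insVertex, ← dist_iff_injective]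
  simp only [dist_prod, im_prod, disjoint_union_left, disjoint_union_right, insertable] at h ⊢
  grind

theorem base_card {τ : Base V k ℓ} (h : Distinct V τ) (hk : 2 * ℓ < k) :
    (im V τ.1.1.1.1 ∪ baseMid τ ∪ im V τ.2.1).card = 2 * (k - ℓ) + ℓ := by
  have h1 := congrArg card (im_base τ)
  rw [card_union_of_disjoint (disjoint_insertable h), h, ← image_insVertex,
    card_image_of_injective _ (insVertex_injective h), card_fin] at h1
  have : Blk.sz V (Base V k ℓ) = ℓ + (k - 2 * ℓ) + ℓ + (k - 2 * ℓ + ℓ + (k - 2 * ℓ + ℓ)) +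
    (ℓ + (k - 2 * ℓ)) := rfl
  grind

variable [Fintype V] {E : Finset (Finset V)} {η ε : ℝ}

theorem BaseOk.path {τ : Base V k ℓ} (h : BaseOk E k ℓ τ) (hk : 2 * ℓ < k) (hd : Distinct V τ) :
    PathOn E ℓ (im V τ.1.1.1.1) (baseMid τ) (im V τ.2.1) := by
  obtain ⟨⟨⟨⟨L₀, I₁⟩, M₂⟩, ⟨I, L₁⟩, I', L'⟩, L₅, I₄⟩ := τ
  obtain ⟨⟨⟨e1, -⟩, -⟩, e2⟩ := h
  have hcd : ∀ {a : ℕ} (x : Fin a → V), Distinct V x → (im V x).card = a := fun x hx => hx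
  simp only [dist_prod, im_prod, disjoint_union_left, disjoint_union_right] at hd e1 e2
  have p1 : PathOn E ℓ (im V L₀) (im V I₁) (im V L₁) := by
    refine .edge_plus (k := k) (hcd _ ?_) (hcd _ ?_) ?_ ?_ ?_ (by grind) e1 <;> grind
  have p2 : PathOn E ℓ (im V L₁) (im V I₄) (im V L₅) := by
    refine .edge_plus (k := k) (hcd _ ?_) (hcd _ ?_) ?_ ?_ ?_ (by grind) (by
      grind) <;> grind
  exact p1.cat p2 (by
    simp only [disjoint_union_left, disjoint_union_right]
    grind)

theorem BaseOk.path_insert {τ : Base V k ℓ} (h : BaseOk E k ℓ τ) (hk : 2 * ℓ < k) (hd : Distinct V τ) :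
    PathOn E ℓ (im V τ.1.1.1.1) (baseMid τ ∪ im V (insertable τ)) (im V τ.2.1) := by
  obtain ⟨⟨⟨⟨L₀, I₁⟩, M₂⟩, ⟨I, L₁⟩, I', L'⟩, L₅, I₄⟩ := τ
  obtain ⟨⟨⟨-, e1⟩, e2, e3⟩, e4⟩ := h
  have hcd : ∀ {a : ℕ} (x : Fin a → V), Distinct V x → (im V x).card = a := fun x hx => hx
  simp only [dist_prod, im_prod, disjoint_union_left, disjoint_union_right] at hd e1 e2 e3 e4
  have p1 : PathOn E ℓ (im V L₀) (im V I₁) (im V L') := by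
    refine .edge_plus (k := k) (hcd _ ?_) (hcd _ ?_) ?_ ?_ ?_ (by grind) e2 <;> grind
  have p2 : PathOn E ℓ (im V L') (im V I') (im V M₂) := by
    refine .edge_plus (k := k) (hcd _ ?_) (hcd _ ?_) ?_ ?_ ?_ (by grind) (by
      grind) <;> grind
  have p3 : PathOn E ℓ (im V M₂) (im V I) (im V L₁) := by
    refine .edge_plus (k := k) (hcd _ ?_) (hcd _ ?_) ?_ ?_ ?_ (by grind) e1 <;> grind
  have p4 : PathOn E ℓ (im V L₁) (im V I₄) (im V L₅) := by
    refine .edge_plus (k := k) (hcd _ ?_) (hcd _ ?_) ?_ ?_ ?_ (by grind) (by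
      grind) <;> grind
  have q1 := p1.cat p2 (by
    simp only [disjoint_union_left, disjoint_union_right]
    grind)
  have q2 := p3.cat p4 (by
    simp only [disjoint_union_left, disjoint_union_right]
    grind)
  have q := q1.cat q2 (by
    simp only [disjoint_union_left, disjoint_union_right]
    grind)
  convert q using 1
  clear * -
  simp only [baseMid, insertable, im_prod]
  grind

variable [Nonempty V]

theorem le_pr_baseOk (h : LowDeg E k η) (hη0 : 0 ≤ η) (hη : η ≤ 1) (hk4 : 4 ≤ k)
    (hk : 2 * ℓ < k) : η ^ 5 ≤ pr (BaseOk E k ℓ (V := V)) := by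
  let L := Fin ℓ → V
  let I := Fin (k - 2 * ℓ) → V
  let H := Half V k ℓ
  let Q : H × L → I × L → Prop := fun b d => im V b.1 ∪ im V d.2 ∈ plus E k ∧
    im V b.2 ∪ im V d.1 ∪ im V d.2 ∈ plus E k
  have hL : ∀ x : L, η ≤ pr fun y : H => im V x ∪ im V y ∈ plus E k := fun x =>
    h.le_pr_plus hη (im V x) (s := ℓ) (card_im_le x) (by omega)
      (by change ℓ + (k - 2 * ℓ) + ℓ = k; omega)
  have h1 : η ^ 2 ≤ pr fun x : (H × L) × (I × L) => Q x.1 x.2 := by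
    let e : L × (H × H) ≃ (H × L) × (I × L) :=
      ⟨fun x => ((x.2.1, x.2.2.1), (x.2.2.2, x.1)), fun y => (y.2.2, (y.1.1, (y.1.2, y.2.1))),
        fun _ => rfl, fun _ => rfl⟩
    rw [← pr_equiv e]
    refine le_pr_prod fun x => ?_
    have h2 := pr_and_prod (fun y : H => im V x ∪ im V y ∈ plus E k) fun y : H => im V x ∪ im V y ∈ plus E k
    have h3 : pr (fun z : H × H => im V x ∪ im V z.1 ∈ plus E k ∧ im V x ∪ im V z.2 ∈ plus E k) ≤
        pr fun z : H × H => Q (e (x, z)).1 (e (x, z)).2 := pr_mono fun z hz => by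
      refine ⟨by rw [union_comm]; exact hz.1, ?_⟩
      have := hz.2
      rw [im_prod, union_comm] at this
      exact this
    rw [h2] at h3
    refine le_trans ?_ h3
    rw [sq]
    exact mul_le_mul (hL x) (hL x) hη0 (pr_nonneg _)
  have h2 := (pow_le_pow_left₀ (by positivity) h1 2).trans (pr_sq_le Q)
  have h3 := mul_pr_le_prod (c := η)
    (P := fun x : (H × L) × (I × L) × (I × L) => Q x.1 x.2.1 ∧ Q x.1 x.2.2)
    (Q := fun x (y : H) => im V x.2.1.2 ∪ im V y ∈ plus E k) fun x _ => hL _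
  refine le_trans ?_ h3
  nlinarith [mul_le_mul_of_nonneg_left h2 hη0]

theorem pr_insVertex (P : V → Prop) (i : Fin (absNum k ℓ)) :
    pr (fun τ : Base V k ℓ => P (insVertex τ i)) = pr P := by
  let L := Fin ℓ → V
  let I := Fin (k - 2 * ℓ) → V
  let H := Half V k ℓ
  let e : Base V k ℓ ≃ (L × I × L × I) × (H × L × H) :=
    ⟨fun τ => (insertable τ, (τ.1.1.1, τ.1.2.1.2, τ.2)),
      fun y => (((y.2.1, y.1.2.2.1), ((y.1.2.2.2, y.2.2.1), (y.1.2.1, y.1.1))), y.2.2.2),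
      fun _ => rfl, fun _ => rfl⟩
  have h1 := pr_equiv e fun y => P (Blk.eqv (V := V) y.1 i)
  have h2 := pr_fst (Ω' := H × L × H) fun y : L × I × L × I => P (Blk.eqv (V := V) y i)
  have h3 := pr_equiv (Blk.eqv (V := V) (Ω := L × I × L × I)) fun y => P (y i)
  have h4 := pr_eval i P
  exact h1.trans (h2.trans (h3.trans h4))

set_option synthInstance.maxHeartbeats 400000 in
set_option synthInstance.maxSize 4096 in
instance : Fintype (Absorber V k ℓ) := inferInstance

/-- The base path works, and all its insertable vertices can be exchanged for those of `s`. -/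
def AbsorbOk (E : Finset (Finset V)) (k ℓ : ℕ) (s : Fin (absNum k ℓ) → V) (ω : Absorber V k ℓ) : Prop :=
  BaseOk E k ℓ ω.1 ∧ ∀ i, Passes E k ℓ (s i) (insVertex ω.1 i) (ω.2 i)

theorem le_pr_absorbOk (h : LowDeg E k η) (hη0 : 0 < η) (hη : η ≤ 1) (hε : 0 ≤ ε) (hεη : ε < η)
    (hk4 : 4 ≤ k) (hℓ : 1 ≤ ℓ) (hk : 2 * ℓ < k) (s : Fin (absNum k ℓ) → V) :
    passDensity η ε ^ absNum k ℓ * (η ^ 5 - absNum k ℓ * (16 * ε / (η * (η - ε) ^ 2))) ≤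
      pr (AbsorbOk E k ℓ s) := by
  have hp0 : 0 ≤ passDensity η ε := by unfold passDensity; positivity
  have h1 := mul_pr_le_prod (c := passDensity η ε ^ absNum k ℓ)
    (P := fun τ : Base V k ℓ => BaseOk E k ℓ τ ∧
      ¬ ∃ i ∈ (univ : Finset (Fin (absNum k ℓ))), pr (Passes E k ℓ (s i) (insVertex τ i)) < passDensity η ε)
    (Q := fun τ (z : Fin (absNum k ℓ) → Switch V k ℓ) => ∀ i, Passes E k ℓ (s i) (insVertex τ i) (z i))
    fun τ hτ => by
      rw [pr_pi]
      calc _ = ∏ _i : Fin (absNum k ℓ), passDensity η ε := by simp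
        _ ≤ _ := prod_le_prod (fun _ _ => hp0) fun i _ => not_lt.1 fun hlt => hτ.2 ⟨i, mem_univ i, hlt⟩
  refine le_trans ?_ (h1.trans (pr_mono fun ω hω => ⟨hω.1.1, hω.2⟩))
  refine mul_le_mul_of_nonneg_left (le_trans ?_ (pr_sub_le _ _)) (by positivity)
  refine sub_le_sub (le_pr_baseOk h hη0.le hη hk4 hk) ((pr_exists_le _ _).trans ?_)
  calc _ ≤ ∑ _i : Fin (absNum k ℓ), 16 * ε / (η * (η - ε) ^ 2) := sum_le_sum fun i _ => by
        rw [pr_insVertex (fun v => pr (Passes E k ℓ (s i) v) < passDensity η ε)]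
        exact pr_passes_lt_le h hη0 hη hε hεη hk4 hℓ hk (s i)
    _ = _ := by simp

end Absorbers

noncomputable section Absorbing

variable {V : Type} [DecidableEq V] {k ℓ : ℕ}

/-- The sets of vertices which are put into the empty slots of the base path and of the gadgets. -/
def fill {p : ℕ} (F : Finset V) (a b : Fin p → V) : Option (Fin p × Bool) → Finset V
  | none => F
  | some (i, false) => {a i}
  | some (i, true) => {b i}

theorem fill_subset {p : ℕ} (F : Finset V) (a b : Fin p → V) (j : Option (Fin p × Bool)) :
    fill F a b j ⊆ F ∪ univ.image a ∪ univ.image b := by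
  rcases j with _ | ⟨i, _ | _⟩ <;> intro v <;> simp [fill] <;> grind

theorem biUnion_fill {p : ℕ} (F : Finset V) (a b : Fin p → V) :
    univ.biUnion (fill F a b) = F ∪ univ.image a ∪ univ.image b := by
  refine Subset.antisymm (biUnion_subset.2 fun j _ => fill_subset F a b j) ?_
  intro v hv
  rw [mem_biUnion]
  simp only [mem_union, mem_image, mem_univ, true_and] at hv
  rcases hv with (hv | ⟨i, rfl⟩) | ⟨i, rfl⟩
  · exact ⟨none, mem_univ _, hv⟩
  · exact ⟨some (i, false), mem_univ _, mem_singleton_self _⟩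
  · exact ⟨some (i, true), mem_univ _, mem_singleton_self _⟩

theorem disjoint_fill {p : ℕ} {F : Finset V} {a b : Fin p → V} (ha : a.Injective) (hb : b.Injective)
    (hF : Disjoint F (univ.image a ∪ univ.image b)) (hab : Disjoint (univ.image a) (univ.image b))
    {i j : Option (Fin p × Bool)} (hij : i ≠ j) : Disjoint (fill F a b i) (fill F a b j) := by
  simp only [disjoint_left, mem_union, mem_image, mem_univ, true_and, not_or, not_exists,
    forall_exists_index, forall_apply_eq_imp_iff] at hF hab
  rcases i with _ | ⟨i, _ | _⟩ <;> rcases j with _ | ⟨j, _ | _⟩ <;>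
    simp only [fill, disjoint_singleton_left, disjoint_singleton_right, mem_singleton] <;>
    grind [Function.Injective]

/-- The starts of the pieces of an absorber. -/
def absStart (ω : Absorber V k ℓ) : Option (Fin (absNum k ℓ) × Bool) → Finset V
  | none => im V ω.1.1.1.1.1
  | some (i, false) => im V (ω.2 i).2.1.1.1
  | some (i, true) => im V (ω.2 i).2.2.1.1

/-- The final ends of the pieces of an absorber. -/
def absEnd (ω : Absorber V k ℓ) : Option (Fin (absNum k ℓ) × Bool) → Finset V
  | none => im V ω.1.2.1
  | some (i, false) => im V (ω.2 i).2.1.2.2.2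
  | some (i, true) => im V (ω.2 i).2.2.2.2.2

variable [Fintype V]

/-- The fixed interior vertices of the pieces of an absorber. -/
def absCore (ω : Absorber V k ℓ) : Option (Fin (absNum k ℓ) × Bool) → Finset V
  | none => baseMid ω.1
  | some (i, false) => gadgetMid (ω.2 i).2.1
  | some (i, true) => gadgetMid (ω.2 i).2.2

/-- The pivots of the switches of an absorber. -/
def pivot (ω : Absorber V k ℓ) (i : Fin (absNum k ℓ)) : V := (ω.2 i).1

/-- The interiors of the pieces of an absorber which has not swallowed anything. -/
def absMid (ω : Absorber V k ℓ) (j : Option (Fin (absNum k ℓ) × Bool)) : Finset V :=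
  absCore ω j ∪ fill ∅ (pivot ω) (insVertex ω.1) j

/-- The fixed vertices of the pieces of an absorber. -/
def absFixed (ω : Absorber V k ℓ) (j : Option (Fin (absNum k ℓ) × Bool)) : Finset V :=
  absStart ω j ∪ absCore ω j ∪ absEnd ω j

theorem absFixed_some (ω : Absorber V k ℓ) (i : Fin (absNum k ℓ)) :
    absFixed ω (some (i, false)) = im V (ω.2 i).2.1 ∧ absFixed ω (some (i, true)) = im V (ω.2 i).2.2 :=
  ⟨(im_gadget _).symm, (im_gadget _).symm⟩

theorem im_absorber (ω : Absorber V k ℓ) :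
    im V ω = univ.biUnion (absFixed ω) ∪ (im V (insertable ω.1) ∪ univ.image (pivot ω)) := by
  have h1 : im V ω = im V ω.1 ∪ univ.biUnion fun i => im V (ω.2 i) := by rw [im_prod, im_pi]
  ext v
  rw [h1, im_base]
  simp only [im_prod (ω.2 _), im_vertex, mem_union, mem_biUnion, mem_univ, true_and, mem_image,
    mem_singleton]
  constructor
  · rintro (((hv | hv) | hv) | ⟨i, hv | hv⟩)
    · exact .inl ⟨none, by simp only [absFixed, absStart, absCore, absEnd, mem_union]; exact .inl hv⟩
    · exact .inl ⟨none, by simp only [absFixed, absStart, absCore, absEnd, mem_union]; exact .inr hv⟩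
    · exact .inr (.inl hv)
    · exact .inr (.inr ⟨i, hv.symm⟩)
    · rw [im_prod, mem_union] at hv
      rcases hv with hv | hv
      · exact .inl ⟨some (i, false), by rwa [(absFixed_some ω i).1]⟩
      · exact .inl ⟨some (i, true), by rwa [(absFixed_some ω i).2]⟩
  · rintro (⟨_ | ⟨i, _ | _⟩, hv⟩ | hv | ⟨i, rfl⟩)
    · left; left
      simpa only [absFixed, absStart, absCore, absEnd, mem_union] using hv
    · rw [(absFixed_some ω i).1] at hv
      exact .inr ⟨i, .inr (by rw [im_prod]; exact mem_union_left _ hv)⟩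
    · rw [(absFixed_some ω i).2] at hv
      exact .inr ⟨i, .inr (by rw [im_prod]; exact mem_union_right _ hv)⟩
    · exact .inl (.inr hv)
    · exact .inr ⟨i, .inl rfl⟩

/-- The vertices of an absorber are pairwise distinct. -/
structure AbsDistinct (ω : Absorber V k ℓ) : Prop where
  base : Distinct V ω.1
  gadget : ∀ i, Distinct V (ω.2 i).2.1 ∧ Distinct V (ω.2 i).2.2
  pivot_injective : (pivot ω).Injective
  fixed : ∀ i j, i ≠ j → Disjoint (absFixed ω i) (absFixed ω j)
  fixed_pivot : ∀ j, Disjoint (absFixed ω j) (univ.image (pivot ω))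
  fixed_ins : ∀ j, Disjoint (absFixed ω j) (im V (insertable ω.1))
  ins_pivot : Disjoint (im V (insertable ω.1)) (univ.image (pivot ω))

theorem Distinct.absDistinct {ω : Absorber V k ℓ} (h : Distinct V ω) : AbsDistinct ω := by
  obtain ⟨h1, h2, h3⟩ := (dist_prod ω).1 h
  obtain ⟨h4, h5⟩ := Distinct.pi h2
  have hd : ∀ i, Distinct V (ω.2 i).2.1 ∧ Distinct V (ω.2 i).2.2 ∧
      Disjoint (im V (ω.2 i).2.1) (im V (ω.2 i).2.2) ∧
      pivot ω i ∉ im V (ω.2 i).2.1 ∧ pivot ω i ∉ im V (ω.2 i).2.2 := fun i => by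
    obtain ⟨-, h6, h7⟩ := (dist_prod (ω.2 i)).1 (h4 i)
    obtain ⟨h8, h9, h10⟩ := (dist_prod (ω.2 i).2).1 h6
    rw [im_prod (ω.2 i).2, im_vertex, disjoint_singleton_left, mem_union, not_or] at h7
    exact ⟨h8, h9, h10, h7⟩
  have him : ∀ i, im V (ω.2 i) = {pivot ω i} ∪ (im V (ω.2 i).2.1 ∪ im V (ω.2 i).2.2) := fun i => by
    rw [im_prod (ω.2 i), im_prod (ω.2 i).2, im_vertex, pivot]
  have hF := disjoint_insertable h1
  rw [im_pi] at h3
  simp only [disjoint_biUnion_right, mem_univ, true_imp_iff, him] at h3 h5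
  rw [im_base] at h3
  have hn : absFixed ω none = im V ω.1.1.1.1.1 ∪ baseMid ω.1 ∪ im V ω.1.2.1 := rfl
  have hs := absFixed_some ω
  rw [← hn] at hF h3
  have key : ∀ j, j = none ∨ ∃ i, absFixed ω j = im V (ω.2 i).2.1 ∨ absFixed ω j = im V (ω.2 i).2.2 := by
    rintro (_ | ⟨i, _ | _⟩)
    · exact .inl rfl
    · exact .inr ⟨i, .inl (hs i).1⟩
    · exact .inr ⟨i, .inr (hs i).2⟩
  have hbase := h1
  clear h h2 h4 him hn
  generalize hP : pivot ω = P at *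
  generalize hG₁ : (fun i => im V (ω.2 i).2.1) = G₁
  generalize hG₂ : (fun i => im V (ω.2 i).2.2) = G₂
  have e1 : ∀ i, im V (ω.2 i).2.1 = G₁ i := fun i => by rw [← hG₁]
  have e2 : ∀ i, im V (ω.2 i).2.2 = G₂ i := fun i => by rw [← hG₂]
  simp only [e1, e2, disjoint_union_left, disjoint_union_right, disjoint_singleton_left,
    disjoint_singleton_right, mem_singleton, mem_union, not_or] at h3 h5 hd hs key
  refine ⟨hbase, fun i => ⟨(hd i).1, (hd i).2.1⟩, ?_, ?_, ?_, ?_, ?_⟩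
  · rw [hP]
    intro i j hij
    grind
  · rintro (_ | ⟨i, _ | _⟩) (_ | ⟨j, _ | _⟩) hij
    all_goals
      try simp only [hs]
    all_goals grind
  · rw [hP]
    intro j
    simp only [disjoint_right, mem_image, mem_univ, true_and, forall_exists_index,
      forall_apply_eq_imp_iff]
    intro i
    rcases key j with rfl | ⟨i', h | h⟩
    · exact (h3 i).1.1
    all_goals
      grind
  · intro j
    rcases key j with rfl | ⟨i, h | h⟩
    · exact hF
    all_goals
      grind
  · rw [hP]
    simp only [disjoint_right, mem_image, mem_univ, true_and, forall_exists_index,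
      forall_apply_eq_imp_iff]
    exact fun i => (h3 i).1.2

theorem start_mid_end (ω : Absorber V k ℓ) (f : Option (Fin (absNum k ℓ) × Bool) → Finset V) (j) :
    absStart ω j ∪ (absCore ω j ∪ f j) ∪ absEnd ω j = absFixed ω j ∪ f j := by
  rw [absFixed, ← union_assoc, union_right_comm]

theorem AbsDistinct.disjoint {ω : Absorber V k ℓ} (h : AbsDistinct ω)
    {f : Option (Fin (absNum k ℓ) × Bool) → Finset V} (hf : ∀ i j, i ≠ j → Disjoint (f i) (f j))
    (hc : ∀ i j, Disjoint (absFixed ω i) (f j)) (i j) (hij : i ≠ j) :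
    Disjoint (absStart ω i ∪ (absCore ω i ∪ f i) ∪ absEnd ω i)
      (absStart ω j ∪ (absCore ω j ∪ f j) ∪ absEnd ω j) := by
  simp only [start_mid_end, disjoint_union_left, disjoint_union_right]
  exact ⟨⟨h.fixed i j hij, (hc j i).symm⟩, hc i j, hf i j hij⟩

theorem biUnion_absorber (ω : Absorber V k ℓ) (f : Option (Fin (absNum k ℓ) × Bool) → Finset V) :
    (univ.biUnion fun j => absStart ω j ∪ (absCore ω j ∪ f j) ∪ absEnd ω j) =
      univ.biUnion (absFixed ω) ∪ univ.biUnion f := by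
  simp only [start_mid_end]
  grind

variable {E : Finset (Finset V)}

theorem AbsorbOk.path {s : Fin (absNum k ℓ) → V} {ω : Absorber V k ℓ} (h : AbsorbOk E k ℓ s ω)
    (hℓ : 1 ≤ ℓ) (hk : 2 * ℓ < k) (hd : AbsDistinct ω) (j) :
    PathOn E ℓ (absStart ω j) (absMid ω j) (absEnd ω j) := by
  rcases j with _ | ⟨i, _ | _⟩
  · simpa [absMid, fill, absStart, absCore, absEnd] using h.1.path hk hd.base
  · refine (h.2 i).1.path_right hℓ hk (hd.gadget i).1 fun hm => ?_
    exact disjoint_left.1 (hd.fixed_pivot (some (i, false))) ((absFixed_some ω i).1 ▸ hm)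
      (mem_image_of_mem _ (mem_univ i))
  · refine (h.2 i).2.path_right hℓ hk (hd.gadget i).2 fun hm => ?_
    exact disjoint_left.1 (hd.fixed_ins (some (i, true))) ((absFixed_some ω i).2 ▸ hm)
      (image_insVertex ω.1 ▸ mem_image_of_mem _ (mem_univ i))

theorem AbsorbOk.path_absorb {s : Fin (absNum k ℓ) → V} {ω : Absorber V k ℓ} (h : AbsorbOk E k ℓ s ω)
    (hℓ : 1 ≤ ℓ) (hk : 2 * ℓ < k) (hd : AbsDistinct ω) (hs : ∀ i, s i ∉ im V ω) (j) :
    PathOn E ℓ (absStart ω j) (absCore ω j ∪ fill (im V (insertable ω.1)) s (pivot ω) j)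
      (absEnd ω j) := by
  have hF : ∀ j, absFixed ω j ⊆ im V ω := fun j => by
    rw [im_absorber]
    grind
  rcases j with _ | ⟨i, _ | _⟩
  · exact h.1.path_insert hk hd.base
  · exact (h.2 i).1.path_left hℓ hk (hd.gadget i).1 fun hm =>
      hs i (hF (some (i, false)) ((absFixed_some ω i).1 ▸ hm))
  · refine (h.2 i).2.path_left hℓ hk (hd.gadget i).2 fun hm => ?_
    exact disjoint_left.1 (hd.fixed_pivot (some (i, true))) ((absFixed_some ω i).2 ▸ hm)
      (mem_image_of_mem _ (mem_univ i))

theorem AbsDistinct.card {ω : Absorber V k ℓ} (hd : AbsDistinct ω) (hℓ : 1 ≤ ℓ) (hk : 2 * ℓ < k) (j) :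
    (absFixed ω j ∪ fill ∅ (pivot ω) (insVertex ω.1) j).card = 2 * (k - ℓ) + ℓ := by
  have hg : ∀ g : Gadget V k ℓ, Distinct V g → (im V g).card + 1 = 2 * (k - ℓ) + ℓ := fun g hg => by
    rw [hg]
    have : Blk.sz V (Gadget V k ℓ) = ℓ + (k - 1 - 2 * ℓ + (ℓ - 1)) + (1 + 1 + (k - 1 - 2 * ℓ + ℓ)) := rfl
    omega
  rcases j with _ | ⟨i, _ | _⟩
  · simpa [absFixed, fill, absStart, absCore, absEnd] using base_card hd.base hk
  · rw [(absFixed_some ω i).1, fill, card_union_of_disjoint, card_singleton, hg _ (hd.gadget i).1]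
    rw [← (absFixed_some ω i).1]
    exact (hd.fixed_pivot _).mono_right (singleton_subset_iff.2 (mem_image_of_mem _ (mem_univ i)))
  · rw [(absFixed_some ω i).2, fill, card_union_of_disjoint, card_singleton, hg _ (hd.gadget i).2]
    rw [← (absFixed_some ω i).2]
    exact (hd.fixed_ins _).mono_right (singleton_subset_iff.2
      (image_insVertex ω.1 ▸ mem_image_of_mem _ (mem_univ i)))

/-- Good absorbers are valid for the weighting that counts vertices modulo `2 (k - ℓ)`. -/
theorem AbsorbOk.valid {s : Fin (absNum k ℓ) → V} {ω : Absorber V k ℓ} (h : AbsorbOk E k ℓ s ω)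
    (hℓ : 1 ≤ ℓ) (hk : 2 * ℓ < k) (hd : Distinct V ω) :
    AbsValid E ℓ (fun L => L.card = ℓ) (fun _ => (1 : ZMod (2 * (k - ℓ)))) (-ℓ) (absStart ω) (absMid ω)
      (absEnd ω) (im V ω) := by
  have ha := hd.absDistinct
  refine ⟨fun j => ⟨h.path hℓ hk ha j, (h.path hℓ hk ha j).card_left, (h.path hℓ hk ha j).card_right, ?_⟩,
    ?_, ?_⟩
  · rw [absMid, start_mid_end, sum_const, ha.card hℓ hk j]
    simp
  · refine ha.disjoint (fun i j hij => disjoint_fill ha.pivot_injective (insVertex_injective ha.base)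
      (disjoint_empty_left _) ?_ hij) fun i j => ?_
    · rw [image_insVertex]; exact ha.ins_pivot.symm
    · refine Disjoint.mono_right (fill_subset _ _ _ j) ?_
      rw [empty_union, image_insVertex]
      exact disjoint_union_right.2 ⟨ha.fixed_pivot i, ha.fixed_ins i⟩
  · rw [im_absorber, ← image_insVertex, union_comm (univ.image _), ← empty_union (univ.image (pivot ω)),
      ← biUnion_fill]
    exact biUnion_absorber ω _

/-- Good absorbers swallow the given vertices. -/
theorem AbsorbOk.spans {s : Fin (absNum k ℓ) → V} {ω : Absorber V k ℓ} (h : AbsorbOk E k ℓ s ω)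
    (hℓ : 1 ≤ ℓ) (hk : 2 * ℓ < k) (hd : Distinct V ω) (hs : s.Injective)
    (hω : Disjoint (im V ω) (univ.image s)) :
    Spans E ℓ (absStart ω) (absEnd ω) (im V ω ∪ univ.image s) := by
  have ha := hd.absDistinct
  have hω' := hω
  simp only [im_absorber, disjoint_union_left, disjoint_biUnion_left, mem_univ, true_imp_iff] at hω'
  refine ⟨_, h.path_absorb hℓ hk ha fun i hi =>
    disjoint_left.1 hω hi (mem_image_of_mem _ (mem_univ i)), ?_, ?_⟩
  · refine ha.disjoint (fun i j hij => disjoint_fill hs ha.pivot_injective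
      (disjoint_union_right.2 ⟨hω'.2.1, ha.ins_pivot⟩) hω'.2.2.symm hij) fun i j => ?_
    refine Disjoint.mono_right (fill_subset _ _ _ j) ?_
    exact disjoint_union_right.2 ⟨disjoint_union_right.2 ⟨ha.fixed_ins i, hω'.1 i⟩, ha.fixed_pivot i⟩
  · rw [im_absorber, union_assoc, union_right_comm _ _ (univ.image s), ← biUnion_fill]
    exact biUnion_absorber ω _

end Absorbing

theorem exists_forall_div_le (C : ℝ) {c : ℝ} (hc : 0 < c) : ∃ n₀ : ℕ, ∀ n : ℕ, n₀ ≤ n → C / n ≤ c := by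
  obtain ⟨n₀, h⟩ := exists_nat_gt (C / c)
  refine ⟨n₀ + 1, fun n hn => ?_⟩
  have hn0 : (0 : ℝ) < n := by exact_mod_cast (by omega : 0 < n)
  rw [div_le_iff₀ hn0, mul_comm, ← div_le_iff₀ hc]
  exact h.le.trans (by exact_mod_cast (by omega : n₀ ≤ n))

theorem exists_partition_card {V : Type} [DecidableEq V] (s m : ℕ) : ∀ U : Finset V, U.card = s * m →
    ∃ P : Finset (Finset V), (∀ S ∈ P, S.card = s) ∧
      (∀ S ∈ P, ∀ S' ∈ P, S ≠ S' → Disjoint S S') ∧ P.biUnion id = U := by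
  induction m with
  | zero => exact fun U hU => ⟨∅, by simp, by simp, by simpa [eq_comm] using hU⟩
  | succ m ih =>
    intro U hU
    obtain ⟨S, hS, hSc⟩ := exists_subset_card_eq (s := U) (n := s) (by rw [hU, mul_add]; omega)
    obtain ⟨P, h1, h2, h3⟩ := ih (U \ S) (by grind)
    have h4 : ∀ S' ∈ P, Disjoint S S' := fun S' hS' => by
      have : S' ⊆ U \ S := h3 ▸ subset_biUnion_of_mem id hS'
      exact disjoint_sdiff.mono_right this
    refine ⟨insert S P, ?_, ?_, ?_⟩
    · simpa using ⟨hSc, h1⟩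
    · grind
    · rw [biUnion_insert, h3, id, union_sdiff_of_subset hS]

section Generic

variable {V : Type} [DecidableEq V] [Fintype V] {E : Finset (Finset V)} {k ℓ : ℕ} {η : ℝ}

/-- Any two disjoint ℓ-sets are joined by many paths with four edges. -/
theorem exists_connector_density (hη0 : 0 < η) (hη : η ≤ 1) (hk4 : 4 ≤ k) (hk : 2 * ℓ < k) (z : ℕ) :
    ∃ c > 0, ∃ n₀ : ℕ, ∀ (V : Type) [DecidableEq V] [Fintype V] (E : Finset (Finset V)),
      n₀ ≤ Fintype.card V → LowDeg E k η → ∀ A B Z : Finset V, A.card = ℓ → B.card = ℓ →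
      Disjoint A B → Z.card ≤ z →
      c ≤ pr fun ω : Fin (4 * (k - ℓ) - ℓ) → V => PathOn E ℓ A (im V ω) B ∧ Disjoint (im V ω) Z ∧
        (im V ω).card = 4 * (k - ℓ) - ℓ := by
  set q := 4 * (k - ℓ) - ℓ with hq
  set c := (η ^ 3 / 2) ^ 2 * (η ^ 3 / 16) ^ 4 with hc
  have hc0 : 0 < c := by positivity
  obtain ⟨n₀, hn₀⟩ := exists_forall_div_le ((q : ℝ) ^ 2 + q * (2 * ℓ + z) + ((q : ℝ) ^ 2 + 0)) (half_pos hc0)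
  refine ⟨c / 2, half_pos hc0, max n₀ 1, fun V _ _ E hn h A B Z hA hB hAB hZ => ?_⟩
  have : Nonempty V := Fintype.card_pos_iff.1 (lt_of_lt_of_le one_pos ((le_max_right _ _).trans hn))
  have h1 := connector h hη0 hη hk4 hk (Z := Z) hA hB hAB
  have h2 := pr_clean (V := V) (fun ω : Fin q → V => PathOn E ℓ A (im V ω) B ∧ Disjoint (im V ω) Z) ∅
  have h3 := hn₀ _ ((le_max_left _ _).trans hn)
  have h4 : ((A ∪ B ∪ Z).card : ℝ) ≤ 2 * ℓ + z := by
    have := card_union_le (A ∪ B) Z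
    have := card_union_le A B
    exact_mod_cast (by omega : (A ∪ B ∪ Z).card ≤ 2 * ℓ + z)
  have h5 : ((q : ℝ) ^ 2 + q * ((A ∪ B ∪ Z).card : ℝ)) / Fintype.card V +
      ((q : ℝ) ^ 2 + q * ((∅ : Finset V).card : ℝ)) / Fintype.card V ≤ c / 2 := by
    rw [← add_div]
    refine le_trans ?_ h3
    rw [card_empty, Nat.cast_zero, mul_zero]
    gcongr
  have h6 : Blk.sz V (Fin q → V) = q := rfl
  rw [h6] at h2
  refine le_trans ?_ (h2.trans (pr_mono fun ω hω => ⟨hω.1.1, hω.1.2, hω.2.1⟩))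
  rw [← hq] at h1
  linarith

/-- Any small set of vertices is swallowed by many absorbers. -/
theorem exists_absorber_density (hη0 : 0 < η) (hη : η ≤ 1) (hk4 : 4 ≤ k) (hℓ : 1 ≤ ℓ)
    (hk : 2 * ℓ < k) (z : ℕ) :
    ∃ c > 0, ∃ n₀ : ℕ, ∀ (V : Type) [DecidableEq V] [Fintype V] (E : Finset (Finset V)),
      n₀ ≤ Fintype.card V → LowDeg E k η → ∀ S Z : Finset V, S.card = 2 * (k - ℓ) → Z.card ≤ z →
      c ≤ pr fun ω : Absorber V k ℓ => Disjoint (im V ω) Z ∧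
        AbsValid E ℓ (fun L => L.card = ℓ) (fun _ => (1 : ZMod (2 * (k - ℓ)))) (-ℓ) (absStart ω) (absMid ω)
          (absEnd ω) (im V ω) ∧ Spans E ℓ (absStart ω) (absEnd ω) (im V ω ∪ S) := by
  set p := absNum k ℓ with hp
  have hp' : p = 2 * (k - ℓ) := by rw [hp, absNum]; omega
  have hp1 : (1 : ℝ) ≤ p := by exact_mod_cast (by omega : 1 ≤ p)
  set ε := η ^ 8 / (128 * p) with hε
  have hε0 : 0 < ε := by positivity
  have hεη : ε ≤ η / 2 := by
    rw [hε, div_le_iff₀ (by positivity)]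
    have : η ^ 8 ≤ η ^ 1 := pow_le_pow_of_le_one hη0.le hη (by norm_num)
    nlinarith
  have hpass : 0 < passDensity η ε := by
    have : 0 < η - ε := by linarith
    unfold passDensity; positivity
  have hbad : p * (16 * ε / (η * (η - ε) ^ 2)) ≤ η ^ 5 / 2 := by
    have h1 : (η / 2) ^ 2 ≤ (η - ε) ^ 2 := pow_le_pow_left₀ (by positivity) (by linarith) 2
    have h2 : 16 * ε / (η * (η - ε) ^ 2) ≤ 16 * ε / (η * (η / 2) ^ 2) := by gcongr
    have h3 : p * (16 * ε / (η * (η / 2) ^ 2)) = η ^ 5 / 2 := by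
      rw [hε]; field_simp; norm_num
    rw [← h3]
    gcongr
  set c := passDensity η ε ^ p * (η ^ 5 / 2) with hc
  have hc0 : 0 < c := by positivity
  set q := ℓ + (k - 2 * ℓ) + ℓ + (k - 2 * ℓ + ℓ + (k - 2 * ℓ + ℓ)) + (ℓ + (k - 2 * ℓ)) + p * (1 +
    ((ℓ + (k - 1 - 2 * ℓ + (ℓ - 1)) + (1 + 1 + (k - 1 - 2 * ℓ + ℓ))) +
      (ℓ + (k - 1 - 2 * ℓ + (ℓ - 1)) + (1 + 1 + (k - 1 - 2 * ℓ + ℓ))))) with hq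
  obtain ⟨n₀, hn₀⟩ := exists_forall_div_le ((q : ℝ) ^ 2 + q * (p + z)) (half_pos hc0)
  refine ⟨c / 2, half_pos hc0, max n₀ 1, fun V _ _ E hn h S Z hS hZ => ?_⟩
  have : Nonempty V := Fintype.card_pos_iff.1 (lt_of_lt_of_le one_pos ((le_max_right _ _).trans hn))
  have hq' : Blk.sz V (Absorber V k ℓ) = q := rfl
  let e := S.equivFinOfCardEq (hS.trans hp'.symm)
  let s : Fin (absNum k ℓ) → V := fun i => (e.symm i).1
  have hs : s.Injective := Subtype.val_injective.comp e.symm.injective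
  have hsS : univ.image s = S := by
    ext v
    simp only [mem_image, mem_univ, true_and, s]
    exact ⟨fun ⟨i, hi⟩ => hi ▸ (e.symm i).2, fun hv => ⟨e ⟨v, hv⟩, by simp⟩⟩
  have h1 := le_pr_absorbOk h hη0 hη hε0.le (by linarith : ε < η) hk4 hℓ hk s
  have h2 := pr_clean (V := V) (AbsorbOk E k ℓ s) (S ∪ Z)
  rw [hq'] at h2
  have h3 := hn₀ _ ((le_max_left _ _).trans hn)
  have h4 : ((S ∪ Z).card : ℝ) ≤ p + z := by
    have := card_union_le S Z
    exact_mod_cast (by omega : (S ∪ Z).card ≤ p + z)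
  have h5 : ((q : ℝ) ^ 2 + q * ((S ∪ Z).card : ℝ)) / Fintype.card V ≤ c / 2 := by
    refine le_trans ?_ h3
    gcongr
  have h6 : c ≤ passDensity η ε ^ p * (η ^ 5 - p * (16 * ε / (η * (η - ε) ^ 2))) := by
    rw [hc]
    gcongr
    linarith
  refine le_trans ?_ (h2.trans (pr_mono fun ω hω => ?_))
  · linarith
  · obtain ⟨ok, hd, hdis⟩ := hω
    rw [disjoint_union_right] at hdis
    refine ⟨hdis.2, ok.valid hℓ hk hd, ?_⟩
    have := ok.spans hℓ hk hd hs (hsS.symm ▸ hdis.1)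
    rwa [hsS] at this

theorem exists_mem_of_lowDeg [Nonempty V] (h : LowDeg E k η) (hη0 : 0 < η) (hk4 : 4 ≤ k) :
    ∃ e, e ∈ E := by
  have := h ∅ (by simp; omega)
  obtain ⟨x, hx⟩ := exists_of_pr_pos (lt_of_lt_of_le hη0 this)
  exact ⟨_, hx⟩

end Generic

/-- If almost all vertices outside any small set can be covered by few paths, then there is a
Hamiltonian cycle. -/
theorem hamC_of_cover {k ℓ : ℕ} (hk4 : 4 ≤ k) (hℓ : 1 ≤ ℓ) (hk : 2 * ℓ < k) {η γ : ℝ} (hη0 : 0 < η)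
    (hη : η ≤ 1) (hγ : 0 < γ) :
    ∃ β > 0, ∃ n₀ : ℕ, ∀ (V : Type) [DecidableEq V] [Fintype V] (E : Finset (Finset V)),
      n₀ ≤ Fintype.card V → (k - ℓ) ∣ Fintype.card V → (∀ e ∈ E, e.card = k) → LowDeg E k η →
      (∀ Z : Finset V, (Z.card : ℝ) ≤ γ * Fintype.card V →
        ∃ (b : ℕ) (L M L' : Fin b → Finset V), (b : ℝ) ≤ β * Fintype.card V ∧
          (∀ i, PathOn E ℓ (L i) (M i) (L' i) ∧ (∃ m, (L i ∪ M i ∪ L' i).card = 2 * (k - ℓ) * m + ℓ) ∧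
            Disjoint (L i ∪ M i ∪ L' i) Z) ∧
          (∀ i j, i ≠ j → Disjoint (L i ∪ M i ∪ L' i) (L j ∪ M j ∪ L' j)) ∧
          ((univ \ (Z ∪ univ.biUnion fun i => L i ∪ M i ∪ L' i)).card : ℝ) ≤ β * Fintype.card V) →
      HamC E ℓ := by
  set t := k - ℓ with ht
  have ht0 : ℓ < t := by omega
  obtain ⟨cC, hcC, nC, hC⟩ := exists_connector_density hη0 hη hk4 hk (4 * t + ℓ)
  obtain ⟨cA, hcA, nA, hA⟩ := exists_absorber_density hη0 hη hk4 hℓ hk (4 * t + ℓ)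
  set q := ℓ + (k - 2 * ℓ) + ℓ + (k - 2 * ℓ + ℓ + (k - 2 * ℓ + ℓ)) + (ℓ + (k - 2 * ℓ)) +
    absNum k ℓ * (1 + ((ℓ + (k - 1 - 2 * ℓ + (ℓ - 1)) + (1 + 1 + (k - 1 - 2 * ℓ + ℓ))) +
      (ℓ + (k - 1 - 2 * ℓ + (ℓ - 1)) + (1 + 1 + (k - 1 - 2 * ℓ + ℓ))))) with hq
  obtain ⟨β, hβ, n₁, hasm⟩ := assembly ℓ (4 * t - ℓ) q
    (Fintype.card (Option (Fin (absNum k ℓ) × Bool))) (2 * t) (by omega) (by omega) (by omega)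
    (lt_min hcC hcA) (half_pos hγ) le_rfl
  obtain ⟨n₂, hn₂⟩ := exists_forall_div_le (4 * t + ℓ) (half_pos hγ)
  refine ⟨β, hβ, max n₁ (max n₂ (max nC (max nA (2 * k)))), fun V _ _ E hn hdvd hE h hcov => ?_⟩
  simp only [max_le_iff] at hn
  obtain ⟨hn1, hn2, hnC, hnA, hnk⟩ := hn
  have hnpos : 0 < Fintype.card V := by omega
  have : Nonempty V := Fintype.card_pos_iff.1 hnpos
  have h2t : ((2 * t : ℕ) : ZMod (2 * t)) = 0 := ZMod.natCast_self _
  have hcast : ∀ m : ℕ, ((2 * t * m : ℕ) : ZMod (2 * t)) = 0 := fun m => by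
    rw [Nat.cast_mul, h2t, zero_mul]
  obtain ⟨m, hm⟩ := hdvd
  -- an initial path whose number of edges has the right parity
  obtain ⟨L₀, M₀, L₁, hP, hPle, hPw⟩ : ∃ L₀ M₀ L₁, PathOn E ℓ L₀ M₀ L₁ ∧
      (L₀ ∪ M₀ ∪ L₁).card ≤ 4 * t + ℓ ∧
      ((Fintype.card V : ℕ) : ZMod (2 * t)) = ((L₀ ∪ M₀ ∪ L₁).card : ZMod (2 * t)) + -(ℓ : ZMod (2 * t)) := by
    rcases Nat.even_or_odd' m with ⟨r, hr | hr⟩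
    · obtain ⟨X, -, hX⟩ := exists_subset_card_eq (s := (univ : Finset V)) (n := 2 * ℓ) (by
        rw [card_univ]; omega)
      obtain ⟨A, hAX, hA⟩ := exists_subset_card_eq (s := X) (n := ℓ) (by omega)
      obtain ⟨ω, hω, -, hωc⟩ := exists_of_pr_pos (hcC.trans_le (hC V E hnC h A (X \ A) ∅ hA
        (by rw [card_sdiff_of_subset hAX]; omega) disjoint_sdiff (by simp)))
      have hcard : (A ∪ im V ω ∪ X \ A).card = 4 * t + ℓ := by
        have := hω.disj
        rw [card_union_of_disjoint (disjoint_union_left.2 ⟨this.2.1, this.2.2⟩),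
          card_union_of_disjoint this.1, hω.card_left, hω.card_right, hωc]
        omega
      refine ⟨_, _, _, hω, hcard.le, ?_⟩
      rw [hcard, hm, hr, show t * (2 * r) = 2 * t * r by ring, hcast,
        show 4 * t + ℓ = 2 * t * 2 + ℓ by ring, Nat.cast_add, hcast]
      ring
    · obtain ⟨X, hX⟩ := exists_mem_of_lowDeg h hη0 hk4
      have hXc := hE X hX
      obtain ⟨A, hAX, hA⟩ := exists_subset_card_eq (s := X) (n := ℓ) (by omega)
      obtain ⟨B, hBX, hB⟩ := exists_subset_card_eq (s := X \ A) (n := ℓ) (by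
        rw [card_sdiff_of_subset hAX]; omega)
      have hAB : Disjoint A B := disjoint_sdiff.mono_right hBX
      have hu : A ∪ X \ (A ∪ B) ∪ B = X := by
        rw [union_right_comm, union_sdiff_of_subset (union_subset hAX (hBX.trans sdiff_subset))]
      refine ⟨A, X \ (A ∪ B), B, .edge hA hB (disjoint_sdiff.mono_left subset_union_left) hAB
        (sdiff_disjoint.mono_right subset_union_right) (hu.symm ▸ hX), ?_, ?_⟩
      · rw [hu, hXc]; omega
      · rw [hu, hXc, hm, hr, show t * (2 * r + 1) = 2 * t * r + t by ring, Nat.cast_add, hcast,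
          show k = t + ℓ by omega, Nat.cast_add]
        ring
  have hDZ : ∀ X : Finset V, X ⊆ univ \ (L₀ ∪ M₀ ∪ L₁) ↔ Disjoint X (L₀ ∪ M₀ ∪ L₁) := fun X => by
    rw [subset_sdiff]; simp
  refine hasm V (ZMod (2 * t)) (Absorber V k ℓ) (Option (Fin (absNum k ℓ) × Bool)) E (fun _ => 1) (-ℓ)
    (fun L => L.card = ℓ) (fun S => S.card = 2 * t) (univ \ (L₀ ∪ M₀ ∪ L₁)) L₀ M₀ L₁ absStart absMid absEnd
    hn1 rfl rfl hP hP.card_left hP.card_right (fun _ h => h) rfl ?_ ?_ (fun _ h => h) ?_ ?_ ?_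
  · simpa using hPw
  · intro A B hA hB hAB
    refine (min_le_left _ _).trans ((hC V E hnC h A B _ hA hB hAB hPle).trans (pr_mono fun ω hω => ?_))
    refine ⟨hω.1, (hDZ _).2 hω.2.1, ?_⟩
    rw [sum_const, hω.2.2, nsmul_eq_mul, mul_one, eq_neg_iff_add_eq_zero, ← Nat.cast_add,
      show 4 * t - ℓ + ℓ = 2 * t * 2 by omega, hcast]
  · intro S hS hSD
    refine (min_le_right _ _).trans ((hA V E hnA h S _ hS hPle).trans (pr_mono fun ω hω => ?_))
    exact ⟨(hDZ _).2 hω.1, hω.2⟩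
  · intro U _ hU
    rw [sum_const, nsmul_eq_mul, mul_one, ZMod.natCast_eq_zero_iff] at hU
    obtain ⟨m', hm'⟩ := hU
    exact exists_partition_card (2 * t) m' U hm'
  · intro R₁ hR₁ R₂ hR₂ _ _ hR
    have hu : (univ \ (L₀ ∪ M₀ ∪ L₁)) \ (R₁ ∪ R₂) = (univ : Finset V) \ (L₀ ∪ M₀ ∪ L₁ ∪ (R₁ ∪ R₂)) := by
      rw [sdiff_sdiff_left]; rfl
    obtain ⟨b, L, M, L', hb, h1, h2, h3⟩ := hcov (L₀ ∪ M₀ ∪ L₁ ∪ (R₁ ∪ R₂)) (by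
      have h4 : ((L₀ ∪ M₀ ∪ L₁ ∪ (R₁ ∪ R₂)).card : ℝ) ≤ (4 * t + ℓ) + (R₁ ∪ R₂).card := by
        exact_mod_cast (card_union_le _ _).trans (Nat.add_le_add_right hPle _)
      have h5 := hn₂ _ hn2
      rw [div_le_iff₀ (by exact_mod_cast hnpos)] at h5
      linarith)
    refine ⟨b, L, M, L', hb, fun i => ?_, h2, ?_⟩
    · obtain ⟨p, ⟨r, hr⟩, hdis⟩ := h1 i
      refine ⟨p, p.card_left, p.card_right, ?_, ?_⟩
      · rw [sum_const, hr, nsmul_eq_mul, mul_one, Nat.cast_add, hcast, zero_add, neg_neg]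
      · rw [hu, subset_sdiff]; exact ⟨subset_univ _, hdis⟩
    · rw [sdiff_sdiff_left, sup_eq_union, ← union_assoc]
      simpa using h3

noncomputable section Regularity

variable {V : Type} [Fintype V] [DecidableEq V] {k : ℕ}

/-- A colour class. -/
def cell {T : ℕ} (χ : V → Fin T) (j : Fin T) : Finset V := univ.filter fun v => χ v = j

/-- The tuples whose entries have given colours. -/
def cellBox {T : ℕ} (χ : V → Fin T) (I : Fin k → Fin T) : Finset (Fin k → V) :=
  Fintype.piFinset fun i => cell χ (I i)

theorem mem_cellBox {T : ℕ} {χ : V → Fin T} {I : Fin k → Fin T} {x : Fin k → V} :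
    x ∈ cellBox χ I ↔ χ ∘ x = I := by
  simp [cellBox, cell, funext_iff]

/-- The average of `F` over a set. -/
def avg (F : (Fin k → V) → ℝ) (s : Finset (Fin k → V)) : ℝ := (∑ x ∈ s, F x) / s.card

omit [Fintype V] [DecidableEq V] in
theorem avg_mul_card (F : (Fin k → V) → ℝ) (s : Finset (Fin k → V)) :
    avg F s * s.card = ∑ x ∈ s, F x := by
  rcases s.eq_empty_or_nonempty with rfl | hs
  · simp
  · rw [avg, div_mul_cancel₀]
    exact_mod_cast hs.card_pos.ne'

omit [Fintype V] [DecidableEq V] in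
theorem sum_sub_avg_sq_le (F : (Fin k → V) → ℝ) (s : Finset (Fin k → V)) (c : ℝ) :
    ∑ x ∈ s, (F x - avg F s) ^ 2 ≤ ∑ x ∈ s, (F x - c) ^ 2 := by
  have h1 : ∑ x ∈ s, (F x - c) ^ 2 = ∑ x ∈ s, (F x - avg F s) ^ 2 + s.card * (avg F s - c) ^ 2 := by
    have h2 : ∀ x, (F x - c) ^ 2 = (F x - avg F s) ^ 2 +
        (2 * (avg F s - c) * F x + (c ^ 2 - avg F s ^ 2)) := fun x => by ring
    rw [sum_congr rfl fun x _ => h2 x, sum_add_distrib, sum_add_distrib, ← mul_sum, sum_const,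
      nsmul_eq_mul, ← avg_mul_card F s]
    ring
  rw [h1]
  have : (0 : ℝ) ≤ s.card * (avg F s - c) ^ 2 := by positivity
  linarith

theorem sum_eq_sum_cellBox {T : ℕ} (χ : V → Fin T) (G : (Fin k → V) → ℝ) :
    ∑ x, G x = ∑ I : Fin k → Fin T, ∑ x ∈ cellBox χ I, G x := by
  classical
  rw [← sum_fiberwise univ (fun x : Fin k → V => χ ∘ x) G]
  refine sum_congr rfl fun I _ => sum_congr ?_ fun _ _ => rfl
  ext x; simp [mem_cellBox]

/-- The mean square error of approximating `F` by its averages over the boxes of a colouring. -/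
def boxErr {T : ℕ} (F : (Fin k → V) → ℝ) (χ : V → Fin T) : ℝ :=
  ex fun x => (F x - avg F (cellBox χ (χ ∘ x))) ^ 2

theorem boxErr_le {T : ℕ} (F : (Fin k → V) → ℝ) (χ : V → Fin T) (g : (Fin k → Fin T) → ℝ) :
    boxErr F χ ≤ ex fun x => (F x - g (χ ∘ x)) ^ 2 := by
  unfold boxErr ex
  refine div_le_div_of_nonneg_right ?_ (by positivity)
  rw [sum_eq_sum_cellBox χ, sum_eq_sum_cellBox χ fun x => (F x - g (χ ∘ x)) ^ 2]
  refine sum_le_sum fun I _ => ?_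
  have h1 : ∀ x ∈ cellBox χ I, χ ∘ x = I := fun x hx => mem_cellBox.1 hx
  rw [sum_congr rfl fun x hx => by rw [h1 x hx]]
  rw [sum_congr (f := fun x => (F x - g (χ ∘ x)) ^ 2) rfl fun x hx => by rw [h1 x hx]]
  exact sum_sub_avg_sq_le F _ _

/-- The box has a large sub-box on which the average of `F` is substantially smaller. -/
def Irregular {T : ℕ} (F : (Fin k → V) → ℝ) (ε : ℝ) (χ : V → Fin T) (I : Fin k → Fin T) : Prop :=
  ∃ A : Fin k → Finset V, (∀ i, A i ⊆ cell χ (I i)) ∧ (∀ i, ε * (cell χ (I i)).card ≤ (A i).card) ∧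
    ∑ x ∈ Fintype.piFinset A, F x ≤ (avg F (cellBox χ I) - ε) * (Fintype.piFinset A).card

/-- Lots of irregular boxes allow to improve a colouring by refining it. -/
theorem exists_refinement {T T' : ℕ} (F : (Fin k → V) → ℝ) {ε : ℝ} (hε : 0 < ε) (χ : V → Fin T)
    (e : Fin T × ((Fin k → Fin T) × Fin k → Bool) ≃ Fin T') :
    ∃ χ' : V → Fin T', boxErr F χ' ≤ boxErr F χ -
      ε ^ 2 * ε ^ k * pr fun x : Fin k → V => Irregular F ε χ (χ ∘ x) := by
  classical
  have hA : ∀ I, ∃ A : Fin k → Finset V, Irregular F ε χ I → (∀ i, A i ⊆ cell χ (I i)) ∧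
      (∀ i, ε * (cell χ (I i)).card ≤ (A i).card) ∧
      ∑ x ∈ Fintype.piFinset A, F x ≤ (avg F (cellBox χ I) - ε) * (Fintype.piFinset A).card := fun I => by
    by_cases h : Irregular F ε χ I
    · exact ⟨h.choose, fun _ => h.choose_spec⟩
    · exact ⟨fun _ => ∅, fun h' => absurd h' h⟩
  choose A hA using hA
  let χ' : V → Fin T' := fun v => e (χ v, fun p => decide (v ∈ A p.1 p.2))
  let g : (Fin k → Fin T') → ℝ := fun I' =>
    avg F (cellBox χ fun i => (e.symm (I' i)).1) -
      if Irregular F ε χ (fun i => (e.symm (I' i)).1) ∧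
        ∀ i, (e.symm (I' i)).2 (fun i => (e.symm (I' i)).1, i) = true then ε else 0
  have hg : ∀ x : Fin k → V, g (χ' ∘ x) = avg F (cellBox χ (χ ∘ x)) -
      if Irregular F ε χ (χ ∘ x) ∧ x ∈ Fintype.piFinset (A (χ ∘ x)) then ε else 0 := fun x => by
    have h1 : (fun i => (e.symm ((χ' ∘ x) i)).1) = χ ∘ x := by
      funext i; simp [χ']
    simp only [g, h1]
    simp [χ']
  refine ⟨χ', (boxErr_le F χ' g).trans ?_⟩
  simp only [hg, boxErr, pr]
  rw [← ex_mul_left, ← ex_sub]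
  unfold ex
  refine div_le_div_of_nonneg_right ?_ (by positivity)
  rw [sum_eq_sum_cellBox χ, sum_eq_sum_cellBox χ fun x => _ - _]
  refine sum_le_sum fun I _ => ?_
  have h1 : ∀ x ∈ cellBox χ I, χ ∘ x = I := fun x hx => mem_cellBox.1 hx
  rw [sum_congr rfl fun x hx => by rw [h1 x hx]]
  rw [sum_congr (s₁ := cellBox χ I) (f := fun x => (F x - avg F (cellBox χ (χ ∘ x))) ^ 2 - _) rfl
    fun x hx => by simp only [h1 x hx]; rfl]
  by_cases hI : Irregular F ε χ I
  swap
  · simp [hI]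
  obtain ⟨a1, a2, a3⟩ := hA I hI
  have hsub : Fintype.piFinset (A I) ⊆ cellBox χ I := Fintype.piFinset_subset _ _ a1
  simp only [hI, true_and, if_true, mul_one]
  set d := avg F (cellBox χ I) with hd
  set P := Fintype.piFinset (A I) with hP
  have h2 : ∀ x, (F x - (d - if x ∈ P then ε else 0)) ^ 2 =
      (F x - d) ^ 2 + if x ∈ P then 2 * ε * F x + (ε ^ 2 - 2 * ε * d) else 0 := fun x => by
    split_ifs <;> ring
  simp only [h2]
  rw [sum_add_distrib, sum_sub_distrib, sum_ite_mem, inter_eq_right.2 hsub, sum_add_distrib, ← mul_sum,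
    sum_const, sum_const, nsmul_eq_mul, nsmul_eq_mul]
  have h3 : ε ^ k * (cellBox χ I).card ≤ P.card := by
    rw [hP, cellBox, Fintype.card_piFinset, Fintype.card_piFinset, Nat.cast_prod, Nat.cast_prod]
    calc _ = ∏ i : Fin k, ε * ((cell χ (I i)).card : ℝ) := by rw [prod_mul_distrib]; simp
      _ ≤ _ := prod_le_prod (fun i _ => by positivity) fun i _ => a2 i
  have h4 : ε ^ 2 * (ε ^ k * (cellBox χ I).card) ≤ ε ^ 2 * P.card := by gcongr
  nlinarith [mul_le_mul_of_nonneg_left a3 hε.le]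

/-- The numbers of colours used in the regularity lemma. -/
def colours (k : ℕ) : ℕ → ℕ
  | 0 => 1
  | m + 1 => Fintype.card (Fin (colours k m) × ((Fin k → Fin (colours k m)) × Fin k → Bool))

theorem colours_pos (k m : ℕ) : 0 < colours k m := by
  induction m with
  | zero => exact one_pos
  | succ m ih =>
    have : Nonempty (Fin (colours k m)) := ⟨⟨0, ih⟩⟩
    exact Fintype.card_pos

/-- Weak regularity lemma. -/
theorem exists_regular_colouring (k : ℕ) {ε : ℝ} (hε : 0 < ε) : ∃ T₀ : ℕ,
    ∀ (V : Type) [Fintype V] [DecidableEq V] (F : (Fin k → V) → ℝ), (∀ x, 0 ≤ F x ∧ F x ≤ 1) →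
      ∃ T ≤ T₀, 0 < T ∧ ∃ χ : V → Fin T, pr (fun x : Fin k → V => Irregular F ε χ (χ ∘ x)) ≤ ε := by
  set g := ε ^ 2 * ε ^ k * ε with hg
  have hg0 : 0 < g := by positivity
  obtain ⟨N, hN⟩ := exists_nat_gt (1 / g)
  refine ⟨∑ m ∈ range (N + 1), colours k m, fun V _ _ F hF => ?_⟩
  by_contra! hc
  have hmin : ∀ m, ∃ χ : V → Fin (colours k m), ∀ χ', boxErr F χ ≤ boxErr F χ' := fun m => by
    have : Nonempty (Fin (colours k m)) := ⟨⟨0, colours_pos k m⟩⟩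
    exact Finite.exists_min _
  choose χ hχ using hmin
  have hstep : ∀ m ≤ N, boxErr F (χ m) ≤ 1 - m * g := by
    intro m
    induction m with
    | zero =>
      intro _
      refine (boxErr_le F (χ 0) fun _ => 0).trans ?_
      simp only [sub_zero, Nat.cast_zero, zero_mul]
      exact (ex_mono fun x => (by nlinarith [hF x] : F x ^ 2 ≤ 1)).trans (ex_const_le zero_le_one)
    | succ m ih =>
      intro hm
      obtain ⟨χ', h'⟩ := exists_refinement F hε (χ m) (Fintype.equivFin _)
      have h1 := hc (colours k m) (single_le_sum (f := colours k) (fun _ _ => Nat.zero_le _)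
        (mem_range.2 (by omega : m < N + 1))) (colours_pos k m) (χ m)
      have h2 := (hχ (m + 1) χ').trans h'
      have h3 : g ≤ ε ^ 2 * ε ^ k * pr fun x : Fin k → V => Irregular F ε (χ m) (χ m ∘ x) := by
        rw [hg]; gcongr
      have := ih (by omega)
      push_cast
      linarith
  have h1 := hstep N le_rfl
  have h2 : 0 ≤ boxErr F (χ N) := ex_nonneg fun _ => sq_nonneg _
  rw [div_lt_iff₀ hg0] at hN
  linarith

end Regularity

theorem farkas {ι τ : Type} [Fintype ι] [Fintype τ] [DecidableEq ι] (load : τ → ι → ℝ) (μ : ι → ℝ) (hμ : ∀ i, 0 ≤ μ i)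
    {s : ℝ} (hs : 0 < s) :
    (∃ w : τ → ℝ, (∀ I, 0 ≤ w I) ∧ ∑ I, w I = s ∧ ∀ j, ∑ I, w I * load I j ≤ μ j) ∨
    ∃ (y : ι → ℝ) (r : ℝ), (∀ j, 0 ≤ y j) ∧ 0 < r ∧ ∑ j, y j * μ j ≤ r ∧
      ∀ I, r ≤ s * ∑ j, y j * load I j := by
  let f : (τ → ℝ) →ₗ[ℝ] (ι → ℝ) :=
    { toFun := fun w j => ∑ I, w I * (s * load I j)
      map_add' := fun a b => by ext j; simp [add_mul, sum_add_distrib]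
      map_smul' := fun c a => by ext j; simp [mul_sum, mul_assoc] }
  let A : Set (ι → ℝ) := f '' stdSimplex ℝ τ
  let B : Set (ι → ℝ) := Set.Iic μ
  by_cases hAB : Disjoint A B
  · right
    obtain ⟨g, u, v, h1, h2, h3⟩ := geometric_hahn_banach_compact_closed
      ((convex_stdSimplex ℝ τ).linear_image f)
      ((isCompact_stdSimplex ℝ τ).image (LinearMap.continuous_of_finiteDimensional f)) (convex_Iic μ) isClosed_Iic hAB
    have hg : ∀ x : ι → ℝ, g x = ∑ j, x j * g (Pi.single j 1) := fun x => by
      conv_lhs => rw [pi_eq_sum_univ' x]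
      rw [map_sum]
      refine sum_congr rfl fun j _ => ?_
      rw [map_smul, smul_eq_mul]
    have hneg : ∀ j, g (Pi.single j 1) ≤ 0 := fun j => by
      by_contra! hc
      have h4 := h3 (μ - ((g μ - v) / g (Pi.single j 1)) • Pi.single j 1) (by
        have h5 : 0 ≤ (g μ - v) / g (Pi.single j 1) :=
          div_nonneg (by grind) hc.le
        intro i
        have : (0 : ℝ) ≤ (Pi.single j (1 : ℝ) : ι → ℝ) i := by
          grind
        simp only [Pi.sub_apply, Pi.smul_apply, smul_eq_mul]
        nlinarith [mul_nonneg h5 this])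
      rw [map_sub, map_smul, smul_eq_mul, div_mul_cancel₀ _ hc.ne'] at h4
      linarith
    have hv : v < 0 := by
      have h4 := h3 μ (le_refl μ)
      rw [hg] at h4
      have : ∑ j, μ j * g (Pi.single j 1) ≤ 0 :=
        sum_nonpos fun j _ => mul_nonpos_of_nonneg_of_nonpos (hμ j) (hneg j)
      linarith
    refine ⟨fun j => - g (Pi.single j 1), -v, fun j => by linarith [hneg j], by linarith, ?_, fun I => ?_⟩
    · have h4 := h3 μ (le_refl μ)
      rw [hg] at h4
      simp only [neg_mul, sum_neg_distrib]
      grind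
    · classical
      have h4 := h1 (f (Pi.single I 1)) ⟨_, single_mem_stdSimplex ℝ I, rfl⟩
      rw [hg] at h4
      have h5 : ∀ j, f (Pi.single I 1) j = s * load I j := fun j => by
        simp [f, Pi.single_apply]
      simp only [h5] at h4
      simp only [neg_mul, sum_neg_distrib]
      have h6 : s * ∑ j, g (Pi.single j 1) * load I j = ∑ j, s * load I j * g (Pi.single j 1) := by
        rw [mul_sum]; grind
      linarith
  · left
    obtain ⟨_, ⟨w, hw, rfl⟩, hB⟩ := Set.not_disjoint_iff.1 hAB
    refine ⟨fun I => s * w I, fun I => mul_nonneg hs.le (hw.1 I), by rw [← mul_sum, hw.2, mul_one],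
      fun j => ?_⟩
    have := hB j
    refine le_trans (le_of_eq ?_) this
    exact sum_congr rfl fun I _ => by ring
theorem le_half_add {a γ p r : ℝ} (ha : 0 < a) (ha' : a ≤ 1 / 6) (hγ : 0 ≤ γ) (hp : 0 ≤ p) (hpr : p ≤ r)
    (h : 2 * a - a ^ 2 - γ ≤ 2 * p - p ^ 2 + (r - p) ^ 2) : a - γ ≤ (p + r) / 2 := by
  by_contra! hc
  obtain ⟨m, d, rfl, rfl⟩ : ∃ m d, p = m - d ∧ r = m + d := ⟨(p + r) / 2, (r - p) / 2, by ring, by ring⟩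
  have hm : m < a - γ := by linarith
  have hd : 0 ≤ d := by linarith
  nlinarith [mul_nonneg hd (by linarith : 0 ≤ m - d), mul_nonneg hd (by linarith : 0 ≤ 2 - 5 * m),
    mul_nonneg (by linarith : 0 ≤ a - γ - m) (by linarith : 0 ≤ 1 - a - m)]

theorem add_le_half_add {a γ ξ p r : ℝ} (ha : 0 < a) (ha' : a ≤ 1 / 6) (hξ : 0 < ξ) (hξ' : ξ ≤ 1 / 2)
    (hγ : γ ≤ ξ / 8) (hp : 0 ≤ p) (hpr : p ≤ r) (hr : a + ξ ≤ r)
    (h : 2 * a - a ^ 2 - γ ≤ 2 * p - p ^ 2 + (r - p) ^ 2) : a + ξ / 8 ≤ (p + r) / 2 := by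
  by_contra! hc
  obtain ⟨m, d, rfl, rfl⟩ : ∃ m d, p = m - d ∧ r = m + d := ⟨(p + r) / 2, (r - p) / 2, by ring, by ring⟩
  have hm : m < a + ξ / 8 := by linarith
  have hd : 3 * ξ / 4 ≤ d := by linarith
  nlinarith [mul_nonneg (by linarith : 0 ≤ d) (by linarith : 0 ≤ m - d),
    mul_nonneg (by linarith : 0 ≤ d - 3 * ξ / 4) (by linarith : 0 ≤ 2 - 5 * m),
    mul_nonneg hξ.le (by linarith : 0 ≤ 1 / 3 - m),
    mul_nonneg (by linarith : 0 ≤ a + ξ / 8 - m) (by linarith : 0 ≤ 2 - a - m)]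

variable {V : Type} [Fintype V]

theorem pr_pair_le (z : V → ℝ) {s : ℝ} (hs : s ≤ 1 / 2) :
    (pr fun x : V × V => 1 ≤ z x.1 + z x.2) ≤
      2 * (pr fun v => 1 - s ≤ z v) - (pr fun v => 1 - s ≤ z v) ^ 2 +
        ((pr fun v => s ≤ z v) - pr fun v => 1 - s ≤ z v) ^ 2 := by
  rcases isEmpty_or_nonempty V with hV | hV
  · have : ∀ P : V → Prop, pr P = 0 := fun P => pr_false fun v => isEmptyElim v
    rw [this, this, pr_false fun v => isEmptyElim v.1]; norm_num
  have h1 := pr_split (fun v => s ≤ z v) fun v => 1 - s ≤ z v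
  rw [pr_congr (P := fun v => s ≤ z v ∧ 1 - s ≤ z v) (Q := fun v => 1 - s ≤ z v)
    fun v => ⟨fun h => h.2, fun h => ⟨by linarith, h⟩⟩] at h1
  rw [show (pr fun v => s ≤ z v) - (pr fun v => 1 - s ≤ z v) = pr fun v => s ≤ z v ∧ ¬ 1 - s ≤ z v by
    linarith, sq (pr fun v => s ≤ z v ∧ ¬ 1 - s ≤ z v), ← pr_and_prod]
  have h2 := pr_add_pr_not fun x : V × V => 1 - s ≤ z x.1 ∨ 1 - s ≤ z x.2
  have h3 := pr_and_prod (fun v => ¬ 1 - s ≤ z v) fun v => ¬ 1 - s ≤ z v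
  have h4 := pr_add_pr_not fun v => 1 - s ≤ z v
  have h5 : (pr fun x : V × V => ¬ (1 - s ≤ z x.1 ∨ 1 - s ≤ z x.2)) =
      pr fun x : V × V => ¬ 1 - s ≤ z x.1 ∧ ¬ 1 - s ≤ z x.2 := pr_congr fun x => not_or
  rw [h5, h3, show (pr fun v => ¬ 1 - s ≤ z v) = 1 - pr fun v => 1 - s ≤ z v by linarith] at h2
  refine (pr_mono fun x hx => ?_).trans ((pr_or_le (fun x : V × V => 1 - s ≤ z x.1 ∨ 1 - s ≤ z x.2)
    fun x => (s ≤ z x.1 ∧ ¬ 1 - s ≤ z x.1) ∧ s ≤ z x.2 ∧ ¬ 1 - s ≤ z x.2).trans (by nlinarith))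
  grind

theorem sum_level_le (z : V → ℝ) (hz : ∀ v, 0 ≤ z v) (N : ℕ) :
    ∑ i ∈ range N, ((pr fun v => ((i : ℝ) + 1) / (2 * N + 1) ≤ z v) +
      pr fun v => 1 - ((i : ℝ) + 1) / (2 * N + 1) ≤ z v) ≤ (2 * N + 1) * ex z := by
  classical
  have hM : (0 : ℝ) < 2 * N + 1 := by positivity
  have h1 : ∑ i ∈ range N, ((pr fun v => ((i : ℝ) + 1) / (2 * N + 1) ≤ z v) +
      pr fun v => 1 - ((i : ℝ) + 1) / (2 * N + 1) ≤ z v) =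
      ∑ i ∈ range (2 * N), pr fun v => ((i : ℝ) + 1) / (2 * N + 1) ≤ z v := by
    rw [show range (2 * N) = range (N + N) by rw [two_mul], sum_range_add, sum_add_distrib]
    congr 1
    rw [← sum_range_reflect]
    refine sum_congr rfl fun i hi => ?_
    refine pr_congr fun v => ?_
    have : ((N - 1 - i : ℕ) : ℝ) = N - 1 - i := by
      have := mem_range.1 hi
      rw [Nat.cast_sub (by omega), Nat.cast_sub (by omega)]; simp
    rw [this]
    grind
  rw [h1]
  unfold pr
  rw [← ex_sum, ← ex_mul_left]
  refine ex_mono fun v => ?_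
  rw [sum_boole]
  have h2 : ((range (2 * N)).filter fun i : ℕ => ((i : ℝ) + 1) / (2 * N + 1) ≤ z v) ⊆
      range ⌊(2 * N + 1) * z v⌋₊ := fun i hi => by
    rw [mem_filter, div_le_iff₀ hM] at hi
    rw [mem_range, Nat.lt_iff_add_one_le, Nat.le_floor_iff (by have := hz v; positivity)]
    push_cast; linarith [hi.2]
  have h3 := card_le_card h2
  rw [card_range] at h3
  exact (Nat.cast_le.2 h3).trans (Nat.floor_le (by have := hz v; positivity))

/-- A fractional cover of a dense graph of minimal weight is essentially integral. -/
theorem pr_level_le {κ ξ : ℝ} (hκ : 0 < κ) (hξ : 0 < ξ) (hξ' : ξ ≤ 1 / 2) : ∃ γ > 0,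
    ∀ (V : Type) [Fintype V] (z : V → ℝ) (a : ℝ), 0 < a → a ≤ 1 / 6 → (∀ v, 0 ≤ z v) → ex z ≤ a →
      2 * a - a ^ 2 - γ ≤ (pr fun x : V × V => 1 ≤ z x.1 + z x.2) →
      pr (fun v => κ ≤ z v) ≤ a + ξ := by
  obtain ⟨K, hK⟩ := exists_nat_gt (1 / κ)
  obtain ⟨N', hN'⟩ := exists_nat_gt (8 / ξ)
  have hK0 : (0 : ℝ) < K := lt_trans (by positivity) hK
  have hN0 : (0 : ℝ) < N' := lt_trans (by positivity) hN'
  rw [div_lt_iff₀ hκ] at hK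
  rw [div_lt_iff₀ hξ] at hN'
  obtain ⟨N, hN⟩ : ∃ N, N = K * N' := ⟨_, rfl⟩
  have hNr : (N : ℝ) = K * N' := by rw [hN]; push_cast; ring
  have hNp : (0 : ℝ) < N := by rw [hNr]; positivity
  have hle : N' ≤ N := by
    rw [hN]; exact Nat.le_mul_of_pos_left _ (by exact_mod_cast hK0)
  refine ⟨min (ξ / 8) (1 / (2 * N)), by positivity, fun V _ z a ha ha' hz hza h => ?_⟩
  set γ := min (ξ / 8) (1 / (2 * N)) with hγ
  have hγ1 : γ ≤ ξ / 8 := min_le_left _ _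
  have hγ2 : γ ≤ 1 / (2 * N) := min_le_right _ _
  rw [le_div_iff₀ (by positivity)] at hγ2
  have hγ0 : 0 ≤ γ := by positivity
  by_contra! hc
  have h1 := sum_level_le z hz N
  have hs : ∀ i ∈ range N, ((i : ℝ) + 1) / (2 * N + 1) ≤ 1 / 2 := fun i hi => by
    have : (i : ℝ) + 1 ≤ N := by exact_mod_cast mem_range.1 hi
    rw [div_le_iff₀ (by positivity)]; linarith
  have h2 : ∀ i ∈ range N, 2 * (a - γ) + (if i < N' then ξ / 4 else 0) ≤
      (pr fun v => ((i : ℝ) + 1) / (2 * N + 1) ≤ z v) +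
        pr fun v => 1 - ((i : ℝ) + 1) / (2 * N + 1) ≤ z v := fun i hi => by
    have h3 := h.trans (pr_pair_le z (hs i hi))
    have h4 : (pr fun v => 1 - ((i : ℝ) + 1) / (2 * N + 1) ≤ z v) ≤
        pr fun v => ((i : ℝ) + 1) / (2 * N + 1) ≤ z v := pr_mono fun v hv => by linarith [hs i hi]
    split_ifs with hi'
    · have h5 : a + ξ ≤ pr fun v => ((i : ℝ) + 1) / (2 * N + 1) ≤ z v :=
        hc.le.trans (pr_mono fun v hv => le_trans (by
          have : (i : ℝ) + 1 ≤ N' := by exact_mod_cast hi'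
          rw [div_le_iff₀ (by positivity), hNr]
          nlinarith) hv)
      have := add_le_half_add ha ha' hξ hξ' hγ1 (pr_nonneg _) h4 h5 h3
      linarith
    · have := le_half_add ha ha' hγ0 (pr_nonneg _) h4 h3
      linarith
  have h3 := (sum_le_sum h2).trans h1
  rw [sum_add_distrib, sum_const, card_range, nsmul_eq_mul, ← sum_filter, sum_const,
    show (range N).filter (fun i => i < N') = range N' by ext i; simp; omega, card_range,
    nsmul_eq_mul] at h3
  nlinarith [mul_le_mul_of_nonneg_left hza (by positivity : (0 : ℝ) ≤ 2 * N + 1)]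

/-- The contribution of a position of an edge to the number of private vertices of a path. -/
noncomputable def wt (ℓ i : ℕ) : ℝ := if i < 2 * ℓ then 1 / 2 else 1

theorem wt_pos (ℓ i : ℕ) : 0 < wt ℓ i := by unfold wt; split_ifs <;> norm_num

theorem sum_wt {k ℓ : ℕ} (h : 2 * ℓ ≤ k) : ∑ i : Fin k, wt ℓ i = k - ℓ := by
  rw [Fin.sum_univ_eq_sum_range (fun i => wt ℓ i) k]
  obtain ⟨r, rfl⟩ := Nat.exists_eq_add_of_le h
  have h1 : ∀ x ∈ range (2 * ℓ), wt ℓ x = 1 / 2 := fun x hx => if_pos (mem_range.1 hx)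
  have h2 : ∀ x ∈ range r, wt ℓ (2 * ℓ + x) = 1 := fun x _ => if_neg (by omega)
  rw [sum_range_add, sum_congr rfl h1, sum_congr rfl h2]
  simp; ring

/-- All sets of size `k - 2` have large degree. -/
def PairDeg {V : Type} [Fintype V] [DecidableEq V] (E : Finset (Finset V)) (k : ℕ) (d : ℝ) : Prop :=
  ∀ S : Finset V, S.card + 2 = k → d ≤ pr fun x : V × V => S ∪ {x.1, x.2} ∈ E

/-- No set of more than a certain size is almost independent. -/
def Spread {V : Type} [Fintype V] [DecidableEq V] (E : Finset (Finset V)) (k : ℕ) (a ξ : ℝ) : Prop :=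
  ∀ B : Finset V, (1 - a - ξ) * Fintype.card V ≤ B.card →
    ξ < pr fun x : Fin k → V => univ.image x ⊆ B ∧ univ.image x ∈ E

theorem exists_quantile {V : Type} [Fintype V] [Nonempty V] (Y : V → ℝ) {ρ : ℝ} (hρ : 0 < ρ)
    (hρ' : ρ ≤ 1) : ∃ v₀, ρ ≤ pr (fun v => Y v ≤ Y v₀) ∧ pr (fun v => Y v < Y v₀) < ρ := by
  classical
  have h0 : (univ.filter fun v₀ => ρ ≤ pr fun v => Y v ≤ Y v₀).Nonempty := by
    obtain ⟨v₀, -, h⟩ := exists_max_image univ Y univ_nonempty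
    exact ⟨v₀, mem_filter.2 ⟨mem_univ _, by rw [pr_true fun v => h v (mem_univ v)]; exact hρ'⟩⟩
  obtain ⟨v₀, h1, h2⟩ := exists_min_image _ Y h0
  refine ⟨v₀, (mem_filter.1 h1).2, ?_⟩
  rcases (univ.filter fun v => Y v < Y v₀).eq_empty_or_nonempty with h3 | h3
  · rw [pr_false fun v hv => (notMem_empty v) (h3 ▸ mem_filter.2 ⟨mem_univ _, hv⟩)]
    exact hρ
  · obtain ⟨v₁, h4, h5⟩ := exists_max_image _ Y h3
    have h6 := (mem_filter.1 h4).2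
    by_contra! hc
    have h7 := h2 v₁ (mem_filter.2 ⟨mem_univ _, hc.trans (pr_mono fun v hv =>
      h5 v (mem_filter.2 ⟨mem_univ _, hv⟩))⟩)
    linarith

/-- Tuples with two distinguished entries. -/
def consTwo (V : Type) (r : ℕ) : (Fin r → V) × (V × V) ≃ (Fin (r + 2) → V) where
  toFun x := Fin.cons x.2.1 (Fin.cons x.2.2 x.1)
  invFun y := (Fin.tail (Fin.tail y), y 0, y 1)
  left_inv x := by
    refine Prod.ext rfl (Prod.ext rfl ?_)
    simp [Fin.cons_one]
  right_inv y := by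
    refine funext fun i => ?_
    refine Fin.cases rfl (fun i => ?_) i
    refine Fin.cases rfl (fun i => rfl) i

set_option maxHeartbeats 1000000 in
theorem no_dual {k ℓ : ℕ} (hk4 : 4 ≤ k) (hℓ : 1 ≤ ℓ) (hk : 2 * ℓ < k) {ξ : ℝ} (hξ : 0 < ξ)
    (hξ' : ξ ≤ 1 / 2) : ∃ γ > 0, ∀ β > 0, β < 1 → ∃ ε > 0, ∃ n₀ : ℕ, ∀ (V : Type) [Fintype V]
      [DecidableEq V] (E : Finset (Finset V)) (a : ℝ), n₀ ≤ Fintype.card V → a = 1 / (2 * (k - ℓ)) →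
      PairDeg E k (2 * a - a ^ 2 - γ) → Spread E k a ξ → ∀ Y : V → ℝ, (∀ v, 0 ≤ Y v) → ex Y ≤ 1 - β →
      ε < pr fun x : Fin k → V => univ.image x ∈ E ∧ ∑ i : Fin k, wt ℓ i * Y (x i) < k - ℓ := by
  obtain ⟨r, rfl⟩ : ∃ r, k = r + 2 := ⟨k - 2, by omega⟩
  have hk0 : (0 : ℝ) < 2 * ((r + 2 : ℕ) : ℝ) := by positivity
  obtain ⟨γ, hγ, hstab⟩ := pr_level_le (κ := 1 / (2 * ((r + 2 : ℕ) : ℝ))) (by positivity) hξ hξ'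
  refine ⟨γ / 2, by positivity, fun β hβ hβ1 => ?_⟩
  set ρ := β / 2 with hρ
  have hρ0 : 0 < ρ := by positivity
  obtain ⟨n₀, hn₀⟩ := exists_forall_div_le ((r : ℝ) ^ 2) (c := ρ ^ r / 2) (by positivity)
  refine ⟨min ξ (γ / 2 * (ρ ^ r / 4)), by positivity, max n₀ 1, fun V _ _ E a hn ha hE hS Y hY hYe => ?_⟩
  set t : ℝ := ((r + 2 : ℕ) : ℝ) - ℓ with ht
  have ht3 : 3 ≤ t := by
    have : ℓ + 3 ≤ r + 2 := by omega
    have : ((ℓ + 3 : ℕ) : ℝ) ≤ ((r + 2 : ℕ) : ℝ) := by exact_mod_cast this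
    grind
  by_contra! hbad
  have : Nonempty V := Fintype.card_pos_iff.1 (lt_of_lt_of_le one_pos ((le_max_right _ _).trans hn))
  obtain ⟨v₀, hv1, hv2⟩ := exists_quantile Y hρ0 (by linarith)
  set lam := Y v₀ with hlam
  have hl0 : 0 ≤ lam := hY v₀
  have hl1 : lam < 1 := by
    have h1 : lam * (1 - ρ) ≤ 1 - β := by
      have h2 := (markov hY lam).trans hYe
      have h3 := pr_add_pr_not fun v => Y v < lam
      simp only [not_lt] at h3
      nlinarith
    nlinarith
  set z : V → ℝ := fun v => max (Y v - lam) 0 / (2 * t * (1 - lam)) with hz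
  have hD : 0 < 2 * t * (1 - lam) := mul_pos (by linarith) (by linarith)
  have hz0 : ∀ v, 0 ≤ z v := fun v => div_nonneg (le_max_right _ _) hD.le
  have hYz : ∀ v, Y v ≤ lam + 2 * t * (1 - lam) * z v := fun v => by
    rw [hz]; simp only []
    rw [mul_div_cancel₀ _ hD.ne']
    linarith [le_max_left (Y v - lam) 0]
  have ha0 : 0 < a := by rw [ha]; positivity
  have hza : ex z ≤ a := by
    classical
    have h1 : ex (fun v => max (Y v - lam) 0) ≤ ex fun v => Y v + lam * (if Y v < lam then 1 else 0) - lam :=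
      ex_mono fun v => by
        split_ifs with h
        · grind
        · rw [max_eq_left (by linarith)]; linarith
    rw [ex_sub, ex_add, ex_mul_left, ex_const] at h1
    have h2 : (ex fun v => if Y v < lam then (1 : ℝ) else 0) < ρ := by
      convert hv2 using 1; unfold pr; congr
    have h3 : ex z = (1 / (2 * t * (1 - lam))) * ex fun v => max (Y v - lam) 0 := by
      rw [← ex_mul_left]; grind
    rw [h3, ha]
    calc _ ≤ 1 / (2 * t * (1 - lam)) * (1 - lam) := by
          refine mul_le_mul_of_nonneg_left ?_ (by positivity)
          nlinarith
      _ = _ := by grind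
  have ha6 : a ≤ 1 / 6 := by
    rw [ha, div_le_div_iff₀ (by positivity) (by norm_num)]; linarith
  -- a good set of size `k - 2`
  set Bad : (Fin (r + 2) → V) → Prop := fun x => univ.image x ∈ E ∧ ∑ i : Fin (r + 2), wt ℓ i * Y (x i) < t with hBad
  have him : ∀ (p : Fin r → V) (u v : V), univ.image (consTwo V r (p, u, v)) = univ.image p ∪ {u, v} :=
    fun p u v => by
      ext w
      simp only [mem_image, mem_univ, true_and, mem_union, mem_insert, mem_singleton,
        Fin.exists_fin_succ, consTwo, Equiv.coe_fn_mk, Fin.cons_zero, Fin.cons_succ]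
      clear * -
      grind
  obtain ⟨p, hp1, hp2, hp3⟩ : ∃ p : Fin r → V, (∀ i, Y (p i) ≤ lam) ∧ Distinct V p ∧
      (pr fun x : V × V => Bad (consTwo V r (p, x))) ≤ γ / 2 := by
    by_contra! hc
    have h1 := mul_pr_le_prod (P := fun p : Fin r → V => (∀ i, Y (p i) ≤ lam) ∧ Distinct V p)
      (Q := fun p (x : V × V) => Bad (consTwo V r (p, x))) (c := γ / 2) fun p hp => (hc p hp.1 hp.2).le
    have h2 : (pr fun x : (Fin r → V) × (V × V) =>
        ((∀ i, Y (x.1 i) ≤ lam) ∧ Distinct V x.1) ∧ Bad (consTwo V r (x.1, x.2))) ≤ pr Bad := by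
      rw [← pr_equiv (consTwo V r)]
      exact pr_mono fun x hx => hx.2
    have h3 := pr_clean (V := V) (fun p : Fin r → V => ∀ i, Y (p i) ≤ lam) ∅
    rw [pr_pi fun (_ : Fin r) v => Y v ≤ lam, prod_const, card_univ, Fintype.card_fin] at h3
    have h4 : ρ ^ r ≤ (pr fun v => Y v ≤ lam) ^ r := pow_le_pow_left₀ hρ0.le hv1 r
    have h5 : ((Blk.sz V (Fin r → V) : ℝ) ^ 2 + Blk.sz V (Fin r → V) * (∅ : Finset V).card) / Fintype.card V ≤
        ρ ^ r / 2 := by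
      have : Blk.sz V (Fin r → V) = r := rfl
      rw [this]
      simpa using hn₀ _ ((le_max_left _ _).trans hn)
    have h6 : (pr fun p : Fin r → V => (∀ i, Y (p i) ≤ lam) ∧ Distinct V p ∧ Disjoint (im V p) ∅) ≤
        pr fun p : Fin r → V => (∀ i, Y (p i) ≤ lam) ∧ Distinct V p := pr_mono fun p h => ⟨h.1, h.2.1⟩
    have h7 : pr Bad ≤ γ / 2 * (ρ ^ r / 4) := hbad.trans (min_le_right _ _)
    have h8 : γ / 2 * (ρ ^ r / 2) ≤ γ / 2 * pr fun p : Fin r → V => (∀ i, Y (p i) ≤ lam) ∧ Distinct V p :=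
      mul_le_mul_of_nonneg_left (by linarith) (by positivity)
    have : 0 < γ / 2 * (ρ ^ r / 4) := by positivity
    nlinarith
  have hpair : 2 * a - a ^ 2 - γ ≤ pr fun x : V × V => 1 ≤ z x.1 + z x.2 := by
    have h1 := hE (univ.image p) (by
      have : (im V p).card = r := hp2
      rw [← im_tuple, this])
    have h2 := pr_or_le (fun x : V × V => Bad (consTwo V r (p, x))) fun x => 1 ≤ z x.1 + z x.2
    refine le_trans ?_ (le_trans (sub_le_sub_right (h1.trans ((pr_mono fun x hx => ?_).trans h2))
      (γ / 2)) (by linarith : _ ≤ _))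
    · linarith
    by_cases hb : Bad (consTwo V r (p, x))
    · exact Or.inl hb
    right
    obtain ⟨u, v⟩ := x
    simp only [hBad, him, not_and, not_lt] at hb
    have h3 := hb hx
    rw [Fin.sum_univ_succ, Fin.sum_univ_succ] at h3
    simp only [consTwo, Equiv.coe_fn_mk, Fin.cons_zero, Fin.cons_succ] at h3
    have h4 := sum_wt (k := r + 2) hk.le
    rw [Fin.sum_univ_succ, Fin.sum_univ_succ, ← ht] at h4
    have h5 : wt ℓ ((0 : Fin (r + 2)) : ℕ) = 1 / 2 := if_pos (by simp; omega)
    have h6 : wt ℓ (((0 : Fin (r + 1)).succ : Fin (r + 2)) : ℕ) = 1 / 2 := if_pos (by simp; omega)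
    rw [h5, h6] at h3 h4
    have h7 : ∑ i : Fin r, wt ℓ (i.succ.succ : Fin (r + 2)) * Y (p i) ≤
        ∑ i : Fin r, wt ℓ (i.succ.succ : Fin (r + 2)) * lam :=
      sum_le_sum fun i _ => mul_le_mul_of_nonneg_left (hp1 i) (wt_pos _ _).le
    rw [← sum_mul] at h7
    have h8 := hYz u
    have h9 := hYz v
    have h10 : t * (1 - lam) * 1 ≤ t * (1 - lam) * (z u + z v) := by nlinarith
    exact le_of_mul_le_mul_left h10 (mul_pos (by linarith) (by linarith))
  have hlev := hstab V z a ha0 ha6 hz0 hza hpair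
  classical
  set B : Finset V := univ.filter fun v => z v < 1 / (2 * ((r + 2 : ℕ) : ℝ)) with hB
  have hBc : (1 - a - ξ) * Fintype.card V ≤ B.card := by
    have h1 := pr_add_pr_not fun v => z v < 1 / (2 * ((r + 2 : ℕ) : ℝ))
    simp only [not_lt] at h1
    have h2 : (0 : ℝ) < Fintype.card V := by exact_mod_cast Fintype.card_pos
    have h3 : 1 - a - ξ ≤ pr fun v => z v < 1 / (2 * ((r + 2 : ℕ) : ℝ)) := by linarith
    rw [pr_eq, le_div_iff₀ h2] at h3
    convert h3 using 3
  obtain ⟨x, ⟨hx1, hx2⟩, hx3⟩ := exists_of_pr_lt ((hbad.trans (min_le_left _ _)).trans_lt (hS B hBc))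
  have h1 : t ≤ ∑ i : Fin (r + 2), wt ℓ i * Y (x i) := by
    grind
  have h2 : ∑ i : Fin (r + 2), wt ℓ i * Y (x i) ≤ ∑ i : Fin (r + 2), wt ℓ i * (lam + 2 * t * (1 - lam) * (1 / (2 * ((r + 2 : ℕ) : ℝ)))) :=
    sum_le_sum fun i _ => mul_le_mul_of_nonneg_left ((hYz _).trans (by
      have h3 := (mem_filter.1 (hx1 (mem_image_of_mem x (mem_univ i)))).2
      gcongr)) (wt_pos _ _).le
  rw [← sum_mul, sum_wt hk.le, ← ht] at h2
  have h3 : t < ((r + 2 : ℕ) : ℝ) := by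
    have : (1 : ℝ) ≤ ℓ := by exact_mod_cast hℓ
    rw [ht]; linarith
  have h4 : 2 * t * (1 - lam) * (1 / (2 * ((r + 2 : ℕ) : ℝ))) < 1 - lam := by
    rw [mul_one_div, div_lt_iff₀ hk0]
    nlinarith
  nlinarith

section Folding

variable {V : Type} [DecidableEq V]

/-- The number of sets of a family that are contained in `D`. -/
def use {p : ℕ} (A : Fin p → Finset V) (D : Finset V) : ℕ := (univ.filter fun i => A i ⊆ D).card

/-- Every set of the family is either contained in `D` or disjoint from it. -/
def Compat {p : ℕ} (A : Fin p → Finset V) (D : Finset V) : Prop := ∀ i, A i ⊆ D ∨ Disjoint (A i) D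

theorem card_im_inter_le_use {p : ℕ} {A : Fin p → Finset V} {D : Finset V} (h : Compat A D)
    {x : Fin p → V} (hx : ∀ i, x i ∈ A i) : (im V x ∩ D).card ≤ use A D := by
  have h1 : im V x ∩ D ⊆ (univ.filter fun i => A i ⊆ D).image x := fun v hv => by
    rw [mem_inter, im_tuple, mem_image] at hv
    obtain ⟨⟨i, -, rfl⟩, h2⟩ := hv
    rcases h i with h3 | h3
    · exact mem_image_of_mem _ (mem_filter.2 ⟨mem_univ _, h3⟩)
    · exact absurd h2 (disjoint_left.1 h3 (hx i))
  exact (card_le_card h1).trans card_image_le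

theorem card_union_inter_le (A B D : Finset V) :
    ((A ∪ B) ∩ D).card ≤ (A ∩ D).card + (B ∩ D).card := by
  rw [union_inter_distrib_right]; exact card_union_le _ _

variable [Fintype V]

/-- Repeatedly gluing two copies of a path along an end gives many long paths. -/
theorem exists_folded {E : Finset (Finset V)} {ℓ p : ℕ} (AY AX : Fin ℓ → Finset V)
    (AZ : Fin p → Finset V) {c : ℝ} (hc : 0 ≤ c)
    (h : c ≤ pr fun x : (Fin ℓ → V) × ((Fin ℓ → V) × (Fin p → V)) =>
      im V x.1 ∪ im V x.2.1 ∪ im V x.2.2 ∈ E ∧ (∀ i, x.1 i ∈ AY i) ∧ (∀ i, x.2.1 i ∈ AX i) ∧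
        ∀ i, x.2.2 i ∈ AZ i) (m : ℕ) :
    ∃ (C : Type) (_ : Fintype C) (_ : Blk V C) (R : (Fin ℓ → V) → (Fin ℓ → V) → C → Prop),
      Blk.sz V C + 2 * ℓ = 2 ^ (m + 1) * (ℓ + p) + ℓ ∧
      c ^ 2 ^ (m + 1) ≤ pr (fun x : (Fin ℓ → V) × ((Fin ℓ → V) × C) => R x.1 x.2.1 x.2.2) ∧
      ∀ x x' d, R x x' d → (∀ i, x i ∈ AX i) ∧ (∀ i, x' i ∈ AX i) ∧
        (∀ D, Compat AY D → Compat AX D → Compat AZ D → (im V d ∩ D).card + use AX D ≤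
          2 ^ m * (use AY D + use AX D) + 2 ^ (m + 1) * use AZ D) ∧
        (Distinct V (x, (x', d)) → PathOn E ℓ (im V x) (im V d) (im V x')) := by
  induction m with
  | zero =>
    refine ⟨(Fin ℓ → V) × ((Fin p → V) × (Fin p → V)), inferInstance, inferInstance,
      fun x x' d => (im V d.1 ∪ im V x ∪ im V d.2.1 ∈ E ∧ (∀ i, d.1 i ∈ AY i) ∧ (∀ i, x i ∈ AX i) ∧
        ∀ i, d.2.1 i ∈ AZ i) ∧ (im V d.1 ∪ im V x' ∪ im V d.2.2 ∈ E ∧ (∀ i, d.1 i ∈ AY i) ∧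
        (∀ i, x' i ∈ AX i) ∧ ∀ i, d.2.2 i ∈ AZ i), ?_, ?_, ?_⟩
    · simp only [Blk.sz]; ring
    · have h1 := (pow_le_pow_left₀ hc h 2).trans (pr_sq_le fun (y : Fin ℓ → V)
        (w : (Fin ℓ → V) × (Fin p → V)) => im V y ∪ im V w.1 ∪ im V w.2 ∈ E ∧ (∀ i, y i ∈ AY i) ∧
          (∀ i, w.1 i ∈ AX i) ∧ ∀ i, w.2 i ∈ AZ i)
      refine h1.trans (le_of_eq ?_)
      let e : (Fin ℓ → V) × (((Fin ℓ → V) × (Fin p → V)) × ((Fin ℓ → V) × (Fin p → V))) ≃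
          (Fin ℓ → V) × ((Fin ℓ → V) × ((Fin ℓ → V) × ((Fin p → V) × (Fin p → V)))) :=
        ⟨fun x => (x.2.1.1, (x.2.2.1, (x.1, (x.2.1.2, x.2.2.2)))),
          fun x => (x.2.2.1, ((x.1, x.2.2.2.1), (x.2.1, x.2.2.2.2))), fun _ => rfl, fun _ => rfl⟩
      rw [← pr_equiv e]
      rfl
    · rintro x x' ⟨y, z, z'⟩ ⟨⟨h1, h2, h3, h4⟩, h5, -, h7, h8⟩
      refine ⟨h3, h7, fun D hY hX hZ => ?_, fun hd => ?_⟩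
      · have a1 : (im V y ∩ D).card ≤ _ := card_im_inter_le_use hY h2
        have a2 : (im V z ∩ D).card ≤ _ := card_im_inter_le_use hZ h4
        have a3 : (im V z' ∩ D).card ≤ _ := card_im_inter_le_use hZ h8
        have a4 := card_union_inter_le (im V y) (im V (z, z')) D
        have a5 := card_union_inter_le (im V z) (im V z') D
        rw [im_prod (A := Fin ℓ → V)]
        rw [im_prod (A := Fin p → V)] at a4 ⊢
        simp only [] at a4 ⊢
        omega
      · simp only [dist_prod, im_prod, disjoint_union_right] at hd
        obtain ⟨b1, ⟨b2, ⟨b3, ⟨b4, b5, b6⟩, b7, b8⟩, b9, b10, b11⟩, b12, b13, b14, b15⟩ := hd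
        have e1 : PathOn E ℓ (im V x) (im V z) (im V y) :=
          .edge b1 b3 b14 b13 b7.symm (by
            rwa [union_right_comm, union_comm (im V x)])
        have e2 : PathOn E ℓ (im V y) (im V z') (im V x') :=
          .edge b3 b2 b8 b9.symm b11.symm (by rwa [union_right_comm])
        have := e1.cat e2 (by
          simp only [disjoint_union_left, disjoint_union_right]
          exact ⟨⟨b15, b6⟩, b12, b10.symm⟩)
        rw [im_prod, im_prod]
        rwa [union_comm (im V z), union_assoc] at this
  | succ m ih =>
    obtain ⟨C, iF, iB, R, hsz, hpr, hR⟩ := ih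
    refine ⟨(Fin ℓ → V) × (C × C), inferInstance, inferInstance,
      fun x x' d => R d.1 x d.2.1 ∧ R d.1 x' d.2.2, ?_, ?_, ?_⟩
    · have : Blk.sz V ((Fin ℓ → V) × (C × C)) = ℓ + (Blk.sz V C + Blk.sz V C) := rfl
      rw [this, pow_succ]
      linarith
    · have h1 := (pow_le_pow_left₀ (by positivity) hpr 2).trans
        (pr_sq_le fun (y : Fin ℓ → V) (w : (Fin ℓ → V) × C) => R y w.1 w.2)
      rw [← pow_mul, ← pow_succ] at h1
      refine h1.trans (le_of_eq ?_)
      let e : (Fin ℓ → V) × (((Fin ℓ → V) × C) × ((Fin ℓ → V) × C)) ≃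
          (Fin ℓ → V) × ((Fin ℓ → V) × ((Fin ℓ → V) × (C × C))) :=
        ⟨fun x => (x.2.1.1, (x.2.2.1, (x.1, (x.2.1.2, x.2.2.2)))),
          fun x => (x.2.2.1, ((x.1, x.2.2.2.1), (x.2.1, x.2.2.2.2))), fun _ => rfl, fun _ => rfl⟩
      rw [← pr_equiv e]
      rfl
    · rintro x x' ⟨y, d, d'⟩ ⟨h1, h2⟩
      obtain ⟨c1, c2, c3, c4⟩ := hR _ _ _ h1
      obtain ⟨-, c6, c7, c8⟩ := hR _ _ _ h2
      refine ⟨c2, c6, fun D hY hX hZ => ?_, fun hd => ?_⟩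
      · have a1 := card_im_inter_le_use hX c1
        have a2 := c3 D hY hX hZ
        have a3 := c7 D hY hX hZ
        have a4 := card_union_inter_le (im V y) (im V (d, d')) D
        have a5 := card_union_inter_le (im V d) (im V d') D
        rw [im_prod (A := Fin ℓ → V)]
        rw [im_prod (A := C)] at a4 ⊢
        simp only [pow_succ] at a2 a3 a4 ⊢
        linarith
      · simp only [dist_prod, im_prod, disjoint_union_right] at hd c4 c8
        obtain ⟨b1, ⟨b2, ⟨b3, ⟨b4, b5, b6⟩, b7, b8⟩, b9, b10, b11⟩, b12, b13, b14, b15⟩ := hd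
        have e1 := (c4 ⟨b3, ⟨b1, b4, b14⟩, b13.symm, b7⟩).symm
        have e2 := c8 ⟨b3, ⟨b2, b5, b11⟩, b9.symm, b8⟩
        have := e1.cat e2 (by
          simp only [disjoint_union_left, disjoint_union_right]
          exact ⟨⟨b15, b6⟩, b12, b10.symm⟩)
        rw [im_prod, im_prod]
        rwa [union_comm (im V d), union_assoc] at this

end Folding

section PathInParts

theorem cast_use {V : Type} [DecidableEq V] {p : ℕ} (A : Fin p → Finset V) (D : Finset V) :
    (use A D : ℝ) = ∑ i, if A i ⊆ D then (1 : ℝ) else 0 := by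
  rw [use, card_filter]; push_cast; rfl

/-- A dense partite collection of edges contains a path with `2 ^ (m + 1)` edges that uses the parts
in the prescribed proportions. -/
theorem exists_path_in_parts (ℓ p m : ℕ) {c : ℝ} (hc : 0 < c) : ∃ n₀ : ℕ, ∀ (V : Type)
    [DecidableEq V] [Fintype V] (E : Finset (Finset V)) (A : Fin (ℓ + (ℓ + p)) → Finset V),
    n₀ ≤ Fintype.card V →
    c ≤ pr (fun x : Fin (ℓ + (ℓ + p)) → V => univ.image x ∈ E ∧ ∀ i, x i ∈ A i) →
    ∃ L M L', PathOn E ℓ L M L' ∧ (L ∪ M ∪ L').card = 2 ^ (m + 1) * (ℓ + p) + ℓ ∧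
      ∀ D, Compat A D → ((((L ∪ M ∪ L') ∩ D).card : ℕ) : ℝ) ≤
        2 * (2 ^ m + 1) * ∑ i : Fin (ℓ + (ℓ + p)), if A i ⊆ D then wt ℓ i else 0 := by
  have hc' : 0 < c ^ 2 ^ (m + 1) / 2 := by positivity
  obtain ⟨n₀, hn₀⟩ := exists_forall_div_le (((2 ^ (m + 1) * (ℓ + p) + ℓ : ℕ) : ℝ) ^ 2) hc'
  refine ⟨n₀, fun V _ _ E A hn h => ?_⟩
  let AY : Fin ℓ → Finset V := fun i => A (Fin.castAdd _ i)
  let AX : Fin ℓ → Finset V := fun i => A (Fin.natAdd ℓ (Fin.castAdd p i))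
  let AZ : Fin p → Finset V := fun i => A (Fin.natAdd ℓ (Fin.natAdd ℓ i))
  have h1 : c ≤ pr fun x : (Fin ℓ → V) × ((Fin ℓ → V) × (Fin p → V)) =>
      im V x.1 ∪ im V x.2.1 ∪ im V x.2.2 ∈ E ∧ (∀ i, x.1 i ∈ AY i) ∧ (∀ i, x.2.1 i ∈ AX i) ∧
        ∀ i, x.2.2 i ∈ AZ i := by
    refine h.trans (le_of_eq ?_)
    let e := ((Equiv.refl (Fin ℓ → V)).prodCongr (Fin.appendEquiv (α := V) ℓ p)).trans
      (Fin.appendEquiv (α := V) ℓ (ℓ + p))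
    rw [← pr_equiv e]
    refine pr_congr fun x => ?_
    have h2 : univ.image (e x) = im V x := by
      rw [im]; congr 1
    rw [h2, im_prod, im_prod, union_assoc]
    refine and_congr Iff.rfl ?_
    rw [Fin.forall_fin_add]
    conv_lhs => rhs; rw [Fin.forall_fin_add]
    have e1 : ∀ i, e x (Fin.castAdd _ i) = x.1 i := fun i => Fin.append_left _ _ i
    have e2 : ∀ i, e x (Fin.natAdd ℓ i) = Fin.append x.2.1 x.2.2 i := fun i => Fin.append_right _ _ i
    simp only [e1, e2, Fin.append_left, Fin.append_right]
    rfl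
  obtain ⟨C, _, _, R, hsz, hR, hR'⟩ := exists_folded AY AX AZ hc.le h1 m
  have hsz' : Blk.sz V ((Fin ℓ → V) × ((Fin ℓ → V) × C)) = 2 ^ (m + 1) * (ℓ + p) + ℓ := by
    simp only [Blk.sz]; omega
  have h3 := pr_clean (V := V)
    (fun x : (Fin ℓ → V) × ((Fin ℓ → V) × C) => R x.1 x.2.1 x.2.2) ∅
  rw [card_empty, hsz'] at h3
  have h4 := hn₀ _ hn
  have h5 : (0 : ℝ) < pr (fun x : (Fin ℓ → V) × ((Fin ℓ → V) × C) =>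
      R x.1 x.2.1 x.2.2 ∧ Distinct V x ∧ Disjoint (im V x) ∅) := by
    refine lt_of_lt_of_le ?_ h3
    rw [Nat.cast_zero, mul_zero, add_zero]
    linarith
  obtain ⟨⟨x, x', d⟩, hx, hd, -⟩ := exists_of_pr_pos h5
  obtain ⟨b1, b2, b3, b4⟩ := hR' x x' d hx
  have hu : im V x ∪ im V d ∪ im V x' = im V (x, (x', d)) := by
    rw [im_prod, im_prod, union_assoc, union_comm (im V d)]
  refine ⟨im V x, im V d, im V x', b4 hd, ?_, fun D hD => ?_⟩
  · rw [hu, ← hsz']; exact hd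
  · have hY : Compat AY D := fun i => hD _
    have hX : Compat AX D := fun i => hD _
    have hZ : Compat AZ D := fun i => hD _
    have a1 : (im V x ∩ D).card ≤ _ := card_im_inter_le_use hX b1
    have a2 : (im V x' ∩ D).card ≤ _ := card_im_inter_le_use hX b2
    have a3 := b3 D hY hX hZ
    have a4 := card_union_inter_le (im V x ∪ im V d) (im V x') D
    have a5 := card_union_inter_le (im V x) (im V d) D
    have a6 : ((im V x ∪ im V d ∪ im V x') ∩ D).card ≤
        2 ^ m * (use AY D + use AX D) + 2 ^ (m + 1) * use AZ D + use AX D := by omega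
    have a7 : ((((im V x ∪ im V d ∪ im V x') ∩ D).card : ℕ) : ℝ) ≤
        2 ^ m * (use AY D + use AX D) + 2 ^ (m + 1) * use AZ D + use AX D := by exact_mod_cast a6
    have a8 : ∑ i : Fin (ℓ + (ℓ + p)), (if A i ⊆ D then wt ℓ i else 0) =
        1 / 2 * (use AY D + use AX D) + use AZ D := by
      rw [Fin.sum_univ_add, Fin.sum_univ_add (a := ℓ) (b := p), cast_use, cast_use, cast_use,
        mul_add, mul_sum, mul_sum, ← add_assoc]
      have w1 : ∀ i : Fin ℓ, wt ℓ (Fin.castAdd (ℓ + p) i : Fin (ℓ + (ℓ + p))) = 1 / 2 := fun i => by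
        rw [wt, if_pos]; simp only [Fin.val_castAdd]; omega
      have w2 : ∀ i : Fin ℓ, wt ℓ (Fin.natAdd ℓ (Fin.castAdd p i) : Fin (ℓ + (ℓ + p))) = 1 / 2 :=
        fun i => by rw [wt, if_pos]; simp only [Fin.val_castAdd, Fin.val_natAdd]; omega
      have w3 : ∀ i : Fin p, wt ℓ (Fin.natAdd ℓ (Fin.natAdd ℓ i) : Fin (ℓ + (ℓ + p))) = 1 :=
        fun i => by rw [wt, if_neg]; simp only [Fin.val_natAdd]; omega
      congr 1
      · congr 1
        all_goals
          refine sum_congr rfl fun i _ => ?_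
          simp only [w1, w2, mul_ite, mul_one, mul_zero, AY, AX]
      · refine sum_congr rfl fun i _ => ?_
        simp only [w3, AZ]
    rw [a8]
    have p1 : (0 : ℝ) ≤ use AY D := Nat.cast_nonneg _
    have p2 : (0 : ℝ) ≤ use AX D := Nat.cast_nonneg _
    have p3 : (0 : ℝ) ≤ use AZ D := Nat.cast_nonneg _
    have p4 : (1 : ℝ) ≤ 2 ^ m := one_le_pow₀ (by norm_num)
    rw [pow_succ] at a7
    nlinarith

end PathInParts

section GoodBoxes

variable {V : Type} [Fintype V] [DecidableEq V]

/-- The indicator function of the tuples spanning an edge. -/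
def edgeInd (E : Finset (Finset V)) {k : ℕ} (x : Fin k → V) : ℝ := if univ.image x ∈ E then 1 else 0

/-- A tuple of large colour classes between which the edges are dense and regular. -/
def GoodBox (E : Finset (Finset V)) {k T : ℕ} (ε : ℝ) (χ : V → Fin T) (I : Fin k → Fin T) : Prop :=
  (∀ i, ε * Fintype.card V / T ≤ (cell χ (I i)).card) ∧ ¬ Irregular (edgeInd E) ε χ I ∧
    2 * ε ≤ avg (edgeInd E) (cellBox χ I)

/-- The load of a tuple of colour classes on a given class. -/
noncomputable def load (ℓ : ℕ) {k T : ℕ} (I : Fin k → Fin T) (j : Fin T) : ℝ :=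
  ∑ i : Fin k, if I i = j then wt ℓ i else 0

theorem load_nonneg (ℓ : ℕ) {k T : ℕ} (I : Fin k → Fin T) (j : Fin T) : 0 ≤ load ℓ I j :=
  sum_nonneg fun i _ => by split_ifs <;> [exact (wt_pos _ _).le; exact le_rfl]

theorem GoodBox.dense {E : Finset (Finset V)} {k T T₀ : ℕ} {ε : ℝ} {χ : V → Fin T}
    {I : Fin k → Fin T} (h : GoodBox E ε χ I) (hε : 0 < ε) (hV : 0 < Fintype.card V) (hT : 0 < T)
    (hT₀ : T ≤ T₀) {A : Fin k → Finset V} (hA : ∀ i, A i ⊆ cell χ (I i))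
    (hA' : ∀ i, ε * (cell χ (I i)).card ≤ (A i).card) :
    ε * (ε * ε / T₀) ^ k ≤ pr (fun x : Fin k → V => univ.image x ∈ E ∧ ∀ i, x i ∈ A i) := by
  classical
  obtain ⟨h1, h2, h3⟩ := h
  have hn : (0 : ℝ) < Fintype.card V := by exact_mod_cast hV
  have hT' : (0 : ℝ) < T := by exact_mod_cast hT
  have hT₀' : (T : ℝ) ≤ T₀ := by exact_mod_cast hT₀
  have h4 : (avg (edgeInd E) (cellBox χ I) - ε) * (Fintype.piFinset A).card <
      ∑ x ∈ Fintype.piFinset A, edgeInd E x := by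
    by_contra! hc; exact h2 ⟨A, hA, hA', hc⟩
  have h5 : ε * ((Fintype.piFinset A).card : ℝ) ≤ ∑ x ∈ Fintype.piFinset A, edgeInd E x :=
    (mul_le_mul_of_nonneg_right (by linarith) (Nat.cast_nonneg _)).trans h4.le
  have h6 : pr (fun x : Fin k → V => univ.image x ∈ E ∧ ∀ i, x i ∈ A i) =
      (∑ x ∈ Fintype.piFinset A, edgeInd E x) / (Fintype.card V : ℝ) ^ k := by
    rw [pr, ex, Fintype.card_fun, Fintype.card_fin, Nat.cast_pow]
    congr 1
    have e1 : Fintype.piFinset A = univ.filter fun x : Fin k → V => ∀ i, x i ∈ A i := by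
      ext x; simp
    rw [e1, sum_filter]
    refine sum_congr rfl fun x _ => ?_
    unfold edgeInd
    by_cases a1 : univ.image x ∈ E <;> by_cases a2 : ∀ i, x i ∈ A i <;> simp [a1, a2]
  rw [h6, le_div_iff₀ (by positivity)]
  refine le_trans ?_ h5
  rw [mul_assoc]
  refine mul_le_mul_of_nonneg_left ?_ hε.le
  rw [Fintype.card_piFinset, Nat.cast_prod, ← mul_pow]
  calc _ = ∏ _i : Fin k, (ε * ε / T₀ * Fintype.card V) := by simp
    _ ≤ _ := prod_le_prod (fun i _ => by positivity) fun i _ => by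
      refine le_trans ?_ ((mul_le_mul_of_nonneg_left (h1 i) hε.le).trans (hA' i))
      rw [div_mul_eq_mul_div, mul_div_assoc', mul_assoc ε ε, ← mul_assoc]
      gcongr

/-- Disjoint paths inside good boxes can be found greedily. -/
theorem exists_disjoint_paths (ℓ p m T₀ : ℕ) {ε : ℝ} (hε : 0 < ε) (hT₀ : 0 < T₀) : ∃ n₀ : ℕ, ∀ (V : Type)
    [DecidableEq V] [Fintype V] (E : Finset (Finset V)) (T : ℕ) (χ : V → Fin T),
    n₀ ≤ Fintype.card V → 0 < T → T ≤ T₀ → ∀ (ι : Type) (_ : DecidableEq ι) (s : Finset ι)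
      (I : ι → Fin (ℓ + (ℓ + p)) → Fin T), (∀ a ∈ s, GoodBox E ε χ (I a)) →
      (∀ j, ∑ a ∈ s, 2 * (2 ^ m + 1) * load ℓ (I a) j ≤ (1 - ε) * (cell χ j).card) →
      ∃ L M L' : ι → Finset V, (∀ a ∈ s, PathOn E ℓ (L a) (M a) (L' a) ∧
        (L a ∪ M a ∪ L' a).card = 2 ^ (m + 1) * (ℓ + p) + ℓ) ∧
        (∀ a ∈ s, ∀ b ∈ s, a ≠ b → Disjoint (L a ∪ M a ∪ L' a) (L b ∪ M b ∪ L' b)) ∧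
        ∀ j, ((((s.biUnion fun a => L a ∪ M a ∪ L' a) ∩ cell χ j).card : ℕ) : ℝ) ≤
          ∑ a ∈ s, 2 * (2 ^ m + 1) * load ℓ (I a) j := by
  have hc : 0 < ε * (ε * ε / T₀) ^ (ℓ + (ℓ + p)) := by positivity
  obtain ⟨n₀, hn₀⟩ := exists_path_in_parts ℓ p m hc
  refine ⟨n₀ + 1, fun V _ _ E T χ hn hT hTT₀ ι _ s => ?_⟩
  have hV : 0 < Fintype.card V := by omega
  have hn' : (0 : ℝ) < Fintype.card V := by exact_mod_cast hV
  have hT' : (0 : ℝ) < T := by exact_mod_cast hT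
  induction s using Finset.induction_on with
  | empty => intro I _ _; exact ⟨fun _ => ∅, fun _ => ∅, fun _ => ∅, by simp, by simp, by simp⟩
  | insert b s hb ih =>
    intro I hI hl
    have hpos : ∀ a j, 0 ≤ 2 * (2 ^ m + 1) * load ℓ (I a) j := fun a j =>
      mul_nonneg (by positivity) (load_nonneg _ _ _)
    obtain ⟨L, M, L', h1, h2, h3⟩ := ih I (fun a ha => hI a (mem_insert_of_mem ha)) fun j =>
      (sum_le_sum_of_subset_of_nonneg (subset_insert _ _) fun a _ _ => hpos a j).trans (hl j)
    set U := s.biUnion fun a => L a ∪ M a ∪ L' a with hU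
    let A : Fin (ℓ + (ℓ + p)) → Finset V := fun i => cell χ (I b i) \ U
    have hA : ∀ i, ε * (cell χ (I b i)).card ≤ (A i).card := fun i => by
      have e1 := card_sdiff_add_card_inter (cell χ (I b i)) U
      rw [inter_comm] at e1
      have e2 : ((A i).card : ℝ) + ((U ∩ cell χ (I b i)).card : ℝ) = (cell χ (I b i)).card := by
        exact_mod_cast e1
      have e3 := h3 (I b i)
      have e4 := hl (I b i)
      rw [sum_insert hb] at e4
      have e5 := hpos b (I b i)
      linarith
    have hne : ∀ i, (A i).Nonempty := fun i => by
      rw [← card_pos, ← Nat.cast_pos (α := ℝ)]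
      refine lt_of_lt_of_le ?_ (hA i)
      have := (hI b (mem_insert_self _ _)).1 i
      have : 0 < ε * Fintype.card V / T := by positivity
      have : (0 : ℝ) < (cell χ (I b i)).card := by linarith
      positivity
    obtain ⟨P, Q, P', c1, c2, c3⟩ := hn₀ V E A (by omega)
      ((hI b (mem_insert_self _ _)).dense hε hV hT hTT₀ (fun i => sdiff_subset) hA)
    have hPU : Disjoint (P ∪ Q ∪ P') U := by
      have hd : ∀ i, Disjoint (A i) U := fun i => sdiff_disjoint
      have e1 := c3 U fun i => Or.inr (hd i)
      rw [sum_eq_zero, mul_zero] at e1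
      · have e2 : ((P ∪ Q ∪ P') ∩ U).card = 0 := by exact_mod_cast le_antisymm e1 (Nat.cast_nonneg _)
        rwa [card_eq_zero, ← disjoint_iff_inter_eq_empty] at e2
      · intro i _
        rw [if_neg]
        intro hs
        obtain ⟨v, hv⟩ := hne i
        exact disjoint_left.1 (hd i) hv (hs hv)
    have hPc : ∀ j, ((((P ∪ Q ∪ P') ∩ cell χ j).card : ℕ) : ℝ) ≤ 2 * (2 ^ m + 1) * load ℓ (I b) j := by
      intro j
      have e0 : ∀ i, ∀ v ∈ A i, χ v = I b i := fun i v hv => by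
        have := (mem_sdiff.1 hv).1; simpa [cell] using this
      refine (c3 (cell χ j) fun i => ?_).trans (le_of_eq ?_)
      · by_cases hij : I b i = j
        · exact Or.inl (hij ▸ sdiff_subset)
        · exact Or.inr (disjoint_left.2 fun v hv hv' => hij ((e0 i v hv).symm.trans (by
            simpa [cell] using hv')))
      · rw [load]
        congr 1
        refine sum_congr rfl fun i _ => if_congr ?_ rfl rfl
        constructor
        · intro hs
          obtain ⟨v, hv⟩ := hne i
          exact (e0 i v hv).symm.trans (by simpa [cell] using hs hv)
        · rintro rfl; exact sdiff_subset
    have hub : ∀ a ∈ s, L a ∪ M a ∪ L' a ⊆ U := fun a ha => subset_biUnion_of_mem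
      (fun a => L a ∪ M a ∪ L' a) ha
    have hnb : ∀ a ∈ s, a ≠ b := fun a ha hab => hb (hab ▸ ha)
    have hs' : ∀ a ∈ s, Function.update L b P a ∪ Function.update M b Q a ∪ Function.update L' b P' a =
        L a ∪ M a ∪ L' a := fun a ha => by simp [Function.update_of_ne (hnb a ha)]
    refine ⟨Function.update L b P, Function.update M b Q, Function.update L' b P', ?_, ?_, ?_⟩
    · rw [forall_mem_insert]
      refine ⟨by simp only [Function.update_self]; exact ⟨c1, c2⟩, fun a ha => ?_⟩
      simpa [Function.update_of_ne (hnb a ha)] using h1 a ha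
    · intro a ha a' ha' haa'
      rw [mem_insert] at ha ha'
      rcases ha with rfl | ha <;> rcases ha' with rfl | ha'
      · exact absurd rfl haa'
      · rw [hs' a' ha']; simpa using hPU.mono_right (hub a' ha')
      · rw [hs' a ha]; simpa using (hPU.mono_right (hub a ha)).symm
      · rw [hs' a ha, hs' a' ha']; exact h2 a ha a' ha' haa'
    · intro j
      rw [biUnion_insert, sum_insert hb, biUnion_congr rfl hs']
      simp only [Function.update_self]
      have e1 := card_union_inter_le (P ∪ Q ∪ P') U (cell χ j)
      have e2 : ((((P ∪ Q ∪ P' ∪ U) ∩ cell χ j).card : ℕ) : ℝ) ≤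
        (((P ∪ Q ∪ P') ∩ cell χ j).card : ℝ) + ((U ∩ cell χ j).card : ℝ) := by exact_mod_cast e1
      linarith [hPc j, h3 j]

end GoodBoxes

section Cover

theorem edgeInd_mem {V : Type} [DecidableEq V] (E : Finset (Finset V)) {k : ℕ} (x : Fin k → V) :
    0 ≤ edgeInd E x ∧ edgeInd E x ≤ 1 := by
  unfold edgeInd; split_ifs <;> norm_num

/-- Only few edges do not belong to a good box. -/
theorem pr_not_goodBox_le {V : Type} [Fintype V] [DecidableEq V] (E : Finset (Finset V)) {k T : ℕ}
    (χ : V → Fin T) {ε : ℝ} (hε : 0 < ε) (hT : 0 < T) (hV : 0 < Fintype.card V)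
    (hχ : pr (fun x : Fin k → V => Irregular (edgeInd E) ε χ (χ ∘ x)) ≤ ε) :
    pr (fun x : Fin k → V => univ.image x ∈ E ∧ ¬ GoodBox E ε χ (χ ∘ x)) ≤ (k + 3) * ε := by
  classical
  have hn : (0 : ℝ) < Fintype.card V := by exact_mod_cast hV
  have hne : Nonempty V := Fintype.card_pos_iff.1 hV
  have hT' : (0 : ℝ) < T := by exact_mod_cast hT
  have h1 : pr (fun x : Fin k → V => ∃ i ∈ (univ : Finset (Fin k)),
      ((cell χ (χ (x i))).card : ℝ) < ε * Fintype.card V / T) ≤ k * ε := by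
    refine (pr_exists_le univ fun (i : Fin k) (x : Fin k → V) =>
      ((cell χ (χ (x i))).card : ℝ) < ε * Fintype.card V / T).trans ?_
    have h2 : ∀ i : Fin k, pr (fun x : Fin k → V =>
        ((cell χ (χ (x i))).card : ℝ) < ε * Fintype.card V / T) ≤ ε := fun i => by
      rw [pr_eval i fun v : V => ((cell χ (χ v)).card : ℝ) < ε * Fintype.card V / T]
      rw [pr_eq, div_le_iff₀ hn]
      have e1 : (univ.filter fun v : V => ((cell χ (χ v)).card : ℝ) < ε * Fintype.card V / T) ⊆
          (univ.filter fun j : Fin T => ((cell χ j).card : ℝ) < ε * Fintype.card V / T).biUnion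
            (cell χ) := fun v hv => by
        rw [mem_filter] at hv
        exact mem_biUnion.2 ⟨χ v, mem_filter.2 ⟨mem_univ _, hv.2⟩, by simp [cell]⟩
      have e2 : ((univ.filter fun v : V => ((cell χ (χ v)).card : ℝ) <
          ε * Fintype.card V / T).card : ℝ) ≤ ∑ j ∈ univ.filter fun j : Fin T =>
            ((cell χ j).card : ℝ) < ε * Fintype.card V / T, ((cell χ j).card : ℝ) := by
        exact_mod_cast (card_le_card e1).trans card_biUnion_le
      refine e2.trans ((sum_le_sum fun j hj => (mem_filter.1 hj).2.le).trans ?_)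
      rw [sum_const, nsmul_eq_mul]
      have e3 : (((univ.filter fun j : Fin T => ((cell χ j).card : ℝ) <
          ε * Fintype.card V / T).card : ℕ) : ℝ) ≤ T := by
        exact_mod_cast (card_le_univ _).trans (by simp)
      calc _ ≤ (T : ℝ) * (ε * Fintype.card V / T) := mul_le_mul_of_nonneg_right e3 (by positivity)
        _ = _ := by field_simp
    refine (sum_le_sum fun i _ => h2 i).trans ?_
    simp
  have h2 : pr (fun x : Fin k → V => univ.image x ∈ E ∧
      avg (edgeInd E) (cellBox χ (χ ∘ x)) < 2 * ε) ≤ 2 * ε := by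
    rw [pr, ex, div_le_iff₀ (by exact_mod_cast Fintype.card_pos), sum_eq_sum_cellBox χ]
    have e1 : (Fintype.card (Fin k → V) : ℝ) = ∑ I : Fin k → Fin T, ((cellBox χ I).card : ℝ) := by
      have := sum_eq_sum_cellBox (k := k) χ fun _ => (1 : ℝ)
      simpa using this
    rw [e1, mul_sum]
    refine sum_le_sum fun I _ => ?_
    by_cases hI : avg (edgeInd E) (cellBox χ I) < 2 * ε
    · refine le_trans (le_of_eq ?_)
        (mul_le_mul_of_nonneg_right hI.le (Nat.cast_nonneg (cellBox χ I).card))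
      rw [avg_mul_card]
      refine sum_congr rfl fun x hx => ?_
      rw [mem_cellBox.1 hx]
      simp [edgeInd, hI]
    · rw [sum_eq_zero]
      · positivity
      · intro x hx
        rw [mem_cellBox.1 hx, if_neg fun h => hI h.2]
  have h3 : pr (fun x : Fin k → V => univ.image x ∈ E ∧ ¬ GoodBox E ε χ (χ ∘ x)) ≤
      pr (fun x : Fin k → V => (∃ i ∈ (univ : Finset (Fin k)),
        ((cell χ (χ (x i))).card : ℝ) < ε * Fintype.card V / T) ∨
        (Irregular (edgeInd E) ε χ (χ ∘ x) ∨ (univ.image x ∈ E ∧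
          avg (edgeInd E) (cellBox χ (χ ∘ x)) < 2 * ε))) := pr_mono fun x hx => by
    by_contra! hc
    obtain ⟨c1, c2, c3⟩ := hc
    exact hx.2 ⟨fun i => c1 i (mem_univ i), c2, c3 hx.1⟩
  have h4 := h3.trans (pr_or_le _ _)
  have h5 := pr_or_le (fun x : Fin k → V => Irregular (edgeInd E) ε χ (χ ∘ x)) fun x =>
    univ.image x ∈ E ∧ avg (edgeInd E) (cellBox χ (χ ∘ x)) < 2 * ε
  linarith

theorem sum_mul_load (ℓ : ℕ) {k T : ℕ} (I : Fin k → Fin T) (y : Fin T → ℝ) :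
    ∑ j, y j * load ℓ I j = ∑ i : Fin k, wt ℓ i * y (I i) := by
  simp only [load, mul_sum]
  rw [sum_comm]
  refine sum_congr rfl fun i _ => ?_
  rw [sum_eq_single (I i)]
  · rw [if_pos rfl, mul_comm]
  · grind
  · simp

/-- In the non-extremal case there is a fractional packing of good boxes. -/
theorem exists_weight {k ℓ : ℕ} (hk4 : 4 ≤ k) (hℓ : 1 ≤ ℓ) (hk : 2 * ℓ < k) {ξ : ℝ} (hξ : 0 < ξ)
    (hξ' : ξ ≤ 1 / 2) : ∃ γ > 0, ∀ β > 0, β < 1 → ∃ ε₀ > 0, ∀ ε > 0, ε ≤ ε₀ → ∃ (T₀ n₀ : ℕ), 0 < T₀ ∧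
      ∀ (V : Type) [Fintype V] [DecidableEq V] (E : Finset (Finset V)) (a : ℝ), n₀ ≤ Fintype.card V →
      a = 1 / (2 * (k - ℓ)) → PairDeg E k (2 * a - a ^ 2 - γ) → Spread E k a ξ →
      ∃ T, T ≤ T₀ ∧ 0 < T ∧ ∃ (χ : V → Fin T) (w : (Fin k → Fin T) → ℝ), (∀ I, 0 ≤ w I) ∧
        (∀ I, ¬ GoodBox E ε χ I → w I = 0) ∧ (k - ℓ) * ∑ I, w I = 1 - β ∧
        ∀ j, ∑ I, w I * load ℓ I j ≤ (cell χ j).card / Fintype.card V := by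
  classical
  obtain ⟨γ, hγ, h⟩ := no_dual hk4 hℓ hk hξ hξ'
  refine ⟨γ, hγ, fun β hβ hβ1 => ?_⟩
  obtain ⟨ε₁, hε₁, n₁, hn₁⟩ := h β hβ hβ1
  refine ⟨ε₁ / (k + 3), by positivity, fun ε hε hεε => ?_⟩
  obtain ⟨T₀, hT₀⟩ := exists_regular_colouring k hε
  refine ⟨max T₀ 1, max n₁ 1, by simp, fun V _ _ E a hn ha hE hS => ?_⟩
  simp only [max_le_iff] at hn
  obtain ⟨T, hT, hTpos, χ, hχ⟩ := hT₀ V (edgeInd E) fun x => edgeInd_mem E x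
  refine ⟨T, hT.trans (le_max_left _ _), hTpos, χ, ?_⟩
  have hn0 : (0 : ℝ) < Fintype.card V := by exact_mod_cast hn.2
  have hbad := pr_not_goodBox_le E χ hε hTpos hn.2 hχ
  have hbad' : (k + 3) * ε ≤ ε₁ := by
    rwa [le_div_iff₀ (by positivity), mul_comm] at hεε
  have hkl : (0 : ℝ) < k - ℓ := by
    have : ((2 * ℓ : ℕ) : ℝ) < k := by exact_mod_cast hk
    grind
  have hs : 0 < (1 - β) / (k - ℓ) := div_pos (by linarith) hkl
  rcases farkas (τ := {I : Fin k → Fin T // GoodBox E ε χ I}) (fun I j => load ℓ I.1 j)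
    (fun j => (cell χ j).card / (Fintype.card V : ℝ)) (fun j => by positivity) hs with
    ⟨w, hw0, hws, hw⟩ | ⟨y, r, hy0, hr, hyr, hy⟩
  · refine ⟨fun I => if hI : GoodBox E ε χ I then w ⟨I, hI⟩ else 0, fun I => ?_, fun I hI => ?_, ?_,
      fun j => ?_⟩
    · dsimp only; split_ifs with h1
      · exact hw0 _
      · exact le_rfl
    · exact dif_neg hI
    · have e1 : ∑ I, (if hI : GoodBox E ε χ I then w ⟨I, hI⟩ else 0) = ∑ I, w I := by
        rw [← Fintype.sum_subtype_add_sum_subtype (fun I => GoodBox E ε χ I)]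
        rw [sum_congr rfl fun (I : {I // GoodBox E ε χ I}) _ => dif_pos I.2,
          sum_congr rfl fun (I : {I // ¬ GoodBox E ε χ I}) _ => dif_neg I.2]
        simp
      rw [e1, hws]
      field_simp
    · refine le_trans (le_of_eq ?_) (hw j)
      rw [← Fintype.sum_subtype_add_sum_subtype (fun I => GoodBox E ε χ I)]
      rw [sum_congr rfl fun (I : {I // GoodBox E ε χ I}) _ => show _ = w I * load ℓ I.1 j by
          grind,
        sum_congr rfl fun (I : {I // ¬ GoodBox E ε χ I}) _ => show _ = (0 : ℝ) by
          simp only [dif_neg I.2, zero_mul]]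
      simp
  · exfalso
    have hc : 0 < (1 - β) / r := div_pos (by linarith) hr
    have h1 := hn₁ V E a hn.1 ha hE hS (fun v => (1 - β) / r * y (χ v))
      (fun v => mul_nonneg hc.le (hy0 _)) (by
        rw [ex_mul_left]
        have e1 : ex (fun v => y (χ v)) = ∑ j, y j * ((cell χ j).card / (Fintype.card V : ℝ)) := by
          rw [ex, ← sum_fiberwise univ χ, sum_div]
          refine sum_congr rfl fun j _ => ?_
          rw [mul_div_assoc', sum_congr rfl fun v hv => by rw [(mem_filter.1 hv).2], sum_const,
            nsmul_eq_mul, mul_comm]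
          rfl
        rw [e1]
        calc _ ≤ (1 - β) / r * r := mul_le_mul_of_nonneg_left hyr hc.le
          _ = _ := by field_simp)
    refine absurd (h1.trans_le (pr_mono fun x hx => ⟨hx.1, fun hg => ?_⟩)) (not_lt.2
      (hbad.trans hbad'))
    have h2 := hy ⟨χ ∘ x, hg⟩
    rw [sum_mul_load] at h2
    have h3 := hx.2
    refine absurd h3 (not_lt.2 ?_)
    have h4 : ∑ i : Fin k, wt ℓ i * ((1 - β) / r * y (χ (x i))) =
        (1 - β) / r * ∑ i : Fin k, wt ℓ i * y ((χ ∘ x) i) := by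
      rw [mul_sum]; exact sum_congr rfl fun i _ => by rw [Function.comp]; ring
    rw [h4]
    rw [div_mul_eq_mul_div, le_div_iff₀ hkl] at h2
    rw [div_mul_eq_mul_div, le_div_iff₀ hr]
    linarith

set_option maxHeartbeats 1000000 in
/-- In the non-extremal case almost all vertices can be covered by few disjoint paths. -/
theorem exists_path_cover {k ℓ : ℕ} (hk4 : 4 ≤ k) (hℓ : 1 ≤ ℓ) (hk : 2 * ℓ < k) {ξ : ℝ} (hξ : 0 < ξ)
    (hξ' : ξ ≤ 1 / 2) : ∃ γ > 0, ∀ β > 0, ∃ n₀ : ℕ, ∀ (V : Type) [Fintype V] [DecidableEq V]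
      (E : Finset (Finset V)) (a : ℝ), n₀ ≤ Fintype.card V → a = 1 / (2 * (k - ℓ)) →
      PairDeg E k (2 * a - a ^ 2 - γ) → Spread E k a ξ →
      ∃ (b : ℕ) (L M L' : Fin b → Finset V), (b : ℝ) ≤ β * Fintype.card V ∧
        (∀ i, PathOn E ℓ (L i) (M i) (L' i) ∧
          ∃ m, (L i ∪ M i ∪ L' i).card = 2 * (k - ℓ) * m + ℓ) ∧
        (∀ i j, i ≠ j → Disjoint (L i ∪ M i ∪ L' i) (L j ∪ M j ∪ L' j)) ∧
        ((univ \ univ.biUnion fun i => L i ∪ M i ∪ L' i).card : ℝ) ≤ β * Fintype.card V := by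
  classical
  obtain ⟨γ, hγ, h⟩ := exists_weight hk4 hℓ hk hξ hξ'
  refine ⟨γ, hγ, fun β hβ => ?_⟩
  set θ := min (β / 4) (1 / 2) with hθ
  have hθ0 : 0 < θ := lt_min (by positivity) (by norm_num)
  have hθβ : θ ≤ β / 4 := min_le_left _ _
  have hθ2 : θ ≤ 1 / 2 := min_le_right _ _
  obtain ⟨ε₀, hε₀, h1⟩ := h θ hθ0 (by linarith)
  set ε := min ε₀ (θ / 4) with hε
  have hε0 : 0 < ε := lt_min hε₀ (by positivity)
  have hεθ : ε ≤ θ / 4 := min_le_right _ _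
  obtain ⟨T₀, n₁, hT₀, h2⟩ := h1 ε hε0 (min_le_left _ _)
  obtain ⟨m, hm⟩ := pow_unbounded_of_one_lt (4 / θ) one_lt_two
  obtain ⟨p, rfl⟩ : ∃ p, k = ℓ + (ℓ + p) := ⟨k - 2 * ℓ, by omega⟩
  obtain ⟨n₂, h3⟩ := exists_disjoint_paths ℓ p m T₀ hε0 hT₀
  set t : ℝ := ((ℓ + p : ℕ) : ℝ) with ht
  have htk : ((ℓ + (ℓ + p) : ℕ) : ℝ) - ℓ = t := by rw [ht]; push_cast; ring
  have ht1 : 1 ≤ t := by rw [ht]; exact_mod_cast (by omega : 1 ≤ ℓ + p)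
  set q : ℝ := 2 ^ m with hq
  have hq0 : 0 < q := by positivity
  have hqθ : 4 ≤ q * θ := by rw [div_lt_iff₀ hθ0] at hm; exact hm.le
  obtain ⟨n₃, hn₃⟩ := exists_forall_div_le ((T₀ : ℝ) ^ (ℓ + (ℓ + p)) * (2 * q * t)) hθ0
  refine ⟨max n₁ (max n₂ (max n₃ 1)), fun V _ _ E a hn ha hE hS => ?_⟩
  simp only [max_le_iff] at hn
  obtain ⟨hn1, hn2, hn3, hn4⟩ := hn
  obtain ⟨T, hTT, hT, χ, w, hw0, hwg, hws, hwl⟩ := h2 V E a hn1 ha hE hS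
  rw [htk] at hws
  set n : ℝ := (Fintype.card V : ℝ) with hn
  have hn0 : 0 < n := by rw [hn]; exact_mod_cast hn4
  set N : (Fin (ℓ + (ℓ + p)) → Fin T) → ℕ := fun I => ⌊w I * n * (1 - θ) / (2 * q)⌋₊ with hN
  have hNle : ∀ I, (N I : ℝ) ≤ w I * n * (1 - θ) / (2 * q) := fun I => Nat.floor_le (by
    have := hw0 I; have : 0 ≤ 1 - θ := by linarith
    positivity)
  have hNge : ∀ I, w I * n * (1 - θ) / (2 * q) - 1 ≤ N I := fun I => by
    have := Nat.lt_floor_add_one (w I * n * (1 - θ) / (2 * q))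
    simp only [hN]; linarith
  have hNg : ∀ I, N I ≠ 0 → GoodBox E ε χ I := fun I hI => by
    by_contra hc
    exact hI (by simp [hN, hwg I hc])
  let ι := Σ I : Fin (ℓ + (ℓ + p)) → Fin T, Fin (N I)
  have hsum : ∀ f : (Fin (ℓ + (ℓ + p)) → Fin T) → ℝ,
      ∑ x : ι, f x.1 = ∑ I, N I * f I := fun f => by
    rw [Fintype.sum_sigma]; simp
  obtain ⟨L, M, L', c1, c2, -⟩ := h3 V E T χ hn2 hT hTT ι inferInstance univ (fun x => x.1)
    (fun x _ => hNg _ (by have := x.2.pos; omega)) fun j => by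
      rw [hsum fun I => 2 * (2 ^ m + 1) * load ℓ I j]
      have e1 : ∑ I, N I * (2 * (2 ^ m + 1) * load ℓ I j) ≤
          ∑ I, n * (1 - θ) * ((q + 1) / q) * (w I * load ℓ I j) := by
        refine sum_le_sum fun I _ => ?_
        refine (mul_le_mul_of_nonneg_right (hNle I)
          (mul_nonneg (by positivity) (load_nonneg _ _ _))).trans (le_of_eq ?_)
        rw [← hq]; field_simp
      refine e1.trans ?_
      rw [← mul_sum]
      have e2 : 0 ≤ n * (1 - θ) * ((q + 1) / q) := by
        have : 0 ≤ 1 - θ := by linarith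
        positivity
      refine (mul_le_mul_of_nonneg_left (hwl j) e2).trans ?_
      have e3 : n * (1 - θ) * ((q + 1) / q) * ((cell χ j).card / (Fintype.card V : ℝ)) =
          (1 - θ) * ((q + 1) / q) * (cell χ j).card := by
        rw [← hn]; field_simp
      rw [e3]
      refine mul_le_mul_of_nonneg_right ?_ (Nat.cast_nonneg _)
      rw [mul_div_assoc', div_le_iff₀ hq0]
      nlinarith
  have hcard : (Fintype.card ι : ℝ) = ∑ I, (N I : ℝ) := by
    rw [Fintype.card_sigma]; simp
  have hws' : ∑ I, w I * n * (1 - θ) / (2 * q) = (1 - θ) * n * (1 - θ) / (2 * q * t) := by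
    rw [← sum_div, ← sum_mul, ← sum_mul, ← hws]
    field_simp
  have hcu : (Fintype.card ι : ℝ) ≤ (1 - θ) * n * (1 - θ) / (2 * q * t) := by
    rw [hcard, ← hws']; exact sum_le_sum fun I _ => hNle I
  have hcl : (1 - θ) * n * (1 - θ) / (2 * q * t) - (T₀ : ℝ) ^ (ℓ + (ℓ + p)) ≤ Fintype.card ι := by
    rw [hcard, ← hws']
    have e1 : ∑ I, (w I * n * (1 - θ) / (2 * q) - 1) ≤ ∑ I, (N I : ℝ) := sum_le_sum fun I _ => hNge I
    rw [sum_sub_distrib, sum_const, nsmul_one, card_univ, Fintype.card_fun, Fintype.card_fin,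
      Fintype.card_fin] at e1
    have e2 : ((T ^ (ℓ + (ℓ + p)) : ℕ) : ℝ) ≤ (T₀ : ℝ) ^ (ℓ + (ℓ + p)) := by
      exact_mod_cast Nat.pow_le_pow_left hTT _
    linarith
  let e := (Fintype.equivFin ι).symm
  refine ⟨Fintype.card ι, fun i => L (e i), fun i => M (e i), fun i => L' (e i), ?_, fun i => ?_,
    fun i j hij => ?_, ?_⟩
  · refine hcu.trans ?_
    rw [div_le_iff₀ (by positivity)]
    have e1 : (1 - θ) * n * (1 - θ) ≤ n := by nlinarith [mul_pos hθ0 hn0]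
    have e2 : 1 ≤ β * q := by nlinarith [mul_le_mul_of_nonneg_right hθβ hq0.le]
    have e3 : 1 ≤ β * q * t := one_le_mul_of_one_le_of_one_le e2 ht1
    nlinarith
  · refine ⟨(c1 _ (mem_univ _)).1, 2 ^ m, ?_⟩
    rw [(c1 _ (mem_univ _)).2, show ℓ + (ℓ + p) - ℓ = ℓ + p by omega]; ring
  · exact c2 _ (mem_univ _) _ (mem_univ _) fun h => hij (e.injective h)
  · have e1 : (univ.biUnion fun i => L (e i) ∪ M (e i) ∪ L' (e i)).card =
        Fintype.card ι * (2 ^ (m + 1) * (ℓ + p) + ℓ) := by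
      rw [card_biUnion fun i _ j _ hij => c2 _ (mem_univ _) _ (mem_univ _) fun h =>
        hij (e.injective h), sum_congr rfl fun i _ => (c1 _ (mem_univ _)).2, sum_const, card_univ,
        Fintype.card_fin, smul_eq_mul]
    have e2 : ((univ \ univ.biUnion fun i => L (e i) ∪ M (e i) ∪ L' (e i)).card : ℝ) =
        n - Fintype.card ι * (2 * q * t + ℓ) := by
      rw [← compl_eq_univ_sdiff, card_compl, Nat.cast_sub (card_le_univ _), e1]
      grind
    rw [e2]
    have e3 := hn₃ _ hn3
    rw [← hn, div_le_iff₀ hn0] at e3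
    have e4 : 0 < 2 * q * t := by positivity
    have e5 : (1 - θ) * n * (1 - θ) - (T₀ : ℝ) ^ (ℓ + (ℓ + p)) * (2 * q * t) ≤
        Fintype.card ι * (2 * q * t) := by
      calc _ = ((1 - θ) * n * (1 - θ) / (2 * q * t) - (T₀ : ℝ) ^ (ℓ + (ℓ + p))) * (2 * q * t) := by
            field_simp
        _ ≤ _ := mul_le_mul_of_nonneg_right hcl e4.le
    have e6 : (0 : ℝ) ≤ Fintype.card ι * ℓ := by positivity
    have e7 : (1 - 2 * θ) * n ≤ (1 - θ) * n * (1 - θ) := by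
      nlinarith [mul_pos (mul_pos hθ0 hθ0) hn0]
    nlinarith

end Cover

section NonExtremal

theorem pr_range_le {Ω Ω' : Type} [Fintype Ω] [Fintype Ω'] {g : Ω' → Ω} (hg : Function.Injective g)
    (Q : Ω → Prop) : pr (fun ω => Q ω ∧ ω ∈ Set.range g) ≤ pr fun ω' => Q (g ω') := by
  classical
  rcases isEmpty_or_nonempty Ω' with h | h
  · have : pr (fun ω => Q ω ∧ ω ∈ Set.range g) = 0 := pr_false fun ω hω => by
      obtain ⟨x, -⟩ := hω.2; exact h.elim x
    rw [this]; exact pr_nonneg _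
  have h3 := Fintype.card_le_of_injective g hg
  have h4 : 0 < Fintype.card Ω' := Fintype.card_pos
  rw [pr_eq, pr_eq]
  refine le_of_eq_of_le (b := ((univ.filter fun ω' => Q (g ω')).card : ℝ) / Fintype.card Ω) ?_
    (by gcongr)
  rw [← card_image_of_injective _ hg]
  congr 3
  ext ω
  simp only [mem_filter, mem_univ, true_and, mem_image, Set.mem_range]
  grind

/-- The non-extremal case. -/
theorem hamC_of_spread {k ℓ : ℕ} (hk4 : 4 ≤ k) (hℓ : 1 ≤ ℓ) (hk : 2 * ℓ < k) {η ξ : ℝ} (hη0 : 0 < η)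
    (hη : η ≤ 1) (hξ : 0 < ξ) (hξ' : ξ ≤ 1 / 2) : ∃ γ > 0, ∃ n₀ : ℕ, ∀ (V : Type) [DecidableEq V]
      [Fintype V] (E : Finset (Finset V)) (a : ℝ), n₀ ≤ Fintype.card V → (k - ℓ) ∣ Fintype.card V →
      (∀ e ∈ E, e.card = k) → LowDeg E k η → a = 1 / (2 * (k - ℓ)) →
      PairDeg E k (2 * a - a ^ 2 - γ) → Spread E k a ξ → HamC E ℓ := by
  classical
  obtain ⟨γ, hγ, h1⟩ := exists_path_cover hk4 hℓ hk (half_pos hξ) (by linarith)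
  set γ₀ := min (γ / 4) (min (ξ / 2) (1 / 2)) with hγ₀
  have hγ₀0 : 0 < γ₀ := lt_min (by positivity) (lt_min (by positivity) (by norm_num))
  have hγ₁ : γ₀ ≤ γ / 4 := min_le_left _ _
  have hγ₂ : γ₀ ≤ ξ / 2 := (min_le_right _ _).trans (min_le_left _ _)
  have hγ₃ : γ₀ ≤ 1 / 2 := (min_le_right _ _).trans (min_le_right _ _)
  obtain ⟨β, hβ, n₁, h2⟩ := hamC_of_cover hk4 hℓ hk hη0 hη hγ₀0
  obtain ⟨n₂, h3⟩ := h1 β hβ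
  refine ⟨γ / 2, by positivity, max n₁ (max (2 * n₂) 1), fun V _ _ E a hn hdvd hE hL ha hP hS => ?_⟩
  simp only [max_le_iff] at hn
  have ha1 : a ≤ 1 / 4 := by
    rw [ha]
    have : ((2 * ℓ + 1 : ℕ) : ℝ) ≤ k := by exact_mod_cast hk
    push_cast at this
    have : (1 : ℝ) ≤ ℓ := by exact_mod_cast hℓ
    rw [div_le_div_iff₀ (by linarith) (by norm_num)]
    linarith
  refine h2 V E hn.1 hdvd hE hL fun Z hZ => ?_
  set n : ℝ := (Fintype.card V : ℝ) with hnn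
  have hn0 : 0 < n := by rw [hnn]; exact_mod_cast hn.2.2
  let W := {v // v ∉ Z}
  let f : W ↪ V := Function.Embedding.subtype _
  have hf : ∀ w, f w ∉ Z := fun w => w.2
  have hrange : ∀ v, v ∉ Z → ∃ w, f w = v := fun v hv => ⟨⟨v, hv⟩, rfl⟩
  have hW : (Fintype.card W : ℝ) = n - Z.card := by
    have : Fintype.card W = Fintype.card V - Z.card := by
      rw [Fintype.card_subtype_compl]; simp
    rw [this, Nat.cast_sub (card_le_univ _)]
  let E' : Finset (Finset W) := univ.filter fun e => e.map f ∈ E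
  have hE' : ∀ e, e ∈ E' ↔ e.map f ∈ E := fun e => by simp [E']
  obtain ⟨b, L, M, L', c1, c2, c3, c4⟩ := h3 W E' a (by
    have : (n₂ : ℝ) ≤ Fintype.card W := by
      have : ((2 * n₂ : ℕ) : ℝ) ≤ n := by rw [hnn]; exact_mod_cast hn.2.1
      push_cast at this
      nlinarith
    exact_mod_cast this) ha (by
    intro S hS2
    let g : W × W → V × V := fun x => (f x.1, f x.2)
    have hg : Function.Injective g := fun x y hxy => by
      simp only [g, Prod.mk.injEq, EmbeddingLike.apply_eq_iff_eq] at hxy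
      exact Prod.ext hxy.1 hxy.2
    have e1 := hP (S.map f) (by rwa [card_map])
    have e2 := pr_range_le hg fun x => S.map f ∪ {x.1, x.2} ∈ E
    have e3 := pr_sub_le (fun x : V × V => S.map f ∪ {x.1, x.2} ∈ E)
      fun x => ¬ Disjoint (im V x) Z
    have e4 := pr_hit_le (V := V) (Ω := V × V) Z
    have e5 : pr (fun x : V × V => S.map f ∪ {x.1, x.2} ∈ E ∧ ¬ ¬ Disjoint (im V x) Z) ≤
        pr fun x : V × V => S.map f ∪ {x.1, x.2} ∈ E ∧ x ∈ Set.range g :=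
      pr_mono fun x hx => ⟨hx.1, by
        have h6 := not_not.1 hx.2
        rw [im_prod, im_vertex, im_vertex, disjoint_union_left, disjoint_singleton_left,
          disjoint_singleton_left] at h6
        obtain ⟨w, hw⟩ := hrange _ h6.1
        obtain ⟨w', hw'⟩ := hrange _ h6.2
        exact ⟨(w, w'), by simp only [g, hw, hw']⟩⟩
    have e6 : pr (fun x : W × W => S.map f ∪ {(g x).1, (g x).2} ∈ E) =
        pr fun x : W × W => S ∪ {x.1, x.2} ∈ E' := pr_congr fun x => by
      rw [hE', map_union, map_insert, map_singleton]
    have e7 : (Blk.sz V (V × V) : ℝ) * (Z.card / Fintype.card V) ≤ 2 * γ₀ := by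
      have : Blk.sz V (V × V) = 2 := rfl
      rw [this, ← hnn, mul_div_assoc', div_le_iff₀ hn0]; push_cast; linarith
    linarith) (by
    intro B hB
    have e1 : (1 - a - ξ) * n ≤ (B.map f).card := by
      rw [card_map]
      refine le_trans ?_ hB
      rw [hW]
      have : 0 ≤ a := by
        rw [ha]
        have : ((2 * ℓ + 1 : ℕ) : ℝ) ≤ k := by exact_mod_cast hk
        push_cast at this
        have : (0 : ℝ) ≤ ℓ := Nat.cast_nonneg _
        exact div_nonneg zero_le_one (by linarith)
      have : 0 ≤ 1 - a - ξ / 2 := by linarith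
      nlinarith [mul_nonneg this (sub_nonneg.2 hZ)]
    have e2 := hS (B.map f) e1
    let g : (Fin k → W) → (Fin k → V) := fun x i => f (x i)
    have hg : Function.Injective g := fun x y hxy => funext fun i => f.injective (congrFun hxy i)
    have e3 := pr_range_le hg fun x => univ.image x ⊆ B.map f ∧ univ.image x ∈ E
    have e4 : pr (fun x : Fin k → V => univ.image x ⊆ B.map f ∧ univ.image x ∈ E) ≤
        pr fun x : Fin k → V => (univ.image x ⊆ B.map f ∧ univ.image x ∈ E) ∧ x ∈ Set.range g :=
      pr_mono fun x hx => ⟨hx, by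
        have : ∀ i, ∃ w, f w = x i := fun i => by
          have := hx.1 (mem_image_of_mem x (mem_univ i))
          obtain ⟨w, -, hw⟩ := mem_map.1 this
          exact ⟨w, hw⟩
        choose w hw using this
        exact ⟨w, funext hw⟩⟩
    have e5 : pr (fun x : Fin k → W => univ.image (g x) ⊆ B.map f ∧ univ.image (g x) ∈ E) =
        pr fun x : Fin k → W => univ.image x ⊆ B ∧ univ.image x ∈ E' := pr_congr fun x => by
      have : univ.image (g x) = (univ.image x).map f := by
        rw [map_eq_image, image_image]; rfl
      rw [hE', this, map_subset_map]
    linarith)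
  have hmap : ∀ i, (L i).map f ∪ (M i).map f ∪ (L' i).map f = (L i ∪ M i ∪ L' i).map f := fun i => by
    rw [map_union, map_union]
  have hWn : (Fintype.card W : ℝ) ≤ n := by rw [hW]; linarith [Nat.cast_nonneg (α := ℝ) Z.card]
  refine ⟨b, fun i => (L i).map f, fun i => (M i).map f, fun i => (L' i).map f,
    c1.trans (by gcongr), fun i => ⟨(c2 i).1.map f fun e he => (hE' e).1 he, ?_, ?_⟩,
    fun i j hij => ?_, ?_⟩
  · obtain ⟨m, hm⟩ := (c2 i).2
    exact ⟨m, by rw [hmap, card_map, hm]⟩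
  · rw [hmap, disjoint_left]
    intro v hv hvZ
    obtain ⟨w, -, rfl⟩ := mem_map.1 hv
    exact hf w hvZ
  · simp only [hmap]
    exact (disjoint_map f).2 (c3 i j hij)
  · have e1 : (univ \ (Z ∪ univ.biUnion fun i => (L i).map f ∪ (M i).map f ∪ (L' i).map f)) =
        (univ \ univ.biUnion fun i => L i ∪ M i ∪ L' i).map f := by
      ext v
      simp only [hmap, mem_sdiff, mem_univ, true_and, mem_union, mem_biUnion, not_or, not_exists,
        mem_map]
      constructor
      · rintro ⟨h4, h5⟩
        obtain ⟨w, rfl⟩ := hrange v h4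
        exact ⟨w, fun i => by have := h5 i w; grind, rfl⟩
      · rintro ⟨w, h4, rfl⟩
        refine ⟨hf w, fun i => ?_⟩
        rintro w' ⟨h5, h6⟩
        rw [f.injective h6] at h5
        have := h4 i; grind
    rw [e1, card_map]
    exact c4.trans (by gcongr)

end NonExtremal

section Combinatorial

variable {V : Type} [DecidableEq V] {E : Finset (Finset V)} {k ℓ : ℕ} {L M L' X S : Finset V}

theorem pathOn_two (hk : 2 * ℓ < k) (hℓ : 1 ≤ ℓ) (hL : L.card = ℓ) (hL' : L'.card = ℓ)
    (hLM : Disjoint L M) (hLL : Disjoint L L') (hML : Disjoint M L')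
    (hM : M.card + ℓ = 2 * (k - ℓ)) (hX : (M ∩ X).card = 1)
    (hE : ∀ T ⊆ M, T.card = k - ℓ → (T ∩ X).card = 1 → L ∪ T ∈ E ∧ L' ∪ T ∈ E) :
    PathOn E ℓ L M L' := by
  obtain ⟨x, hx⟩ := card_eq_one.1 hX
  have hxM : x ∈ M := (mem_inter.1 (hx ▸ mem_singleton_self x : x ∈ M ∩ X)).1
  obtain ⟨N, hxN, hNM, hN⟩ := exists_subsuperset_card_eq (singleton_subset_iff.2 hxM)
    (by simpa using hℓ) (by omega : ℓ ≤ M.card)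
  rw [singleton_subset_iff] at hxN
  have hc := card_sdiff_of_subset hNM
  obtain ⟨I, hIM, hI⟩ := exists_subset_card_eq (s := M \ N) (n := k - 2 * ℓ) (by omega)
  have hc' := card_sdiff_of_subset hIM
  have hIN : Disjoint I N := disjoint_of_subset_left hIM sdiff_disjoint
  have key : ∀ T ⊆ M, x ∈ T → (T ∩ X).card = 1 := fun T hT hxT => by
    rw [card_eq_one]
    refine ⟨x, ?_⟩
    rw [← inter_eq_left.2 hT, inter_assoc, hx]
    exact inter_singleton_of_mem hxT
  have hI' : Disjoint N ((M \ N) \ I) := by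
    rw [disjoint_left]; intro a ha; simp [ha]
  have s1 : I ∪ N ⊆ M := union_subset (hIM.trans sdiff_subset) hNM
  have s2 : N ∪ (M \ N) \ I ⊆ M := union_subset hNM (sdiff_subset.trans sdiff_subset)
  have e1 := (hE _ s1 (by rw [card_union_of_disjoint hIN]; omega)
    (key _ s1 (mem_union_right _ hxN))).1
  have e2 := (hE _ s2 (by rw [card_union_of_disjoint hI']; omega)
    (key _ s2 (mem_union_left _ hxN))).2
  have p1 : PathOn E ℓ L I N := .edge hL hN (hLM.mono_right (hIM.trans sdiff_subset))
    (hLM.mono_right hNM) hIN (by rwa [union_assoc])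
  have p2 : PathOn E ℓ N ((M \ N) \ I) L' := .edge hN hL' hI' (hML.mono_left hNM)
    (hML.mono_left (sdiff_subset.trans sdiff_subset)) (by rwa [union_comm])
  have := p1.cat p2 (by
    simp only [disjoint_union_left, disjoint_union_right]
    exact ⟨⟨hLM.mono_right (sdiff_subset.trans sdiff_subset), disjoint_sdiff⟩, hLL,
      hML.mono_left (hIM.trans sdiff_subset)⟩)
  convert this using 1
  ext y
  grind

theorem exists_starter (h : (M ∩ X).Nonempty) : ∃ x, ∃ F ⊆ M, F.card ≤ 2 ∧ F ∩ X = {x} ∧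
    ((∃ s, F ∩ S = {s}) ∨ M ∩ S = ∅) := by
  obtain ⟨x, hx, hxS⟩ : ∃ x ∈ M ∩ X, x ∈ S ∨ M ∩ X ∩ S = ∅ := by
    grind
  rw [mem_inter] at hx
  rcases (M ∩ S).eq_empty_or_nonempty with h | ⟨s, hs⟩
  · exact ⟨x, {x}, by simp [hx], by simp, by simp [hx], .inr h⟩
  · rcases hxS with h | h
    · exact ⟨x, {x}, by simp [hx], by simp, by simp [hx], .inl ⟨x, by simp [h]⟩⟩
    · rw [mem_inter] at hs
      have h1 : s ∉ X := fun h' => notMem_empty s (h ▸ mem_inter.2 ⟨mem_inter.2 ⟨hs.1, h'⟩, hs.2⟩)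
      have h2 : x ∉ S := fun h' => notMem_empty x (h ▸ mem_inter.2 ⟨mem_inter.2 ⟨hx.1, hx.2⟩, h'⟩)
      refine ⟨x, {x, s}, insert_subset hx.1 (by simpa using hs.1), card_le_two, ?_, .inl ⟨s, ?_⟩⟩
      · grind
      grind

/-- A set whose `k`-subsets meeting `X` in one vertex are edges, provided that they have at most
one vertex in the sparse set `S`, is spanned by a path with the right proportion in `X`. -/
theorem pathOn_of_complete (hk : 2 * ℓ < k) (hℓ : 1 ≤ ℓ) (hk4 : 4 ≤ k) (j : ℕ) : ∀ L M L' : Finset V,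
    L.card = ℓ → L'.card = ℓ → Disjoint L M → Disjoint L L' → Disjoint M L' →
    Disjoint (L ∪ L') (X ∪ S) → M.card + ℓ = 2 * (k - ℓ) * (j + 1) → (M ∩ X).card = j + 1 →
    (M ∩ S).card ≤ j + 1 →
    (∀ e ⊆ L ∪ M ∪ L', e.card = k → (e ∩ X).card = 1 → (e ∩ S).card ≤ 1 → e ∈ E) →
    PathOn E ℓ L M L' := by
  have two : ∀ L M L' : Finset V, L.card = ℓ → L'.card = ℓ → Disjoint L M → Disjoint L L' →
      Disjoint M L' → Disjoint (L ∪ L') (X ∪ S) → M.card + ℓ = 2 * (k - ℓ) → (M ∩ X).card = 1 →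
      (M ∩ S).card ≤ 1 →
      (∀ e ⊆ L ∪ M ∪ L', e.card = k → (e ∩ X).card = 1 → (e ∩ S).card ≤ 1 → e ∈ E) →
      PathOn E ℓ L M L' := by
    intro L M L' hL hL' hLM hLL hML hd hM hX hS hE
    simp only [disjoint_union_left, disjoint_union_right] at hd
    have key : ∀ A ⊆ L ∪ M ∪ L', A.card = ℓ → Disjoint A M → Disjoint A X → Disjoint A S → ∀ T ⊆ M,
        T.card = k - ℓ → (T ∩ X).card = 1 → A ∪ T ∈ E := by
      intro A hA hAc hAM hAX hAS T hT hTc hTX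
      refine hE _ (union_subset hA (hT.trans ?_)) ?_ ?_ ?_
      · grind
      · rw [card_union_of_disjoint (hAM.mono_right hT)]; omega
      · rwa [union_inter_distrib_right, disjoint_iff_inter_eq_empty.1 hAX, empty_union]
      · rw [union_inter_distrib_right, disjoint_iff_inter_eq_empty.1 hAS, empty_union]
        exact (card_le_card (inter_subset_inter_right hT)).trans hS
    exact pathOn_two hk hℓ hL hL' hLM hLL hML hM hX fun T hT hTc hTX =>
      ⟨key L (subset_union_left.trans subset_union_left) hL hLM hd.1.1 hd.2.1 T hT hTc hTX,
        key L' subset_union_right hL' hML.symm hd.1.2 hd.2.2 T hT hTc hTX⟩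
  induction j with
  | zero => simpa using two
  | succ j ih =>
    intro L M L' hL hL' hLM hLL hML hd hM hX hS hE
    obtain ⟨x, F, hFM, hF2, hFX, hFS⟩ := exists_starter (S := S) (card_pos.1 (by omega : 0 < (M ∩ X).card))
    set R := M \ (X ∪ S) with hR
    have hRc : 2 * (k - ℓ) ≤ R.card + 1 := by
      have h2 : (M ∩ (X ∪ S)).card ≤ 2 * (j + 2) := by
        rw [inter_union_distrib_left]; grind
      have h3 : R.card = M.card - (M ∩ (X ∪ S)).card := by rw [hR, card_sdiff, inter_comm]
      have h4 := Nat.mul_le_mul_right j (by omega : 3 ≤ k - ℓ)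
      have h5 : 2 * (k - ℓ) * (j + 1 + 1) = 2 * ((k - ℓ) * j) + 4 * (k - ℓ) := by ring
      omega
    have hRM : R ⊆ M := sdiff_subset
    have hxF : x ∈ F ∩ X := hFX ▸ mem_singleton_self x
    rw [mem_inter] at hxF
    have hFR : (F ∪ R) \ {x} ⊇ R := fun y hy => by
      simp only [mem_sdiff, mem_union, mem_singleton]
      exact ⟨.inr hy, fun h => (mem_sdiff.1 hy).2 (mem_union_left _ (h ▸ hxF.2))⟩
    have hFRc := card_le_card hFR
    rw [card_sdiff_of_subset (singleton_subset_iff.2 (mem_union_left R hxF.1)), card_singleton] at hFRc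
    obtain ⟨M₁, hF1, h1, hM₁⟩ := exists_subsuperset_card_eq (subset_union_left : F ⊆ F ∪ R)
      (by omega : F.card ≤ 2 * (k - ℓ) - ℓ) (by omega)
    have hRM₁ : (R ∩ M₁).card + 1 ≤ M₁.card := by
      rw [← card_singleton x, ← card_union_of_disjoint]
      · exact card_le_card (union_subset inter_subset_right (by simpa using hF1 hxF.1))
      · rw [disjoint_singleton_right]
        exact fun h => (mem_sdiff.1 (mem_inter.1 h).1).2 (mem_union_left _ hxF.2)
    have := card_sdiff_add_card_inter R M₁
    obtain ⟨N, hN, hNc⟩ := exists_subset_card_eq (s := R \ M₁) (n := ℓ) (by omega)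
    have hM₁M : M₁ ⊆ M := h1.trans (union_subset hFM hRM)
    have hRX : ∀ y ∈ R, y ∈ M ∧ y ∉ X ∧ y ∉ S := fun y hy => by simpa [hR] using hy
    have hNR : ∀ y ∈ N, y ∈ R ∧ y ∉ M₁ := fun y hy => mem_sdiff.1 (hN hy)
    have hNM : N ⊆ M \ M₁ := fun y hy => mem_sdiff.2 ⟨hRM (hNR y hy).1, (hNR y hy).2⟩
    have e1 : M₁ ∩ X = {x} := by
      rw [← hFX]
      refine Subset.antisymm (fun y hy => ?_) (inter_subset_inter_right hF1)
      rw [mem_inter] at hy ⊢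
      exact ⟨(mem_union.1 (h1 hy.1)).resolve_right fun h => (hRX y h).2.1 hy.2, hy.2⟩
    have e2 : M₁ ∩ S = F ∩ S := by
      refine Subset.antisymm (fun y hy => ?_) (inter_subset_inter_right hF1)
      rw [mem_inter] at hy ⊢
      exact ⟨(mem_union.1 (h1 hy.1)).resolve_right fun h => (hRX y h).2.2 hy.2, hy.2⟩
    have hM₂ : ((M \ M₁) \ N).card + 2 * (k - ℓ) = M.card := by
      have := card_le_card hNM
      have := card_sdiff_add_card_eq_card hM₁M
      rw [card_sdiff_of_subset hNM]; omega
    have hNX : Disjoint N (X ∪ S) := disjoint_left.2 fun y hy => by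
      simpa using (hRX y (hNR y hy).1).2
    have split : ∀ A, Disjoint N A → (((M \ M₁) \ N) ∩ A).card + (M₁ ∩ A).card = (M ∩ A).card := by
      intro A hA
      rw [← card_union_of_disjoint]
      · congr 1; ext y
        have := @hM₁M y
        have : y ∈ N → y ∉ A := fun h => disjoint_left.1 hA h
        simp only [mem_union, mem_inter, mem_sdiff]; tauto
      · exact disjoint_of_subset_left (inter_subset_left.trans sdiff_subset)
          (disjoint_of_subset_right inter_subset_left sdiff_disjoint)
    rw [disjoint_union_right] at hNX
    rw [disjoint_union_left, disjoint_union_right, disjoint_union_right] at hd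
    have sX := split X hNX.1
    have sS := split S hNX.2
    rw [e1, card_singleton] at sX
    rw [e2] at sS
    have hN' : N ⊆ M := hNM.trans sdiff_subset
    have hM₂' : (M \ M₁) \ N ⊆ M := sdiff_subset.trans sdiff_subset
    have p1 : PathOn E ℓ L M₁ N := two L M₁ N hL hNc (hLM.mono_right hM₁M) (hLM.mono_right hN')
      (disjoint_of_subset_right hNM disjoint_sdiff)
      (by simp only [disjoint_union_left, disjoint_union_right]; grind)
      (by omega) (by rw [e1, card_singleton])
      (by rw [e2]; rcases hFS with ⟨s, hs⟩ | h
          · rw [hs, card_singleton]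
          · rw [card_eq_zero.2 (subset_empty.1 (h ▸ inter_subset_inter_right hFM))]; omega)
      fun e he => hE e (he.trans (union_subset (union_subset
        (subset_union_left.trans subset_union_left) ((hM₁M.trans subset_union_right).trans
        subset_union_left)) ((hN'.trans subset_union_right).trans subset_union_left)))
    have p2 : PathOn E ℓ N ((M \ M₁) \ N) L' := ih N _ L' hNc hL' disjoint_sdiff
      (hML.mono_left hN') (hML.mono_left hM₂')
      (by simp only [disjoint_union_left, disjoint_union_right]; exact ⟨⟨hNX.1, hd.2.1⟩, hNX.2, hd.2.2⟩)
      (by rw [mul_add _ (j + 1)] at hM; omega) (by omega)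
      (by rcases hFS with ⟨s, hs⟩ | h
          · rw [hs, card_singleton] at sS; omega
          · rw [h, card_empty] at sS; omega)
      fun e he => hE e (he.trans (union_subset (union_subset
        ((hN'.trans subset_union_right).trans subset_union_left)
        ((hM₂'.trans subset_union_right).trans subset_union_left)) subset_union_right))
    have := p1.cat p2 (by
      simp only [disjoint_union_left, disjoint_union_right]
      exact ⟨⟨hLM.mono_right hM₂', disjoint_of_subset_right sdiff_subset disjoint_sdiff⟩, hLL,
        hML.mono_left hM₁M⟩)
    convert this using 1
    ext y
    have := @hM₁M y
    have := @hN' y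
    simp only [mem_union, mem_sdiff]
    tauto

end Combinatorial

section Rich

variable {V : Type} [DecidableEq V] [Fintype V]

theorem pr_comp_inj [Nonempty V] {s m : ℕ} {g : Fin s → Fin m} (hg : Function.Injective g)
    (P : (Fin s → V) → Prop) : pr (fun ω : Fin m → V => P (ω ∘ g)) = pr P := by
  classical
  let e := (Equiv.piEquivPiSubtypeProd (fun i => i ∈ Set.range g) fun _ => V).trans
    (Equiv.prodCongr (Equiv.arrowCongr (Equiv.ofInjective g hg).symm (Equiv.refl V)) (Equiv.refl _))
  rw [← pr_fst (Ω' := {i // ¬ i ∈ Set.range g} → V) P, ← pr_equiv e]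
  exact pr_congr fun ω => by rfl

theorem pr_exists_subset_le [Nonempty V] (m s : ℕ) (Q : Finset V → Prop) :
    pr (fun ω : Fin m → V => ∃ T ⊆ im V ω, T.card = s ∧ Q T) ≤
      m ^ s * pr fun ω : Fin s → V => (im V ω).card = s ∧ Q (im V ω) := by
  classical
  refine (pr_mono fun ω h => ?_).trans (pr_exists_le (univ.filter Function.Injective)
    fun (g : Fin s → Fin m) (ω : Fin m → V) => (im V (ω ∘ g)).card = s ∧ Q (im V (ω ∘ g))) |>.trans ?_
  · obtain ⟨T, hT, hTs, hQ⟩ := h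
    have hT' : ∀ i : Fin s, ∃ a : Fin m, ω a = (T.equivFinOfCardEq hTs).symm i := fun i => by
      simpa [im_tuple] using hT ((T.equivFinOfCardEq hTs).symm i).2
    choose g hg using hT'
    have : im V (ω ∘ g) = T := by
      ext v
      simp only [im_tuple, mem_image, mem_univ, true_and, Function.comp, hg]
      refine ⟨fun ⟨i, hi⟩ => hi ▸ Subtype.prop _, fun hv => ⟨T.equivFinOfCardEq hTs ⟨v, hv⟩, by simp⟩⟩
    refine ⟨g, mem_filter.2 ⟨mem_univ _, fun i j hij => ?_⟩, by rwa [this], by rwa [this]⟩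
    exact (T.equivFinOfCardEq hTs).symm.injective (Subtype.ext (by rw [← hg, ← hg, hij]))
  · rw [sum_congr rfl fun g hg => pr_comp_inj (mem_filter.1 hg).2
      fun ω : Fin s → V => (im V ω).card = s ∧ Q (im V ω), sum_const, nsmul_eq_mul]
    refine mul_le_mul_of_nonneg_right ?_ (pr_nonneg _)
    refine (Nat.cast_le.2 (card_le_univ _)).trans ?_
    simp

/-- `F ∪ T` meets `X` in one vertex but is not an edge. -/
def Bad (E : Finset (Finset V)) (X Y F T : Finset V) : Prop :=
  Disjoint F T ∧ T ⊆ X ∪ Y ∧ ((F ∪ T) ∩ X).card = 1 ∧ F ∪ T ∉ E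

/-- The proportion of the tuples completing `F` badly. -/
noncomputable def badPr (E : Finset (Finset V)) (X Y : Finset V) (k : ℕ) (F : Finset V) : ℝ :=
  pr fun ω : Fin (k - F.card) → V => (im V ω).card = k - F.card ∧ Bad E X Y F (im V ω)

def Typ (E : Finset (Finset V)) (X Y : Finset V) (k ℓ : ℕ) (τ : ℝ) (L : Finset V) : Prop :=
  L.card = ℓ ∧ L ⊆ Y ∧ badPr E X Y k L ≤ τ

variable {E : Finset (Finset V)} {X Y X' Y' : Finset V} {k ℓ : ℕ}

theorem pr_typed_le {δ : ℝ} (hδ : 0 ≤ δ) (hXY : Disjoint X' Y') (hX : δ * Fintype.card V ≤ X'.card)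
    (hY : δ * Fintype.card V ≤ Y'.card) (j q : ℕ) [Nonempty V] :
    δ ^ (j + q) - ((j + q : ℕ) : ℝ) ^ 2 / Fintype.card V ≤ pr fun ω : Fin (j + q) → V =>
      (im V ω).card = j + q ∧ im V ω ⊆ X' ∪ Y' ∧ (im V ω ∩ X').card = j := by
  have hn : (0 : ℝ) < Fintype.card V := by exact_mod_cast Fintype.card_pos
  set P : Fin (j + q) → V → Prop := fun i v => v ∈ (if (i : ℕ) < j then X' else Y') with hP
  have h1 : δ ^ (j + q) ≤ pr fun ω : Fin (j + q) → V => ∀ i, P i (ω i) := by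
    rw [pr_pi]
    refine le_trans (by simp) (prod_le_prod (f := fun _ => δ) (fun _ _ => hδ) fun i _ => ?_)
    simp only [hP]
    rw [pr_mem, le_div_iff₀ hn]
    split_ifs
    exacts [hX, hY]
  have h2 := pr_clean (V := V) (fun ω : Fin (j + q) → V => ∀ i, P i (ω i)) ∅
  have h3 : (Blk.sz V (Fin (j + q) → V)) = j + q := rfl
  simp only [h3, card_empty, Nat.cast_zero, mul_zero, add_zero] at h2
  refine le_trans (by linarith) (h2.trans (pr_mono fun ω h => ⟨h.2.1, ?_, ?_⟩))
  · intro v hv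
    obtain ⟨i, -, rfl⟩ := mem_image.1 (im_tuple ω ▸ hv)
    have := h.1 i
    simp only [hP] at this
    split_ifs at this
    exacts [mem_union_left _ this, mem_union_right _ this]
  · have hinj := (dist_tuple ω).1 h.2.1
    have : im V ω ∩ X' = (univ.filter fun i : Fin (j + q) => (i : ℕ) < j).image ω := by
      ext v
      simp only [im_tuple, mem_inter, mem_image, mem_univ, true_and, mem_filter]
      constructor
      · rintro ⟨⟨i, rfl⟩, hi⟩
        refine ⟨i, ?_, rfl⟩
        by_contra hc
        have := h.1 i
        simp only [hP, if_neg hc] at this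
        exact disjoint_left.1 hXY hi this
      · rintro ⟨i, hi, rfl⟩
        have := h.1 i
        simp only [hP, if_pos hi] at this
        exact ⟨⟨i, rfl⟩, this⟩
    rw [this, card_image_of_injective _ hinj, Fin.card_filter_val_lt]
    omega

/-- A random set with prescribed intersection sizes is complete, together with any of the sets of
a family with few bad completions, and all its `ℓ`-subsets in `Y` are typical. -/
theorem pr_rich_le [Nonempty V] {δ ε τ : ℝ} (hδ : 0 ≤ δ) (hXY : Disjoint X Y) (hX' : X' ⊆ X)
    (hY' : Y' ⊆ Y) (hX : δ * Fintype.card V ≤ X'.card) (hY : δ * Fintype.card V ≤ Y'.card) {j q : ℕ}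
    (hjq : 0 < j + q) (hℓk : ℓ ≤ k)
    (𝓕 : Finset (Finset V)) (hF : ∀ F ∈ 𝓕, badPr E X Y k F ≤ ε)
    (hT : pr (fun ω : Fin ℓ → V => (im V ω).card = ℓ ∧ im V ω ⊆ Y ∧ ¬ Typ E X Y k ℓ τ (im V ω)) ≤ ε)
    (hs : ((j + q : ℕ) : ℝ) ^ k * ((𝓕.card + 1) * ε) + ((j + q : ℕ) : ℝ) ^ 2 / Fintype.card V ≤
      δ ^ (j + q) / 2) :
    δ ^ (j + q) / 2 ≤ pr fun ω : Fin (j + q) → V =>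
      (im V ω).card = j + q ∧ im V ω ⊆ X' ∪ Y' ∧ (im V ω ∩ X).card = j ∧
      (∀ F ∈ 𝓕, ∀ T ⊆ im V ω, T.card = k - F.card → ¬ Bad E X Y F T) ∧
      ∀ L ⊆ im V ω, L.card = ℓ → L ⊆ Y → Typ E X Y k ℓ τ L := by
  set m := j + q with hm
  have h1 := pr_typed_le hδ (hXY.mono hX' hY') hX hY j q
  rw [← hm] at h1
  have hm1 : (1 : ℝ) ≤ m := by exact_mod_cast hjq
  have hε : 0 ≤ ε := le_trans (pr_nonneg _) hT
  have h2 : pr (fun ω : Fin m → V => ∃ F ∈ 𝓕, ∃ T ⊆ im V ω, T.card = k - F.card ∧ Bad E X Y F T) ≤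
      m ^ k * (𝓕.card * ε) := by
    refine (pr_exists_le 𝓕 _).trans ((sum_le_card_nsmul _ _ ((m : ℝ) ^ k * ε) fun F hF' => ?_).trans
      (by rw [nsmul_eq_mul]; exact le_of_eq (by ring)))
    refine (pr_exists_subset_le m _ _).trans (mul_le_mul ?_ (hF F hF') (pr_nonneg _) (by positivity))
    exact pow_le_pow_right₀ hm1 (Nat.sub_le _ _)
  have h3 : pr (fun ω : Fin m → V => ∃ L ⊆ im V ω, L.card = ℓ ∧ (L ⊆ Y ∧ ¬ Typ E X Y k ℓ τ L)) ≤
      m ^ k * ε := by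
    refine (pr_exists_subset_le m _ _).trans (mul_le_mul ?_ hT (pr_nonneg _) (by positivity))
    exact pow_le_pow_right₀ hm1 hℓk
  have h4 := pr_sub_le (fun ω : Fin m → V => (im V ω).card = m ∧ im V ω ⊆ X' ∪ Y' ∧
      (im V ω ∩ X').card = j) fun ω =>
    (∃ F ∈ 𝓕, ∃ T ⊆ im V ω, T.card = k - F.card ∧ Bad E X Y F T) ∨
      ∃ L ⊆ im V ω, L.card = ℓ ∧ (L ⊆ Y ∧ ¬ Typ E X Y k ℓ τ L)
  have h5 := pr_or_le (fun ω : Fin m → V => ∃ F ∈ 𝓕, ∃ T ⊆ im V ω, T.card = k - F.card ∧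
    Bad E X Y F T) fun ω => ∃ L ⊆ im V ω, L.card = ℓ ∧ (L ⊆ Y ∧ ¬ Typ E X Y k ℓ τ L)
  refine le_trans (by linarith) (h4.trans (pr_mono fun ω h => ⟨h.1.1, h.1.2.1, ?_, ?_, ?_⟩))
  · rw [← h.1.2.2]
    congr 1
    refine Subset.antisymm (fun v hv => ?_) (inter_subset_inter_left hX')
    rw [mem_inter] at hv ⊢
    exact ⟨hv.1, (mem_union.1 (h.1.2.1 hv.1)).resolve_right
      fun hc => disjoint_left.1 hXY hv.2 (hY' hc)⟩
  · exact fun F hF' T hT hTc hB => h.2 (.inl ⟨F, hF', T, hT, hTc, hB⟩)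
  · exact fun L hL hLc hLY => by_contra fun hc => h.2 (.inr ⟨L, hL, hLc, hLY, hc⟩)

end Rich

section Connector

variable {V : Type} [DecidableEq V] {E : Finset (Finset V)} {k ℓ : ℕ} {X Y : Finset V}

theorem pathOn_connector {A B P I : Finset V} {x : V} (hk : 2 * ℓ < k) (hℓ : 1 ≤ ℓ) (hXY : Disjoint X Y)
    (hA : A.card = ℓ) (hB : B.card = ℓ) (hBY : B ⊆ Y) (hAB : Disjoint A B) (hP : P.card = k - ℓ)
    (hI : I.card = k - 2 * ℓ) (hPI : Disjoint P I) (hZ : Disjoint (P ∪ I) (A ∪ B)) (hx : x ∈ P)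
    (hPX : P ∩ X ⊆ {x}) (hX : (P ∩ X).card + (I ∩ X).card = 1) (hs : P ∪ I ⊆ X ∪ Y) (hE : A ∪ P ∈ E)
    (hbad : ∀ T ⊆ P ∪ I, T.card = k - ℓ → ¬ Bad E X Y B T) : PathOn E ℓ A (P ∪ I) B := by
  obtain ⟨N, hxN, hNP, hN⟩ := exists_subsuperset_card_eq (singleton_subset_iff.2 hx)
    (by simpa using hℓ) (by omega : ℓ ≤ P.card)
  rw [singleton_subset_iff] at hxN
  simp only [disjoint_union_left, disjoint_union_right] at hZ
  obtain ⟨⟨hPA, hIA⟩, hPB, hIB⟩ := hZ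
  have hsub : N ∪ I ⊆ P ∪ I := union_subset_union_left hNP
  have hNI : Disjoint N I := hPI.mono_left hNP
  have e2 : N ∪ I ∪ B ∈ E := by
    by_contra hc
    refine hbad (N ∪ I) hsub (by rw [card_union_of_disjoint hNI]; omega)
      ⟨disjoint_union_right.2 ⟨(hPB.mono_left hNP).symm, hIB.symm⟩, hsub.trans hs, ?_, by rwa [union_comm]⟩
    have h1 : (B ∪ (N ∪ I)) ∩ X = (P ∩ X) ∪ (I ∩ X) := by
      ext v
      simp only [mem_inter, mem_union]
      have h2 : v ∈ B → v ∉ X := fun hv hvX => disjoint_left.1 hXY hvX (hBY hv)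
      grind
    rw [h1, card_union_of_disjoint (hPI.mono inter_subset_left inter_subset_left), hX]
  have p1 : PathOn E ℓ A (P \ N) N := .edge hA hN (hPA.symm.mono_right sdiff_subset)
    (hPA.symm.mono_right hNP) sdiff_disjoint (by rwa [union_assoc, sdiff_union_of_subset hNP])
  have p2 : PathOn E ℓ N I B := .edge hN hB hNI (hPB.mono_left hNP) hIB e2
  have := p1.cat p2 (by
    simp only [disjoint_union_left, disjoint_union_right]
    exact ⟨⟨hIA.symm, hPI.mono_left sdiff_subset⟩, hAB, hPB.mono_left sdiff_subset⟩)
  rwa [sdiff_union_of_subset hNP] at this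

variable [Fintype V]

theorem pr_extension_le [Nonempty V] {a d : ℝ} (h : PairDeg E k d)
    (h0 : ((univ \ (X ∪ Y)).card : ℝ) ≤ a / 4 * Fintype.card V)
    (hd : a + (((univ \ Y).card : ℝ) / Fintype.card V) ^ 2 ≤ d) {S : Finset V} (hS : S.card + 2 = k) :
    a / 4 ≤ pr fun x : V × V => S ∪ {x.1, x.2} ∈ E ∧ x.1 ∈ X ∪ Y ∧ x.2 ∈ Y := by
  have hn : (0 : ℝ) < Fintype.card V := by exact_mod_cast Fintype.card_pos
  have h1 := h S hS
  have h2 : pr (fun x : V × V => x.1 ∈ univ \ Y ∧ x.2 ∈ univ \ Y) =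
      (((univ \ Y).card : ℝ) / Fintype.card V) ^ 2 := by
    rw [pr_and_prod (fun v : V => v ∈ univ \ Y) fun v : V => v ∈ univ \ Y, pr_mem, sq]
  have h3 := pr_sub_le (fun x : V × V => S ∪ {x.1, x.2} ∈ E) fun x => x.1 ∈ univ \ Y ∧ x.2 ∈ univ \ Y
  have h4 : pr (fun x : V × V => S ∪ {x.1, x.2} ∈ E ∧ ¬ (x.1 ∈ univ \ Y ∧ x.2 ∈ univ \ Y)) ≤
      2 * pr fun x : V × V => S ∪ {x.1, x.2} ∈ E ∧ x.2 ∈ Y := by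
    refine (pr_mono fun x hx => ?_).trans ((pr_or_le (fun x : V × V => S ∪ {x.1, x.2} ∈ E ∧ x.2 ∈ Y)
      fun x : V × V => S ∪ {x.2, x.1} ∈ E ∧ x.1 ∈ Y).trans (le_of_eq ?_))
    · have := hx.2
      simp only [mem_sdiff, mem_univ, true_and] at this
      rw [pair_comm x.2 x.1]
      grind
    · rw [pr_swap fun x : V × V => S ∪ {x.2, x.1} ∈ E ∧ x.1 ∈ Y, two_mul]
  have h5 := pr_sub_le (fun x : V × V => S ∪ {x.1, x.2} ∈ E ∧ x.2 ∈ Y) fun x => x.1 ∈ univ \ (X ∪ Y)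
  have h6 : pr (fun x : V × V => x.1 ∈ univ \ (X ∪ Y)) ≤ a / 4 := by
    rw [pr_fst fun v : V => v ∈ univ \ (X ∪ Y), pr_mem, div_le_iff₀ hn]
    exact h0
  refine le_trans (by linarith) (h5.trans (pr_mono fun x hx => ⟨hx.1.1, ?_, hx.1.2⟩))
  grind

/-- Every `ℓ`-set in `Y` can be connected to every typical set in a positive proportion of ways. -/
theorem exists_connector {k ℓ : ℕ} (hk4 : 4 ≤ k) (hℓ : 1 ≤ ℓ) (hk : 2 * ℓ < k) {a : ℝ} (ha : 0 < a)
    (ha1 : a ≤ 1) : ∃ c > 0, ∃ τ > 0, ∃ n₀ : ℕ, ∀ (V : Type) [DecidableEq V] [Fintype V]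
      (E : Finset (Finset V)) (X Y : Finset V) (d : ℝ), n₀ ≤ Fintype.card V → Disjoint X Y →
      a / 2 * Fintype.card V ≤ X.card → (Fintype.card V : ℝ) / 2 ≤ Y.card →
      ((univ \ (X ∪ Y)).card : ℝ) ≤ a / 4 * Fintype.card V → PairDeg E k d →
      a + (((univ \ Y).card : ℝ) / Fintype.card V) ^ 2 ≤ d →
      ∀ A B, A ⊆ Y → A.card = ℓ → Typ E X Y k ℓ τ B → Disjoint A B →
      c ≤ pr fun ω : Fin (2 * (k - ℓ) - ℓ) → V => PathOn E ℓ A (im V ω) B ∧ im V ω ⊆ X ∪ Y ∧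
        (im V ω).card = 2 * (k - ℓ) - ℓ ∧ (im V ω ∩ X).card = 1 := by
  set δ := a / 4 with hδ
  have hδ0 : 0 < δ := by positivity
  set u := k - ℓ - 2 with hu
  set v := k - 2 * ℓ - 1 with hv
  set c₁ := δ ^ u / 2 with hc₁
  set c₂ := δ ^ (1 + v) / 2 with hc₂
  set c := c₁ * (a / 4) * c₂ with hc
  have hc₁0 : 0 < c₁ := by positivity
  have hc₂0 : 0 < c₂ := by positivity
  have hc0 : 0 < c := by positivity
  set m := 2 * (k - ℓ) - ℓ with hm
  have hmpos : 0 < m := by omega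
  have hmr : (0 : ℝ) < m := by exact_mod_cast hmpos
  obtain ⟨n₁, hn₁⟩ := exists_forall_div_le ((u : ℝ) ^ 2) hc₁0
  obtain ⟨n₂, hn₂⟩ := exists_forall_div_le (((1 + v : ℕ) : ℝ) ^ 2) hc₂0
  obtain ⟨n₃, hn₃⟩ := exists_forall_div_le ((m : ℝ) ^ 2 + m * (2 * ℓ)) (by positivity : 0 < c / 4)
  obtain ⟨n₄, hn₄⟩ := exists_forall_div_le (2 * ℓ : ℝ) (by norm_num : (0 : ℝ) < 1 / 4)
  refine ⟨c / 2, by positivity, c / 4 / (m : ℝ) ^ (k - ℓ), by positivity, n₁ + n₂ + n₃ + n₄ + 1, ?_⟩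
  intro V _ _ E X Y d hn hXY hX hY h0 hE hd A B hAY hA hB hAB
  have hne : Nonempty V := Fintype.card_pos_iff.1 (by omega)
  have hnr : (0 : ℝ) < Fintype.card V := by exact_mod_cast Fintype.card_pos
  have e1 := hn₁ (Fintype.card V) (by omega)
  have e2 := hn₂ (Fintype.card V) (by omega)
  have e3 := hn₃ (Fintype.card V) (by omega)
  have e4 := hn₄ (Fintype.card V) (by omega)
  rw [div_le_iff₀ hnr] at e4
  have hZc : (A ∪ B).card = 2 * ℓ := by rw [card_union_of_disjoint hAB, hA, hB.1, two_mul]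
  have hY' : δ * Fintype.card V ≤ (Y \ (A ∪ B)).card := by
    have h1 : Y.card ≤ (Y \ (A ∪ B)).card + (A ∪ B).card := by
      grind
    have h1' : (Y.card : ℝ) ≤ (Y \ (A ∪ B)).card + 2 * ℓ := by
      rw [hZc] at h1
      exact_mod_cast h1
    have : δ * Fintype.card V ≤ 1 / 4 * Fintype.card V :=
      mul_le_mul_of_nonneg_right (by linarith) hnr.le
    linarith
  have hX' : δ * Fintype.card V ≤ X.card :=
    le_trans (mul_le_mul_of_nonneg_right (by linarith) hnr.le) hX
  have hXY' : Disjoint X (Y \ (A ∪ B)) := hXY.mono_right sdiff_subset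
  have memY : ∀ W : Finset V, W ⊆ X ∪ Y \ (A ∪ B) → (W ∩ X).card = 0 → W ⊆ Y := fun W hW h w hw => by
    have h1 := hW hw
    rw [card_eq_zero] at h
    simp only [mem_union, mem_sdiff] at h1
    rcases h1 with h1 | h1
    · exact absurd (h ▸ mem_inter.2 ⟨hw, h1⟩ : w ∈ (∅ : Finset V)) (by simp)
    · exact h1.1
  let G₁ : (Fin u → V) → Prop := fun R => (im V R).card = u ∧ im V R ⊆ X ∪ Y \ (A ∪ B) ∧
    (im V R ∩ X).card = 0
  let G₂ : (Fin u → V) × (V × V) → Prop := fun p => G₁ p.1 ∧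
    (A ∪ im V p.1 ∪ {p.2.1, p.2.2} ∈ E ∧ p.2.1 ∈ X ∪ Y ∧ p.2.2 ∈ Y)
  let G₃ : (Fin u → V) × (V × V) → (Fin (k - 2 * ℓ) → V) → Prop := fun p I =>
    (im V I ∩ X).card = (if p.2.1 ∈ X then 0 else 1) ∧ im V I ⊆ X ∪ Y
  have typed : ∀ j q r : ℕ, j + q = r → δ ^ r - (r : ℝ) ^ 2 / Fintype.card V ≤ pr fun ω : Fin r → V =>
      (im V ω).card = r ∧ im V ω ⊆ X ∪ Y \ (A ∪ B) ∧ (im V ω ∩ X).card = j := by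
    rintro j q _ rfl
    exact pr_typed_le hδ0.le hXY' hX' hY' j q
  have b1 : c₁ ≤ pr G₁ := by
    exact le_trans (by linarith) (typed 0 u u (by omega))
  have b2 : c₁ * (a / 4) ≤ pr G₂ := by
    refine le_trans ?_ (mul_pr_le_prod (P := G₁) (c := a / 4)
      (Q := fun R (x : V × V) => A ∪ im V R ∪ {x.1, x.2} ∈ E ∧ x.1 ∈ X ∪ Y ∧ x.2 ∈ Y) fun R hR => ?_)
    · rw [mul_comm]; exact mul_le_mul_of_nonneg_left b1 (by positivity)
    · refine pr_extension_le hE h0 hd ?_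
      rw [card_union_of_disjoint, hA, hR.1]
      · omega
      · rw [disjoint_right]
        intro w hw hwA
        have := hR.2.1 hw
        simp only [mem_union, mem_sdiff] at this
        rcases this with h | h
        · exact disjoint_left.1 hXY h (hAY hwA)
        · exact h.2 (.inl hwA)
  have b3 : ∀ p, c₂ ≤ pr (G₃ p) := fun p => by
    have hsub : X ∪ Y \ (A ∪ B) ⊆ X ∪ Y := union_subset_union_right sdiff_subset
    have hv' : k - 2 * ℓ = 1 + v := by omega
    simp only [G₃]
    rw [hv']
    by_cases hp : p.2.1 ∈ X
    · refine le_trans (by linarith) ((typed 0 _ _ (zero_add (1 + v))).trans (pr_mono fun I hI =>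
        ⟨by rw [if_pos hp]; exact hI.2.2, hI.2.1.trans hsub⟩))
    · refine le_trans (by linarith) ((typed 1 v _ rfl).trans (pr_mono fun I hI =>
        ⟨by rw [if_neg hp]; exact hI.2.2, hI.2.1.trans hsub⟩))
  have b4 : c ≤ pr fun ω : ((Fin u → V) × (V × V)) × (Fin (k - 2 * ℓ) → V) => G₂ ω.1 ∧ G₃ ω.1 ω.2 := by
    refine le_trans ?_ (mul_pr_le_prod (P := G₂) (c := c₂) fun p _ => b3 p)
    rw [hc, mul_comm c₂]
    exact mul_le_mul_of_nonneg_right b2 hc₂0.le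
  have hsz : Blk.sz V (((Fin u → V) × (V × V)) × (Fin (k - 2 * ℓ) → V)) = m := by
    change u + (1 + 1) + (k - 2 * ℓ) = m
    omega
  have b5 := pr_clean (V := V)
    (fun ω : ((Fin u → V) × (V × V)) × (Fin (k - 2 * ℓ) → V) => G₂ ω.1 ∧ G₃ ω.1 ω.2) (A ∪ B)
  have b6 : pr (fun ω : ((Fin u → V) × (V × V)) × (Fin (k - 2 * ℓ) → V) =>
      ∃ T ⊆ im V ω, T.card = k - ℓ ∧ Bad E X Y B T) ≤ c / 4 := by
    rw [pr_tuple (fun W => ∃ T ⊆ W, T.card = k - ℓ ∧ Bad E X Y B T) hsz]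
    refine (pr_exists_subset_le m (k - ℓ) fun T => Bad E X Y B T).trans ?_
    have h := hB.2.2
    unfold badPr at h
    rw [hB.1, le_div_iff₀ (by positivity), mul_comm] at h
    exact h
  have b7 := pr_sub_le (fun ω : ((Fin u → V) × (V × V)) × (Fin (k - 2 * ℓ) → V) =>
    (G₂ ω.1 ∧ G₃ ω.1 ω.2) ∧ Distinct V ω ∧ Disjoint (im V ω) (A ∪ B))
    fun ω => ∃ T ⊆ im V ω, T.card = k - ℓ ∧ Bad E X Y B T
  rw [hsz, hZc] at b5
  push_cast at b5
  refine le_trans (by linarith) (b7.trans ?_)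
  have := pr_tuple (V := V) (Ω := ((Fin u → V) × (V × V)) × (Fin (k - 2 * ℓ) → V)) (fun W =>
    PathOn E ℓ A W B ∧ W ⊆ X ∪ Y ∧ W.card = m ∧ (W ∩ X).card = 1) hsz
  refine le_trans (pr_mono ?_) this.le
  rintro ⟨⟨R, x, y⟩, I⟩ ⟨⟨⟨⟨⟨r1, r2, r3⟩, hxyE, hx, hy⟩, i1, i2⟩, hD, hZ⟩, hbad⟩
  dsimp only at *
  have hcard : (im V (((R, (x, y)), I) : ((Fin u → V) × (V × V)) × (Fin (k - 2 * ℓ) → V))).card = m :=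
    hsz ▸ hD
  have hIc : (im V I).card ≤ k - 2 * ℓ := card_im_le I
  have hPc : (im V ((R, (x, y)) : (Fin u → V) × (V × V))).card ≤ u + (1 + 1) := card_im_le _
  rw [im_prod] at hcard hZ hbad ⊢
  have hPeq : im V ((R, (x, y)) : (Fin u → V) × (V × V)) = im V R ∪ {x, y} := by
    rw [im_prod, im_prod, im_vertex, im_vertex]; rfl
  dsimp only at *
  set P := im V ((R, (x, y)) : (Fin u → V) × (V × V)) with hP
  have hui := card_union_add_card_inter P (im V I)
  have hPI : Disjoint P (im V I) := by
    rw [disjoint_iff_inter_eq_empty, ← card_eq_zero]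
    omega
  rw [card_union_of_disjoint hPI] at hcard
  have hRY : im V R ⊆ Y := memY _ r2 r3
  have hs : P ∪ im V I ⊆ X ∪ Y := by
    rw [hPeq]
    refine union_subset (union_subset (hRY.trans subset_union_right) ?_) i2
    intro w hw
    rcases mem_insert.1 hw with rfl | hw
    · exact hx
    grind
  have hPX : P ∩ X ⊆ {x} := fun w hw => by
    rw [hPeq, mem_inter, mem_union, mem_insert, mem_singleton] at hw
    obtain ⟨hw | hw | hw, hwX⟩ := hw
    · exact absurd (hRY hw) (disjoint_left.1 hXY hwX)
    · exact mem_singleton.2 hw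
    · exact absurd (hw ▸ hy) (disjoint_left.1 hXY hwX)
  have hxP : x ∈ P := by rw [hPeq]; simp
  have hX1 : (P ∩ X).card + (im V I ∩ X).card = 1 := by
    rw [i1]
    split_ifs with h
    · rw [Subset.antisymm hPX (singleton_subset_iff.2 (mem_inter.2 ⟨hxP, h⟩)), card_singleton]
    · rw [card_eq_zero.2, zero_add]
      refine eq_empty_of_forall_notMem fun w hw => h ?_
      rw [← mem_singleton.1 (hPX hw)]
      grind
  refine ⟨pathOn_connector hk hℓ hXY hA hB.1 hB.2.1 hAB (by omega) (by omega) hPI hZ hxP hPX hX1 hs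
    (by grind) fun T hT hTc hb => hbad ⟨T, hT, hTc, hb⟩, hs, ?_, ?_⟩
  · rw [card_union_of_disjoint hPI]; omega
  · rw [union_inter_distrib_right, card_union_of_disjoint
      (hPI.mono inter_subset_left inter_subset_left), hX1]

end Connector

section Units

variable {V : Type} [DecidableEq V]

/-- The weight under which the vertex set of an alternating union of units is balanced. -/
def wgt (Y : Finset V) (t : ℕ) (v : V) : ℤ := if v ∈ Y then -1 else 2 * t - 1

theorem sum_wgt (Y U : Finset V) (t : ℕ) : ∑ v ∈ U, wgt Y t v = 2 * t * (U \ Y).card - U.card := by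
  have : ∀ v, wgt Y t v = 2 * t * (if v ∉ Y then 1 else 0) - 1 := fun v => by
    unfold wgt; split_ifs <;> simp_all
  simp only [this, sum_sub_distrib, ← mul_sum, sum_boole, filter_notMem_eq_sdiff, sum_const,
    nsmul_eq_mul, mul_one]

theorem sum_wgt_inter {X Y U : Finset V} (hXY : Disjoint X Y) (hU : U ⊆ X ∪ Y) (t : ℕ) :
    ∑ v ∈ U, wgt Y t v = 2 * t * (U ∩ X).card - U.card := by
  rw [sum_wgt]
  congr 4
  ext v
  have := @hU v
  have := @disjoint_left _ X Y
  grind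

variable {E : Finset (Finset V)} {k ℓ : ℕ} {X Y S W Z : Finset V}

theorem exists_disjoint_ends (ℓ : ℕ) (U : Finset V) : ∃ A B : Finset V, 2 * ℓ ≤ U.card → A ⊆ U ∧ B ⊆ U ∧
    Disjoint A B ∧ A.card = ℓ ∧ B.card = ℓ := by
  by_cases h : 2 * ℓ ≤ U.card
  · obtain ⟨A, hA, hAc⟩ := exists_subset_card_eq (s := U) (n := ℓ) (by omega)
    obtain ⟨B, hB, hBc⟩ := exists_subset_card_eq (s := U \ A) (n := ℓ) (by
      grind)
    exact ⟨A, B, fun _ => ⟨hA, hB.trans sdiff_subset, disjoint_sdiff.mono_right hB, hAc, hBc⟩⟩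
  grind

theorem pathOn_unit (hk : 2 * ℓ < k) (hℓ : 1 ≤ ℓ) (hk4 : 4 ≤ k) (hW : W ⊆ X ∪ Y)
    (hWS : Disjoint W S) {A B : Finset V} (hA : A ⊆ W \ X) (hB : B ⊆ W \ X)
    (hAB : Disjoint A B) (hAc : A.card = ℓ) (hBc : B.card = ℓ) {j : ℕ} (hj : 0 < j)
    (hc : (W ∪ S).card = 2 * (k - ℓ) * j + ℓ) (hX : ((W ∪ S) ∩ X).card = j) (hSc : S.card ≤ j)
    (h0 : ∀ T ⊆ W, T.card = k → ¬ Bad E X Y ∅ T)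
    (h1 : ∀ s ∈ S, ∀ T ⊆ W, T.card = k - 1 → ¬ Bad E X Y {s} T) :
    PathOn E ℓ A ((W ∪ S) \ (A ∪ B)) B := by
  obtain ⟨j, rfl⟩ : ∃ i, j = i + 1 := ⟨j - 1, by omega⟩
  have hAW := hA.trans sdiff_subset
  have hBW := hB.trans sdiff_subset
  have hsub : A ∪ B ⊆ W ∪ S := (union_subset hAW hBW).trans subset_union_left
  have hABX : Disjoint (A ∪ B) X := by
    rw [disjoint_union_left]
    exact ⟨disjoint_of_subset_left hA sdiff_disjoint, disjoint_of_subset_left hB sdiff_disjoint⟩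
  have hABc : (A ∪ B).card = 2 * ℓ := by rw [card_union_of_disjoint hAB, hAc, hBc, two_mul]
  have hle := card_le_card hsub
  refine pathOn_of_complete (X := X) (S := S) hk hℓ hk4 j _ _ _ hAc hBc
    (disjoint_sdiff.mono_left subset_union_left) hAB (sdiff_disjoint.mono_right subset_union_right)
    (disjoint_union_right.2 ⟨hABX, hWS.mono_left (union_subset hAW hBW)⟩) ?_ ?_
    ((card_le_card inter_subset_right).trans hSc) ?_
  · grind
  · rw [← hX]
    congr 1
    grind
  · rw [union_sdiff_union_eq (hAW.trans subset_union_left) (hBW.trans subset_union_left)]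
    intro e he hec heX heS
    rcases Nat.le_one_iff_eq_zero_or_eq_one.1 heS with h | h
    · rw [card_eq_zero] at h
      by_contra hc
      have heW : e ⊆ W := fun v hv => (mem_union.1 (he hv)).resolve_right fun hv' =>
        notMem_empty v (h ▸ mem_inter.2 ⟨hv, hv'⟩)
      exact h0 e heW hec ⟨disjoint_empty_left _, heW.trans hW, by rwa [empty_union], by rwa [empty_union]⟩
    · obtain ⟨s, hs⟩ := card_eq_one.1 h
      have hse : s ∈ e ∩ S := hs ▸ mem_singleton_self s
      rw [mem_inter] at hse
      by_contra hc
      have heW : e.erase s ⊆ W := fun v hv => by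
        rw [mem_erase] at hv
        refine (mem_union.1 (he hv.2)).resolve_right fun hv' => hv.1 ?_
        rw [← mem_singleton, ← hs]
        grind
      have heq : {s} ∪ e.erase s = e := by rw [← insert_eq, insert_erase hse.1]
      exact h1 s hse.2 _ heW (by grind)
        ⟨by simp, heW.trans hW, by rwa [heq], by rwa [heq]⟩

variable [Fintype V]

/-- `W ⊆ Z` has `j` vertices in `X`, completes no member of `𝓕` badly, and has typical ends. -/
def Rich (E : Finset (Finset V)) (X Y : Finset V) (k ℓ : ℕ) (τ : ℝ) (𝓕 : Finset (Finset V)) (j : ℕ)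
    (Z W : Finset V) : Prop :=
  W ⊆ Z ∧ (W ∩ X).card = j ∧ (∀ F ∈ 𝓕, ∀ T ⊆ W, T.card = k - F.card → ¬ Bad E X Y F T) ∧
    ∀ L ⊆ W, L.card = ℓ → L ⊆ Y → Typ E X Y k ℓ τ L

/-- `(X, Y)` is an almost complete pair. -/
structure ExtPair (E : Finset (Finset V)) (X Y : Finset V) (k ℓ : ℕ) (τ ε : ℝ) : Prop where
  disj : Disjoint X Y
  bad_empty : badPr E X Y k ∅ ≤ ε
  bad_singleton : ∀ v ∈ X ∪ Y, badPr E X Y k {v} ≤ ε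
  typ : pr (fun ω : Fin ℓ → V => (im V ω).card = ℓ ∧ im V ω ⊆ Y ∧ ¬ Typ E X Y k ℓ τ (im V ω)) ≤ ε

theorem exists_rich {k ℓ : ℕ} (hℓk : ℓ ≤ k) {δ : ℝ} (hδ : 0 < δ) {j m : ℕ} (hj : j ≤ m) (hm : 0 < m) (N : ℕ) :
    ∃ ε > 0, ∃ n₀ : ℕ, ∀ (V : Type) [DecidableEq V] [Fintype V] (E : Finset (Finset V))
      (X Y Z : Finset V) (τ : ℝ) (𝓕 : Finset (Finset V)), n₀ ≤ Fintype.card V → ExtPair E X Y k ℓ τ ε →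
      δ * Fintype.card V ≤ (Z ∩ X).card → δ * Fintype.card V ≤ (Z ∩ Y).card → 𝓕.card ≤ N →
      (∀ F ∈ 𝓕, badPr E X Y k F ≤ ε) →
      δ ^ m / 2 ≤ pr fun ω : Fin m → V => (im V ω).card = m ∧ Rich E X Y k ℓ τ 𝓕 j Z (im V ω) := by
  have hmr : (0 : ℝ) < m := by exact_mod_cast hm
  obtain ⟨n₁, hn₁⟩ := exists_forall_div_le ((m : ℝ) ^ 2) (by positivity : 0 < δ ^ m / 4)
  refine ⟨δ ^ m / 4 / (m ^ k * (N + 1)), by positivity, n₁ + 1, ?_⟩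
  intro V _ _ E X Y Z τ 𝓕 hn h hX hY hN hF
  have hne : Nonempty V := Fintype.card_pos_iff.1 (by omega)
  obtain ⟨q, rfl⟩ := Nat.exists_eq_add_of_le hj
  set ε := δ ^ (j + q) / 4 / ((j + q : ℕ) ^ k * (N + 1) : ℝ) with hε
  have hε0 : 0 < ε := by positivity
  have h1 := hn₁ (Fintype.card V) (by omega)
  refine (pr_rich_le hδ.le h.disj inter_subset_right inter_subset_right hX hY hm hℓk 𝓕 hF h.typ
    ?_).trans (pr_mono fun ω hω => ⟨hω.1, hω.2.1.trans ?_, hω.2.2⟩)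
  · have h2 : ((j + q : ℕ) : ℝ) ^ k * ((𝓕.card + 1) * ε) ≤ ((j + q : ℕ) : ℝ) ^ k * ((N + 1) * ε) := by
      gcongr
    have h3 : ((j + q : ℕ) : ℝ) ^ k * ((N + 1) * ε) = δ ^ (j + q) / 4 := by
      rw [hε]; field_simp
    linarith
  grind

/-- The two ends of an absorbing unit. -/
noncomputable def unitEnd (ℓ : ℕ) (X : Finset V) (b : Bool) (W : Finset V) : Finset V :=
  if b then (exists_disjoint_ends ℓ (W \ X)).choose else (exists_disjoint_ends ℓ (W \ X)).choose_spec.choose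

theorem absorbing_unit {τ : ℝ} (hk : 2 * ℓ < k) (hℓ : 1 ≤ ℓ) (hk4 : 4 ≤ k) (hXY : Disjoint X Y)
    (hZ : Z ⊆ X ∪ Y) (hZS : Disjoint Z S) (hSc : S.card = 2 * (k - ℓ))
    (hSX : (S ∩ X).card = 1) (hc : W.card = 2 * (k - ℓ) * (2 * (k - ℓ)) + ℓ)
    (hW : Rich E X Y k ℓ τ (insert ∅ (S.image singleton)) (2 * (k - ℓ)) Z W) :
    AbsValid E ℓ (Typ E X Y k ℓ τ) (wgt Y (k - ℓ)) ℓ (fun _ : Unit => unitEnd ℓ X true W)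
      (fun _ => W \ (unitEnd ℓ X true W ∪ unitEnd ℓ X false W)) (fun _ => unitEnd ℓ X false W) W ∧
    Spans E ℓ (fun _ : Unit => unitEnd ℓ X true W) (fun _ => unitEnd ℓ X false W) (W ∪ S) := by
  obtain ⟨hWZ, hWX, hWb, hWt⟩ := hW
  set t := k - ℓ with ht
  have htpos : 3 ≤ t := by omega
  have hWs := card_sdiff_add_card_inter W X
  have hbig : 2 * ℓ ≤ (W \ X).card := by
    have := Nat.mul_le_mul_left (2 * t) (by omega : 3 ≤ 2 * t)
    omega
  obtain ⟨hA, hB, hAB, hAc, hBc⟩ := (exists_disjoint_ends ℓ (W \ X)).choose_spec.choose_spec hbig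
  change unitEnd ℓ X true W ⊆ _ at hA
  change unitEnd ℓ X false W ⊆ _ at hB
  change Disjoint (unitEnd ℓ X true W) (unitEnd ℓ X false W) at hAB
  change (unitEnd ℓ X true W).card = _ at hAc
  change (unitEnd ℓ X false W).card = _ at hBc
  set A := unitEnd ℓ X true W
  set B := unitEnd ℓ X false W
  have hAW := hA.trans sdiff_subset
  have hBW := hB.trans sdiff_subset
  have hWs : W ⊆ X ∪ Y := hWZ.trans hZ
  have hWS : Disjoint W S := hZS.mono_left hWZ
  have hXY' : ∀ T ⊆ W \ X, T ⊆ Y := fun T hT v hv => by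
    have := mem_sdiff.1 (hT hv)
    grind
  have h0 : ∀ T ⊆ W, T.card = k → ¬ Bad E X Y ∅ T := fun T hT hTc =>
    hWb ∅ (mem_insert_self _ _) T hT (by rwa [card_empty])
  have p0 := pathOn_unit (S := ∅) hk hℓ hk4 hWs (disjoint_empty_right _) hA hB hAB hAc
    hBc (j := 2 * t) (by omega) (by rwa [union_empty]) (by rwa [union_empty]) (by simp) h0 (by simp)
  have p1 := pathOn_unit (S := S) hk hℓ hk4 hWs hWS hA hB hAB hAc
    hBc (j := 2 * t + 1) (by omega) (by rw [card_union_of_disjoint hWS, hc, hSc]; ring)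
    (by rw [union_inter_distrib_right, card_union_of_disjoint
      (hWS.mono inter_subset_left inter_subset_left), hWX, hSX]) (by omega) h0
    fun s hs T hT hTc => hWb {s} (mem_insert_of_mem (mem_image_of_mem _ hs)) T hT (by rwa [card_singleton])
  rw [union_empty] at p0
  have e0 := union_sdiff_union_eq hAW hBW
  have e1 := union_sdiff_union_eq (hAW.trans (subset_union_left (s₂ := S))) (hBW.trans subset_union_left)
  refine ⟨⟨fun _ => ⟨p0, hWt A hAW hAc (hXY' A hA), hWt B hBW hBc (hXY' B hB), ?_⟩,
    fun i j hij => absurd rfl hij, ?_⟩, fun _ => (W ∪ S) \ (A ∪ B), fun _ => p1,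
    fun i j hij => absurd rfl hij, ?_⟩
  · dsimp only
    rw [e0, sum_wgt_inter hXY hWs, hWX, hc]
    push_cast
    ring
  · simpa using e0
  · simpa using e1

/-- A balanced set splits into sets consisting of one vertex of `X` and `2 * t - 1` vertices of `Y`. -/
theorem exists_split {U : Finset V} {t : ℕ} (ht : 0 < t) (hXY : Disjoint X Y) (hU : U ⊆ X ∪ Y)
    (hw : ∑ v ∈ U, wgt Y t v = 0) : ∃ P : Finset (Finset V),
      (∀ S ∈ P, S ⊆ U ∧ S.card = 2 * t ∧ (S ∩ X).card = 1) ∧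
      (∀ S ∈ P, ∀ S' ∈ P, S ≠ S' → Disjoint S S') ∧ P.biUnion id = U := by
  rw [sum_wgt_inter hXY hU, sub_eq_zero] at hw
  norm_cast at hw
  have hs := card_sdiff_add_card_inter U X
  obtain ⟨P, hP, hPd, hPU⟩ := exists_partition_card (2 * t - 1) (U ∩ X).card (U \ X) (by
    rw [Nat.sub_mul]; omega)
  have hPc : P.card = (U ∩ X).card := by
    have h1 := card_biUnion (s := P) (t := id) fun S hS S' hS' h => hPd S hS S' hS' h
    rw [hPU, sum_congr rfl fun S hS => (hP S hS : (id S).card = _), sum_const, smul_eq_mul] at h1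
    have h2 : (2 * t - 1) * P.card = (2 * t - 1) * (U ∩ X).card := by
      rw [mul_comm, ← h1, Nat.sub_mul]; omega
    exact Nat.eq_of_mul_eq_mul_left (by omega) h2
  obtain ⟨e⟩ : Nonempty (P ≃ (U ∩ X : Finset V)) := ⟨equivOfCardEq hPc⟩
  have hsub : ∀ S ∈ P, S ⊆ U \ X := fun S hS => hPU ▸ subset_biUnion_of_mem id hS
  have hnot : ∀ S ∈ P, ∀ v ∈ U ∩ X, v ∉ S := fun S hS v hv h =>
    (mem_sdiff.1 (hsub S hS h)).2 (mem_inter.1 hv).2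
  refine ⟨univ.image fun S : P => insert (e S : V) S.1, ?_, ?_, ?_⟩
  · simp only [mem_image, mem_univ, true_and, forall_exists_index, forall_apply_eq_imp_iff]
    rintro ⟨S, hS⟩
    have hm := mem_inter.1 (e ⟨S, hS⟩).2
    refine ⟨insert_subset hm.1 ((hsub S hS).trans sdiff_subset), ?_, ?_⟩
    · grind
    · rw [insert_inter_of_mem hm.2, disjoint_iff_inter_eq_empty.1
        (disjoint_of_subset_left (hsub S hS) sdiff_disjoint)]
      rfl
  · simp only [mem_image, mem_univ, true_and, forall_exists_index, forall_apply_eq_imp_iff]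
    rintro ⟨S, hS⟩ ⟨S', hS'⟩ hne
    have hne' : S ≠ S' := fun h => hne (by subst h; rfl)
    rw [disjoint_insert_left, disjoint_insert_right, mem_insert, not_or]
    refine ⟨⟨fun h => hne' ?_, hnot S' hS' _ (e _).2⟩, hnot S hS _ (e _).2, hPd S hS S' hS' hne'⟩
    simpa using e.injective (Subtype.ext h)
  · ext v
    simp only [mem_biUnion, mem_image, mem_univ, true_and, id, exists_exists_eq_and, mem_insert]
    constructor
    · grind
    · intro hv
      by_cases hvX : v ∈ X
      · exact ⟨e.symm ⟨v, mem_inter.2 ⟨hv, hvX⟩⟩, .inl (by simp)⟩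
      · have : v ∈ P.biUnion id := hPU ▸ mem_sdiff.2 ⟨hv, hvX⟩
        obtain ⟨S, hS, hvS⟩ := mem_biUnion.1 this
        exact ⟨⟨S, hS⟩, .inr hvS⟩

end Units

section Cover

variable {V : Type} [DecidableEq V] {E : Finset (Finset V)} {k ℓ : ℕ} {X Y Z : Finset V}

/-- `U` is the vertex set of a path with typical ends that has weight `-ℓ`. -/
def IsPiece [Fintype V] (E : Finset (Finset V)) (X Y : Finset V) (k ℓ : ℕ) (τ : ℝ) (U : Finset V) : Prop :=
  ∃ L M L', PathOn E ℓ L M L' ∧ Typ E X Y k ℓ τ L ∧ Typ E X Y k ℓ τ L' ∧ L ∪ M ∪ L' = U ∧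
    ∑ v ∈ U, wgt Y (k - ℓ) v = -ℓ

theorem Rich.isPiece [Fintype V] {τ : ℝ} {W : Finset V} {j : ℕ} (hk : 2 * ℓ < k) (hℓ : 1 ≤ ℓ) (hk4 : 4 ≤ k)
    (hXY : Disjoint X Y) (hZ : Z ⊆ X ∪ Y) (hj : 0 < j) (hW : Rich E X Y k ℓ τ {∅} j Z W)
    (hc : W.card = 2 * (k - ℓ) * j + ℓ) : IsPiece E X Y k ℓ τ W := by
  obtain ⟨hWZ, hWX, hWb, hWt⟩ := hW
  have hWs := card_sdiff_add_card_inter W X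
  have hbig : 2 * ℓ ≤ (W \ X).card := by
    have h1 := Nat.mul_le_mul_right j (by omega : 2 * ℓ + 1 ≤ 2 * (k - ℓ))
    have h2 : 2 * ℓ * 1 ≤ 2 * ℓ * j := Nat.mul_le_mul_left (2 * ℓ) hj
    grind
  obtain ⟨A, B, h⟩ := exists_disjoint_ends ℓ (W \ X)
  obtain ⟨hA, hB, hAB, hAc, hBc⟩ := h hbig
  have hAW := hA.trans sdiff_subset
  have hBW := hB.trans sdiff_subset
  have hXY' : ∀ T ⊆ W \ X, T ⊆ Y := fun T hT v hv => by
    grind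
  have p0 := pathOn_unit (S := ∅) hk hℓ hk4 (hWZ.trans hZ) (disjoint_empty_right _) hA hB hAB hAc
    hBc hj (by rwa [union_empty]) (by rwa [union_empty]) (by simp)
    (fun T hT hTc => hWb ∅ (mem_singleton_self _) T hT (by rwa [card_empty])) (by simp)
  rw [union_empty] at p0
  refine ⟨A, _, B, p0, hWt A hAW hAc (hXY' A hA), hWt B hBW hBc (hXY' B hB),
    union_sdiff_union_eq hAW hBW, ?_⟩
  rw [sum_wgt_inter hXY (hWZ.trans hZ), hWX, hc]
  push_cast
  ring

theorem exists_cover {k ℓ : ℕ} (hk4 : 4 ≤ k) (hℓ : 1 ≤ ℓ) (hk : 2 * ℓ < k) {β : ℝ} (hβ : 0 < β) :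
    ∃ ε > 0, ∃ n₀ : ℕ, ∀ (V : Type) [DecidableEq V] [Fintype V] (E : Finset (Finset V))
      (X Y D R₁ R₂ : Finset V) (τ : ℝ), n₀ ≤ Fintype.card V → ExtPair E X Y k ℓ τ ε → D ⊆ X ∪ Y →
      R₁ ⊆ D → R₂ ⊆ D → Disjoint R₁ R₂ → ∑ v ∈ D \ R₁, wgt Y (k - ℓ) v = ℓ →
      ∃ (b : ℕ) (L M L' : Fin b → Finset V), (b : ℝ) ≤ β * Fintype.card V ∧
        (∀ i, PathOn E ℓ (L i) (M i) (L' i) ∧ Typ E X Y k ℓ τ (L i) ∧ Typ E X Y k ℓ τ (L' i) ∧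
          ∑ v ∈ L i ∪ M i ∪ L' i, wgt Y (k - ℓ) v = -ℓ ∧ L i ∪ M i ∪ L' i ⊆ D \ (R₁ ∪ R₂)) ∧
        (∀ i j, i ≠ j → Disjoint (L i ∪ M i ∪ L' i) (L j ∪ M j ∪ L' j)) ∧
        ((D \ (R₁ ∪ R₂ ∪ univ.biUnion fun i => L i ∪ M i ∪ L' i)).card : ℝ) ≤
          β * Fintype.card V + 2 * (k - ℓ : ℕ) * R₂.card := by
  set t := k - ℓ with ht
  obtain ⟨j, hj⟩ := exists_nat_gt (4 / β)
  have hjr : (0 : ℝ) < j := lt_trans (by positivity) hj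
  have hjpos : 0 < j := by exact_mod_cast hjr
  have htr : (3 : ℝ) ≤ t := by exact_mod_cast (by omega : 3 ≤ t)
  rw [div_lt_iff₀ hβ] at hj
  set δ := β / (4 * t) with hδ
  set m := 2 * t * j + ℓ with hm
  have hmj : j + 1 ≤ m := by
    have := Nat.mul_le_mul_right j (by omega : 1 ≤ 2 * t)
    omega
  obtain ⟨ε, hε, n₁, hrich⟩ := exists_rich (k := k) (ℓ := ℓ) (by omega) (by positivity : 0 < δ) (j := j) (m := m)
    (by omega) (by omega) 1
  obtain ⟨n₂, hn₂⟩ := exists_forall_div_le (ℓ : ℝ) (by positivity : 0 < β / 8)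
  refine ⟨ε, hε, n₁ + n₂ + 1, fun V _ _ E X Y D R₁ R₂ τ hn h hD hR₁ hR₂ hR hw => ?_⟩
  classical
  have hnr : (0 : ℝ) < Fintype.card V := by exact_mod_cast (by omega : 0 < Fintype.card V)
  have hℓn := hn₂ (Fintype.card V) (by omega)
  rw [div_le_iff₀ hnr] at hℓn
  set F := D \ (R₁ ∪ R₂) with hF
  let fam : Finset (Finset (Finset V)) := univ.filter fun P =>
    (∀ U ∈ P, U ⊆ F ∧ U.card = m ∧ IsPiece E X Y k ℓ τ U) ∧ ∀ U ∈ P, ∀ U' ∈ P, U ≠ U' → Disjoint U U'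
  obtain ⟨P, hP, hmax⟩ := exists_max_image fam card ⟨∅, by simp [fam]⟩
  obtain ⟨hPu, hPd⟩ := (mem_filter.1 hP).2
  set Z := F \ P.biUnion id with hZ
  have hZs : Z ⊆ X ∪ Y := sdiff_subset.trans (sdiff_subset.trans hD)
  have hsmall : ((Z ∩ X).card : ℝ) < δ * Fintype.card V ∨ ((Z ∩ Y).card : ℝ) < δ * Fintype.card V := by
    by_contra! hc
    obtain ⟨ω, hωc, hω⟩ := exists_of_pr_pos (lt_of_lt_of_le (by positivity)
      (hrich V E X Y Z τ {∅} (by omega) h hc.1 hc.2 (by simp) (by simpa using h.bad_empty)))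
    have hωZ := hω.1
    have hdis : ∀ U ∈ P, Disjoint (im V ω) U := fun U hU => by
      refine disjoint_of_subset_left hωZ (sdiff_disjoint.mono_right ?_)
      grind
    have hnot : im V ω ∉ P := fun hU => by
      grind
    have hins : insert (im V ω) P ∈ fam := by
      refine mem_filter.2 ⟨mem_univ _, fun U hU => ?_, fun U hU U' hU' hne => ?_⟩
      · rcases mem_insert.1 hU with rfl | hU
        · exact ⟨hωZ.trans sdiff_subset, hωc, hω.isPiece hk hℓ hk4 h.disj hZs hjpos hωc⟩
        · exact hPu U hU
      grind
    grind
  have hPdis : (P : Set (Finset V)).PairwiseDisjoint id := fun U hU U' hU' hne => hPd U hU U' hU' hne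
  have hPF : P.biUnion id ⊆ F := biUnion_subset.2 fun U hU => (hPu U hU).1
  have hb : P.card * m ≤ Fintype.card V := by
    rw [← card_univ]
    refine le_trans (le_of_eq ?_) (card_le_card (subset_univ (P.biUnion id)))
    rw [card_biUnion hPdis, sum_congr rfl fun U hU => ((hPu U hU).2.1 : (id U).card = m), sum_const,
      smul_eq_mul]
  have hwP : ∑ v ∈ P.biUnion id, wgt Y t v = -(P.card * ℓ) := by
    have h1 : ∀ U ∈ P, ∑ v ∈ id U, wgt Y t v = -ℓ := fun U hU => by
      obtain ⟨-, -, -, -, -, -, -, h⟩ := (hPu U hU).2.2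
      exact h
    rw [sum_biUnion hPdis, sum_congr rfl h1, sum_const, nsmul_eq_mul]
    ring
  have hw1 : ∑ v ∈ Z, wgt Y t v + ∑ v ∈ P.biUnion id, wgt Y t v = ∑ v ∈ F, wgt Y t v := sum_sdiff hPF
  have hw2 : ∑ v ∈ F, wgt Y t v + ∑ v ∈ R₂, wgt Y t v = ∑ v ∈ D \ R₁, wgt Y t v := by
    rw [hF, show D \ (R₁ ∪ R₂) = (D \ R₁) \ R₂ from sdiff_sdiff_left.symm]
    exact sum_sdiff (subset_sdiff.2 ⟨hR₂, hR.symm⟩)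
  have hwR : |∑ v ∈ R₂, wgt Y t v| ≤ (2 * t - 1) * R₂.card := by
    refine (abs_sum_le_sum_abs _ _).trans ((sum_le_card_nsmul _ _ (2 * t - 1 : ℤ) fun v _ => ?_).trans
      (by grind))
    unfold wgt
    grind
  have hZc : Z.card = (Z ∩ X).card + (Z ∩ Y).card := by
    rw [← card_union_of_disjoint (h.disj.mono inter_subset_right inter_subset_right),
      ← inter_union_distrib_left, inter_eq_left.2 hZs]
  rw [hwP, sum_wgt_inter h.disj hZs, hZc] at hw1
  have hrel : 2 * (t : ℤ) * (Z ∩ X).card - ((Z ∩ X).card + (Z ∩ Y).card : ℕ) - P.card * ℓ +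
      ∑ v ∈ R₂, wgt Y t v = ℓ := by linarith
  have hrel' : 2 * (t : ℝ) * (Z ∩ X).card - ((Z ∩ X).card + (Z ∩ Y).card : ℕ) - P.card * ℓ +
      ((∑ v ∈ R₂, wgt Y t v : ℤ) : ℝ) = ℓ := by exact_mod_cast hrel
  have hwR' : |((∑ v ∈ R₂, wgt Y t v : ℤ) : ℝ)| ≤ (2 * t - 1) * R₂.card := by exact_mod_cast hwR
  generalize hsdef : ((∑ v ∈ R₂, wgt Y t v : ℤ) : ℝ) = s at hrel' hwR'
  have hbr : (P.card : ℝ) * (2 * t * j + ℓ) ≤ Fintype.card V := by exact_mod_cast hb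
  have hℓt : (ℓ : ℝ) ≤ t := by exact_mod_cast (by omega : ℓ ≤ t)
  have hPℓ : (P.card : ℝ) * ℓ ≤ β / 8 * Fintype.card V := by
    have h1 : (P.card : ℝ) * ℓ * 8 ≤ P.card * (2 * t * j) * β := by
      have : (P.card : ℝ) * (ℓ * 8) ≤ P.card * (2 * t * (j * β)) :=
        mul_le_mul_of_nonneg_left (by nlinarith) (Nat.cast_nonneg _)
      linarith
    have h2 : (P.card : ℝ) * (2 * t * j) ≤ Fintype.card V := by
      have : (0 : ℝ) ≤ P.card * ℓ := by positivity
      linarith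
    nlinarith
  have hleft : (Z.card : ℝ) ≤ β * Fintype.card V + 2 * t * R₂.card := by
    have h2 := abs_le.1 hwR'
    have hδt : t * (δ * Fintype.card V) = β / 4 * Fintype.card V := by
      rw [hδ]; field_simp
    have hR0 : (0 : ℝ) ≤ R₂.card := Nat.cast_nonneg _
    have hX0 : (0 : ℝ) ≤ (Z ∩ X).card := Nat.cast_nonneg _
    have hP0 : (0 : ℝ) ≤ (P.card : ℝ) * ℓ := by positivity
    have hℓ0 : (0 : ℝ) ≤ ℓ := Nat.cast_nonneg _
    have hn0 : 0 < β * Fintype.card V := by positivity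
    push_cast at hrel'
    rw [hZc]
    push_cast
    rcases hsmall with hx | hy
    · have : (t : ℝ) * (Z ∩ X).card ≤ t * (δ * Fintype.card V) :=
        mul_le_mul_of_nonneg_left hx.le (by linarith)
      linarith
    · have : (3 : ℝ) * (Z ∩ X).card ≤ t * (Z ∩ X).card := mul_le_mul_of_nonneg_right htr hX0
      have h3 : 3 * (δ * Fintype.card V) ≤ t * (δ * Fintype.card V) :=
        mul_le_mul_of_nonneg_right htr (by positivity)
      linarith
  have hPb : (P.card : ℝ) ≤ β * Fintype.card V := by
    have : (P.card : ℝ) * 1 ≤ P.card * ℓ :=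
      mul_le_mul_of_nonneg_left (by exact_mod_cast hℓ) (Nat.cast_nonneg _)
    grind
  have hex : ∀ U : P, IsPiece E X Y k ℓ τ U.1 := fun U => (hPu U.1 U.2).2.2
  choose L M L' hp hL hL' hU hwU using hex
  let e := P.equivFin.symm
  have hun : univ.biUnion (fun i => L (e i) ∪ M (e i) ∪ L' (e i)) = P.biUnion id := by
    ext v
    simp only [mem_biUnion, mem_univ, true_and, hU, id]
    refine ⟨fun ⟨i, hi⟩ => ⟨_, (e i).2, hi⟩, fun ⟨U, hU, hv⟩ => ⟨e.symm ⟨U, hU⟩, by simpa using hv⟩⟩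
  refine ⟨P.card, fun i => L (e i), fun i => M (e i), fun i => L' (e i), hPb, fun i =>
    ⟨hp _, hL _, hL' _, ?_, ?_⟩, fun i i' hne => ?_, ?_⟩
  · rw [hU]; exact hwU _
  · grind
  · rw [hU, hU]
    exact hPd _ (e i).2 _ (e i').2 fun h => hne (e.injective (Subtype.ext h))
  · rw [hun, show D \ (R₁ ∪ R₂ ∪ P.biUnion id) = Z from sdiff_sdiff_left.symm]
    exact hleft

end Cover

section Initial

variable {V : Type} [DecidableEq V] {E : Finset (Finset V)} {k ℓ N : ℕ} {X Y : Finset V} {τ : ℝ}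

/-- `P` is the vertex set of a path outside `U` with ends in `Y` and weight `s - ℓ`. -/
def Block (E : Finset (Finset V)) (Y : Finset V) (k ℓ : ℕ) (s : ℤ) (U P : Finset V) : Prop :=
  ∃ L M L', PathOn E ℓ L M L' ∧ L ⊆ Y ∧ L' ⊆ Y ∧ L ∪ M ∪ L' = P ∧ P.card ≤ 2 * k ∧ Disjoint P U ∧
    ∑ v ∈ P, wgt Y (k - ℓ) v + ℓ = s

variable [Fintype V]

/-- `W` is the vertex set of a path with typical ends and weight `z - ℓ`. -/
def Trail (E : Finset (Finset V)) (X Y : Finset V) (k ℓ : ℕ) (τ : ℝ) (z : ℤ) (W : Finset V) : Prop :=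
  ∃ L M L', PathOn E ℓ L M L' ∧ Typ E X Y k ℓ τ L ∧ Typ E X Y k ℓ τ L' ∧ L ∪ M ∪ L' = W ∧
    ∑ v ∈ W, wgt Y (k - ℓ) v + ℓ = z

/-- Outside any set of at most `N` vertices there are connectors and small rich sets. -/
structure Flexible (E : Finset (Finset V)) (X Y : Finset V) (k ℓ : ℕ) (τ : ℝ) (N : ℕ) : Prop where
  disj : Disjoint X Y
  conn : ∀ U A B, U.card ≤ N → A ⊆ Y → A.card = ℓ → Typ E X Y k ℓ τ B → Disjoint A B → ∃ Q, Disjoint Q U ∧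
    Q ⊆ X ∪ Y ∧ PathOn E ℓ A Q B ∧ ∑ v ∈ Q, wgt Y (k - ℓ) v = ℓ ∧ Q.card ≤ 2 * k
  rich : ∀ U, U.card ≤ N → ∃ W, W.card = 2 * (k - ℓ) * 1 + ℓ ∧ Rich E X Y k ℓ τ {∅} 1 ((X ∪ Y) \ U) W

variable {z s : ℤ} {U W P : Finset V}

theorem Flexible.exists_typ (h : Flexible E X Y k ℓ τ N) (hk : 2 * ℓ < k) (hU : U.card ≤ N) :
    ∃ T, Typ E X Y k ℓ τ T ∧ Disjoint T U := by
  obtain ⟨W, hc, hW, h1, -, ht⟩ := h.rich U hU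
  have h2 := card_sdiff_add_card_inter W X
  obtain ⟨T, hT, hTc⟩ := exists_subset_card_eq (s := W \ X) (n := ℓ) (by omega)
  have hTW := hT.trans sdiff_subset
  refine ⟨T, ht T hTW hTc fun v hv => ?_, disjoint_of_subset_left (hTW.trans hW) sdiff_disjoint⟩
  grind

theorem Trail.append (h : Flexible E X Y k ℓ τ N) (hk : 2 * ℓ < k) (hW : Trail E X Y k ℓ τ z W)
    (hN : W.card + 5 * k ≤ N) (hP : Block E Y k ℓ s W P) :
    ∃ W', Trail E X Y k ℓ τ (z + s) W' ∧ W'.card ≤ W.card + 7 * k ∧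
      W' \ (X ∪ Y) = (W ∪ P) \ (X ∪ Y) := by
  obtain ⟨L₀, M₀, L₁, p0, t0, t1, rfl, hz⟩ := hW
  obtain ⟨L, M, L', p1, hL, hL', rfl, hPc, hPd, hs⟩ := hP
  set W := L₀ ∪ M₀ ∪ L₁ with hW
  set P := L ∪ M ∪ L' with hP
  have hWP := card_union_le W P
  obtain ⟨T, hT, hTd⟩ := h.exists_typ (U := W ∪ P) hk (by omega)
  have hTc : T.card = ℓ := hT.1
  have hWPT := card_union_le (W ∪ P) T
  obtain ⟨Q₁, hQ₁, hQ₁X, q1, hw1, hc1⟩ := h.conn (W ∪ P ∪ T) L L₁ (by omega) hL p1.card_left t1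
    (hPd.mono (subset_union_left.trans subset_union_left) subset_union_right)
  have hWQ := card_union_le (W ∪ P ∪ T) Q₁
  obtain ⟨Q₂, hQ₂, hQ₂X, q2, hw2, hc2⟩ := h.conn (W ∪ P ∪ T ∪ Q₁) L' T (by omega) hL' p1.card_right hT
    (hTd.mono_right (subset_union_right.trans subset_union_right)).symm
  have d0 := p0.disj
  have d1 := p1.disj
  simp only [disjoint_union_right] at hQ₁ hQ₂ hTd
  obtain ⟨⟨hQW, hQP⟩, hQT⟩ := hQ₁
  obtain ⟨⟨⟨hRW, hRP⟩, hRT⟩, hRQ⟩ := hQ₂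
  obtain ⟨hTW, hTP⟩ := hTd
  have hW₁ : L₀ ∪ M₀ ⊆ W := subset_union_left
  have hP₁ : M ∪ L' ⊆ P := by grind
  have hLP : L ⊆ P := subset_union_left.trans subset_union_left
  have hL₁W : L₁ ⊆ W := subset_union_right
  have c1 := p0.cat q1.symm (by
    rw [disjoint_union_right]
    grind)
  have hL0P : L₀ ∪ (M₀ ∪ L₁ ∪ Q₁) = W ∪ Q₁ := by grind
  have c2 := c1.cat p1 (by
    rw [hL0P, disjoint_union_left]
    grind)
  have hL1P : L₀ ∪ (M₀ ∪ L₁ ∪ Q₁ ∪ L ∪ M) = W ∪ Q₁ ∪ (L ∪ M) := by grind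
  have hLM : L ∪ M ⊆ P := subset_union_left
  have c3 := c2.cat q2 (by
    rw [hL1P, disjoint_union_right]
    exact ⟨disjoint_union_left.2 ⟨disjoint_union_left.2 ⟨hRW.symm, hRQ.symm⟩, (hRP.mono_right hLM).symm⟩,
      disjoint_union_left.2 ⟨disjoint_union_left.2 ⟨hTW.symm, hQT⟩, (hTP.mono_right hLM).symm⟩⟩)
  have hall : L₀ ∪ (M₀ ∪ L₁ ∪ Q₁ ∪ L ∪ M ∪ L' ∪ Q₂) ∪ T = W ∪ Q₁ ∪ P ∪ Q₂ ∪ T := by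
    grind
  have e1 : Disjoint W Q₁ := hQW.symm
  have e2 : Disjoint (W ∪ Q₁) P := disjoint_union_left.2 ⟨hPd.symm, hQP⟩
  have e3 : Disjoint (W ∪ Q₁ ∪ P) Q₂ :=
    disjoint_union_left.2 ⟨disjoint_union_left.2 ⟨hRW.symm, hRQ.symm⟩, hRP.symm⟩
  have e4 : Disjoint (W ∪ Q₁ ∪ P ∪ Q₂) T := disjoint_union_left.2
    ⟨disjoint_union_left.2 ⟨disjoint_union_left.2 ⟨hTW.symm, hQT⟩, hTP.symm⟩, hRT⟩
  have hTX : T ⊆ X ∪ Y := hT.2.1.trans subset_union_right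
  refine ⟨W ∪ Q₁ ∪ P ∪ Q₂ ∪ T, ⟨L₀, _, T, c3, t0, hT, hall, ?_⟩, ?_, ?_⟩
  · have hwT : ∑ v ∈ T, wgt Y (k - ℓ) v = -ℓ := by
      rw [sum_wgt, sdiff_eq_empty_iff_subset.2 hT.2.1, hTc]; simp
    rw [sum_union e4, sum_union e3, sum_union e2, sum_union e1, hw1, hw2, hwT]
    linarith
  · grind
  grind

theorem Trail.iterate (h : Flexible E X Y k ℓ τ N) (hk : 2 * ℓ < k) {m : ℕ} (hmN : m + 5 * k ≤ N)
    (hs : ∀ U : Finset V, U.card ≤ m → ∃ P ⊆ X ∪ Y, Block E Y k ℓ s U P) (hW : Trail E X Y k ℓ τ z W) (r : ℕ)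
    (hr : W.card + 7 * k * r ≤ m + 7 * k) :
    ∃ W', Trail E X Y k ℓ τ (z + r * s) W' ∧ W'.card ≤ W.card + 7 * k * r ∧
      W' \ (X ∪ Y) = W \ (X ∪ Y) := by
  induction r with
  | zero => grind
  | succ r ih =>
    have hr' : 7 * k * (r + 1) = 7 * k * r + 7 * k := by ring
    obtain ⟨W', h1, h2, h3⟩ := ih (by omega)
    obtain ⟨P, hPX, hP⟩ := hs W' (by omega)
    obtain ⟨W'', h4, h5, h6⟩ := h1.append h hk (by omega) hP
    refine ⟨W'', ?_, by omega, ?_⟩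
    · grind
    grind

theorem Trail.cover (h : Flexible E X Y k ℓ τ N) (hk : 2 * ℓ < k) {m : ℕ} (hmN : m + 5 * k ≤ N)
    (hs : ∀ U : Finset V, U.card ≤ m → ∀ v ∉ X ∪ Y, v ∉ U → ∃ P, P \ (X ∪ Y) = {v} ∧ Block E Y k ℓ 0 U P)
    (hW : Trail E X Y k ℓ τ z W) (hWX : W ⊆ X ∪ Y) (T : Finset V) (hT : Disjoint T (X ∪ Y))
    (hr : W.card + 7 * k * T.card ≤ m + 7 * k) :
    ∃ W', Trail E X Y k ℓ τ z W' ∧ W'.card ≤ W.card + 7 * k * T.card ∧ W' \ (X ∪ Y) = T := by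
  induction T using Finset.induction_on with
  | empty => grind
  | insert v T hv ih =>
    rw [card_insert_of_notMem hv, mul_add] at *
    rw [disjoint_insert_left] at hT
    obtain ⟨W', h1, h2, h3⟩ := ih hT.2 (by omega)
    obtain ⟨P, hPX, hP⟩ := hs W' (by omega) v hT.1 fun hv' =>
      hv (h3 ▸ mem_sdiff.2 ⟨hv', hT.1⟩)
    obtain ⟨W'', h4, h5, h6⟩ := h1.append h hk (by omega) hP
    refine ⟨W'', by simpa using h4, by omega, ?_⟩
    rw [h6, union_sdiff_distrib, hPX, h3, union_comm, insert_eq]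

theorem Flexible.exists_start (h : Flexible E X Y k ℓ τ N) (hk : 2 * ℓ < k) (hℓ : 1 ≤ ℓ) (hk4 : 4 ≤ k) :
    ∃ W ⊆ X ∪ Y, Trail E X Y k ℓ τ 0 W ∧ W.card ≤ 2 * k := by
  obtain ⟨W, hc, hW⟩ := h.rich ∅ (by simp)
  obtain ⟨L, M, L', p, h1, h2, h3, h4⟩ := hW.isPiece hk hℓ hk4 h.disj sdiff_subset one_pos hc
  exact ⟨W, hW.1.trans sdiff_subset, ⟨L, M, L', p, h1, h2, h3, by rw [h4]; simp⟩, by omega⟩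

omit [Fintype V] in
theorem block_of_edge {e : Finset V} (hk : 2 * ℓ < k) (hE : ∀ e ∈ E, e.card = k) (he : e ∈ E)
    (hU : Disjoint e U) {i : ℕ} (hXY : Disjoint X Y) (heX : e ⊆ X ∪ Y) (hi : (e ∩ X).card = i) (hik : i ≤ 1) :
    Block E Y k ℓ ((k - ℓ : ℕ) * (2 * i - 1)) U e := by
  have hc := hE e he
  have h1 := card_sdiff_add_card_inter e X
  obtain ⟨A, B, h⟩ := exists_disjoint_ends ℓ (e \ X)
  obtain ⟨hA, hB, hAB, hAc, hBc⟩ := h (by omega)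
  have hAe := hA.trans sdiff_subset
  have hBe := hB.trans sdiff_subset
  have hY : ∀ T ⊆ e \ X, T ⊆ Y := fun T hT v hv =>
    (mem_union.1 (heX (mem_sdiff.1 (hT hv)).1)).resolve_left (mem_sdiff.1 (hT hv)).2
  have heq := union_sdiff_union_eq hAe hBe
  refine ⟨A, e \ (A ∪ B), B, .edge hAc hBc (disjoint_sdiff.mono_left subset_union_left) hAB
    (sdiff_disjoint.mono_right subset_union_right) (by rwa [heq]), hY A hA, hY B hB, heq, by omega, hU, ?_⟩
  rw [sum_wgt_inter hXY heX, hi, hc, Nat.cast_sub (by omega)]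
  ring

theorem Flexible.exists_block (h : Flexible E X Y k ℓ τ N) (hk : 2 * ℓ < k) (hE : ∀ e ∈ E, e.card = k)
    (hU : U.card ≤ N) : ∃ P ⊆ X ∪ Y, Block E Y k ℓ (k - ℓ : ℕ) U P := by
  obtain ⟨W, hc, hW, h1, hb, -⟩ := h.rich U hU
  obtain ⟨e, hxe, heW, hec⟩ := exists_subsuperset_card_eq (s := W ∩ X) (t := W) inter_subset_left
    (n := k) (by omega) (by omega)
  have heX : (e ∩ X).card = 1 := by
    rw [← h1]
    congr 1
    grind
  have heXY : e ⊆ X ∪ Y := (heW.trans hW).trans sdiff_subset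
  refine ⟨e, heXY, ?_⟩
  have he : e ∈ E := by
    by_contra he
    exact hb ∅ (mem_singleton_self _) e heW (by grind)
      ⟨disjoint_empty_left _, heXY, by rwa [empty_union], by rwa [empty_union]⟩
  convert block_of_edge hk hE he
    (disjoint_of_subset_left (heW.trans hW) sdiff_disjoint) h.disj heXY heX le_rfl using 1
  push_cast
  ring

end Initial

section Blocks

variable {V : Type} [DecidableEq V] [Fintype V] {E : Finset (Finset V)} {k ℓ : ℕ} {X Y U : Finset V}

theorem pr_prod_le_mul {A B : Type} [Fintype A] [Fintype B] {P : A → Prop} {Q : A → B → Prop} {c : ℝ}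
    (h : ∀ a, P a → pr (Q a) ≤ c) : pr (fun x : A × B => P x.1 ∧ Q x.1 x.2) ≤ c * pr P := by
  rw [pr_prod, pr, ← ex_mul_left]
  refine ex_mono fun a => ?_
  split_ifs with ha
  · rw [mul_one]; exact (pr_mono fun _ hb => hb.2).trans (h a ha)
  · rw [pr_false fun _ hb => ha hb.1, mul_zero]

theorem pr_meet_le {m : ℕ} {P : Finset V → Prop} {σ : ℝ}
    (h : ∀ b ∈ U, pr (fun ω : Fin m → V => P (insert b (univ.image ω))) ≤ σ) :
    pr (fun ω : Fin (m + 1) → V => P (univ.image ω) ∧ ¬ Disjoint (univ.image ω) U) ≤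
      (m + 1) * (σ * (U.card / Fintype.card V)) := by
  have h1 : ∀ i : Fin (m + 1), pr (fun ω : Fin (m + 1) → V => ω i ∈ U ∧ P (univ.image ω)) ≤
      σ * (U.card / Fintype.card V) := fun i => by
    rw [← pr_mem, ← pr_equiv (Fin.insertNthEquiv (fun _ => V) i)]
    refine (pr_mono fun x hx => ?_).trans (pr_prod_le_mul h)
    have h2 : univ.image (Fin.insertNthEquiv (fun _ => V) i x) = insert x.1 (univ.image x.2) := by
      rw [← coe_inj, coe_insert, coe_image, coe_image, coe_univ, coe_univ, Set.image_univ, Set.image_univ]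
      exact Fin.range_insertNth i x.1 x.2
    rw [h2] at hx
    simpa using hx
  refine (pr_mono fun ω hω => ?_).trans ((pr_exists_le univ fun (i : Fin (m + 1)) (ω : Fin (m + 1) → V) =>
    ω i ∈ U ∧ P (univ.image ω)).trans ((sum_le_card_nsmul _ _ _ fun i _ => h1 i).trans (le_of_eq ?_)))
  · obtain ⟨v, hv, hvU⟩ := not_disjoint_iff.1 hω.2
    grind
  · simp

theorem pr_inner_pair_le [Nonempty V] {d : ℝ} (h : PairDeg E k d) (hE : ∀ e ∈ E, e.card = k) {S : Finset V}
    (hS : S.card + 2 = k) : d - 1 + ((Y.card : ℝ) / Fintype.card V) ^ 2 +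
      (1 - (Y.card : ℝ) / Fintype.card V) / Fintype.card V ≤
      pr fun x : V × V => S ∪ {x.1, x.2} ∈ E ∧ x.1 ∈ Y ∧ x.2 ∈ Y := by
  have hn : (0 : ℝ) < Fintype.card V := by exact_mod_cast Fintype.card_pos
  have h1 := h S hS
  rw [pr_split _ fun x : V × V => x.1 ∈ Y ∧ x.2 ∈ Y] at h1
  have h2 := pr_and_prod (fun v : V => v ∈ Y) (fun v : V => v ∈ Y)
  rw [pr_mem] at h2
  have h3 := pr_add_pr_not fun x : V × V => x.1 ∈ Y ∧ x.2 ∈ Y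
  rw [pr_split (fun x : V × V => ¬ (x.1 ∈ Y ∧ x.2 ∈ Y)) fun x : V × V => S ∪ {x.1, x.2} ∈ E] at h3
  have h4 : pr (fun x : V × V => S ∪ {x.1, x.2} ∈ E ∧ ¬ (x.1 ∈ Y ∧ x.2 ∈ Y)) ≤
      pr fun x : V × V => ¬ (x.1 ∈ Y ∧ x.2 ∈ Y) ∧ S ∪ {x.1, x.2} ∈ E := pr_mono fun x hx => hx.symm
  have h5 : 1 / (Fintype.card V : ℝ) * pr (fun v : V => ¬ v ∈ Y) ≤
      pr fun x : V × V => ¬ (x.1 ∈ Y ∧ x.2 ∈ Y) ∧ ¬ S ∪ {x.1, x.2} ∈ E := by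
    refine (mul_pr_le_prod (Q := fun a b : V => b ∈ ({a} : Finset V)) fun a _ => by
      rw [pr_mem, card_singleton, Nat.cast_one]).trans (pr_mono fun x hx => ⟨fun h => hx.1 h.1, fun h => ?_⟩)
    grind
  have h6 := pr_add_pr_not fun v : V => v ∈ Y
  rw [pr_mem] at h6
  rw [← h6, add_sub_cancel_left, div_eq_inv_mul (pr _), ← one_div, sq]
  linarith

/-- If `Y` is larger than its ideal size then there are edges inside `Y` avoiding a given small set. -/
theorem exists_edge_avoiding {a θ σ : ℝ} (hk4 : 4 ≤ k) (hE : ∀ e ∈ E, e.card = k) (ha : 0 < a)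
    (ha6 : a ≤ 1 / 6) (hθ : 1 ≤ θ) (hY : ((univ \ Y).card : ℝ) + θ / 2 = a * Fintype.card V)
    (hd : PairDeg E k ((2 * a - a ^ 2) * (1 - 1 / Fintype.card V))) (hσ : 0 ≤ σ)
    (hb : ∀ b ∈ Y, pr (fun ω : Fin (k - 1) → V => im V ω ⊆ Y ∧ insert b (im V ω) ∈ E) ≤ σ)
    (hn : (k : ℝ) ^ 2 / Fintype.card V ≤ (1 / 2) ^ k)
    (hU : k * (σ * U.card) < θ / 2 * (1 / 2) ^ k) : ∃ e ∈ E, e ⊆ Y ∧ Disjoint e U := by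
  obtain ⟨m, rfl⟩ : ∃ m, k = m + 2 := ⟨k - 2, by omega⟩
  have hn0 : (0 : ℝ) < Fintype.card V := by
    grind
  have hne : Nonempty V := Fintype.card_pos_iff.1 (by exact_mod_cast hn0)
  set n := (Fintype.card V : ℝ) with hnn
  have hYc : (Y.card : ℝ) + (univ \ Y).card = n := by
    rw [hnn, ← card_univ, ← card_sdiff_add_card_eq_card (subset_univ Y)]; push_cast; ring
  have hy : (Y.card : ℝ) / n = 1 - a + θ / (2 * n) := by
    field_simp; linarith
  have hθn : θ / (2 * n) ≤ a := by
    rw [div_le_iff₀ (by positivity)]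
    grind
  have hθ0 : 0 ≤ θ / (2 * n) := by positivity
  have h1 : ∀ S : Finset V, S.card = m ∧ S ⊆ Y → θ / (2 * n) ≤
      pr fun x : V × V => (S ∪ {x.1, x.2} ∈ E ∧ x.1 ∈ Y ∧ x.2 ∈ Y) := fun S hS => by
    refine le_trans ?_ (pr_inner_pair_le hd hE (by rw [hS.1]))
    rw [hy]
    set u := θ / (2 * n) with hu
    have h2 : 1 / n ≤ 2 * u := by
      rw [hu]; field_simp; exact hθ
    set i := 1 / n with hi
    have h3 : (1 - (1 - a + u)) / n = (a - u) * i := by rw [hi]; ring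
    rw [h3]
    have hi0 : 0 < i := by positivity
    nlinarith [mul_nonneg hi0.le hθ0, mul_nonneg hi0.le ha.le, mul_nonneg (by linarith : 0 ≤ 1 / 6 - a) hθ0,
      mul_nonneg (by linarith : 0 ≤ 2 * u - i) (mul_nonneg ha.le (by linarith : 0 ≤ 1 - a)), sq_nonneg u]
  have h2 : (1 / 2 : ℝ) ^ (m + 2) ≤ pr fun ω : Fin m → V => (im V ω).card = m ∧ im V ω ⊆ Y := by
    have h3 := pr_clean (fun ω : Fin m → V => ∀ i, ω i ∈ Y) (∅ : Finset V)
    rw [pr_pi fun _ : Fin m => fun v : V => v ∈ Y] at h3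
    simp only [prod_const, card_univ, Fintype.card_fin, pr_mem, card_empty, Nat.cast_zero, mul_zero,
      add_zero] at h3
    have h4 : (1 / 2 : ℝ) ^ m ≤ (Y.card / n) ^ m := pow_le_pow_left₀ (by norm_num) (by rw [hy]; linarith) m
    have h5 : ((Blk.sz V (Fin m → V) : ℕ) : ℝ) ^ 2 / n ≤ (1 / 2) ^ (m + 2) := by
      refine le_trans ?_ hn
      gcongr
      exact (Nat.le_add_right m 2 : m ≤ m + 2)
    have h6 : (1 / 2 : ℝ) ^ (m + 2) = (1 / 2) ^ m / 4 := by grind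
    have h7 : (0 : ℝ) < (1 / 2) ^ m := by positivity
    refine le_trans (by linarith) (h3.trans (pr_mono fun ω hω => ⟨hω.2.1, fun v hv => ?_⟩))
    rw [im_tuple, mem_image] at hv
    grind
  have h3 : θ / (2 * n) * (1 / 2) ^ (m + 2) ≤
      pr fun ω : Fin (m + 2) → V => univ.image ω ∈ E ∧ univ.image ω ⊆ Y := by
    rw [← pr_tuple (Ω := (Fin m → V) × V × V) (fun e => e ∈ E ∧ e ⊆ Y) (a := m + 2) rfl]
    refine (mul_le_mul_of_nonneg_left h2 hθ0).trans ((mul_pr_le_prod (Q := fun (ω : Fin m → V) (x : V × V) =>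
      im V ω ∪ {x.1, x.2} ∈ E ∧ x.1 ∈ Y ∧ x.2 ∈ Y) fun ω => h1 _).trans (pr_mono fun x hx => ?_))
    obtain ⟨hx1, hx2, hx3, hx4⟩ := hx
    have h5 : im V x = im V x.1 ∪ {x.2.1, x.2.2} := by
      rw [im_prod, im_prod, im_vertex, im_vertex, ← insert_eq]
    grind
  have h4 := pr_meet_le (m := m + 1) (U := U) (P := fun e => e ∈ E ∧ e ⊆ Y) (σ := σ) fun b _ => by
    by_cases hbY : b ∈ Y
    · exact (pr_mono fun ω hω => ⟨(subset_insert _ _).trans hω.2, hω.1⟩).trans (hb b hbY)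
    · rw [pr_false fun ω hω => hbY (hω.2 (mem_insert_self _ _))]; exact hσ
  have h5 : ((m + 1 : ℕ) + 1 : ℝ) * (σ * (U.card / n)) < θ / (2 * n) * (1 / 2) ^ (m + 2) := by
    push_cast at hU ⊢
    calc ((m : ℝ) + 1 + 1) * (σ * (U.card / n)) = (m + 2) * (σ * U.card) / n := by ring
      _ < θ / 2 * (1 / 2) ^ (m + 2) / n := by gcongr
      _ = _ := by field_simp
  grind

/-- A vertex outside `X ∪ Y` lies in the middle of many short paths. -/
theorem exists_block_through {ρ : ℝ} {v : V} (hℓ : 1 ≤ ℓ) (hk : 2 * ℓ < k)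
    (hv : v ∉ X ∪ Y) (hvU : v ∉ U) (hρ : 0 ≤ ρ)
    (h : ρ ≤ pr fun ω : Fin (k - 1) → V => im V ω ⊆ Y ∧ insert v (im V ω) ∈ E)
    (hU : ((2 * k : ℕ) ^ 2 + (2 * k : ℕ) * (U.card : ℝ)) / Fintype.card V < ρ ^ 2) :
    ∃ P, P \ (X ∪ Y) = {v} ∧ Block E Y k ℓ 0 U P := by
  have h1 : ρ ^ 2 ≤ pr fun x : (Fin (ℓ - 1) → V) × (Fin (k - ℓ) → V) × (Fin (k - ℓ) → V) =>
      (im V x.1 ∪ im V x.2.1 ⊆ Y ∧ insert v (im V x.1 ∪ im V x.2.1) ∈ E) ∧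
      (im V x.1 ∪ im V x.2.2 ⊆ Y ∧ insert v (im V x.1 ∪ im V x.2.2) ∈ E) := by
    refine le_trans (pow_le_pow_left₀ hρ (h.trans (le_of_eq ?_)) 2) (pr_sq_le fun
      (y : Fin (ℓ - 1) → V) (z : Fin (k - ℓ) → V) => im V y ∪ im V z ⊆ Y ∧ insert v (im V y ∪ im V z) ∈ E)
    simp only [im_tuple]
    rw [← pr_tuple (Ω := (Fin (ℓ - 1) → V) × (Fin (k - ℓ) → V)) (fun e => e ⊆ Y ∧ insert v e ∈ E)
      (a := k - 1) (by change ℓ - 1 + (k - ℓ) = k - 1; omega)]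
    simp only [im_prod, im_tuple]
  have h2 := pr_clean (fun x : (Fin (ℓ - 1) → V) × (Fin (k - ℓ) → V) × (Fin (k - ℓ) → V) =>
      (im V x.1 ∪ im V x.2.1 ⊆ Y ∧ insert v (im V x.1 ∪ im V x.2.1) ∈ E) ∧
      (im V x.1 ∪ im V x.2.2 ⊆ Y ∧ insert v (im V x.1 ∪ im V x.2.2) ∈ E)) U
  have hsz : Blk.sz V ((Fin (ℓ - 1) → V) × (Fin (k - ℓ) → V) × (Fin (k - ℓ) → V)) = ℓ - 1 + (k - ℓ + (k - ℓ)) := rfl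
  rw [hsz] at h2
  have h3 : (((ℓ - 1 + (k - ℓ + (k - ℓ)) : ℕ) : ℝ) ^ 2 + (ℓ - 1 + (k - ℓ + (k - ℓ)) : ℕ) * (U.card : ℝ)) /
      Fintype.card V ≤ ((2 * k : ℕ) ^ 2 + (2 * k : ℕ) * (U.card : ℝ)) / Fintype.card V := by
    have : ℓ - 1 + (k - ℓ + (k - ℓ)) ≤ 2 * k := by omega
    gcongr
  obtain ⟨⟨y, z, z'⟩, ⟨⟨hy1, he1⟩, hy2, he2⟩, hd, hdU⟩ := exists_of_pr_pos (lt_of_lt_of_le (by linarith) h2)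
  rw [Distinct, hsz, im_prod, im_prod] at hd
  rw [im_prod, im_prod] at hdU
  simp only at hy1 he1 hy2 he2 hd hdU
  have c1 : (im V y).card ≤ ℓ - 1 := card_im_le y
  have c2 : (im V z).card ≤ k - ℓ := card_im_le z
  have c3 : (im V z').card ≤ k - ℓ := card_im_le z'
  generalize im V y = J at *
  generalize im V z = A at *
  generalize im V z' = B at *
  have c4 := card_union_le J (A ∪ B)
  have c5 := card_union_le A B
  have d1 : Disjoint A B := card_union_eq_card_add_card.1 (by omega)
  have d2 : Disjoint J (A ∪ B) := card_union_eq_card_add_card.1 (by omega)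
  rw [disjoint_union_right] at d2
  have hvY : v ∉ Y := fun h => hv (mem_union_right _ h)
  rw [union_subset_iff] at hy1 hy2
  have hvJ : v ∉ J := fun h => hvY (hy1.1 h)
  have hvA : v ∉ A := fun h => hvY (hy1.2 h)
  have hvB : v ∉ B := fun h => hvY (hy2.2 h)
  obtain ⟨L, hL, hLc⟩ := exists_subset_card_eq (s := A) (n := ℓ) (by omega)
  obtain ⟨L', hL', hLc'⟩ := exists_subset_card_eq (s := B) (n := ℓ) (by omega)
  have hJc : (insert v J).card = ℓ := by grind
  have dA : Disjoint A (insert v J) := disjoint_insert_right.2 ⟨hvA, d2.1.symm⟩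
  have dB : Disjoint B (insert v J) := disjoint_insert_right.2 ⟨hvB, d2.2.symm⟩
  have p1 : PathOn E ℓ L (A \ L) (insert v J) := .edge hLc hJc disjoint_sdiff (dA.mono_left hL)
    (dA.mono_left sdiff_subset) (by rwa [union_sdiff_of_subset hL, union_comm, insert_union])
  have p2 : PathOn E ℓ (insert v J) (B \ L') L' := .edge hJc hLc' (dB.mono_left sdiff_subset).symm
    (dB.mono_left hL').symm sdiff_disjoint (by rwa [union_assoc, sdiff_union_of_subset hL', insert_union])
  have p := p1.cat p2 (by
    rw [union_sdiff_of_subset hL, sdiff_union_of_subset hL']; exact d1)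
  have heq : L ∪ (A \ L ∪ insert v J ∪ B \ L') ∪ L' = A ∪ insert v J ∪ B := by
    grind
  have dAB : Disjoint (A ∪ insert v J) B := disjoint_union_left.2 ⟨d1, dB.symm⟩
  have hcard : (A ∪ insert v J ∪ B).card = 2 * (k - ℓ) + ℓ := by
    grind
  have hsd : ∀ Z ⊆ X ∪ Y, Y ⊆ Z → (A ∪ insert v J ∪ B) \ Z = {v} := fun Z hZX hZ => by
    grind
  refine ⟨A ∪ insert v J ∪ B, hsd _ subset_rfl subset_union_right, L, _, L', p, hL.trans hy1.2,
    hL'.trans hy2.2, heq, by omega, ?_, ?_⟩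
  · grind
  · rw [sum_wgt, hsd Y subset_union_right subset_rfl, hcard]
    push_cast
    simp

end Blocks

section InitialPath

variable {V : Type} [DecidableEq V] [Fintype V] {E : Finset (Finset V)} {k ℓ : ℕ} {X Y : Finset V}

/-- `X` is close to its ideal size, edges inside `Y` are rare at vertices of `Y` only, and almost all
`k`-sets meeting `X` in one vertex are edges. -/
structure NearExtremal (E : Finset (Finset V)) (X Y : Finset V) (k : ℕ) (a σ : ℝ) : Prop where
  disj : Disjoint X Y
  exc : ((univ \ (X ∪ Y)).card : ℝ) ≤ σ ^ 3 * Fintype.card V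
  size : |((univ \ Y).card : ℝ) - a * Fintype.card V| ≤ σ ^ 3 * Fintype.card V
  low : ∀ b ∈ Y, pr (fun ω : Fin (k - 1) → V => im V ω ⊆ Y ∧ insert b (im V ω) ∈ E) ≤ 2 * σ
  high : ∀ v ∉ X ∪ Y, σ / 2 ≤ pr fun ω : Fin (k - 1) → V => im V ω ⊆ Y ∧ insert v (im V ω) ∈ E
  bad_empty : badPr E X Y k ∅ ≤ 4 * k * σ
  bad_singleton : ∀ v ∈ X ∪ Y, badPr E X Y k {v} ≤ 4 * k * σ

theorem NearExtremal.extPair {a σ τ ε : ℝ} (h : NearExtremal E X Y k a σ) (hℓk : ℓ ≤ k) (hτ : 0 < τ)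
    (h1 : 4 * k * σ ≤ ε) (h2 : 4 * k * σ ≤ τ * ε) : ExtPair E X Y k ℓ τ ε := by
  refine ⟨h.disj, h.bad_empty.trans h1, fun v hv => (h.bad_singleton v hv).trans h1,
    le_of_mul_le_mul_left (le_trans ?_ (h.bad_empty.trans h2)) hτ⟩
  have h3 : badPr E X Y k ∅ = pr fun x : (Fin ℓ → V) × (Fin (k - ℓ) → V) =>
      (im V x).card = k ∧ Bad E X Y ∅ (im V x) := by
    rw [pr_tuple (Ω := (Fin ℓ → V) × (Fin (k - ℓ) → V)) (fun T => T.card = k ∧ Bad E X Y ∅ T) (a := k)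
      (by change ℓ + (k - ℓ) = k; omega)]
    rfl
  rw [h3]
  refine (mul_pr_le_prod (Q := fun (ω : Fin ℓ → V) (x : Fin (k - ℓ) → V) =>
    (im V x).card = k - ℓ ∧ Bad E X Y (im V ω) (im V x)) fun ω hω => ?_).trans (pr_mono fun x hx => ?_)
  · by_contra hc
    refine hω.2.2 ⟨hω.1, hω.2.1, ?_⟩
    unfold badPr
    rw [hω.1]
    exact (not_le.1 hc).le
  · obtain ⟨⟨c1, hY, -⟩, c2, hd, hs, hX, hn⟩ := hx
    rw [im_prod, card_union_of_disjoint hd, c1, c2]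
    exact ⟨by omega, disjoint_empty_left _, union_subset (hY.trans subset_union_right) hs,
      by rwa [empty_union], by rwa [empty_union]⟩

/-- An initial path that covers all exceptional vertices and balances the rest. -/
theorem NearExtremal.exists_trail {a σ τ : ℝ} {N q D : ℕ} (h : NearExtremal E X Y k a σ) (hk4 : 4 ≤ k)
    (hℓ : 1 ≤ ℓ) (hk : 2 * ℓ < k) (hE : ∀ e ∈ E, e.card = k) (ha : a = 1 / (2 * (k - ℓ : ℕ)))
    (hd : PairDeg E k ((2 * a - a ^ 2) * (1 - 1 / Fintype.card V))) (hσ : 0 < σ)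
    (hσ1 : 36 * k ^ 2 * σ < (1 / 2) ^ (k + 1)) (hn : (k : ℝ) ^ 2 / Fintype.card V ≤ (1 / 2) ^ k)
    (hf : Flexible E X Y k ℓ τ N) (hq : Fintype.card V = (k - ℓ) * q) (hD : 2 * (univ \ Y).card ≤ q + D)
    (hD' : q ≤ 2 * (univ \ Y).card + D) {m : ℕ} (hm : 2 * k + 7 * k * D + 7 * k * (univ \ (X ∪ Y)).card ≤ m)
    (hmN : m + 5 * k ≤ N)
    (hmσ : ((2 * k : ℕ) ^ 2 + (2 * k : ℕ) * (m : ℝ)) / Fintype.card V < (σ / 2) ^ 2) :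
    ∃ W, Trail E X Y k ℓ τ (∑ v, wgt Y (k - ℓ) v) W ∧ univ \ W ⊆ X ∪ Y ∧ W.card ≤ m := by
  set t := k - ℓ with ht
  have ht3 : 3 ≤ t := by omega
  have htr : (3 : ℝ) ≤ t := by exact_mod_cast ht3
  obtain ⟨W, hWX, hW, hWc⟩ := hf.exists_start hk hℓ hk4
  have h1 : ∃ W', Trail E X Y k ℓ τ (t * (2 * (univ \ Y).card - q)) W' ∧ W'.card ≤ 2 * k + 7 * k * D ∧
      W' \ (X ∪ Y) = W \ (X ∪ Y) := by
    rcases lt_or_ge (2 * (univ \ Y).card) q with hlt | hge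
    · obtain ⟨θ, hθ⟩ := Nat.exists_eq_add_of_lt hlt
      have hθD : 7 * k * (θ + 1) ≤ 7 * k * D := Nat.mul_le_mul_left _ (by omega)
      have hs : ∀ U : Finset V, U.card ≤ 2 * k + 7 * k * (θ + 1) →
          ∃ P ⊆ X ∪ Y, Block E Y k ℓ (t * (2 * (0 : ℕ) - 1)) U P := fun U hU => by
        have hU' : (U.card : ℝ) ≤ 9 * k * (θ + 1 : ℕ) := by
          have : U.card ≤ 9 * k * (θ + 1) := hU.trans (by nlinarith)
          exact_mod_cast this
        have hθ0 : (0 : ℝ) < (θ + 1 : ℕ) := by positivity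
        have hUσ : (k : ℝ) * (2 * σ * U.card) < (θ + 1 : ℕ) / 2 * (1 / 2) ^ k := by
          calc (k : ℝ) * (2 * σ * U.card) ≤ k * (2 * σ * (9 * k * (θ + 1 : ℕ))) := by gcongr
            _ = 36 * k ^ 2 * σ * ((θ + 1 : ℕ) / 2) := by ring
            _ < (1 / 2) ^ (k + 1) * ((θ + 1 : ℕ) / 2) := by gcongr
            _ ≤ _ := by
              rw [pow_succ]
              nlinarith [mul_pos (by positivity : (0 : ℝ) < (1 / 2) ^ k) hθ0]
        obtain ⟨e, he, heY, heU⟩ := exists_edge_avoiding (U := U) (a := a) (θ := (θ + 1 : ℕ)) (σ := 2 * σ) hk4 hE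
          (by rw [ha]; positivity)
          (by rw [ha, one_div_le_one_div (by positivity) (by norm_num)]; linarith)
          (by push_cast; linarith [Nat.cast_nonneg (α := ℝ) θ])
          (by
            rw [ha, hq, hθ]
            push_cast
            field_simp
            ring) hd (by positivity) h.low hn hUσ
        refine ⟨e, heY.trans subset_union_right, block_of_edge hk hE he heU h.disj
          (heY.trans subset_union_right) ?_ (by norm_num)⟩
        rw [card_eq_zero, ← disjoint_iff_inter_eq_empty]
        exact (h.disj.mono_right heY).symm
      obtain ⟨W', h2, h3, h4⟩ := hW.iterate hf hk (by omega) hs (θ + 1) (by omega)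
      refine ⟨W', ?_, by omega, h4⟩
      convert h2 using 1
      rw [hθ]
      push_cast
      ring
    · obtain ⟨r, hr⟩ := Nat.exists_eq_add_of_le hge
      have hrD : 7 * k * r ≤ 7 * k * D := Nat.mul_le_mul_left _ (by omega)
      obtain ⟨W', h2, h3, h4⟩ := hW.iterate hf hk (m := 2 * k + 7 * k * r) (by omega)
        (fun U hU => hf.exists_block hk hE (by omega)) r (by omega)
      refine ⟨W', ?_, by omega, h4⟩
      convert h2 using 1
      have : (2 : ℤ) * (univ \ Y).card = q + r := by exact_mod_cast hr
      rw [this]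
      ring
  obtain ⟨W', h2, h3, h4⟩ := h1
  rw [sdiff_eq_empty_iff_subset.2 hWX, sdiff_eq_empty_iff_subset] at h4
  obtain ⟨W'', h5, h6, h7⟩ := h2.cover hf hk hmN (fun U hU v hv hvU =>
    exists_block_through hℓ hk hv hvU (by positivity) (h.high v hv) (lt_of_le_of_lt (by gcongr) hmσ)) h4
    (univ \ (X ∪ Y)) sdiff_disjoint (by omega)
  refine ⟨W'', ?_, fun v hv => ?_, by omega⟩
  · convert h5 using 1
    rw [sum_wgt, card_univ, hq]
    push_cast
    ring
  · by_contra hc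
    have : v ∈ W'' \ (X ∪ Y) := h7 ▸ mem_sdiff.2 ⟨mem_univ _, hc⟩
    exact (mem_sdiff.1 hv).2 (mem_sdiff.1 this).1

end InitialPath

section NearExtremalCase

set_option maxHeartbeats 1600000 in
theorem exists_hamC_of_nearExtremal {k ℓ : ℕ} (hk4 : 4 ≤ k) (hℓ : 1 ≤ ℓ) (hk : 2 * ℓ < k) :
    ∃ σ₀ > 0, ∀ σ : ℝ, 0 < σ → σ ≤ σ₀ → ∃ n₀ : ℕ, ∀ (V : Type) [DecidableEq V] [Fintype V]
      (E : Finset (Finset V)) (X Y : Finset V) (a : ℝ), n₀ ≤ Fintype.card V → (k - ℓ) ∣ Fintype.card V →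
      (∀ e ∈ E, e.card = k) → a = 1 / (2 * (k - ℓ : ℕ)) →
      PairDeg E k ((2 * a - a ^ 2) * (1 - 1 / Fintype.card V)) → NearExtremal E X Y k a σ → HamC E ℓ := by
  set t := k - ℓ with ht
  have ht3 : 3 ≤ t := by omega
  have htr : (3 : ℝ) ≤ t := by exact_mod_cast ht3
  have hkr : (4 : ℝ) ≤ k := by exact_mod_cast hk4
  set a : ℝ := 1 / (2 * t) with ha
  have ha0 : 0 < a := by positivity
  have ha6 : a ≤ 1 / 6 := by
    rw [ha, one_div_le_one_div (by positivity) (by norm_num)]; linarith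
  obtain ⟨c, hc, τ, hτ, n₁, hconn⟩ := exists_connector hk4 hℓ hk ha0 (by linarith)
  obtain ⟨ε₁, hε₁, n₂, hrich₁⟩ := exists_rich (k := k) (ℓ := ℓ) (by omega) (δ := a / 4) (by positivity)
    (j := 1) (m := 2 * t * 1 + ℓ) (by omega) (by omega) 1
  obtain ⟨ε₂, hε₂, n₃, hrich₂⟩ := exists_rich (k := k) (ℓ := ℓ) (by omega) (δ := a / 4) (by positivity)
    (j := 2 * t) (m := 2 * t * (2 * t) + ℓ) (by nlinarith) (by omega) (2 * t + 1)
  obtain ⟨β, hβ, n₄, hasm⟩ := assembly ℓ (2 * t - ℓ) (2 * t * (2 * t) + ℓ) 1 (2 * t) (by omega) (by omega)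
    (by omega) (c := min (c / 2) ((a / 4) ^ (2 * t * (2 * t) + ℓ) / 2)) (γ₀ := 1) (K := 2 * t)
    (by positivity) one_pos (by positivity)
  obtain ⟨ε₃, hε₃, n₅, hcov⟩ := exists_cover hk4 hℓ hk hβ
  set ν := min (c / (8 * k)) (a / 8) with hν
  have hν0 : 0 < ν := by positivity
  have hνc : 8 * k * ν ≤ c := by
    have := min_le_left (c / (8 * k)) (a / 8)
    rwa [← hν, le_div_iff₀ (by positivity), mul_comm] at this
  have hνa : ν ≤ a / 8 := min_le_right _ _
  set e := min (min ε₁ ε₂) ε₃ with he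
  have he0 : 0 < e := by positivity
  set μ := min (min e (τ * e)) (min ((1 / 2 : ℝ) ^ (k + 1)) ν) with hμ
  have hμ0 : 0 < μ := by positivity
  have hμe : μ ≤ e := (min_le_left _ _).trans (min_le_left _ _)
  have hμτ : μ ≤ τ * e := (min_le_left _ _).trans (min_le_right _ _)
  have hμk : μ ≤ (1 / 2) ^ (k + 1) := (min_le_right _ _).trans (min_le_left _ _)
  have hμν : μ ≤ ν := (min_le_right _ _).trans (min_le_right _ _)
  have he₁ : e ≤ ε₁ := (min_le_left _ _).trans (min_le_left _ _)
  have he₂ : e ≤ ε₂ := (min_le_left _ _).trans (min_le_right _ _)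
  have he₃ : e ≤ ε₃ := min_le_right _ _
  refine ⟨μ / (400 * k ^ 2), by positivity, fun σ hσ hσμ => ?_⟩
  rw [le_div_iff₀ (by positivity)] at hσμ
  have hkk : (k : ℝ) ≤ k ^ 2 := by nlinarith
  have hσk : σ * k ≤ σ * k ^ 2 := by gcongr
  have hσ1 : σ ≤ σ * k := by nlinarith
  have hσ3 : σ ^ 3 ≤ σ := by nlinarith [mul_nonneg hσ.le (by nlinarith : 0 ≤ 1 - σ ^ 2)]
  set κ := min (min (c / 4) ((1 / 2 : ℝ) ^ k)) (min (σ ^ 2 / 16) (ν / 2)) with hκ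
  obtain ⟨n₆, hn₆⟩ := exists_forall_div_le (8 * (k : ℝ) ^ 2) (c := κ) (by positivity)
  have hκc : κ ≤ c / 4 := (min_le_left _ _).trans (min_le_left _ _)
  have hκk : κ ≤ (1 / 2) ^ k := (min_le_left _ _).trans (min_le_right _ _)
  have hκσ : κ ≤ σ ^ 2 / 16 := (min_le_right _ _).trans (min_le_left _ _)
  have hκν : κ ≤ ν / 2 := (min_le_right _ _).trans (min_le_right _ _)
  refine ⟨n₁ + n₂ + n₃ + n₄ + n₅ + n₆ + 4, ?_⟩
  intro V _ _ E X Y a' hn hdvd hE ha' hd h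
  subst ha'
  obtain ⟨q, hq⟩ := hdvd
  have hn6 := hn₆ (Fintype.card V) (by omega)
  have hx : ∀ τ ε, 0 < τ → 4 * k * σ ≤ ε → 4 * k * σ ≤ τ * ε → ExtPair E X Y k ℓ τ ε :=
    fun τ ε => h.extPair (by omega)
  have hσe : 4 * k * σ ≤ e := by linarith
  have hστ : 4 * k * σ ≤ τ * e := by linarith
  have hp : ∀ ε, e ≤ ε → ExtPair E X Y k ℓ τ ε := fun ε hε =>
    hx τ ε hτ (hσe.trans hε) (hστ.trans (by gcongr))
  have hp₂ := hp ε₂ he₂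
  set n := (Fintype.card V : ℝ) with hnn
  have hn4 : (4 : ℝ) ≤ n := by rw [hnn]; exact_mod_cast (by omega : 4 ≤ Fintype.card V)
  have hn0 : 0 < n := by linarith
  rw [div_le_iff₀ hn0] at hn6
  have hXY := h.disj
  have hexc : ((univ \ (X ∪ Y)).card : ℝ) ≤ σ * n := h.exc.trans (by gcongr)
  have hsz := abs_le.1 (h.size.trans (by gcongr : σ ^ 3 * n ≤ σ * n))
  have hYc : (Y.card : ℝ) + (univ \ Y).card = n := by
    rw [hnn, ← card_univ, ← card_sdiff_add_card_eq_card (subset_univ Y)]; push_cast; ring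
  have hXc : (X.card : ℝ) + (univ \ (X ∪ Y)).card = (univ \ Y).card := by
    have h1 := card_sdiff_add_card_eq_card (subset_univ Y)
    have h2 := card_sdiff_add_card_eq_card (subset_univ (X ∪ Y))
    rw [card_union_of_disjoint hXY] at h2
    exact_mod_cast (by omega : X.card + (univ \ (X ∪ Y)).card = (univ \ Y).card)
  have hσa : σ * n ≤ a / 8 * n := by gcongr; linarith
  have han : a * n ≤ 1 / 6 * n := by gcongr
  have hXa : a / 2 * n ≤ X.card := by linarith
  have hYa : n / 2 ≤ Y.card := by linarith
  have hconn' : ∀ U : Finset V, (U.card : ℝ) ≤ ν * n → ∀ A B, A ⊆ Y → A.card = ℓ → Typ E X Y k ℓ τ B →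
      Disjoint A B → c / 2 ≤ pr fun ω : Fin (2 * t - ℓ) → V => PathOn E ℓ A (im V ω) B ∧
        Disjoint (im V ω) U ∧ ∑ v ∈ im V ω, wgt Y t v = ℓ ∧ im V ω ⊆ X ∪ Y ∧ (im V ω).card = 2 * t - ℓ := by
    intro U hU A B hA hAc hB hAB
    have h1 := hconn V E X Y _ (by omega) hXY hXa hYa (hexc.trans (hσa.trans (by gcongr; linarith))) hd (by
      have h2 : ((univ \ Y).card : ℝ) / n ≤ 9 / 8 * a := by
        rw [div_le_iff₀ hn0]; linarith
      have h3 : (((univ \ Y).card : ℝ) / n) ^ 2 ≤ (9 / 8 * a) ^ 2 := by gcongr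
      have h4 : 1 / n ≤ 1 / 4 := one_div_le_one_div_of_le (by norm_num) hn4
      rw [← hnn]
      have h5 := mul_nonneg ha0.le (by linarith : 0 ≤ 1 / 6 - a)
      have h6 := mul_nonneg (by linarith : 0 ≤ 2 * a - a ^ 2) (by linarith : 0 ≤ 1 / 4 - 1 / n)
      linarith) A B hA hAc hB hAB
    refine le_trans ?_ ((sub_le_sub_right h1 _).trans ((pr_clean _ U).trans (pr_mono fun ω hω =>
      ⟨hω.1.1, hω.2.2, ?_, hω.1.2.1, hω.1.2.2.1⟩)))
    · have h2 : ((2 * t - ℓ : ℕ) : ℝ) ≤ 2 * k := by exact_mod_cast (by omega : 2 * t - ℓ ≤ 2 * k)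
      have h3 : (((2 * t - ℓ : ℕ) : ℝ) ^ 2 + (2 * t - ℓ : ℕ) * U.card) / n ≤ c / 2 := by
        rw [div_le_iff₀ hn0]
        calc ((2 * t - ℓ : ℕ) : ℝ) ^ 2 + (2 * t - ℓ : ℕ) * U.card ≤ (2 * k) ^ 2 + 2 * k * (ν * n) := by gcongr
          _ ≤ c / 4 * n + c / 4 * n := by
            linarith [mul_pos hc hn0, hn6.trans (mul_le_mul_of_nonneg_right hκc hn0.le),
              mul_le_mul_of_nonneg_right hνc hn0.le, sq_nonneg (k : ℝ)]
          _ = _ := by ring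
      change c / 2 ≤ c - (((2 * t - ℓ : ℕ) : ℝ) ^ 2 + (2 * t - ℓ : ℕ) * U.card) / n
      linarith
    · obtain ⟨⟨-, h2, h3, h4⟩, -⟩ := hω
      rw [sum_wgt_inter hXY h2, h3, h4]
      omega
  have hsub : ∀ U Z : Finset V, Z ⊆ X ∪ Y → X ∪ Y ⊆ Z ∪ U → (U.card : ℝ) ≤ a / 4 * n →
      a / 4 * n ≤ (Z ∩ X).card ∧ a / 4 * n ≤ (Z ∩ Y).card := by
    intro U Z hZ hZU hU
    have h1 : ∀ T ⊆ X ∪ Y, (T.card : ℝ) ≤ (Z ∩ T).card + U.card := fun T hT => by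
      have : T ⊆ Z ∩ T ∪ U := fun v hv => by
        rcases mem_union.1 (hZU (hT hv)) with h' | h'
        exacts [mem_union_left _ (mem_inter.2 ⟨h', hv⟩), mem_union_right _ h']
      exact_mod_cast (card_le_card this).trans (card_union_le _ _)
    have h2 := h1 X subset_union_left
    have h3 := h1 Y subset_union_right
    constructor <;> linarith
  have hf : Flexible E X Y k ℓ τ ⌊ν * n⌋₊ := by
    have hfl : ∀ U : Finset V, U.card ≤ ⌊ν * n⌋₊ → (U.card : ℝ) ≤ ν * n := fun U hU =>
      (Nat.cast_le.2 hU).trans (Nat.floor_le (by positivity))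
    refine ⟨hXY, fun U A B hU hA hAc hB hAB => ?_, fun U hU => ?_⟩
    · obtain ⟨ω, h1, h2, h3, h4, h5⟩ := exists_of_pr_pos
        (lt_of_lt_of_le (by positivity) (hconn' U (hfl U hU) A B hA hAc hB hAB))
      exact ⟨im V ω, h2, h4, h1, h3, by omega⟩
    · have h1 := hsub U ((X ∪ Y) \ U) sdiff_subset (by rw [sdiff_union_self_eq_union]; exact subset_union_left)
        ((hfl U hU).trans (by gcongr; linarith))
      obtain ⟨ω, h2, h3⟩ := exists_of_pr_pos (lt_of_lt_of_le (by positivity) (hrich₁ V E X Y ((X ∪ Y) \ U) τ {∅}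
        (by omega) (hp ε₁ he₁) h1.1 h1.2 (by simp) (by simpa using (hp ε₁ he₁).bad_empty)))
      exact ⟨im V ω, h2, h3⟩
  obtain ⟨D, hD, hD', hDD⟩ : ∃ D, 2 * (univ \ Y).card ≤ q + D ∧ q ≤ 2 * (univ \ Y).card + D ∧
      (D : ℝ) ≤ 2 * (σ ^ 3 * n) := by
    have han : a * n = q / 2 := by
      rw [ha, hnn, hq]; push_cast; field_simp
    have h1 := abs_le.1 h.size
    rw [← hnn, han] at h1
    rcases le_total (2 * (univ \ Y).card) q with h2 | h2
    · refine ⟨q - 2 * (univ \ Y).card, by omega, by omega, ?_⟩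
      rw [Nat.cast_sub h2]; push_cast; linarith
    · refine ⟨2 * (univ \ Y).card - q, by omega, by omega, ?_⟩
      rw [Nat.cast_sub h2]; push_cast; linarith
  set m := 2 * k + 7 * k * D + 7 * k * (univ \ (X ∪ Y)).card with hm
  have hmr : (m : ℝ) ≤ 2 * k + 21 * k * (σ ^ 3 * n) := by
    have h1 := mul_le_mul_of_nonneg_left hDD (by positivity : 0 ≤ 7 * (k : ℝ))
    have h2 := mul_le_mul_of_nonneg_left h.exc (by positivity : 0 ≤ 7 * (k : ℝ))
    grind
  have hmν : (m : ℝ) + 5 * k ≤ ν * n := by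
    have h1 : 21 * k * (σ ^ 3 * n) ≤ 21 * k * (σ * n) := by gcongr
    have h2 : 21 * (k * σ) * n ≤ ν / 2 * n := by gcongr; linarith
    have h3 : κ * n ≤ ν / 2 * n := by gcongr
    linarith
  have hmσ : ((2 * k : ℕ) ^ 2 + (2 * k : ℕ) * (m : ℝ)) / n < (σ / 2) ^ 2 := by
    have h3 : κ * n ≤ σ ^ 2 / 16 * n := by gcongr
    have h4 : 42 * (k ^ 2 * σ) * (σ ^ 2 * n) ≤ 1 / 8 * (σ ^ 2 * n) := by gcongr; linarith
    have h5 : 0 < σ ^ 2 * n := by positivity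
    rw [div_lt_iff₀ hn0]
    push_cast
    calc (2 * (k : ℝ)) ^ 2 + 2 * k * m ≤ (2 * k) ^ 2 + 2 * k * (2 * k + 21 * k * (σ ^ 3 * n)) := by gcongr
      _ = 8 * k ^ 2 + 42 * (k ^ 2 * σ) * (σ ^ 2 * n) := by ring
      _ < _ := by linarith
  obtain ⟨W, ⟨L₀, M₀, L₁, p0, t0, t1, hW, hz⟩, hWX, hWm⟩ := h.exists_trail (N := ⌊ν * n⌋₊) (τ := τ) hk4 hℓ hk hE ha hd hσ
    (by linarith) (by
      have : κ * n ≤ (1 / 2) ^ k * n := by gcongr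
      rw [← hnn, div_le_iff₀ hn0]; grind) hf hq hD hD' (m := m) hm.ge
    (Nat.le_floor (by push_cast; exact hmν)) hmσ
  have hWν : (W.card : ℝ) ≤ ν * n := by
    have : (W.card : ℝ) ≤ m := by exact_mod_cast hWm
    linarith
  rw [← ht] at hz
  subst hW
  set W := L₀ ∪ M₀ ∪ L₁ with hW
  refine hasm V ℤ (Fin (2 * t * (2 * t) + ℓ) → V) Unit E (wgt Y t) ℓ (Typ E X Y k ℓ τ)
    (fun S => S ⊆ X ∪ Y ∧ S.card = 2 * t ∧ (S ∩ X).card = 1) (univ \ W) L₀ M₀ L₁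
    (fun ω _ => unitEnd ℓ X true (im V ω))
    (fun ω _ => im V ω \ (unitEnd ℓ X true (im V ω) ∪ unitEnd ℓ X false (im V ω)))
    (fun ω _ => unitEnd ℓ X false (im V ω)) (by omega) rfl rfl p0 t0 t1 (fun _ h => h.1) rfl hz.symm
    ?_ (fun _ h => h.2.1) ?_ ?_ ?_
  · intro A B hA hB hAB
    refine (min_le_left _ _).trans ((hconn' W hWν A B hA.2.1 hA.1 hB hAB).trans (pr_mono fun ω hω =>
      ⟨hω.1, fun v hv => mem_sdiff.2 ⟨mem_univ _, disjoint_left.1 hω.2.1 hv⟩, hω.2.2.1⟩))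
  · intro S ⟨hSX, hSc, hS1⟩ hSD
    have h1 := hsub (W ∪ S) ((univ \ W) \ S) (sdiff_subset.trans hWX) (fun v _ => by
      simp only [mem_union, mem_sdiff, mem_univ, true_and]; clear * -; tauto) (by
      have h2 : ((W ∪ S).card : ℝ) ≤ W.card + S.card := by exact_mod_cast card_union_le _ _
      have h3 : (S.card : ℝ) ≤ 2 * k := by exact_mod_cast (by omega : S.card ≤ 2 * k)
      have h4 : κ * n ≤ ν / 2 * n := by gcongr
      have h5 : ν * n ≤ a / 8 * n := by gcongr
      linarith)
    refine (min_le_right _ _).trans ((hrich₂ V E X Y _ τ (insert ∅ (S.image singleton)) (by omega) hp₂ h1.1 h1.2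
      ((card_insert_le _ _).trans (Nat.add_le_add_right (card_image_le.trans hSc.le) 1)) ?_).trans
      (pr_mono fun ω hω => ⟨hω.2.1.trans sdiff_subset, absorbing_unit hk hℓ hk4 hXY (sdiff_subset.trans hWX)
        sdiff_disjoint hSc hS1 hω.1 hω.2⟩))
    simp only [mem_insert, mem_image, forall_eq_or_imp, forall_exists_index, and_imp, forall_apply_eq_imp_iff₂]
    exact ⟨hp₂.bad_empty, fun v hv => hp₂.bad_singleton v (hSX hv)⟩
  · intro U hU hw
    obtain ⟨P, h1, h2, h3⟩ := exists_split (by omega) hXY (hU.trans hWX) hw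
    exact ⟨P, fun S hS => ⟨(h1 S hS).1.trans (hU.trans hWX), (h1 S hS).2⟩, h2, h3⟩
  · intro R₁ h1 R₂ h2 h3 h4 _
    exact hcov V E X Y _ R₁ R₂ τ (by omega) (hp ε₃ he₃) hWX h1 h2 h3 h4

end NearExtremalCase

section Sparse

variable {V : Type} [DecidableEq V] [Fintype V] {E : Finset (Finset V)} {k : ℕ} {B F : Finset V} {d : ℝ}

theorem pr_mixed_pair_le [Nonempty V] (h : PairDeg E k d) {S : Finset V} (hS : S.card + 2 = k) :
    2 * pr (fun x : V × V => x.1 ∉ B ∧ x.2 ∈ B ∧ S ∪ {x.1, x.2} ∉ E) ≤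
      1 - d - ((B.card : ℝ) / Fintype.card V) ^ 2 +
        pr fun x : V × V => (x.1 ∈ B ∧ x.2 ∈ B) ∧ S ∪ {x.1, x.2} ∈ E := by
  have h1 := h S hS
  have h2 := pr_add_pr_not fun x : V × V => S ∪ {x.1, x.2} ∈ E
  rw [pr_split (fun x : V × V => S ∪ {x.1, x.2} ∉ E) fun x => x.1 ∈ B,
    pr_split (fun x : V × V => S ∪ {x.1, x.2} ∉ E ∧ x.1 ∈ B) fun x => x.2 ∈ B] at h2
  have h3 := pr_and_prod (fun v : V => v ∈ B) fun v : V => v ∈ B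
  rw [pr_mem, ← sq, pr_split _ fun x : V × V => S ∪ {x.1, x.2} ∈ E] at h3
  have h4 : pr (fun x : V × V => (x.1 ∈ B ∧ x.2 ∈ B) ∧ S ∪ {x.1, x.2} ∉ E) ≤
      pr fun x : V × V => (S ∪ {x.1, x.2} ∉ E ∧ x.1 ∈ B) ∧ x.2 ∈ B :=
    pr_mono fun x hx => ⟨⟨hx.2, hx.1.1⟩, hx.1.2⟩
  have h5 : pr (fun x : V × V => x.1 ∉ B ∧ x.2 ∈ B ∧ S ∪ {x.1, x.2} ∉ E) ≤
      pr fun x : V × V => S ∪ {x.1, x.2} ∉ E ∧ x.1 ∉ B := pr_mono fun x hx => ⟨hx.2.2, hx.1⟩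
  have h6 : pr (fun x : V × V => x.1 ∉ B ∧ x.2 ∈ B ∧ S ∪ {x.1, x.2} ∉ E) ≤
      pr fun x : V × V => (S ∪ {x.1, x.2} ∉ E ∧ x.1 ∈ B) ∧ x.2 ∉ B := by
    rw [pr_swap]
    exact pr_mono fun x hx => ⟨⟨by rw [pair_comm]; exact hx.2.2, hx.2.1⟩, hx.1⟩
  linarith

/-- The proportion of the tuples with just the first vertex outside `B` that complete `F` to a non-edge. -/
noncomputable def mixPr (E : Finset (Finset V)) (B : Finset V) (k : ℕ) (F : Finset V) : ℝ :=
  pr fun x : V × (Fin (k - F.card - 1) → V) => x.1 ∉ B ∧ im V x.2 ⊆ B ∧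
    (F ∪ insert x.1 (im V x.2)).card = k ∧ F ∪ insert x.1 (im V x.2) ∉ E

theorem pr_inside_ge (B F : Finset V) (m : ℕ) :
    ((B.card : ℝ) / Fintype.card V) ^ m - (m ^ 2 + m * F.card) / Fintype.card V ≤
      pr fun W : Fin m → V => im V W ⊆ B ∧ (F ∪ im V W).card = F.card + m := by
  refine le_trans (le_of_eq ?_) ((pr_clean (fun W : Fin m → V => im V W ⊆ B) F).trans (pr_mono fun W hW =>
    ⟨hW.1, by rw [card_union_of_disjoint hW.2.2.symm]; congr 1; exact hW.2.1⟩))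
  have h1 := pr_pi fun (_ : Fin m) (v : V) => v ∈ B
  rw [pr_mem, prod_const, card_univ, Fintype.card_fin] at h1
  rw [← h1, pr_congr (Q := fun W : Fin m → V => im V W ⊆ B) fun W => by rw [im_tuple, image_subset_iff]; simp]
  rfl

theorem mixPr_le [Nonempty V] (h : PairDeg E k d) (hF : F.card + 2 ≤ k) : ∃ p ≤ (1 : ℝ),
    ((B.card : ℝ) / Fintype.card V) ^ (k - 2 - F.card) - (k ^ 2 + k * k) / Fintype.card V ≤ p ∧
    2 * mixPr E B k F ≤ (1 - d - ((B.card : ℝ) / Fintype.card V) ^ 2) * p +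
      pr fun ω : Fin (k - F.card) → V => im V ω ⊆ B ∧ F ∪ im V ω ∈ E := by
  obtain ⟨m, rfl⟩ := Nat.exists_eq_add_of_le hF
  unfold mixPr
  rw [show F.card + 2 + m - F.card - 1 = m + 1 by omega, show F.card + 2 + m - F.card = m + 2 by omega,
    show F.card + 2 + m - 2 - F.card = m by omega]
  set C : (Fin m → V) → Prop := fun W => im V W ⊆ B ∧ (F ∪ im V W).card = F.card + m with hC
  refine ⟨pr C, pr_le_one _, ?_, ?_⟩
  · refine le_trans (sub_le_sub_left (div_le_div_of_nonneg_right ?_ (by positivity)) _) (pr_inside_ge B F m)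
    have h3 : (m : ℝ) ≤ (F.card + 2 + m : ℕ) := by exact_mod_cast (by omega)
    have h4 : (F.card : ℝ) ≤ (F.card + 2 + m : ℕ) := by exact_mod_cast (by omega)
    gcongr
  · have h1 : ex (fun W => 2 * pr fun x : V × V => C W ∧ x.1 ∉ B ∧ x.2 ∈ B ∧ (F ∪ im V W) ∪ {x.1, x.2} ∉ E) ≤
        ex fun W => (1 - d - ((B.card : ℝ) / Fintype.card V) ^ 2) * (pr fun _ : Unit => C W) +
          pr fun x : V × V => C W ∧ (x.1 ∈ B ∧ x.2 ∈ B) ∧ (F ∪ im V W) ∪ {x.1, x.2} ∈ E := by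
      refine ex_mono fun W => ?_
      by_cases hW : C W
      · simpa [hW, pr_true] using pr_mixed_pair_le (B := B) h
          (by rw [hW.2]; omega : (F ∪ im V W).card + 2 = F.card + 2 + m)
      · simp [hW, pr_false]
    rw [ex_mul_left, ex_add, ex_mul_left, ← pr_prod fun x : (Fin m → V) × (V × V) => C x.1 ∧ x.2.1 ∉ B ∧
      x.2.2 ∈ B ∧ (F ∪ im V x.1) ∪ {x.2.1, x.2.2} ∉ E, ← pr_prod fun x : (Fin m → V) × (V × V) => C x.1 ∧
      (x.2.1 ∈ B ∧ x.2.2 ∈ B) ∧ (F ∪ im V x.1) ∪ {x.2.1, x.2.2} ∈ E,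
      ← pr_prod fun x : (Fin m → V) × Unit => C x.1, pr_fst] at h1
    let e : (Fin m → V) × (V × V) ≃ V × (Fin (m + 1) → V) :=
      { toFun x := (x.2.1, Fin.cons x.2.2 x.1)
        invFun y := (Fin.tail y.2, (y.1, y.2 0))
        left_inv x := by simp
        right_inv y := by simp }
    rw [← pr_equiv e]
    have h2 : ∀ x, im V (e x).2 = insert x.2.2 (im V x.1) := fun x => by
      rw [im_tuple, im_tuple, ← coe_inj, coe_insert, coe_image, coe_image, coe_univ, coe_univ,
        Set.image_univ, Set.image_univ]
      exact Fin.range_cons _ _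
    have h3 : ∀ x : (Fin m → V) × (V × V), F ∪ insert x.2.1 (insert x.2.2 (im V x.1)) =
        (F ∪ im V x.1) ∪ {x.2.1, x.2.2} := fun x => by
      ext v; simp only [mem_union, mem_insert, mem_singleton]; tauto
    refine le_trans (mul_le_mul_of_nonneg_left (pr_mono fun x hx => ?_) two_pos.le) (h1.trans
      (add_le_add_right (le_trans (pr_mono fun x hx => ?_) (pr_tuple (V := V) (Ω := (Fin m → V) × (V × V))
        (fun T => T ⊆ B ∧ F ∪ T ∈ E) (a := m + 2) rfl).le) _))
    · simp only [h2] at hx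
      obtain ⟨h4, h5, h6, h7⟩ := hx
      rw [insert_subset_iff] at h5
      change F ∪ insert x.2.1 _ ∉ E at h7
      change (F ∪ insert x.2.1 _).card = _ at h6
      rw [h3] at h6 h7
      refine ⟨⟨h5.2, le_antisymm ?_ ?_⟩, h4, h5.1, h7⟩
      · exact (card_union_le _ _).trans (Nat.add_le_add_left (card_image_le.trans (card_fin m).le) _)
      · have := card_union_le (F ∪ im V x.1) {x.2.1, x.2.2}
        have := card_le_two (a := x.2.1) (b := x.2.2)
        omega
    · obtain ⟨⟨h4, -⟩, ⟨h5, h6⟩, h7⟩ := hx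
      have h8 : im V x = im V x.1 ∪ {x.2.1, x.2.2} := by
        rw [im_prod, im_prod, im_vertex, im_vertex]; rfl
      change im V x ⊆ B ∧ F ∪ im V x ∈ E
      rw [h8, ← union_assoc]
      exact ⟨union_subset h4 (by simp [insert_subset_iff, h5, h6]), h7⟩

theorem badPr_le_mixPr {X Y : Finset V} (hXY : Disjoint X Y) (hF : F ⊆ Y) (hk : F.card < k) :
    badPr E X Y k F ≤ k * (mixPr E B k F + ((X ∩ B ∪ Y \ B).card : ℝ) / Fintype.card V) := by
  obtain ⟨m, hm⟩ := Nat.exists_eq_add_of_lt hk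
  unfold badPr mixPr
  rw [show k - F.card - 1 = m by omega, show k - F.card = m + 1 by omega]
  set Q : V × (Fin m → V) → Prop := fun x => x.1 ∉ B ∧ im V x.2 ⊆ B ∧
    (F ∪ insert x.1 (im V x.2)).card = k ∧ F ∪ insert x.1 (im V x.2) ∉ E with hQ
  set Z := X ∩ B ∪ Y \ B with hZ
  have h1 : ∀ i : Fin (m + 1), pr (fun ω : Fin (m + 1) → V => Q ((Fin.insertNthEquiv (fun _ => V) i).symm ω)) =
      pr Q := fun i => pr_equiv (Fin.insertNthEquiv (fun _ => V) i).symm Q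
  have hmk : ((m + 1 : ℕ) : ℝ) ≤ k := by exact_mod_cast (by omega)
  have hkey : ∀ ω : Fin (m + 1) → V, (im V ω).card = m + 1 ∧ Bad E X Y F (im V ω) →
      (∃ i ∈ (univ : Finset (Fin (m + 1))), Q ((Fin.insertNthEquiv (fun _ => V) i).symm ω)) ∨
        ¬ Disjoint (im V ω) Z := by
    rintro ω ⟨hc, hd, hs, hX, hn⟩
    rw [or_iff_not_imp_right, not_not]
    intro hdZ
    have hinj : Function.Injective ω := by
      rw [← Set.injOn_univ, ← coe_univ, ← card_image_iff, card_fin]; exact hc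
    obtain ⟨x, hx⟩ := card_eq_one.1 hX
    have hx' := mem_inter.1 (hx.ge (mem_singleton_self x))
    have hxF : x ∉ F := fun h => disjoint_left.1 hXY hx'.2 (hF h)
    obtain ⟨i, -, rfl⟩ := mem_image.1 ((mem_union.1 hx'.1).resolve_left hxF)
    have hi : ∀ j, ω j ∈ im V ω := fun j => mem_image_of_mem _ (mem_univ j)
    have him : insert (ω i) (im V (i.removeNth ω)) = im V ω := by
      rw [im_tuple, im_tuple, ← coe_inj, coe_insert, coe_image, coe_image, coe_univ, coe_univ,
        Set.image_univ, Set.image_univ]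
      exact (Fin.range_insertNth i _ _).symm.trans (by rw [Fin.insertNth_self_removeNth])
    refine ⟨i, mem_univ _, fun h => disjoint_left.1 hdZ (hi i) (mem_union_left _ (mem_inter.2 ⟨hx'.2, h⟩)),
      fun v hv => ?_, ?_, ?_⟩
    · obtain ⟨j, -, rfl⟩ := mem_image.1 hv
      change ω (i.succAbove j) ∈ B
      by_contra hB
      rcases mem_union.1 (hs (hi (i.succAbove j))) with h | h
      · exact Fin.succAbove_ne i j (hinj (mem_singleton.1
          (hx.le (mem_inter.2 ⟨mem_union_right _ (hi _), h⟩))))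
      · exact disjoint_left.1 hdZ (hi _) (mem_union_right _ (mem_sdiff.2 ⟨h, hB⟩))
    · change (F ∪ insert (ω i) (im V (i.removeNth ω))).card = k
      rw [him, card_union_of_disjoint hd, hc]; omega
    · change F ∪ insert (ω i) (im V (i.removeNth ω)) ∉ E
      rwa [him]
  have h2 := pr_hit_le (V := V) (Ω := Fin (m + 1) → V) Z
  have h3 := pr_exists_le (univ : Finset (Fin (m + 1)))
    fun i (ω : Fin (m + 1) → V) => Q ((Fin.insertNthEquiv (fun _ => V) i).symm ω)
  simp only [h1, sum_const, card_univ, Fintype.card_fin, nsmul_eq_mul] at h3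
  calc _ ≤ _ := (pr_mono hkey).trans (pr_or_le _ _)
    _ ≤ ((m + 1 : ℕ) : ℝ) * pr Q + ((m + 1 : ℕ) : ℝ) * (Z.card / Fintype.card V) := add_le_add h3 h2
    _ = ((m + 1 : ℕ) : ℝ) * (pr Q + Z.card / Fintype.card V) := by ring
    _ ≤ _ := mul_le_mul_of_nonneg_right hmk (add_nonneg (pr_nonneg _) (by positivity))

end Sparse

section NearExtremalOfSparse

set_option maxHeartbeats 1000000 in
theorem exists_nearExtremal {k : ℕ} (hk4 : 4 ≤ k) {σ : ℝ} (hσ : 0 < σ) (hσk : σ ≤ (1 / 2) ^ (k + 1)) :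
    ∃ ξ > 0, ξ ≤ 1 / 2 ∧ ∃ n₀ : ℕ, ∀ (V : Type) [DecidableEq V] [Fintype V] (E : Finset (Finset V)) (a : ℝ),
      n₀ ≤ Fintype.card V → 0 ≤ a → a ≤ 1 / 6 →
      PairDeg E k ((2 * a - a ^ 2) * (1 - 1 / Fintype.card V)) → ¬ Spread E k a ξ →
      ∃ X Y, NearExtremal E X Y k a σ := by
  have hkr : (4 : ℝ) ≤ k := by exact_mod_cast hk4
  obtain ⟨q, hq⟩ : ∃ q : ℝ, q = (1 / 2) ^ k := ⟨_, rfl⟩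
  have hq0 : 0 < q := by rw [hq]; positivity
  have hq16 : q ≤ 1 / 16 := by
    rw [hq, show (1 / 16 : ℝ) = (1 / 2) ^ 4 by norm_num]
    exact pow_le_pow_of_le_one (by norm_num) (by norm_num) hk4
  rw [pow_succ, ← hq] at hσk
  have hσ1 : σ ≤ 1 / 32 := by linarith
  obtain ⟨ξ, hξ⟩ : ∃ ξ, ξ = σ ^ 4 * q / (8 * k) := ⟨_, rfl⟩
  have hξ0 : 0 < ξ := by rw [hξ]; positivity
  have hξk : ξ * (8 * k) = σ ^ 4 * q := by rw [hξ]; field_simp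
  have hξk0 : 0 < ξ * k := by positivity
  have hσ4 : 0 < σ ^ 4 := by positivity
  have hξq : 32 * ξ ≤ σ ^ 4 * q := by linarith [mul_le_mul_of_nonneg_left hkr hξ0.le]
  have hσq : σ ^ 4 * q ≤ σ ^ 4 * (1 / 16) := by gcongr
  have hσ34 : σ ^ 4 ≤ 1 / 32 * σ ^ 3 := by
    rw [pow_succ, mul_comm]; gcongr
  have hσ3 : σ ^ 3 ≤ 1 / 32 * σ := by
    have : σ ^ 2 ≤ 1 / 32 := by linarith [mul_le_mul hσ1 hσ1 hσ.le (by norm_num)]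
    rw [pow_succ]; gcongr
  obtain ⟨n₀, hn₀⟩ := exists_forall_div_le ((k : ℝ) ^ 2 + k * k) (c := min ξ (q / 2)) (by positivity)
  refine ⟨ξ, hξ0, by linarith, n₀ + 1, fun V _ _ E a hn ha0 ha6 hd hS => ?_⟩
  have hnn := hn₀ (Fintype.card V) (by omega)
  obtain ⟨n, hnV⟩ : ∃ n : ℝ, n = Fintype.card V := ⟨_, rfl⟩
  have : Nonempty V := Fintype.card_pos_iff.1 (by omega)
  have hn0 : 0 < n := by rw [hnV]; exact_mod_cast (by omega : 0 < Fintype.card V)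
  rw [← hnV] at hd hnn
  have hnξ := hnn.trans (min_le_left _ _)
  have hnq := hnn.trans (min_le_right _ _)
  have hn1 : 1 / n ≤ ξ := le_trans (div_le_div_of_nonneg_right (by
    linarith [mul_le_mul hkr hkr (by norm_num) k.cast_nonneg, sq_nonneg (k : ℝ)]) hn0.le) hnξ
  unfold Spread at hS
  push Not at hS
  obtain ⟨B, hB, hBE⟩ := hS
  obtain ⟨β, hβ⟩ : ∃ β : ℝ, β = (B.card : ℝ) / n := ⟨_, rfl⟩
  have hBβ : (B.card : ℝ) = β * n := by rw [hβ]; field_simp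
  rw [← hnV, hBβ] at hB
  replace hB := le_of_mul_le_mul_right hB hn0
  have hβ2 : 1 / 2 ≤ β := by linarith
  obtain ⟨D, hD⟩ : ∃ D, D = 1 - (2 * a - a ^ 2) * (1 - 1 / n) - β ^ 2 := ⟨_, rfl⟩
  have haa : 0 ≤ 2 * a - a ^ 2 := by linarith [mul_le_mul_of_nonneg_left ha6 ha0]
  have haa' : (2 * a - a ^ 2) * (1 / n) ≤ ξ := by
    have h1 : (2 * a - a ^ 2) * (1 / n) ≤ 1 * (1 / n) := by
      have := one_div_pos.2 hn0
      gcongr; linarith [sq_nonneg (a - 1)]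
    linarith
  have haa'' : 0 ≤ (2 * a - a ^ 2) * (1 / n) := by positivity
  have hD3 : D ≤ 3 * ξ := by
    linarith [mul_nonneg ha0 hξ0.le, sq_nonneg ξ, pow_le_pow_left₀ (by linarith : 0 ≤ 1 - a - ξ) hB 2]
  have hpow : ∀ m, m + 1 ≤ k → 2 * q ≤ β ^ m := fun m hm => by
    have h1 : (1 / 2 : ℝ) ^ (k - 1) ≤ (1 / 2) ^ m :=
      pow_le_pow_of_le_one (by norm_num) (by norm_num) (by omega)
    have h2 : q = (1 / 2) ^ (k - 1) * (1 / 2) := by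
      rw [hq, ← pow_succ]; congr 1; omega
    have h3 : (1 / 2 : ℝ) ^ m ≤ β ^ m := by gcongr
    linarith
  have hM : ∀ F : Finset V, F.card + 2 ≤ k → ∃ p ≤ (1 : ℝ), q ≤ p ∧ 2 * mixPr E B k F ≤ D * p +
      pr fun ω : Fin (k - F.card) → V => im V ω ⊆ B ∧ F ∪ im V ω ∈ E := fun F hF => by
    obtain ⟨p, hp1, hp, h⟩ := mixPr_le (B := B) hd hF
    grind
  have hDp : ∀ p, q ≤ p → p ≤ 1 → D * p ≤ 3 * ξ := fun p h1 h2 => by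
    linarith [mul_le_mul_of_nonneg_right hD3 (hq0.le.trans h1), mul_le_mul_of_nonneg_left h2 hξ0.le]
  obtain ⟨p, hp1, hp, hM0⟩ := hM ∅ (by simp; omega)
  have hBE' : (pr fun ω : Fin (k - (∅ : Finset V).card) → V => im V ω ⊆ B ∧ ∅ ∪ im V ω ∈ E) ≤ ξ :=
    (pr_mono fun ω h => by rwa [empty_union] at h).trans hBE
  have hβu : β - (1 - a) ≤ σ ^ 3 / 2 := by
    have h1 : 0 ≤ mixPr E B k ∅ := pr_nonneg _
    have h2 : -D * q ≤ ξ := by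
      rcases le_total 0 D with h | h
      · linarith [mul_nonneg h hq0.le]
      · linarith [mul_le_mul_of_nonneg_left hp (neg_nonneg.2 h)]
    have h3 : -D ≤ σ ^ 4 / 32 := le_of_mul_le_mul_right (a := q) (by linarith) hq0
    by_contra! h4
    linarith [mul_le_mul h4.le (by linarith : 1 ≤ β + (1 - a)) zero_le_one (by linarith)]
  have hm0 : mixPr E B k ∅ ≤ 2 * ξ := by linarith [hDp p hp hp1]
  classical
  set lo : V → ℝ := fun v => pr fun ω : Fin (k - 1) → V => im V ω ⊆ B ∧ insert v (im V ω) ∈ E with hlo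
  set hi : V → ℝ := fun v => pr fun ω : Fin (k - 1) → V => im V ω ⊆ B ∧ (insert v (im V ω)).card = k ∧
    insert v (im V ω) ∉ E with hhi
  obtain ⟨X, hX⟩ : ∃ X : Finset V, ∀ v, v ∈ X ↔ hi v ≤ σ := ⟨univ.filter fun v => hi v ≤ σ, by simp⟩
  obtain ⟨Y, hY⟩ : ∃ Y : Finset V, ∀ v, v ∈ Y ↔ lo v ≤ σ := ⟨univ.filter fun v => lo v ≤ σ, by simp⟩
  have hXY : Disjoint X Y := disjoint_left.2 fun v h1 h2 => by
    rw [hX] at h1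
    rw [hY] at h2
    have h3 := pr_inside_ge B {v} (k - 1)
    have h4 : pr (fun ω : Fin (k - 1) → V => im V ω ⊆ B ∧ ({v} ∪ im V ω).card = ({v} : Finset V).card + (k - 1)) ≤
        lo v + hi v := by
      refine (pr_mono fun ω h => ?_).trans (pr_or_le _ _)
      grind
    have h5 : (((k - 1 : ℕ) : ℝ) ^ 2 + (k - 1 : ℕ) * ({v} : Finset V).card) / n ≤ (k ^ 2 + k * k) / n := by
      have h6 : ((k - 1 : ℕ) : ℝ) ≤ k := by exact_mod_cast (by omega)
      have h7 : ((1 : ℕ) : ℝ) ≤ k := by grind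
      rw [card_singleton]
      gcongr
    rw [← hnV, ← hβ] at h3
    grind
  have hu : σ * ((B \ Y).card / n) ≤ ξ := by
    rw [hnV, ← pr_mem]
    refine (mul_pr_le_prod (Q := fun v (ω : Fin (k - 1) → V) => im V ω ⊆ B ∧ insert v (im V ω) ∈ E)
      fun v hv => (not_le.1 (mt (hY v).2 (mem_sdiff.1 hv).2)).le).trans (le_trans (pr_mono fun x hx => ?_)
      ((pr_tuple (V := V) (Ω := V × (Fin (k - 1) → V)) (fun T => T ⊆ B ∧ T ∈ E) (a := k)
        (by change 1 + (k - 1) = k; omega)).le.trans hBE))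
    change im V x ⊆ B ∧ im V x ∈ E
    rw [im_prod, im_vertex, ← insert_eq]
    grind
  have hw : σ * (((univ \ B) \ X).card / n) ≤ 2 * ξ := by
    rw [hnV, ← pr_mem]
    refine (mul_pr_le_prod (Q := fun v (ω : Fin (k - 1) → V) => im V ω ⊆ B ∧ (insert v (im V ω)).card = k ∧
      insert v (im V ω) ∉ E) fun v hv => (not_le.1 (mt (hX v).2 (mem_sdiff.1 hv).2)).le).trans
      (le_trans (pr_mono fun x hx => ?_) hm0)
    simp only [empty_union]
    grind
  obtain ⟨u, hu'⟩ : ∃ u : ℝ, u = (B \ Y).card := ⟨_, rfl⟩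
  obtain ⟨w, hw'⟩ : ∃ w : ℝ, w = ((univ \ B) \ X).card := ⟨_, rfl⟩
  have hu0 : 0 ≤ u := hu'.ge.trans' (Nat.cast_nonneg _)
  have hw0 : 0 ≤ w := hw'.ge.trans' (Nat.cast_nonneg _)
  have hσuw : k * ((u + w) / n) ≤ σ ^ 3 / 32 := by
    rw [← hu'] at hu
    rw [← hw'] at hw
    refine le_of_mul_le_mul_left (a := σ) ?_ hσ
    have h1 : σ * ((u + w) / n) ≤ 3 * ξ := by rw [add_div]; linarith
    calc σ * (k * ((u + w) / n)) = k * (σ * ((u + w) / n)) := by ring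
      _ ≤ k * (3 * ξ) := by gcongr
      _ ≤ σ ^ 4 * (1 / 32) := by linarith
      _ = _ := by ring
  have huw0 : 0 ≤ (u + w) / n := div_nonneg (add_nonneg hu0 hw0) hn0.le
  have huw : (u + w) / n ≤ σ ^ 3 / 128 := by linarith [mul_le_mul_of_nonneg_right hkr huw0]
  have huwn := (div_le_iff₀ hn0).1 huw
  have hYB : Y \ B ⊆ (univ \ B) \ X := fun v hv => mem_sdiff.2 ⟨mem_sdiff.2 ⟨mem_univ _, (mem_sdiff.1 hv).2⟩,
    disjoint_right.1 hXY (mem_sdiff.1 hv).1⟩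
  have hXB : X ∩ B ⊆ B \ Y := fun v hv =>
    mem_sdiff.2 ⟨(mem_inter.1 hv).2, disjoint_left.1 hXY (mem_inter.1 hv).1⟩
  have hYBc : ((Y \ B).card : ℝ) ≤ w := by rw [hw']; exact_mod_cast card_le_card hYB
  have hZ : ((X ∩ B ∪ Y \ B).card : ℝ) ≤ u + w := by
    rw [hu', hw']
    exact_mod_cast (card_union_le _ _).trans (Nat.add_le_add (card_le_card hXB) (card_le_card hYB))
  have hhit : ∀ Z : Finset V, (Z.card : ℝ) ≤ u + w →
      pr (fun ω : Fin (k - 1) → V => ¬ Disjoint (im V ω) Z) ≤ σ / 2 := fun Z hZ => by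
    refine (pr_hit_le Z).trans ?_
    rw [← hnV]
    have h1 : ((k - 1 : ℕ) : ℝ) ≤ k := by exact_mod_cast (by omega)
    calc ((k - 1 : ℕ) : ℝ) * (Z.card / n) ≤ k * ((u + w) / n) :=
          mul_le_mul h1 (div_le_div_of_nonneg_right hZ hn0.le) (div_nonneg (Nat.cast_nonneg _) hn0.le)
            (Nat.cast_nonneg _)
      _ ≤ _ := by linarith
  have hsub : ∀ {A C T : Finset V}, T ⊆ A → Disjoint T (A \ C) → T ⊆ C := fun h1 h2 v hv => by
    by_contra h
    exact disjoint_left.1 h2 hv (mem_sdiff.2 ⟨h1 hv, h⟩)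
  have hZn : ((X ∩ B ∪ Y \ B).card : ℝ) / n ≤ σ / 2 :=
    (div_le_div_of_nonneg_right hZ hn0.le).trans (by linarith)
  have hσkk : σ ≤ k * σ := by linarith [mul_le_mul_of_nonneg_right hkr hσ.le]
  refine ⟨X, Y, hXY, ?_, ?_, fun b hb => ?_, fun v hv => ?_, ?_, fun v hv => ?_⟩
  · have h1 : univ \ (X ∪ Y) ⊆ B \ Y ∪ (univ \ B) \ X := fun v hv => by
      grind
    have h2 : ((univ \ (X ∪ Y)).card : ℝ) ≤ u + w := by
      rw [hu', hw']; exact_mod_cast (card_le_card h1).trans (card_union_le _ _)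
    grind
  · have h1 : (Y.card : ℝ) + (univ \ Y).card = n := by
      rw [hnV, ← card_univ, ← card_sdiff_add_card_eq_card (subset_univ Y)]; push_cast; ring
    have h2 : (B.card : ℝ) ≤ u + Y.card := by
      rw [hu']; exact_mod_cast card_le_card_sdiff_add_card
    have h3 : (Y.card : ℝ) ≤ (Y \ B).card + B.card := by exact_mod_cast card_le_card_sdiff_add_card
    have h4 := mul_le_mul_of_nonneg_right hβu hn0.le
    have h5 := mul_le_mul_of_nonneg_right hB hn0.le
    have h6 : 0 < σ ^ 3 * n := by positivity
    have h7 : ξ * n ≤ σ ^ 3 / 128 * n := by gcongr; linarith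
    rw [← hnV, abs_le]
    constructor <;> linarith
  · have h1 := (pr_mono fun (ω : Fin (k - 1) → V) (h : im V ω ⊆ Y ∧ insert b (im V ω) ∈ E) =>
      (or_iff_not_imp_right.2 fun h2 => ⟨hsub h.1 (not_not.1 h2), h.2⟩ :
        (im V ω ⊆ B ∧ insert b (im V ω) ∈ E) ∨ ¬ Disjoint (im V ω) (Y \ B))).trans (pr_or_le _ _)
    have h2 := (hY b).1 hb
    simp only [hlo] at h2
    linarith [hhit (Y \ B) (by linarith)]
  · have h1 := (pr_mono fun (ω : Fin (k - 1) → V) (h : im V ω ⊆ B ∧ insert v (im V ω) ∈ E) =>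
      (or_iff_not_imp_right.2 fun h2 => ⟨hsub h.1 (not_not.1 h2), h.2⟩ :
        (im V ω ⊆ Y ∧ insert v (im V ω) ∈ E) ∨ ¬ Disjoint (im V ω) (B \ Y))).trans (pr_or_le _ _)
    have h2 := not_le.1 (mt (hY v).2 fun h => hv (mem_union_right _ h))
    simp only [hlo] at h2
    linarith [hhit (B \ Y) (by linarith)]
  · refine (badPr_le_mixPr (B := B) hXY (empty_subset _) (by simp; omega)).trans ?_
    rw [← hnV, mul_comm (4 : ℝ), mul_assoc]
    gcongr
    linarith
  · rcases mem_union.1 hv with hv | hv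
    · have h1 : badPr E X Y k {v} ≤ hi v + pr fun ω : Fin (k - 1) → V => ¬ Disjoint (im V ω) (Y \ B) := by
        refine (pr_mono fun ω h => ?_).trans (pr_or_le _ _)
        obtain ⟨h1, h2, h3, h4, h5⟩ := h
        rw [or_iff_not_imp_right, not_not]
        intro h6
        rw [disjoint_singleton_left] at h2
        rw [← insert_eq] at h4 h5
        refine ⟨hsub (fun x hx => (mem_union.1 (h3 hx)).resolve_left fun hxX => ?_) h6, ?_, h5⟩
        · refine h2 (card_le_one.1 h4.le x (mem_inter.2 ⟨mem_insert_of_mem hx, hxX⟩) v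
            (mem_inter.2 ⟨mem_insert_self _ _, hv⟩) ▸ hx)
        grind
      linarith [(hX v).1 hv, hhit (Y \ B) (by linarith)]
    · refine (badPr_le_mixPr (B := B) hXY (singleton_subset_iff.2 hv) (by simp; omega)).trans ?_
      obtain ⟨p, hp1, hp, h1⟩ := hM {v} (by simp; omega)
      have h2 : (pr fun ω : Fin (k - ({v} : Finset V).card) → V => im V ω ⊆ B ∧ {v} ∪ im V ω ∈ E) ≤ σ :=
        (pr_mono fun ω h => by rwa [← insert_eq] at h).trans ((hY v).1 hv)
      have h3 := hDp p hp hp1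
      rw [← hnV, mul_comm (4 : ℝ), mul_assoc]
      gcongr
      linarith

end NearExtremalOfSparse

section Degrees

theorem two_mul_deg_le {n k : ℕ} {E : Finset (Finset (Fin n))} (hE : Uniform n k E) {S : Finset (Fin n)}
    (hS : S.card + 2 = k) : 2 * (deg E S : ℝ) / n ^ 2 ≤ pr fun x : Fin n × Fin n => S ∪ {x.1, x.2} ∈ E := by
  have h0 : ∀ e ∈ E.filter (S ⊆ ·), ∀ x ∈ (e \ S).offDiag, S ∪ {x.1, x.2} = e := fun e he x hx => by
    rw [mem_filter] at he
    rw [mem_offDiag] at hx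
    refine eq_of_subset_of_card_le (union_subset he.2 (insert_subset (mem_sdiff.1 hx.1).1
      (singleton_subset_iff.2 (mem_sdiff.1 hx.2.1).1))) ?_
    rw [card_union_of_disjoint, card_pair hx.2.2, hE e he.1, hS]
    simpa using ⟨(mem_sdiff.1 hx.1).2, (mem_sdiff.1 hx.2.1).2⟩
  have h1 : ((E.filter (S ⊆ ·)).biUnion fun e => (e \ S).offDiag).card = deg E S * 2 := by
    rw [card_biUnion, deg, ← smul_eq_mul, ← sum_const]
    · refine sum_congr rfl fun e he => ?_
      rw [mem_filter] at he
      rw [offDiag_card, card_sdiff_of_subset he.2, hE e he.1, show k - S.card = 2 by omega]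
    · exact fun e he e' he' hne => disjoint_left.2 fun x hx hx' => hne ((h0 e he x hx).symm.trans (h0 e' he' x hx'))
  classical
  rw [pr_eq, Fintype.card_prod, Fintype.card_fin, Nat.cast_mul, ← sq]
  refine div_le_div_of_nonneg_right ?_ (by positivity)
  have h2 : (E.filter (S ⊆ ·)).biUnion (fun e => (e \ S).offDiag) ⊆
      univ.filter fun x : Fin n × Fin n => S ∪ {x.1, x.2} ∈ E := fun x hx => by
    obtain ⟨e, he, hx⟩ := mem_biUnion.1 hx
    rw [mem_filter, h0 e he x hx]
    exact ⟨mem_univ _, (mem_filter.1 he).1⟩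
  have h3 := card_le_card h2
  rw [h1, mul_comm] at h3
  refine le_trans (b := ((univ.filter fun x : Fin n × Fin n => S ∪ {x.1, x.2} ∈ E).card : ℝ)) (by exact_mod_cast h3) ?_
  exact le_of_eq (by congr)

theorem PairDeg.lowDeg {V : Type} [DecidableEq V] [Fintype V] {E : Finset (Finset V)} {k : ℕ} {d : ℝ}
    (hd0 : 0 ≤ d) (h : PairDeg E k d) (hn : ((k : ℝ) ^ 2 + k * k) / Fintype.card V ≤ 1 / 2)
    (hV : 0 < Fintype.card V) : LowDeg E k (d / 2) := by
  intro S hS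
  obtain ⟨m, rfl⟩ := Nat.exists_eq_add_of_le hS
  rw [show S.card + 2 + m - S.card = m + 2 by omega]
  have h1 := pr_inside_ge (univ : Finset V) S m
  rw [card_univ, div_self (by exact_mod_cast hV.ne'), one_pow] at h1
  have h2 : ((m : ℝ) ^ 2 + m * S.card) / Fintype.card V ≤ 1 / 2 := by
    refine (div_le_div_of_nonneg_right ?_ (by positivity)).trans hn
    have h3 : (m : ℝ) ≤ (S.card + 2 + m : ℕ) := by exact_mod_cast (by omega)
    have h4 : (S.card : ℝ) ≤ (S.card + 2 + m : ℕ) := by exact_mod_cast (by omega)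
    gcongr
  refine le_trans ?_ ((mul_pr_le_prod (Q := fun (W : Fin m → V) (x : V × V) => (S ∪ im V W) ∪ {x.1, x.2} ∈ E)
    fun W (hW : im V W ⊆ univ ∧ (S ∪ im V W).card = S.card + m) => h _ (by rw [hW.2]; omega)).trans
    (le_trans (pr_mono fun x hx => ?_) (pr_tuple (V := V) (Ω := (Fin m → V) × (V × V))
      (fun T => S ∪ T ∈ E) (a := m + 2) rfl).le))
  · rw [div_eq_mul_inv]
    gcongr
    linarith
  · have h8 : im V x = im V x.1 ∪ {x.2.1, x.2.2} := by
      rw [im_prod, im_prod, im_vertex, im_vertex]; rfl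
    change S ∪ im V x ∈ E
    rw [h8, ← union_assoc]
    exact hx.2

end Degrees

/-- For all integers `k ≥ 4` and `1 ≤ ℓ < k/2` there exists `n₀` such
that every `k`-uniform hypergraph `H` on `n ≥ n₀` vertices with `(k-ℓ) ∣ n` and
`δ_{k-2}(H) ≥ ((4(k-ℓ)-1)/(4(k-ℓ)²))·C(n,2)` contains a Hamiltonian ℓ-cycle. -/
theorem statement1 (k ℓ : ℕ) (hk : 4 ≤ k) (hl : 1 ≤ ℓ) (hlk : 2 * ℓ < k) :
    ∃ n₀ : ℕ, ∀ n : ℕ, n₀ ≤ n → (k - ℓ) ∣ n →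
      ∀ E : Finset (Finset (Fin n)), Uniform n k E →
        (4 * ((k - ℓ : ℕ) : ℝ) - 1) / (4 * ((k - ℓ : ℕ) : ℝ) ^ 2) * (n.choose 2 : ℝ) ≤
          (minDeg n E (k - 2) : ℝ) →
        HasHamCycle n k ℓ E := by
  obtain ⟨t, ht⟩ : ∃ t : ℝ, t = (k - ℓ : ℕ) := ⟨_, rfl⟩
  have ht3 : 3 ≤ t := by rw [ht]; exact_mod_cast (by omega : 3 ≤ k - ℓ)
  obtain ⟨a, ha⟩ : ∃ a : ℝ, a = 1 / (2 * t) := ⟨_, rfl⟩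
  have ha0 : 0 < a := by rw [ha]; positivity
  have ha6 : a ≤ 1 / 6 := by
    rw [ha, one_div_le_one_div (by positivity) (by norm_num)]; linarith
  have hat : (4 * t - 1) / (4 * t ^ 2) = 2 * a - a ^ 2 := by rw [ha]; field_simp; ring
  have hC0 : 0 < 2 * a - a ^ 2 := by nlinarith
  have hC1 : 2 * a - a ^ 2 ≤ 1 := by linarith [sq_nonneg (a - 1)]
  obtain ⟨σ₀, hσ₀, hham⟩ := exists_hamC_of_nearExtremal hk hl hlk
  have hσ : 0 < min σ₀ ((1 / 2) ^ (k + 1)) := by positivity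
  obtain ⟨n₁, hham⟩ := hham _ hσ (min_le_left _ _)
  obtain ⟨ξ, hξ, hξ1, n₂, hnear⟩ := exists_nearExtremal hk hσ (min_le_right _ _)
  obtain ⟨γ, hγ, n₃, hspread⟩ := hamC_of_spread hk hl hlk (η := (2 * a - a ^ 2) / 2 / 2) (by positivity)
    (by linarith) hξ hξ1
  obtain ⟨n₄, hn₄⟩ := exists_forall_div_le ((k : ℝ) ^ 2 + k * k) (c := min γ (1 / 2)) (by positivity)
  refine ⟨n₁ + n₂ + n₃ + n₄ + 3 * k, fun n hn hdvd E hE hdeg => ?_⟩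
  have hn0 : (0 : ℝ) < n := by exact_mod_cast (by omega : 0 < n)
  have hk4 : (4 : ℝ) ≤ k := by exact_mod_cast hk
  have hn4 := hn₄ n (by omega)
  have hn1 : 1 / (n : ℝ) ≤ min γ (1 / 2) := le_trans (div_le_div_of_nonneg_right (by nlinarith) hn0.le) hn4
  have hnγ := hn1.trans (min_le_left _ _)
  have hn2 := hn1.trans (min_le_right _ _)
  have hpd : PairDeg E k ((2 * a - a ^ 2) * (1 - 1 / Fintype.card (Fin n))) := fun S hS => by
    refine le_trans ?_ (two_mul_deg_le hE hS)
    have h1 : minDeg n E (k - 2) ≤ deg E S := Nat.sInf_le ⟨S, by omega, rfl⟩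
    have h2 : (minDeg n E (k - 2) : ℝ) ≤ deg E S := by exact_mod_cast h1
    rw [← ht, hat, Nat.cast_choose_two] at hdeg
    rw [Fintype.card_fin, le_div_iff₀ (by positivity)]
    calc (2 * a - a ^ 2) * (1 - 1 / n) * n ^ 2 = 2 * ((2 * a - a ^ 2) * (n * (n - 1) / 2)) := by
          field_simp
      _ ≤ _ := by linarith
  have hV : Fintype.card (Fin n) = n := Fintype.card_fin n
  have hpd' : ∀ {d}, d ≤ (2 * a - a ^ 2) * (1 - 1 / (n : ℝ)) → PairDeg E k d := fun hd S hS =>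
    (hd.trans_eq (by rw [hV])).trans (hpd S hS)
  refine HamC.hasHamCycle hE hlk (by omega) ?_
  by_cases hS : Spread E k a ξ
  · refine hspread _ E a (by omega) (by rwa [hV]) hE ?_ (by rw [ha, ht, Nat.cast_sub (by omega)]) (hpd' ?_) hS
    · refine PairDeg.lowDeg (by positivity) (hpd' ?_) (by rw [hV]; exact hn4.trans (min_le_right _ _)) (by omega)
      rw [div_eq_mul_inv]
      gcongr
      linarith
    · have : (2 * a - a ^ 2) * (1 / (n : ℝ)) ≤ 1 * γ := by gcongr
      linarith
  · obtain ⟨X, Y, h⟩ := hnear _ E a (by omega) ha0.le ha6 hpd hS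
    exact hham _ E X Y a (by omega) (by rwa [hV]) hE (by rw [ha, ht]) hpd h
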